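/- Each of the Table T algebras T₂, T₄, T₅, T₆, T₇, T₈, T₉, T₁₀, T₁₁, T₁₂, T₁₃, T₁₄, T₁₅, T₁₆, T₁₈, T₁₉, T₂₀, T₂₁ over an algebraically closed field K is τ-tilting finite (for all admissible parameter values), with number of isomorphism classes of basic support τ-tilting modules equal to 6, 6, 5, 6, 5, 5, 8, 12, 8, 7, 6, 8, 7, 9, 8, 6, 7, 6 respectively, and Hasse quiver of type H_{1,3}, H_{1,3}, H_{1,2}, H_{1,3}, H_{1,2}, H_{1,2}, H_{3,3}, H_{5,5}, H_{3,3}, H_{2,3}, H_{2,2}, H_{3,3}, H_{2,3}, H_{2,5}, H_{3,3}, H_{2,2}, H_{2,3}, H_{2,2} respectively. -/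

import Mathlib

/-!
Core definitions for τ-tilting theory of finite dimensional algebras.

Throughout, for an algebra `Λ`, *right* `Λ`-modules are formalized as left modules
over the opposite ring `Λᵐᵒᵖ` (the category `RMod Λ := ModuleCat Λᵐᵒᵖ`).

τ-rigidity is formalized via the standard projective-presentation criterion of
Auslander–Smalø/Adachi–Iyama–Reiten: a finitely generated module `M` is τ-rigid iff it admits
a (finite) projective presentation `P₁ → P₀ → M → 0` such that
`Hom(P₀, M) → Hom(P₁, M)` is surjective.
-/

noncomputable section

namespace TwoPoint

/-- A module is indecomposable if it is nonzero and admits no nontrivial direct sum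
decomposition. -/
def IsIndecModule (R : Type) [Ring R] (M : Type) [AddCommGroup M] [Module R M] : Prop :=
  Nontrivial M ∧ ∀ N₁ N₂ : Submodule R M, IsCompl N₁ N₂ → N₁ = ⊥ ∨ N₂ = ⊥

/-- `M` decomposes as a finite direct sum of indecomposable submodules having exactly `n`
isomorphism classes. -/
def HasIndecClassCount (R : Type) [Ring R] (M : ModuleCat.{0} R) (n : ℕ) : Prop :=
  ∃ (k : ℕ) (N : Fin k → Submodule R M),
    DirectSum.IsInternal N ∧ (∀ i, IsIndecModule R (N i)) ∧
    ∃ c : Fin k → Fin n, Function.Surjective c ∧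
      ∀ i j, (c i = c j ↔ Nonempty ((N i) ≃ₗ[R] (N j)))

/-- `M` is basic: it decomposes as a finite direct sum of pairwise nonisomorphic
indecomposable submodules. -/
def IsBasicModuleCat (R : Type) [Ring R] (M : ModuleCat.{0} R) : Prop :=
  ∃ (k : ℕ) (N : Fin k → Submodule R M),
    DirectSum.IsInternal N ∧ (∀ i, IsIndecModule R (N i)) ∧
    ∀ i j, i ≠ j → IsEmpty ((N i) ≃ₗ[R] (N j))

/-- τ-rigidity, via the projective presentation criterion: there is a finite projective
presentation `P₁ —f→ P₀ —g→ M → 0` such that `Hom(—, M)` applied to `f` is surjective,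
i.e. `Hom_Λ(M, τM) = 0`. -/
def IsTauRigidCat (R : Type) [Ring R] (M : ModuleCat.{0} R) : Prop :=
  Module.Finite R M ∧
  ∃ (P₁ P₀ : ModuleCat.{0} R) (f : P₁ →ₗ[R] P₀) (g : P₀ →ₗ[R] M),
    Module.Finite R P₁ ∧ Module.Projective R P₁ ∧
    Module.Finite R P₀ ∧ Module.Projective R P₀ ∧
    Function.Surjective g ∧ LinearMap.range f = LinearMap.ker g ∧
    ∀ h : P₁ →ₗ[R] M, ∃ h' : P₀ →ₗ[R] M, h = h'.comp f

/-- Support τ-tilting module, via support τ-tilting pairs `(M, P)` (Adachi–Iyama–Reiten):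
`M` is τ-rigid, `P` is finitely generated projective with `Hom(P, M) = 0`, and
`|M| + |P| = |R|` where `|X|` is the number of isomorphism classes of indecomposable
direct summands. -/
def IsSupportTauTiltingCat (R : Type) [Ring R] (M : ModuleCat.{0} R) : Prop :=
  IsTauRigidCat R M ∧
  ∃ (P : ModuleCat.{0} R) (p q r : ℕ),
    Module.Finite R P ∧ Module.Projective R P ∧
    (∀ f : P →ₗ[R] M, f = 0) ∧
    HasIndecClassCount R M p ∧ HasIndecClassCount R P q ∧
    HasIndecClassCount R (ModuleCat.of R R) r ∧ p + q = r

/-- The category of (finitely generated) right `Λ`-modules, as left `Λᵐᵒᵖ`-modules. -/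
abbrev RMod (Λ : Type) [Ring Λ] := ModuleCat.{0} Λᵐᵒᵖ

/-- Basic support τ-tilting right `Λ`-module. -/
def IsBasicSupportTauTilting (Λ : Type) [Ring Λ] (M : RMod Λ) : Prop :=
  IsSupportTauTiltingCat Λᵐᵒᵖ M ∧ IsBasicModuleCat Λᵐᵒᵖ M

/-- `Λ` is τ-tilting finite: there are only finitely many isomorphism classes of basic
support τ-tilting right `Λ`-modules. -/
def IsTauTiltingFinite (Λ : Type) [Ring Λ] : Prop :=
  ∃ (n : ℕ) (L : Fin n → RMod Λ),
    ∀ M : RMod Λ, IsBasicSupportTauTilting Λ M → ∃ i, Nonempty (M ≃ₗ[Λᵐᵒᵖ] L i)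

/-- `Λ` has exactly `n` isomorphism classes of basic support τ-tilting modules. -/
def SupportTauTiltingCount (Λ : Type) [Ring Λ] (n : ℕ) : Prop :=
  ∃ L : Fin n → RMod Λ,
    (∀ i, IsBasicSupportTauTilting Λ (L i)) ∧
    (∀ i j, Nonempty ((L i) ≃ₗ[Λᵐᵒᵖ] (L j)) → i = j) ∧
    ∀ M : RMod Λ, IsBasicSupportTauTilting Λ M → ∃ i, Nonempty (M ≃ₗ[Λᵐᵒᵖ] L i)

/-- `Fac M ⊆ Fac N`: every factor module of a finite direct sum of copies of `M` is also a
factor module of a finite direct sum of copies of `N`.  This is the partial order on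
support τ-tilting modules. -/
def FacLE (Λ : Type) [Ring Λ] (M N : RMod Λ) : Prop :=
  ∀ X : RMod Λ,
    (∃ (k : ℕ) (f : (Fin k → M) →ₗ[Λᵐᵒᵖ] X), Function.Surjective f) →
    (∃ (k : ℕ) (f : (Fin k → N) →ₗ[Λᵐᵒᵖ] X), Function.Surjective f)

/-- The Hasse quiver of the poset `sτ-tilt Λ` is of type `H_{m,n}`: the poset of
isomorphism classes of basic support τ-tilting modules is isomorphic to the poset
consisting of a greatest element, a least element, and two incomparable chains with `m`
resp. `n` elements in between (hence two directed paths from `Λ` to `0` with `m` resp. `n`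
intermediate vertices). -/
def HasseType (Λ : Type) [Ring Λ] (m n : ℕ) : Prop :=
  ∃ T : WithTop (WithBot (Fin m ⊕ Fin n)) → RMod Λ,
    (∀ x, IsBasicSupportTauTilting Λ (T x)) ∧
    (∀ x y, Nonempty ((T x) ≃ₗ[Λᵐᵒᵖ] (T y)) → x = y) ∧
    (∀ M : RMod Λ, IsBasicSupportTauTilting Λ M → ∃ x, Nonempty (M ≃ₗ[Λᵐᵒᵖ] T x)) ∧
    ∀ x y, x ≤ y ↔ FacLE Λ (T x) (T y)

/-- `Λ` is τ-tilting finite with exactly `N` basic support τ-tilting modules and Hasse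
quiver of type `H_{m,n}`. -/
def TauTiltingData (Λ : Type) [Ring Λ] (N m n : ℕ) : Prop :=
  IsTauTiltingFinite Λ ∧ SupportTauTiltingCount Λ N ∧ HasseType Λ m n

/-- `B` is a factor algebra of `Λ`: there is a surjective `K`-algebra homomorphism
`Λ → B`. -/
def IsFactorAlgebra (K : Type) [CommRing K] (B Λ : Type) [Ring B] [Ring Λ]
    [Algebra K B] [Algebra K Λ] : Prop :=
  ∃ φ : Λ →ₐ[K] B, Function.Surjective φ

/-- `Λ` is a basic algebra: the regular right module decomposes into pairwise
nonisomorphic indecomposables. -/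
def IsBasicAlgebra (Λ : Type) [Ring Λ] : Prop :=
  IsBasicModuleCat Λᵐᵒᵖ (ModuleCat.of Λᵐᵒᵖ Λᵐᵒᵖ)

/-- `Λ` is representation-finite: finitely many isomorphism classes of indecomposable
finitely generated right modules. -/
def IsRepFinite (Λ : Type) [Ring Λ] : Prop :=
  ∃ (n : ℕ) (L : Fin n → RMod Λ), ∀ M : RMod Λ,
    Module.Finite Λᵐᵒᵖ M → IsIndecModule Λᵐᵒᵖ M → ∃ i, Nonempty (M ≃ₗ[Λᵐᵒᵖ] L i)

end TwoPoint

namespace TwoPoint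

/-! ### Bound quiver algebras on two-point quivers

A two-point quiver is given by an arrow type `σ` together with source and target functions
`s t : σ → Fin 2`.  The corresponding bound quiver algebra `KQ/I` is presented as the
quotient of the free algebra on the two vertex idempotents and the arrows, by the path
algebra relations together with the defining relations of `I` (paths are composed from
left to right, so a relation like `αμβ` is the product `α * μ * β`). -/

/-- Generators for the path algebra of a two-point quiver: two vertex idempotents and the
arrows. -/
inductive TPGen (σ : Type) : Type
  | v : Fin 2 → TPGen σ
  | ar : σ → TPGen σ

/-- The vertex idempotent generator. -/
def vtx (K : Type) [Field K] {σ : Type} (i : Fin 2) : FreeAlgebra K (TPGen σ) :=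
  FreeAlgebra.ι K (TPGen.v i)

/-- The arrow generator. -/
def arr (K : Type) [Field K] {σ : Type} (a : σ) : FreeAlgebra K (TPGen σ) :=
  FreeAlgebra.ι K (TPGen.ar a)

/-- The defining relations of a bound quiver algebra on a two-point quiver:
`e_i e_j = δ_{ij} e_i`, `e_1 + e_2 = 1`, `e_{s(a)} a = a = a e_{t(a)}`, together with the
prescribed relations `rels` (each pair `(x, y) ∈ rels` imposes `x = y`). -/
inductive QuivRel (K : Type) [Field K] (σ : Type) (s t : σ → Fin 2)
    (rels : Set (FreeAlgebra K (TPGen σ) × FreeAlgebra K (TPGen σ))) :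
    FreeAlgebra K (TPGen σ) → FreeAlgebra K (TPGen σ) → Prop
  | idem (i : Fin 2) : QuivRel K σ s t rels (vtx K i * vtx K i) (vtx K i)
  | orth (i j : Fin 2) : i ≠ j → QuivRel K σ s t rels (vtx K i * vtx K j) 0
  | vsum : QuivRel K σ s t rels (vtx K 0 + vtx K 1) 1
  | src (a : σ) : QuivRel K σ s t rels (vtx K (s a) * arr K a) (arr K a)
  | tgt (a : σ) : QuivRel K σ s t rels (arr K a * vtx K (t a)) (arr K a)
  | rel (p : FreeAlgebra K (TPGen σ) × FreeAlgebra K (TPGen σ)) :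
      p ∈ rels → QuivRel K σ s t rels p.1 p.2

/-- The bound quiver algebra of a two-point quiver with relations `rels`. -/
abbrev BoundQuiverAlgebra (K : Type) [Field K] (σ : Type) (s t : σ → Fin 2)
    (rels : Set (FreeAlgebra K (TPGen σ) × FreeAlgebra K (TPGen σ))) : Type :=
  RingQuot (QuivRel K σ s t rels)

/-! Concrete two-point quivers used below.  Vertices are `0` ("1") and `1` ("2"). -/

/- Quiver `μ : 1 → 2`, loop `β` at `2`. -/
namespace QA
def s : Fin 2 → Fin 2 := ![0, 1]
def t : Fin 2 → Fin 2 := ![1, 1]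
def mu (K : Type) [Field K] : FreeAlgebra K (TPGen (Fin 2)) := arr K (0 : Fin 2)
def be (K : Type) [Field K] : FreeAlgebra K (TPGen (Fin 2)) := arr K (1 : Fin 2)
end QA

/- Quiver: loop `α` at `1`, `μ : 1 → 2`, loop `β` at `2`. -/
namespace QB
def s : Fin 3 → Fin 2 := ![0, 0, 1]
def t : Fin 3 → Fin 2 := ![0, 1, 1]
def al (K : Type) [Field K] : FreeAlgebra K (TPGen (Fin 3)) := arr K (0 : Fin 3)
def mu (K : Type) [Field K] : FreeAlgebra K (TPGen (Fin 3)) := arr K (1 : Fin 3)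
def be (K : Type) [Field K] : FreeAlgebra K (TPGen (Fin 3)) := arr K (2 : Fin 3)
end QB

/- Quiver: `μ : 1 → 2`, loops `β₁, β₂` at `2`. -/
namespace QC
def s : Fin 3 → Fin 2 := ![0, 1, 1]
def t : Fin 3 → Fin 2 := ![1, 1, 1]
def mu (K : Type) [Field K] : FreeAlgebra K (TPGen (Fin 3)) := arr K (0 : Fin 3)
def b1 (K : Type) [Field K] : FreeAlgebra K (TPGen (Fin 3)) := arr K (1 : Fin 3)
def b2 (K : Type) [Field K] : FreeAlgebra K (TPGen (Fin 3)) := arr K (2 : Fin 3)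
end QC

/- Quiver: loop `α` at `1`, `μ : 1 → 2`, `ν : 2 → 1`. -/
namespace QD
def s : Fin 3 → Fin 2 := ![0, 0, 1]
def t : Fin 3 → Fin 2 := ![0, 1, 0]
def al (K : Type) [Field K] : FreeAlgebra K (TPGen (Fin 3)) := arr K (0 : Fin 3)
def mu (K : Type) [Field K] : FreeAlgebra K (TPGen (Fin 3)) := arr K (1 : Fin 3)
def nu (K : Type) [Field K] : FreeAlgebra K (TPGen (Fin 3)) := arr K (2 : Fin 3)
end QD

/- Quiver: loops `α` at `1` and `β` at `2`, `μ : 1 → 2`, `ν : 2 → 1`. -/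
namespace QE
def s : Fin 4 → Fin 2 := ![0, 1, 0, 1]
def t : Fin 4 → Fin 2 := ![0, 1, 1, 0]
def al (K : Type) [Field K] : FreeAlgebra K (TPGen (Fin 4)) := arr K (0 : Fin 4)
def be (K : Type) [Field K] : FreeAlgebra K (TPGen (Fin 4)) := arr K (1 : Fin 4)
def mu (K : Type) [Field K] : FreeAlgebra K (TPGen (Fin 4)) := arr K (2 : Fin 4)
def nu (K : Type) [Field K] : FreeAlgebra K (TPGen (Fin 4)) := arr K (3 : Fin 4)
end QE

/- Quiver: `μ : 1 → 2`, `ν : 2 → 1`. -/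
namespace QF
def s : Fin 2 → Fin 2 := ![0, 1]
def t : Fin 2 → Fin 2 := ![1, 0]
def mu (K : Type) [Field K] : FreeAlgebra K (TPGen (Fin 2)) := arr K (0 : Fin 2)
def nu (K : Type) [Field K] : FreeAlgebra K (TPGen (Fin 2)) := arr K (1 : Fin 2)
end QF

/- The Kronecker quiver: `μ₁, μ₂ : 1 → 2`. -/
namespace QG
def s : Fin 2 → Fin 2 := ![0, 0]
def t : Fin 2 → Fin 2 := ![1, 1]
end QG

/- Quiver: `μ₁, μ₂ : 1 → 2`, `ν₁, ν₂ : 2 → 1`. -/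
namespace QH
def s : Fin 4 → Fin 2 := ![0, 0, 1, 1]
def t : Fin 4 → Fin 2 := ![1, 1, 0, 0]
def mu1 (K : Type) [Field K] : FreeAlgebra K (TPGen (Fin 4)) := arr K (0 : Fin 4)
def mu2 (K : Type) [Field K] : FreeAlgebra K (TPGen (Fin 4)) := arr K (1 : Fin 4)
def nu1 (K : Type) [Field K] : FreeAlgebra K (TPGen (Fin 4)) := arr K (2 : Fin 4)
def nu2 (K : Type) [Field K] : FreeAlgebra K (TPGen (Fin 4)) := arr K (3 : Fin 4)
end QH

/- Quiver: loop `α` at `1`, `μ : 1 → 2`. -/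
namespace QI
def s : Fin 2 → Fin 2 := ![0, 0]
def t : Fin 2 → Fin 2 := ![0, 1]
def al (K : Type) [Field K] : FreeAlgebra K (TPGen (Fin 2)) := arr K (0 : Fin 2)
def mu (K : Type) [Field K] : FreeAlgebra K (TPGen (Fin 2)) := arr K (1 : Fin 2)
end QI

/- Quiver: loops `α₁, α₂` at `1`, `μ : 1 → 2`. -/
namespace QJ
def s : Fin 3 → Fin 2 := ![0, 0, 0]
def t : Fin 3 → Fin 2 := ![0, 0, 1]
def a1 (K : Type) [Field K] : FreeAlgebra K (TPGen (Fin 3)) := arr K (0 : Fin 3)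
def a2 (K : Type) [Field K] : FreeAlgebra K (TPGen (Fin 3)) := arr K (1 : Fin 3)
def mu (K : Type) [Field K] : FreeAlgebra K (TPGen (Fin 3)) := arr K (2 : Fin 3)
end QJ

/- Quiver: `μ₁, μ₂ : 1 → 2`, `ν : 2 → 1`. -/
namespace QK
def s : Fin 3 → Fin 2 := ![0, 0, 1]
def t : Fin 3 → Fin 2 := ![1, 1, 0]
def mu1 (K : Type) [Field K] : FreeAlgebra K (TPGen (Fin 3)) := arr K (0 : Fin 3)
def mu2 (K : Type) [Field K] : FreeAlgebra K (TPGen (Fin 3)) := arr K (1 : Fin 3)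
def nu (K : Type) [Field K] : FreeAlgebra K (TPGen (Fin 3)) := arr K (2 : Fin 3)
end QK

/- Quiver: `μ₁, μ₂, μ₃ : 1 → 2`. -/
namespace QL
def s : Fin 3 → Fin 2 := ![0, 0, 0]
def t : Fin 3 → Fin 2 := ![1, 1, 1]
end QL

/- Quiver: loop `α` at `1`, `μ₁, μ₂ : 1 → 2`. -/
namespace QM
def s : Fin 3 → Fin 2 := ![0, 0, 0]
def t : Fin 3 → Fin 2 := ![0, 1, 1]
def al (K : Type) [Field K] : FreeAlgebra K (TPGen (Fin 3)) := arr K (0 : Fin 3)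
def mu1 (K : Type) [Field K] : FreeAlgebra K (TPGen (Fin 3)) := arr K (1 : Fin 3)
def mu2 (K : Type) [Field K] : FreeAlgebra K (TPGen (Fin 3)) := arr K (2 : Fin 3)
end QM

end TwoPoint

namespace TwoPoint

/-! ### The algebras of Han's Table T -/

/-- `T₁` (`k₁k₄ ≠ k₂k₃`, `ℓ₁ℓ₄ ≠ ℓ₂ℓ₃`):
`ν₁μ₁ = ν₂μ₂ = (ℓ₁μ₁+ℓ₂μ₂)(k₁ν₁+k₂ν₂) = (ℓ₃μ₁+ℓ₄μ₂)(k₃ν₁+k₄ν₂) = 0`. -/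
abbrev TabT1 (K : Type) [Field K] (k1 k2 k3 k4 l1 l2 l3 l4 : K) : Type :=
  BoundQuiverAlgebra K (Fin 4) QH.s QH.t
    {(QH.nu1 K * QH.mu1 K, 0), (QH.nu2 K * QH.mu2 K, 0),
     ((l1 • QH.mu1 K + l2 • QH.mu2 K) * (k1 • QH.nu1 K + k2 • QH.nu2 K), 0),
     ((l3 • QH.mu1 K + l4 • QH.mu2 K) * (k3 • QH.nu1 K + k4 • QH.nu2 K), 0)}

/-- `T₂`: `α⁶ = α²μ = 0`. -/
abbrev TabT2 (K : Type) [Field K] : Type :=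
  BoundQuiverAlgebra K (Fin 2) QI.s QI.t
    {(QI.al K ^ 6, 0), (QI.al K ^ 2 * QI.mu K, 0)}

/-- `T₃`: `α² = β² = 0`. -/
abbrev TabT3 (K : Type) [Field K] : Type :=
  BoundQuiverAlgebra K (Fin 3) QB.s QB.t {(QB.al K ^ 2, 0), (QB.be K ^ 2, 0)}

/-- `T₄` (`n ≥ 2`): `α² = βⁿ = μβ = 0`. -/
abbrev TabT4 (K : Type) [Field K] (n : ℕ) : Type :=
  BoundQuiverAlgebra K (Fin 3) QB.s QB.t
    {(QB.al K ^ 2, 0), (QB.be K ^ n, 0), (QB.mu K * QB.be K, 0)}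

/-- `T₅` (`m, n ≥ 2`): `αᵐ = βⁿ = αμ = μβ = 0`. -/
abbrev TabT5 (K : Type) [Field K] (m n : ℕ) : Type :=
  BoundQuiverAlgebra K (Fin 3) QB.s QB.t
    {(QB.al K ^ m, 0), (QB.be K ^ n, 0), (QB.al K * QB.mu K, 0), (QB.mu K * QB.be K, 0)}

/-- `T₆`: `α² = β³ = 0`, `αμ = μβ²`. -/
abbrev TabT6 (K : Type) [Field K] : Type :=
  BoundQuiverAlgebra K (Fin 3) QB.s QB.t
    {(QB.al K ^ 2, 0), (QB.be K ^ 3, 0), (QB.al K * QB.mu K, QB.mu K * QB.be K ^ 2)}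

/-- `T₇`: `α³ = β⁶ = 0`, `αμ = μβ`. -/
abbrev TabT7 (K : Type) [Field K] : Type :=
  BoundQuiverAlgebra K (Fin 3) QB.s QB.t
    {(QB.al K ^ 3, 0), (QB.be K ^ 6, 0), (QB.al K * QB.mu K, QB.mu K * QB.be K)}

/-- `T₈`: `α⁴ = β⁴ = 0`, `αμ = μβ`. -/
abbrev TabT8 (K : Type) [Field K] : Type :=
  BoundQuiverAlgebra K (Fin 3) QB.s QB.t
    {(QB.al K ^ 4, 0), (QB.be K ^ 4, 0), (QB.al K * QB.mu K, QB.mu K * QB.be K)}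

/-- `T₉` (`n ≥ 1`): `α² = μνμ = νμν = (ναμ)ⁿ = 0`. -/
abbrev TabT9 (K : Type) [Field K] (n : ℕ) : Type :=
  BoundQuiverAlgebra K (Fin 3) QD.s QD.t
    {(QD.al K ^ 2, 0), (QD.mu K * QD.nu K * QD.mu K, 0), (QD.nu K * QD.mu K * QD.nu K, 0),
     ((QD.nu K * QD.al K * QD.mu K) ^ n, 0)}

/-- `T₁₀`: `α³ = μν = νμ = ναμ = 0`. -/
abbrev TabT10 (K : Type) [Field K] : Type :=
  BoundQuiverAlgebra K (Fin 3) QD.s QD.t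
    {(QD.al K ^ 3, 0), (QD.mu K * QD.nu K, 0), (QD.nu K * QD.mu K, 0),
     (QD.nu K * QD.al K * QD.mu K, 0)}

/-- `T₁₁`: `α³ = μν`, `νμ = να² = α²μ = 0`. -/
abbrev TabT11 (K : Type) [Field K] : Type :=
  BoundQuiverAlgebra K (Fin 3) QD.s QD.t
    {(QD.al K ^ 3, QD.mu K * QD.nu K), (QD.nu K * QD.mu K, 0), (QD.nu K * QD.al K ^ 2, 0),
     (QD.al K ^ 2 * QD.mu K, 0)}

/-- `T₁₂`: `α⁴ = μν`, `να = α²μ = 0`. -/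
abbrev TabT12 (K : Type) [Field K] : Type :=
  BoundQuiverAlgebra K (Fin 3) QD.s QD.t
    {(QD.al K ^ 4, QD.mu K * QD.nu K), (QD.nu K * QD.al K, 0), (QD.al K ^ 2 * QD.mu K, 0)}

/-- `T₁₃` (`m ≥ 2`, `n ≥ 1`): `αᵐ = να = αμ = (μν)ⁿ = 0`. -/
abbrev TabT13 (K : Type) [Field K] (m n : ℕ) : Type :=
  BoundQuiverAlgebra K (Fin 3) QD.s QD.t
    {(QD.al K ^ m, 0), (QD.nu K * QD.al K, 0), (QD.al K * QD.mu K, 0),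
     ((QD.mu K * QD.nu K) ^ n, 0)}

/-- `T₁₄`: `α² = μν`, `ναμ = 0`. -/
abbrev TabT14 (K : Type) [Field K] : Type :=
  BoundQuiverAlgebra K (Fin 3) QD.s QD.t
    {(QD.al K ^ 2, QD.mu K * QD.nu K), (QD.nu K * QD.al K * QD.mu K, 0)}

/-- `T₁₅`: `α³ = μν`, `να = α²μ = 0`. -/
abbrev TabT15 (K : Type) [Field K] : Type :=
  BoundQuiverAlgebra K (Fin 3) QD.s QD.t
    {(QD.al K ^ 3, QD.mu K * QD.nu K), (QD.nu K * QD.al K, 0), (QD.al K ^ 2 * QD.mu K, 0)}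

/-- `T₁₆`: `α³ = μν`, `να = νμ = 0`. -/
abbrev TabT16 (K : Type) [Field K] : Type :=
  BoundQuiverAlgebra K (Fin 3) QD.s QD.t
    {(QD.al K ^ 3, QD.mu K * QD.nu K), (QD.nu K * QD.al K, 0), (QD.nu K * QD.mu K, 0)}

/-- `T₁₇`: `α² = β² = νμ = μν = 0`. -/
abbrev TabT17 (K : Type) [Field K] : Type :=
  BoundQuiverAlgebra K (Fin 4) QE.s QE.t
    {(QE.al K ^ 2, 0), (QE.be K ^ 2, 0), (QE.nu K * QE.mu K, 0), (QE.mu K * QE.nu K, 0)}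

/-- `T₁₈` (`m ≥ 2`, `n ≥ 1`): `α² = βᵐ = νμ = μβ = βν = (ναμ)ⁿ = 0`. -/
abbrev TabT18 (K : Type) [Field K] (m n : ℕ) : Type :=
  BoundQuiverAlgebra K (Fin 4) QE.s QE.t
    {(QE.al K ^ 2, 0), (QE.be K ^ m, 0), (QE.nu K * QE.mu K, 0), (QE.mu K * QE.be K, 0),
     (QE.be K * QE.nu K, 0), ((QE.nu K * QE.al K * QE.mu K) ^ n, 0)}

/-- `T₁₉` (`m, n ≥ 2`, `r ≥ 1`): `αᵐ = βⁿ = (νμ)ʳ = αμ = να = μβ = βν = 0`. -/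
abbrev TabT19 (K : Type) [Field K] (m n r : ℕ) : Type :=
  BoundQuiverAlgebra K (Fin 4) QE.s QE.t
    {(QE.al K ^ m, 0), (QE.be K ^ n, 0), ((QE.nu K * QE.mu K) ^ r, 0),
     (QE.al K * QE.mu K, 0), (QE.nu K * QE.al K, 0), (QE.mu K * QE.be K, 0),
     (QE.be K * QE.nu K, 0)}

/-- `T₂₀` (`k ≠ 0`): `α² = μν`, `β² = νμ`, `βν = 0`, `αμ = kμβ`. -/
abbrev TabT20 (K : Type) [Field K] (k : K) : Type :=
  BoundQuiverAlgebra K (Fin 4) QE.s QE.t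
    {(QE.al K ^ 2, QE.mu K * QE.nu K), (QE.be K ^ 2, QE.nu K * QE.mu K),
     (QE.be K * QE.nu K, 0), (QE.al K * QE.mu K, k • (QE.mu K * QE.be K))}

/-- `T₂₁` (`k₁, k₂ ≠ 0`): `β² = νμ`, `να = βν`, `k₁α² = μν`, `αμ = k₂μβ`. -/
abbrev TabT21 (K : Type) [Field K] (k1 k2 : K) : Type :=
  BoundQuiverAlgebra K (Fin 4) QE.s QE.t
    {(QE.be K ^ 2, QE.nu K * QE.mu K), (QE.nu K * QE.al K, QE.be K * QE.nu K),
     (k1 • QE.al K ^ 2, QE.mu K * QE.nu K), (QE.al K * QE.mu K, k2 • (QE.mu K * QE.be K))}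

end TwoPoint

set_option linter.unusedSectionVars false

namespace TwoPoint

/-! ### Factor modules of powers -/

/-- `Y` is a factor module of a finite direct power of `N`. -/
def Fac (R : Type) [Ring R] (N Y : Type) [AddCommGroup N] [Module R N]
    [AddCommGroup Y] [Module R Y] : Prop :=
  ∃ (k : ℕ) (g : (Fin k → N) →ₗ[R] Y), Function.Surjective g

section Fac

variable {R : Type} [Ring R] {N Y Z : Type} [AddCommGroup N] [Module R N]
  [AddCommGroup Y] [Module R Y] [AddCommGroup Z] [Module R Z]

theorem Fac.of_pi {ι : Type} [Finite ι] (g : (ι → N) →ₗ[R] Y) (hg : Function.Surjective g) :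
    Fac R N Y := by
  obtain ⟨n, ⟨e⟩⟩ := Finite.exists_equiv_fin ι
  refine ⟨n, g ∘ₗ (LinearEquiv.funCongrLeft R N e).toLinearMap, ?_⟩
  exact hg.comp (LinearEquiv.funCongrLeft R N e).surjective

theorem Fac.of_surjective (g : N →ₗ[R] Y) (hg : Function.Surjective g) : Fac R N Y := by
  refine Fac.of_pi (ι := Unit) (g ∘ₗ LinearMap.proj ()) (hg.comp fun x => ⟨fun _ => x, rfl⟩)

theorem Fac.refl : Fac R N N := Fac.of_surjective LinearMap.id Function.surjective_id

theorem Fac.of_family {ι : Type} [Fintype ι] (g : ι → N →ₗ[R] Y)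
    (hg : ⨆ i, LinearMap.range (g i) = ⊤) : Fac R N Y := by
  classical
  refine Fac.of_pi (LinearMap.lsum R (fun _ => N) ℕ g) ?_
  rw [← LinearMap.range_eq_top, eq_top_iff, ← hg]
  refine iSup_le fun i => ?_
  rintro _ ⟨x, rfl⟩
  refine ⟨Pi.single i x, ?_⟩
  rw [LinearMap.lsum_apply, LinearMap.sum_apply, Finset.sum_eq_single i] <;>
    simp +contextual

theorem Fac.trans (h : Fac R N Y) (h' : Fac R Y Z) : Fac R N Z := by
  obtain ⟨k, g, hg⟩ := h
  obtain ⟨l, g', hg'⟩ := h'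
  refine Fac.of_pi (ι := Fin l × Fin k)
    (g' ∘ₗ LinearMap.pi fun i => g ∘ₗ LinearMap.funLeft R N fun j => (i, j)) (hg'.comp ?_)
  intro y
  choose x hx using fun i => hg (y i)
  exact ⟨fun p => x p.1 p.2, funext hx⟩

theorem Fac.of_equiv (e : N ≃ₗ[R] Y) : Fac R N Y := Fac.of_surjective e.toLinearMap e.surjective

theorem Fac.pi {o : Type} [Finite o] {Y : o → Type} [∀ i, AddCommGroup (Y i)]
    [∀ i, Module R (Y i)] (h : ∀ i, Fac R N (Y i)) : Fac R N (∀ i, Y i) := by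
  choose k g hg using h
  refine Fac.of_pi (ι := Σ i, Fin (k i))
    (LinearMap.pi fun i => g i ∘ₗ LinearMap.funLeft R N (fun j => (⟨i, j⟩ : Σ i, Fin (k i)))) ?_
  intro y
  choose x hx using fun i => hg i (y i)
  exact ⟨fun p => x p.1 p.2, funext hx⟩

theorem fac_proj {o : Type} {Y : o → Type} [∀ i, AddCommGroup (Y i)]
    [∀ i, Module R (Y i)] (i : o) : Fac R (∀ i, Y i) (Y i) := by
  classical
  exact Fac.of_surjective (LinearMap.proj i) (LinearMap.proj_surjective i)

end Fac

theorem facLE_iff {Λ : Type} [Ring Λ] (M N : RMod Λ) : FacLE Λ M N ↔ Fac Λᵐᵒᵖ N M :=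
  ⟨fun h => h M Fac.refl, fun h _ hX => Fac.trans h hX⟩

/-! ### Rigidity and the splitting of presentations -/

/-- Every map from the kernel of a projective presentation of `M` to `Y` extends to the
projective, i.e. `Ext¹(M, Y) = 0`. -/
def RigidTo (R : Type) [Ring R] (M Y : Type) [AddCommGroup M] [Module R M]
    [AddCommGroup Y] [Module R Y] : Prop :=
  ∀ (P : Type) [AddCommGroup P] [Module R P] [Module.Projective R P] (π : P →ₗ[R] M),
    Function.Surjective π → ∀ h : LinearMap.ker π →ₗ[R] Y,
      ∃ h' : P →ₗ[R] Y, ∀ x : LinearMap.ker π, h' x = h x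

/-- Mutual rigidity: `Ext¹(M, Fac N) = 0`. -/
def Comp (R : Type) [Ring R] (M N : Type) [AddCommGroup M] [Module R M]
    [AddCommGroup N] [Module R N] : Prop :=
  ∀ (Y : Type) [AddCommGroup Y] [Module R Y], Fac R N Y → RigidTo R M Y

section Rigid

variable {R : Type} [Ring R] {M N Y : Type} [AddCommGroup M] [Module R M]
  [AddCommGroup N] [Module R N] [AddCommGroup Y] [Module R Y]

theorem rigidTo_of_retract (i : N →ₗ[R] M) (p : M →ₗ[R] N) (hpi : p ∘ₗ i = LinearMap.id)
    {P₀ : Type} [AddCommGroup P₀] [Module R P₀] [Module.Projective R P₀] (g : P₀ →ₗ[R] M)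
    (hg : Function.Surjective g)
    (hext : ∀ h : LinearMap.ker g →ₗ[R] Y, ∃ h' : P₀ →ₗ[R] Y, ∀ x : LinearMap.ker g, h' x = h x) :
    RigidTo R N Y := by
  intro P _ _ _ π hπ h
  obtain ⟨φ, hφ⟩ := Module.projective_lifting_property g (i ∘ₗ π) hg
  obtain ⟨ψ, hψ⟩ := Module.projective_lifting_property π (p ∘ₗ g) hπ
  have hφ' : ∀ x, g (φ x) = i (π x) := fun x => LinearMap.congr_fun hφ x
  have hψ' : ∀ x, π (ψ x) = p (g x) := fun x => LinearMap.congr_fun hψ x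
  have hpi' : ∀ x, p (i x) = x := fun x => LinearMap.congr_fun hpi x
  obtain ⟨k', hk'⟩ := hext (h ∘ₗ (ψ.restrict (p := LinearMap.ker g) (q := LinearMap.ker π)
    fun x hx => by rw [LinearMap.mem_ker] at *; rw [hψ', hx, map_zero]))
  refine ⟨k' ∘ₗ φ + h ∘ₗ ((LinearMap.id - ψ ∘ₗ φ).codRestrict (LinearMap.ker π)
    fun x => by simp [hψ', hφ', hpi']), ?_⟩
  intro x
  have hx : π x = 0 := x.2
  have h1 : φ x ∈ LinearMap.ker g := by rw [LinearMap.mem_ker, hφ', hx, map_zero]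
  have h2 := hk' ⟨φ x, h1⟩
  simp only [LinearMap.add_apply, LinearMap.comp_apply] at h2 ⊢
  rw [h2, ← map_add]
  congr 1
  ext
  simp

theorem RigidTo.retract (hM : RigidTo R M Y) (i : N →ₗ[R] M) (p : M →ₗ[R] N)
    (hpi : p ∘ₗ i = LinearMap.id) : RigidTo R N Y :=
  rigidTo_of_retract i p hpi (P₀ := M →₀ R) (Finsupp.linearCombination R id)
    (fun x => ⟨Finsupp.single x 1, by simp⟩)
    (hM _ _ fun x => ⟨Finsupp.single x 1, by simp⟩)

theorem RigidTo.of_projective [Module.Projective R M] : RigidTo R M Y := by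
  refine rigidTo_of_retract (M := M) LinearMap.id LinearMap.id rfl (P₀ := M) LinearMap.id
    Function.surjective_id fun h => ⟨0, ?_⟩
  rintro ⟨x, hx⟩
  have : x = 0 := hx
  subst this
  exact (map_zero h).symm

theorem comp_of_isTauRigidCat {M : ModuleCat.{0} R} (hM : IsTauRigidCat R M) : Comp R M M := by
  intro Y _ _ ⟨n, q, hq⟩
  obtain ⟨_, P₁, P₀, f, g, _, _, _, _, hg, hfg, hext⟩ := hM
  refine rigidTo_of_retract LinearMap.id LinearMap.id rfl g hg fun h => ?_
  have hf : ∀ x, f x ∈ LinearMap.ker g := fun x => hfg ▸ LinearMap.mem_range_self f x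
  obtain ⟨k, hk⟩ := Module.projective_lifting_property q (h ∘ₗ f.codRestrict _ hf) hq
  choose k' hk' using fun j => hext (LinearMap.proj j ∘ₗ k)
  refine ⟨q ∘ₗ LinearMap.pi k', ?_⟩
  rintro ⟨x, hx⟩
  rw [← hfg] at hx
  obtain ⟨y, rfl⟩ := hx
  have h1 := LinearMap.congr_fun hk y
  simp only [LinearMap.comp_apply] at h1 ⊢
  have h2 : LinearMap.pi k' (f y) = k y := by
    funext j
    exact (LinearMap.congr_fun (hk' j) y).symm
  rw [h2, h1]
  rfl

theorem Comp.retract {M' N' : Type} [AddCommGroup M'] [Module R M'] [AddCommGroup N']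
    [Module R N'] (h : Comp R M N) (i : M' →ₗ[R] M) (p : M →ₗ[R] M')
    (hpi : p ∘ₗ i = LinearMap.id) (hN : Fac R N N') : Comp R M' N' :=
  fun Y _ _ hY => (h Y (hN.trans hY)).retract i p hpi

theorem Comp.congr {M' N' : Type} [AddCommGroup M'] [Module R M'] [AddCommGroup N']
    [Module R N'] (h : Comp R M N) (e : M ≃ₗ[R] M') (e' : N ≃ₗ[R] N') : Comp R M' N' :=
  h.retract e.symm.toLinearMap e.toLinearMap (by ext; simp) (Fac.of_equiv e')

end Rigid

/-- A pair of complementary orthogonal idempotents of `R`, each with a character. -/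
structure Frame (K R : Type) [Field K] [Ring R] [Algebra K R] where
  e₁ : R
  e₂ : R
  ε₁ : R →ₐ[K] K
  ε₂ : R →ₐ[K] K
  mul₁₂ : e₁ * e₂ = 0
  mul₂₁ : e₂ * e₁ = 0
  add : e₁ + e₂ = 1
  ε₁₁ : ε₁ e₁ = 1
  ε₂₂ : ε₂ e₂ = 1

/-- The conclusion of Nakayama's lemma for the left ideal `J`. -/
def Nak {R : Type} [Ring R] (J : Ideal R) : Prop :=
  ∀ (M : Type) [AddCommGroup M] [Module R M] (N N' : Submodule R M), N ≤ N' ⊔ J • N → N ≤ N'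

theorem Nak.bot {R : Type} [Ring R] : Nak (⊥ : Ideal R) :=
  fun _ _ _ _ _ h => by simpa using h

namespace Frame

variable {K R : Type} [Field K] [Ring R] [Algebra K R] (F : Frame K R)

/-- Exchange the two vertices. -/
def swap : Frame K R := ⟨F.e₂, F.e₁, F.ε₂, F.ε₁, F.mul₂₁, F.mul₁₂,
  (add_comm _ _).trans F.add, F.ε₂₂, F.ε₁₁⟩

theorem mul₁₁ : F.e₁ * F.e₁ = F.e₁ := by
  have h := congrArg (F.e₁ * ·) F.add
  simpa [mul_add, F.mul₁₂] using h

theorem mul₂₂ : F.e₂ * F.e₂ = F.e₂ := F.swap.mul₁₁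

theorem ε₁₂ : F.ε₁ F.e₂ = 0 := by
  have h := congrArg F.ε₁ F.mul₁₂
  simpa [F.ε₁₁] using h

theorem ε₂₁ : F.ε₂ F.e₁ = 0 := F.swap.ε₁₂

/-- The arrow ideal: the common kernel of the two characters. -/
def J : Ideal R := RingHom.ker F.ε₁ ⊓ RingHom.ker F.ε₂

theorem J_swap : F.swap.J = F.J := inf_comm _ _

/-- `x` lies in `e₂Re₁`. -/
def IsV (x : R) : Prop := F.e₂ * x = x ∧ x * F.e₁ = x

variable {F}

theorem IsV.ε₁ {x : R} (h : F.IsV x) : F.ε₁ x = 0 := by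
  rw [← h.1, map_mul, F.ε₁₂, zero_mul]

theorem IsV.ε₂ {x : R} (h : F.IsV x) : F.ε₂ x = 0 := by
  rw [← h.2, map_mul, F.ε₂₁, mul_zero]

theorem IsV.mem_J {x : R} (h : F.IsV x) : x ∈ F.J := ⟨h.ε₁, h.ε₂⟩

theorem mem_J_of_e₁ {x : R} (h : x * F.e₁ = x) (h' : F.ε₁ x = 0) : x ∈ F.J :=
  ⟨h', by rw [← h]; simp [F.ε₂₁]⟩

theorem mem_J_of_e₂ {x : R} (h : x * F.e₂ = x) (h' : F.ε₂ x = 0) : x ∈ F.J :=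
  ⟨by rw [← h]; simp [F.ε₁₂], h'⟩

theorem J_smul {M : Type} [AddCommGroup M] [Module R M] {N : Submodule R M}
    {x : R} (hx : x ∈ F.J) {m : M} (hm : m ∈ N) : x • m ∈ F.J • N :=
  Submodule.smul_mem_smul hx hm

variable (F)

theorem e₁_add_smul {M : Type} [AddCommGroup M] [Module R M] (m : M) :
    F.e₁ • m + F.e₂ • m = m := by rw [← add_smul, F.add, one_smul]

theorem e₁_smul_eq_iff {M : Type} [AddCommGroup M] [Module R M] (m : M) :
    F.e₁ • m = m ↔ F.e₂ • m = 0 := by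
  constructor
  · intro h; rw [← h, smul_smul, F.mul₂₁, zero_smul]
  · intro h; simpa [h] using F.e₁_add_smul m

variable {κ ι : Type} [Fintype κ] [Fintype ι] [DecidableEq ι]

/-- The relations of the cokernel of `f : (Re₂)^κ → (Re₁)^ι`. -/
def rel (f : Matrix κ ι R) : Submodule R (ι → R) :=
  Submodule.span R (Set.range f) ⊔ Submodule.span R (Set.range fun i => Pi.single i F.e₂)

/-- The cokernel of `f : (Re₂)^κ → (Re₁)^ι`. -/
abbrev X (f : Matrix κ ι R) : Type := (ι → R) ⧸ F.rel f

/-- All entries lie in `e₂Re₁`. -/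
def EV (f : Matrix κ ι R) : Prop := ∀ k i, F.IsV (f k i)

variable {F} {f : Matrix κ ι R}

theorem sum_single_mul {ι : Type} [Fintype ι] [DecidableEq ι] (x : ι → R) :
    ∑ i, x i • (Pi.single i (1 : R) : ι → R) = x := by
  funext j
  simp [Finset.sum_apply, Pi.single_apply]

theorem mem_rel (hf : F.EV f) {x : ι → R} :
    x ∈ F.rel f ↔ ∃ c : κ → R, ∀ i, x i * F.e₁ = ∑ k, c k * f k i := by
  rw [rel, Submodule.mem_sup]
  constructor
  · rintro ⟨y, hy, z, hz, rfl⟩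
    obtain ⟨c, rfl⟩ := (Submodule.mem_span_range_iff_exists_fun R).1 hy
    obtain ⟨d, rfl⟩ := (Submodule.mem_span_range_iff_exists_fun R).1 hz
    refine ⟨c, fun i => ?_⟩
    have : (∑ i, d i • (Pi.single i F.e₂ : ι → R)) i = d i * F.e₂ := by
      simp [Finset.sum_apply, Pi.single_apply]
    rw [Pi.add_apply, this, add_mul, mul_assoc, F.mul₂₁, mul_zero, add_zero, Finset.sum_apply,
      Finset.sum_mul]
    exact Finset.sum_congr rfl fun k _ => by
      rw [Pi.smul_apply, smul_eq_mul, mul_assoc, (hf k i).2]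
  · rintro ⟨c, hc⟩
    refine ⟨∑ k, c k • f k, Submodule.sum_mem _ fun k _ => Submodule.smul_mem _ _
      (Submodule.subset_span ⟨k, rfl⟩), ∑ i, x i • Pi.single i F.e₂,
      Submodule.sum_mem _ fun k _ => Submodule.smul_mem _ _
      (Submodule.subset_span ⟨k, rfl⟩), ?_⟩
    funext i
    have : (∑ i, x i • (Pi.single i F.e₂ : ι → R)) i = x i * F.e₂ := by
      simp [Finset.sum_apply, Pi.single_apply]
    rw [Pi.add_apply, this, Finset.sum_apply]
    simp only [Pi.smul_apply, smul_eq_mul]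
    rw [← hc, ← mul_add, F.add, mul_one]

variable (F f) in
/-- The canonical generators of `X f`. -/
def gen (i : ι) : F.X f := (F.rel f).mkQ (Pi.single i 1)

theorem mkQ_eq_sum (x : ι → R) : (F.rel f).mkQ x = ∑ i, x i • F.gen f i := by
  conv_lhs => rw [← sum_single_mul x]
  simp [gen, map_sum]

theorem exists_gen (x : F.X f) : ∃ r : ι → R, x = ∑ i, r i • F.gen f i := by
  obtain ⟨y, rfl⟩ := Submodule.mkQ_surjective _ x
  exact ⟨y, mkQ_eq_sum y⟩

theorem e₂_gen (i : ι) : F.e₂ • F.gen f i = 0 := by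
  rw [gen, ← map_smul, Submodule.mkQ_apply, Submodule.Quotient.mk_eq_zero, rel]
  refine Submodule.mem_sup_right (Submodule.subset_span ⟨i, ?_⟩)
  funext j
  by_cases h : j = i
  · subst h; simp
  · simp [h]

theorem e₁_gen (i : ι) : F.e₁ • F.gen f i = F.gen f i :=
  (F.e₁_smul_eq_iff _).2 (e₂_gen i)

theorem sum_gen_eq_zero (hf : F.EV f) {x : ι → R} :
    ∑ i, x i • F.gen f i = 0 ↔ ∃ c : κ → R, ∀ i, x i * F.e₁ = ∑ k, c k * f k i := by
  rw [← mkQ_eq_sum, ← mem_rel hf, Submodule.mkQ_apply, Submodule.Quotient.mk_eq_zero]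

theorem row_gen (k : κ) : ∑ i, f k i • F.gen f i = 0 := by
  rw [← mkQ_eq_sum, Submodule.mkQ_apply, Submodule.Quotient.mk_eq_zero, rel]
  exact Submodule.mem_sup_left (Submodule.subset_span ⟨k, rfl⟩)

theorem span_gen : Submodule.span R (Set.range (F.gen f)) = ⊤ := by
  refine eq_top_iff.2 fun x _ => ?_
  obtain ⟨r, rfl⟩ := exists_gen x
  exact Submodule.sum_mem _ fun i _ => Submodule.smul_mem _ _ (Submodule.subset_span ⟨i, rfl⟩)

instance : Module.Finite R (F.X f) := inferInstance

section lift

variable {N : Type} [AddCommGroup N] [Module R N]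

/-- The map out of `X f` determined by images of the generators. -/
def lift (w : ι → N) (h₁ : ∀ i, F.e₁ • w i = w i) (h₂ : ∀ k, ∑ i, f k i • w i = 0) :
    F.X f →ₗ[R] N :=
  (F.rel f).liftQ (Fintype.linearCombination R w) (by
    rw [rel, sup_le_iff, Submodule.span_le, Submodule.span_le]
    constructor
    · rintro _ ⟨k, rfl⟩
      simpa [Fintype.linearCombination_apply] using h₂ k
    · rintro _ ⟨i, rfl⟩
      rw [SetLike.mem_coe, LinearMap.mem_ker, Fintype.linearCombination_apply,
        Finset.sum_eq_single i]
      · simpa using (F.e₁_smul_eq_iff _).1 (h₁ i)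
      · intro j _ hj; simp [hj]
      · simp)

@[simp] theorem lift_gen (w : ι → N) (h₁ : ∀ i, F.e₁ • w i = w i)
    (h₂ : ∀ k, ∑ i, f k i • w i = 0) (i : ι) : lift w h₁ h₂ (F.gen f i) = w i := by
  simp [lift, gen, Fintype.linearCombination_apply, Pi.single_apply]

theorem hom_ext {g h : F.X f →ₗ[R] N} (H : ∀ i, g (F.gen f i) = h (F.gen f i)) : g = h := by
  refine LinearMap.ext_on (span_gen (F := F) (f := f)) ?_
  rintro _ ⟨i, rfl⟩
  exact H i

theorem surjective_of_gen {g : N →ₗ[R] F.X f} (H : ∀ i, F.gen f i ∈ LinearMap.range g) :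
    Function.Surjective g := by
  rw [← LinearMap.range_eq_top, eq_top_iff, ← span_gen (F := F) (f := f), Submodule.span_le]
  rintro _ ⟨i, rfl⟩
  exact H i

variable (F) in
/-- Every map `(Re₂)^κ → N` factors through `f`. -/
def InT (f : Matrix κ ι R) (N : Type) [AddCommGroup N] [Module R N] : Prop :=
  ∀ u : κ → N, (∀ k, F.e₂ • u k = u k) →
    ∃ w : ι → N, (∀ i, F.e₁ • w i = w i) ∧ ∀ k, u k = ∑ i, f k i • w i

theorem InT.of_exists (hf : F.EV f) (h : ∀ u : κ → N, (∀ k, F.e₂ • u k = u k) →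
    ∃ w : ι → N, ∀ k, u k = ∑ i, f k i • w i) : F.InT f N := by
  intro u hu
  obtain ⟨w, hw⟩ := h u hu
  refine ⟨fun i => F.e₁ • w i, fun i => by rw [smul_smul, F.mul₁₁], fun k => ?_⟩
  rw [hw]
  exact Finset.sum_congr rfl fun i _ => by rw [smul_smul, (hf k i).2]

theorem InT.fac {Y : Type} [AddCommGroup Y] [Module R Y] (h : F.InT f N) (hY : Fac R N Y) :
    F.InT f Y := by
  obtain ⟨n, g, hg⟩ := hY
  intro u hu
  choose v hv using fun k => hg (u k)
  choose w hw₁ hw₂ using fun j : Fin n => h (fun k => F.e₂ • v k j)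
    fun k => by rw [smul_smul, F.mul₂₂]
  refine ⟨fun i => g fun j => w j i, fun i => ?_, fun k => ?_⟩
  · rw [← map_smul]
    congr 1
    funext j
    exact hw₁ j i
  · rw [← hu, ← hv, ← map_smul]
    simp_rw [← map_smul, ← map_sum]
    congr 1
    funext j
    rw [Finset.sum_apply]
    exact hw₂ j k

/-- Minimality of the presentation `f` relative to the ideal `I`. -/
def Min (F : Frame K R) (I : Ideal R) (f : Matrix κ ι R) : Prop :=
  ∀ c : κ → R, (∀ i, ∑ k, c k * f k i = 0) → ∀ k, c k * F.e₂ ∈ I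

theorem inT_of_comp {I : Ideal R} (hI : Nak I) (hf : F.EV f) (hmin : F.Min I f)
    (h : Comp R (F.X f) N) : F.InT f N := by
  refine InT.of_exists hf fun u hu => ?_
  let D : Submodule R N :=
    { carrier := {y | ∃ c : κ → R, (∀ i, ∑ k, c k * f k i = 0) ∧ y = ∑ k, c k • u k}
      add_mem' := by
        rintro _ _ ⟨c, hc, rfl⟩ ⟨d, hd, rfl⟩
        refine ⟨c + d, fun i => ?_, ?_⟩
        · simp [add_mul, Finset.sum_add_distrib, hc, hd]
        · simp [add_smul, Finset.sum_add_distrib]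
      zero_mem' := ⟨0, by simp, by simp⟩
      smul_mem' := by
        rintro r _ ⟨c, hc, rfl⟩
        refine ⟨r • c, fun i => ?_, ?_⟩
        · simp [mul_assoc, ← Finset.mul_sum, hc]
        · simp [mul_smul, ← Finset.smul_sum] }
  have hwd : ∀ c d : κ → R, (∀ i, ∑ k, c k * f k i = ∑ k, d k * f k i) →
      D.mkQ (∑ k, c k • u k) = D.mkQ (∑ k, d k • u k) := by
    intro c d hcd
    rw [← sub_eq_zero, ← map_sub, Submodule.mkQ_apply, Submodule.Quotient.mk_eq_zero]
    refine ⟨c - d, fun i => ?_, ?_⟩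
    · simp [sub_mul, Finset.sum_sub_distrib, hcd]
    · simp [sub_smul, Finset.sum_sub_distrib]
  choose c hc using fun x : F.rel f => (mem_rel hf).1 x.2
  have hker : LinearMap.ker (F.rel f).mkQ = F.rel f := Submodule.ker_mkQ _
  let h₀ : F.rel f →ₗ[R] N ⧸ D :=
    { toFun := fun x => D.mkQ (∑ k, c x k • u k)
      map_add' := fun x y => by
        rw [← map_add, ← Finset.sum_add_distrib]
        simp_rw [← add_smul]
        refine hwd _ _ fun i => ?_
        simp only [add_mul, Finset.sum_add_distrib]
        rw [← hc, ← hc, ← hc, ← add_mul]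
        rfl
      map_smul' := fun r x => by
        rw [RingHom.id_apply, ← map_smul, Finset.smul_sum]
        simp_rw [smul_smul]
        refine hwd _ _ fun i => ?_
        simp only [mul_assoc, ← Finset.mul_sum]
        rw [← hc, ← hc, ← mul_assoc]
        rfl }
  have hh₀ : ∀ (x : F.rel f) (d : κ → R), (∀ i, x.1 i * F.e₁ = ∑ k, d k * f k i) →
      h₀ x = D.mkQ (∑ k, d k • u k) := fun x d hd =>
    hwd _ _ fun i => by rw [← hd, ← hc]
  obtain ⟨h', hh'⟩ := h _ (Fac.of_surjective D.mkQ (Submodule.mkQ_surjective _)) _ (F.rel f).mkQ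
    (Submodule.mkQ_surjective _) (h₀ ∘ₗ (LinearEquiv.ofEq _ _ hker).toLinearMap)
  have hh'' : ∀ x (hx : x ∈ F.rel f), h' x = h₀ ⟨x, hx⟩ := fun x hx => hh' ⟨x, hker.symm ▸ hx⟩
  choose w hw using fun i => Submodule.mkQ_surjective D (h' (Pi.single i 1))
  have hd : ∀ k, u k - ∑ i, f k i • w i ∈ D := by
    intro k
    classical
    rw [← Submodule.Quotient.mk_eq_zero, ← Submodule.mkQ_apply, map_sub, sub_eq_zero, map_sum]
    simp_rw [map_smul, hw, ← map_smul, ← map_sum]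
    rw [sum_single_mul (f k), hh'' _ (Submodule.mem_sup_left (Submodule.subset_span ⟨k, rfl⟩)),
      hh₀ _ (Pi.single k 1)]
    · congr 1
      rw [Finset.sum_eq_single k] <;> simp +contextual
    · intro i
      rw [Finset.sum_eq_single k] <;> simp +contextual [(hf k i).2]
  have hD : D = ⊥ := by
    rw [eq_bot_iff]
    refine hI _ _ _ (le_trans ?_ le_sup_right)
    rintro _ ⟨c, hc, rfl⟩
    have : ∑ k, c k • u k = ∑ k, (c k * F.e₂) • (u k - ∑ i, f k i • w i) := by
      simp_rw [smul_sub, Finset.sum_sub_distrib, mul_smul, hu, Finset.smul_sum, smul_smul]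
      rw [eq_comm, sub_eq_self, Finset.sum_comm]
      refine Finset.sum_eq_zero fun i _ => ?_
      rw [← Finset.sum_smul]
      have : ∀ k, c k * (F.e₂ * f k i) = c k * f k i := fun k => by rw [(hf k i).1]
      simp_rw [this, hc, zero_smul]
    rw [this]
    exact Submodule.sum_mem _ fun k _ => Submodule.smul_mem_smul (hmin c hc k) (hd k)
  refine ⟨w, fun k => ?_⟩
  have := hd k
  rw [hD, Submodule.mem_bot, sub_eq_zero] at this
  exact this

end lift

end Frame

theorem IsTauRigidCat.congr {R : Type} [Ring R] {M N : ModuleCat.{0} R} (h : IsTauRigidCat R M)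
    (e : M ≃ₗ[R] N) : IsTauRigidCat R N := by
  obtain ⟨hM, P₁, P₀, f, g, h₁, h₂, h₃, h₄, hg, hfg, hext⟩ := h
  refine ⟨Module.Finite.equiv e, P₁, P₀, f, e.toLinearMap ∘ₗ g, h₁, h₂, h₃, h₄,
    e.surjective.comp hg, ?_, fun k => ?_⟩
  · rw [hfg]; ext x; simp
  · obtain ⟨k', hk'⟩ := hext (e.symm.toLinearMap ∘ₗ k)
    refine ⟨e.toLinearMap ∘ₗ k', ?_⟩
    rw [LinearMap.comp_assoc, ← hk']
    ext x; simp

theorem isTauRigidCat_of_projective {R : Type} [Ring R] (M : ModuleCat.{0} R)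
    [hM : Module.Finite R M] [Module.Projective R M] : IsTauRigidCat R M :=
  ⟨hM, ModuleCat.of R PUnit, M, 0, LinearMap.id, inferInstance, inferInstance, inferInstance,
    inferInstance, Function.surjective_id, by simp, fun h => ⟨0, by
      ext x; simp [Subsingleton.elim x 0]⟩⟩

/-- The module `(Re)^κ`. -/
def PR {R : Type} [Ring R] (e : R) (κ : Type) : Submodule R (κ → R) where
  carrier := {x | ∀ k, x k * e = x k}
  add_mem' hx hy k := by simp [add_mul, hx k, hy k]
  zero_mem' k := by simp
  smul_mem' r x hx k := by simp [mul_assoc, hx k]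

section PR
variable {R : Type} [Ring R] {e : R} (he : e * e = e) (κ : Type)

/-- The projection onto `(Re)^κ`. -/
def PR.retr : (κ → R) →ₗ[R] PR e κ where
  toFun x := ⟨fun k => x k * e, fun k => by rw [mul_assoc, he]⟩
  map_add' x y := by ext; simp [add_mul]
  map_smul' r x := by ext; simp [mul_assoc]

theorem PR.retr_surjective : Function.Surjective (PR.retr he κ) := fun x =>
  ⟨x.1, by ext k; exact x.2 k⟩

theorem PR.retr_comp : PR.retr he κ ∘ₗ (PR e κ).subtype = LinearMap.id := by
  ext x k; exact x.2 k

include he in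
theorem PR.projective [Finite κ] : Module.Projective R (PR e κ) :=
  .of_split (PR e κ).subtype (PR.retr he κ) (PR.retr_comp he κ)

include he in
theorem PR.finite [Finite κ] : Module.Finite R (PR e κ) :=
  .of_surjective _ (PR.retr_surjective he κ)

end PR

namespace Frame

variable {K R : Type} [Field K] [Ring R] [Algebra K R] {F : Frame K R}
variable {κ ι : Type} [Fintype κ] [Fintype ι] [DecidableEq ι] {f : Matrix κ ι R}

theorem isTauRigidCat_X (hf : F.EV f) (h : F.InT f (F.X f)) :
    IsTauRigidCat R (ModuleCat.of R (F.X f)) := by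
  classical
  obtain ⟨G, hGl, hGr⟩ : ∃ G : κ ⊕ ι → ι → R,
      (∀ k, G (Sum.inl k) = fun i => f k i) ∧ ∀ i, G (Sum.inr i) = Pi.single i F.e₂ :=
    ⟨Sum.elim (fun k i => f k i) fun i => Pi.single i F.e₂, fun _ => rfl, fun _ => rfl⟩
  have hG : ∀ k, F.e₂ • G k = G k := by
    rintro (k | i)
    · rw [hGl]; funext i; exact (hf k i).1
    · rw [hGr, ← Pi.single_smul, smul_eq_mul, F.mul₂₂]
  let d : PR F.e₂ (κ ⊕ ι) →ₗ[R] (ι → R) :=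
    Fintype.linearCombination R G ∘ₗ (PR F.e₂ (κ ⊕ ι)).subtype
  have hd : LinearMap.range d = F.rel f := by
    have : F.rel f = LinearMap.range (Fintype.linearCombination R G) := by
      rw [Fintype.range_linearCombination, rel, ← Submodule.span_union]
      congr 1
      ext x
      simp only [Set.mem_union, Set.mem_range, Sum.exists, hGl, hGr]
      rfl
    rw [this]
    refine le_antisymm (LinearMap.range_comp_le_range _ _) ?_
    rintro _ ⟨x, rfl⟩
    refine ⟨PR.retr F.mul₂₂ _ x, ?_⟩
    simp [d, PR.retr, Fintype.linearCombination_apply, mul_smul, hG]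
  refine ⟨inferInstance, ModuleCat.of R (PR F.e₂ (κ ⊕ ι)), ModuleCat.of R (ι → R), d,
    (F.rel f).mkQ, PR.finite F.mul₂₂ _, PR.projective F.mul₂₂ _, ?_, ?_,
    Submodule.mkQ_surjective _, ?_, fun k => ?_⟩
  · change Module.Finite R (ι → R); infer_instance
  · change Module.Projective R (ι → R); infer_instance
  · rw [hd, Submodule.ker_mkQ]
  · let δ : κ ⊕ ι → PR F.e₂ (κ ⊕ ι) := fun a => PR.retr F.mul₂₂ _ (Pi.single a 1)
    change PR F.e₂ (κ ⊕ ι) →ₗ[R] F.X f at k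
    have hδ : ∀ a, F.e₂ • δ a = δ a := by
      intro a
      rw [← map_smul]
      ext b
      by_cases hb : b = a
      · subst hb; simp [δ, PR.retr, F.mul₂₂]
      · simp [δ, PR.retr, hb]
    obtain ⟨w, hw₁, hw₂⟩ := h (fun a => k (δ (Sum.inl a))) fun a => by rw [← map_smul, hδ]
    have hy : ∀ i, F.e₂ • k (δ (Sum.inr i)) = k (δ (Sum.inr i)) := fun i => by
      rw [← map_smul, hδ]
    refine ⟨Fintype.linearCombination R fun i => w i + k (δ (Sum.inr i)), ?_⟩
    have key : ∀ a, k (δ a) = Fintype.linearCombination R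
        (fun i => w i + k (δ (Sum.inr i))) (G a) := by
      rintro (a | i)
      · rw [hw₂, Fintype.linearCombination_apply]
        refine Finset.sum_congr rfl fun i _ => ?_
        rw [smul_add, ← hy, smul_smul]
        have : G (Sum.inl a) i * F.e₂ = 0 := by
          rw [hGl]
          change f a i * F.e₂ = 0
          rw [← (hf a i).2, mul_assoc, F.mul₁₂, mul_zero]
        rw [this, zero_smul, add_zero, hGl]
      · have : F.e₂ • w i = 0 := (F.e₁_smul_eq_iff _).1 (hw₁ i)
        rw [Fintype.linearCombination_apply, Finset.sum_eq_single i]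
        · simp [hGr, this, hy]
        · intro j _ hj; simp [hGr, hj]
        · simp
    refine LinearMap.ext fun x => ?_
    have hx : x = ∑ a, x.1 a • δ a := by
      have h1 : x = PR.retr F.mul₂₂ _ x.1 := (LinearMap.congr_fun (PR.retr_comp F.mul₂₂ _) x).symm
      have h2 := congrArg (PR.retr F.mul₂₂ (κ ⊕ ι)) (sum_single_mul x.1)
      rw [← h1, map_sum] at h2
      exact h2.symm.trans (Finset.sum_congr rfl fun a _ => map_smul _ _ _)
    have hdδ : ∀ a, d (δ a) = G a := by
      intro a
      change Fintype.linearCombination R G _ = _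
      rw [Fintype.linearCombination_apply, Finset.sum_eq_single a]
      · simp [δ, PR.retr, hG]
      · intro b _ hb; simp [δ, PR.retr, hb]
      · simp
    conv_lhs => rw [hx]
    conv_rhs => rw [hx]
    rw [map_sum, map_sum]
    refine Finset.sum_congr rfl fun a _ => ?_
    rw [map_smul, map_smul, key, LinearMap.comp_apply, hdδ]

/-! ### Blocks -/

theorem EV.blockDiagonal' {o : Type} [DecidableEq o] {κ ι : o → Type}
    {f : ∀ a, Matrix (κ a) (ι a) R} (hf : ∀ a, F.EV (f a)) :
    F.EV (Matrix.blockDiagonal' f) := by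
  rintro ⟨a, k⟩ ⟨b, i⟩
  rw [Matrix.blockDiagonal'_apply]
  split_ifs with h
  · exact hf a _ _
  · constructor <;> simp

section block

variable {o : Type} [DecidableEq o] [Fintype o] {κ ι : o → Type} [∀ a, Fintype (κ a)]
  [∀ a, Fintype (ι a)] [∀ a, DecidableEq (ι a)] {f : ∀ a, Matrix (κ a) (ι a) R}

theorem sum_blockDiagonal' {N : Type} [AddCommGroup N] [Module R N] (w : (Σ a, ι a) → N)
    (a : o) (k : κ a) :
    ∑ p, Matrix.blockDiagonal' f ⟨a, k⟩ p • w p = ∑ i, f a k i • w ⟨a, i⟩ := by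
  rw [Fintype.sum_sigma, Finset.sum_eq_single a]
  · simp [Matrix.blockDiagonal'_apply]
  · intro b _ hb
    refine Finset.sum_eq_zero fun i _ => ?_
    rw [Matrix.blockDiagonal'_apply, dif_neg (Ne.symm hb), zero_smul]
  · simp

theorem InT.blockDiagonal' {N : Type} [AddCommGroup N] [Module R N]
    (h : ∀ a, F.InT (f a) N) : F.InT (Matrix.blockDiagonal' f) N := by
  intro u hu
  choose w hw₁ hw₂ using fun a => h a (fun k => u ⟨a, k⟩) fun k => hu _
  refine ⟨fun p => w p.1 p.2, fun p => hw₁ _ _, ?_⟩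
  rintro ⟨a, k⟩
  rw [sum_blockDiagonal', hw₂]

/-- The cokernel of a block diagonal map. -/
def blockEquiv : F.X (Matrix.blockDiagonal' f) ≃ₗ[R] ∀ a, F.X (f a) :=
  LinearEquiv.ofLinearMap
    (F.lift (fun p => Pi.single p.1 (F.gen (f p.1) p.2))
      (fun p => by rw [← Pi.single_smul, e₁_gen]) (by
        rintro ⟨a, k⟩
        rw [sum_blockDiagonal']
        simp_rw [← Pi.single_smul]
        rw [← Pi.single_zero a, ← row_gen (f := f a) k]
        exact (map_sum (LinearMap.single R (fun a => F.X (f a)) a) _ _).symm))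
    (LinearMap.lsum R (fun a => F.X (f a)) ℕ fun a =>
      F.lift (fun i => F.gen (Matrix.blockDiagonal' f) ⟨a, i⟩) (fun i => e₁_gen _) (fun k => by
        rw [← row_gen (f := Matrix.blockDiagonal' f) ⟨a, k⟩, sum_blockDiagonal']))
    (by
      refine LinearMap.pi_ext' fun a => hom_ext fun i => ?_
      simp only [LinearMap.comp_apply, LinearMap.lsum_apply, LinearMap.sum_apply,
        LinearMap.coe_single, LinearMap.proj_apply, LinearMap.id_apply]
      rw [Finset.sum_eq_single a]
      · simp
      · intro b _ hb; simp [hb]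
      · simp)
    (by
      refine hom_ext fun p => ?_
      simp only [LinearMap.comp_apply, lift_gen, LinearMap.lsum_apply, LinearMap.sum_apply,
        LinearMap.proj_apply, LinearMap.id_apply]
      rw [Finset.sum_eq_single p.1]
      · simp
      · intro b _ hb; simp [hb]
      · simp)

end block

/-! ### Tops -/

theorem gen_notMem (hf : F.EV f) (i : ι) : F.gen f i ∉ F.J • (⊤ : Submodule R (F.X f)) := by
  let T : AddSubgroup (F.X f) :=
    { carrier := {y | ∃ r : ι → R, F.ε₁ (r i) = 0 ∧ y = ∑ j, r j • F.gen f j}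
      add_mem' := by
        rintro _ _ ⟨c, hc, rfl⟩ ⟨d, hd, rfl⟩
        exact ⟨c + d, by simp [hc, hd], by simp [add_smul, Finset.sum_add_distrib]⟩
      zero_mem' := ⟨0, by simp, by simp⟩
      neg_mem' := by
        rintro _ ⟨c, hc, rfl⟩
        exact ⟨-c, by simp [hc], by simp⟩ }
  intro h
  have : F.gen f i ∈ T := by
    refine Submodule.smul_induction_on h (fun r hr x _ => ?_) fun x y hx hy => T.add_mem hx hy
    obtain ⟨c, rfl⟩ := exists_gen x
    exact ⟨fun j => r * c j, by rw [map_mul, hr.1, zero_mul], by simp [Finset.smul_sum, mul_smul]⟩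
  obtain ⟨r, hr, h⟩ := this
  have h2 : ∑ j, (r - Pi.single i 1 : ι → R) j • F.gen f j = 0 := by
    simp_rw [Pi.sub_apply, sub_smul]
    rw [Finset.sum_sub_distrib, ← h, sub_eq_zero, Finset.sum_eq_single i] <;> simp +contextual
  obtain ⟨c, hc⟩ := (sum_gen_eq_zero hf).1 h2
  have h3 := congrArg F.ε₁ (hc i)
  simp [hr, F.ε₁₁, (hf _ i).ε₁] at h3

theorem e₂_smul_mem (x : F.X f) : F.e₂ • x ∈ F.J • (⊤ : Submodule R (F.X f)) := by
  obtain ⟨r, rfl⟩ := exists_gen x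
  rw [Finset.smul_sum]
  refine Submodule.sum_mem _ fun i _ => ?_
  rw [← e₁_gen, smul_smul, smul_smul]
  refine Submodule.smul_mem_smul ?_ trivial
  exact ⟨by simp [F.ε₁₂], by simp [F.ε₂₁]⟩

end Frame

open Polynomial in
/-- A linear perturbation of a singular linear system has, for generic parameter, solutions
close to a given one. -/
theorem exists_generic_solution {K A W n : Type} [Field K] [AddCommGroup A] [Module K A]
    [Module.Finite K A] [AddCommGroup W] [Module K W] [Fintype n] [DecidableEq n]
    (Φ Ψ : A →ₗ[K] W) (hΨ : LinearMap.range Ψ ≤ LinearMap.range Φ) (L : A →ₗ[K] Matrix n n K)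
    (x₀ : A) (hx₀ : Φ x₀ = 0) (hL : (L x₀).det ≠ 0) :
    ∃ p : K[X], p.eval 0 ≠ 0 ∧ ∀ c : K, p.eval c ≠ 0 → ∃ x, Φ x + c • Ψ x = 0 ∧
      (L x).det ≠ 0 := by
  obtain ⟨T, hT⟩ := Module.projective_lifting_property Φ.rangeRestrict
    (Ψ.codRestrict (LinearMap.range Φ) fun x => hΨ ⟨x, rfl⟩) Φ.surjective_rangeRestrict
  have hT' : ∀ x, Φ (T x) = Ψ x := fun x => congrArg Subtype.val (LinearMap.congr_fun hT x)
  let b := Module.finBasis K A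
  let M := LinearMap.toMatrix b b T
  let N : Matrix (Fin (Module.finrank K A)) (Fin (Module.finrank K A)) K[X] :=
    1 + (X : K[X]) • M.map C
  let y : Fin (Module.finrank K A) → K[X] := N.adjugate.mulVec fun i => C (b.repr x₀ i)
  let Q : Matrix n n K[X] := ∑ i, y i • (L (b i)).map C
  have hN : ∀ c, N.map (eval c) = 1 + c • M := by
    intro c; ext i j
    by_cases h : i = j
    · subst h; simpa [N] using mul_comm _ _
    · simpa [N, h] using mul_comm _ _
  have hy : ∀ c i, (y i).eval c = ((1 + c • M).adjugate.mulVec fun i => b.repr x₀ i) i := by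
    intro c i
    rw [← hN]
    have := (evalRingHom c).map_mulVec N.adjugate (fun i => C (b.repr x₀ i)) i
    simp only [y]
    refine this.trans ?_
    have h2 := (evalRingHom c).map_adjugate N
    simp only [RingHom.mapMatrix_apply, coe_evalRingHom] at h2
    simp only [coe_evalRingHom]
    rw [← h2]
    congr 1
    ext i
    simp
  have hQ : ∀ c, Q.det.eval c = (L (∑ i, (y i).eval c • b i)).det := by
    intro c
    have := (evalRingHom c).map_det Q
    simp only [coe_evalRingHom, RingHom.mapMatrix_apply] at this
    rw [this]
    congr 1
    ext i j
    simp [Q, Matrix.sum_apply, eval_finsetSum]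
  refine ⟨Q.det, ?_, fun c hc => ⟨∑ i, (y i).eval c • b i, ?_, by rwa [← hQ]⟩⟩
  · rw [hQ]
    convert hL using 3
    conv_rhs => rw [← b.sum_repr x₀]
    refine Finset.sum_congr rfl fun i _ => ?_
    rw [hy]; simp
  · set x := ∑ i, (y i).eval c • b i with hx
    have h1 : ∀ i, b.repr x i = (y i).eval c := fun i => by
      rw [hx]; simp [Finsupp.single_apply]
    have h2 : x + c • T x = (1 + c • M).det • x₀ := by
      apply b.repr.injective
      ext i
      have h3 := congrFun (LinearMap.toMatrix_mulVec_repr b b T x) i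
      have h4 : (⇑(b.repr x)) = (1 + c • M).adjugate.mulVec fun i => b.repr x₀ i := by
        funext i; rw [h1, hy]
      rw [map_add, map_smul, map_smul, Finsupp.add_apply, Finsupp.smul_apply, ← h3,
        Finsupp.smul_apply, smul_eq_mul]
      have h5 : (1 + c • M).mulVec (b.repr x) = (1 + c • M).det • ⇑(b.repr x₀) := by
        rw [h4, Matrix.mulVec_mulVec, Matrix.mul_adjugate, Matrix.smul_mulVec,
          Matrix.one_mulVec]
      have h6 := congrFun h5 i
      rw [Matrix.add_mulVec, Matrix.one_mulVec, Matrix.smul_mulVec] at h6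
      exact h6
    rw [← hT', ← map_smul, ← map_add, h2, map_smul, hx₀, smul_zero]

namespace Frame

variable {K R : Type} [Field K] [Ring R] [Algebra K R] {F : Frame K R}
variable {κ ι κ' ι' : Type} [Fintype κ] [Fintype ι] [DecidableEq ι] [Fintype κ'] [Fintype ι']
  [DecidableEq ι'] {f : Matrix κ ι R} {g : Matrix κ' ι' R}

/-- Relabel rows and columns of a presentation. -/
def reindexEquiv (a : κ' ≃ κ) (b : ι' ≃ ι) : F.X (f.submatrix a b) ≃ₗ[R] F.X f :=
  LinearEquiv.ofLinearMap
    (lift (fun i => F.gen f (b i)) (fun i => e₁_gen _) fun k => by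
      rw [← row_gen (f := f) (a k)]
      exact Equiv.sum_comp b fun i => f (a k) i • F.gen f i)
    (lift (fun i => F.gen (f.submatrix a b) (b.symm i)) (fun i => e₁_gen _) fun k => by
      rw [← row_gen (f := f.submatrix a b) (a.symm k), ← Equiv.sum_comp b]
      simp)
    (hom_ext fun i => by simp)
    (hom_ext fun i => by simp)

theorem exists_hom (hf : F.EV f) (a : Matrix ι ι' R) (d : Matrix κ κ' R) (h : f * a = d * g) :
    ∃ φ : F.X f →ₗ[R] F.X g, ∀ i, φ (F.gen f i) = ∑ j, (F.e₁ * a i j) • F.gen g j := by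
  refine ⟨lift (fun i => ∑ j, (F.e₁ * a i j) • F.gen g j) (fun i => ?_) (fun k => ?_),
    fun i => lift_gen _ _ _ i⟩
  · rw [Finset.smul_sum]
    simp_rw [smul_smul, ← mul_assoc, F.mul₁₁]
  · simp_rw [Finset.smul_sum, smul_smul, ← mul_assoc, (hf k _).2]
    rw [Finset.sum_comm]
    simp_rw [← Finset.sum_smul]
    have : ∀ j, ∑ i, f k i * a i j = ∑ l, d k l * g l j := fun j => congrFun (congrFun h k) j
    simp_rw [this, Finset.sum_smul, mul_smul]
    rw [Finset.sum_comm]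
    simp_rw [← Finset.smul_sum, row_gen, smul_zero, Finset.sum_const_zero]

theorem surjective_of_det {g : Matrix κ' ι R} (hJ : Nak F.J) {φ : F.X f →ₗ[R] F.X g}
    (a : Matrix ι ι R) (hφ : ∀ i, φ (F.gen f i) = ∑ j, (F.e₁ * a i j) • F.gen g j)
    (ha : (a.map F.ε₁).det ≠ 0) : Function.Surjective φ := by
  rw [← LinearMap.range_eq_top, eq_top_iff]
  refine hJ _ _ _ ?_
  rw [← span_gen (F := F) (f := g), Submodule.span_le, span_gen]
  rintro _ ⟨j, rfl⟩
  let b := (a.map F.ε₁)⁻¹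
  have hb : b * a.map F.ε₁ = 1 := Matrix.nonsing_inv_mul _ (isUnit_iff_ne_zero.2 ha)
  let r : ι → R := fun l => ((if j = l then 1 else 0) -
    ∑ i, algebraMap K R (b j i) * (F.e₁ * a i l)) * F.e₁
  have hr : ∀ l, r l ∈ F.J := by
    intro l
    have := congrFun (congrFun hb j) l
    simp only [Matrix.mul_apply, Matrix.map_apply, Matrix.one_apply] at this
    refine ⟨?_, by simp [r, F.ε₂₁]⟩
    change F.ε₁ (r l) = 0
    simp only [r, map_mul, map_sub, map_sum, F.ε₁₁, one_mul, mul_one, AlgHom.commutes,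
      Algebra.algebraMap_self, RingHom.id_apply, this, apply_ite F.ε₁, map_one, map_zero, sub_self]
  have key : F.gen g j = φ (∑ i, algebraMap K R (b j i) • F.gen f i) + ∑ l, r l • F.gen g l := by
    simp only [r, mul_smul, e₁_gen, sub_smul, Finset.sum_sub_distrib, map_sum, map_smul, hφ,
      Finset.smul_sum, Finset.sum_smul]
    rw [Finset.sum_comm, add_sub_cancel]
    simp
  rw [key]
  exact add_mem (Submodule.mem_sup_left ⟨_, rfl⟩) (Submodule.mem_sup_right
    (Submodule.sum_mem _ fun l _ => Submodule.smul_mem_smul (hr l) trivial))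

section generic

variable [DecidableEq κ]

variable (F) in
/-- The linear map `(a, d) ↦ f a - d f`. -/
def bracket (f h : Matrix κ ι R) :
    Matrix ι ι R × Matrix κ κ R →ₗ[K] Matrix κ ι R where
  toFun x := f * x.1.map (· * F.e₁) - x.2.map (F.e₂ * ·) * h
  map_add' x y := by
    have h₁ : (x + y).1.map (· * F.e₁) = x.1.map (· * F.e₁) + y.1.map (· * F.e₁) := by
      ext; simp [add_mul]
    have h₂ : (x + y).2.map (F.e₂ * ·) = x.2.map (F.e₂ * ·) + y.2.map (F.e₂ * ·) := by
      ext; simp [mul_add]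
    rw [h₁, h₂, Matrix.mul_add, Matrix.add_mul]; abel
  map_smul' c x := by
    have h₁ : (c • x).1.map (· * F.e₁) = c • x.1.map (· * F.e₁) := by
      ext; simp
    have h₂ : (c • x).2.map (F.e₂ * ·) = c • x.2.map (F.e₂ * ·) := by
      ext; simp
    rw [h₁, h₂, Matrix.mul_smul, Matrix.smul_mul, RingHom.id_apply, smul_sub]

theorem bracket_apply (f h : Matrix κ ι R) (x : Matrix ι ι R × Matrix κ κ R) :
    F.bracket f h x = f * x.1.map (· * F.e₁) - x.2.map (F.e₂ * ·) * h := rfl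

theorem bracket_one (hf : F.EV f) : F.bracket f f (1, 1) = 0 := by
  rw [bracket_apply, sub_eq_zero]
  ext k i
  rw [Matrix.mul_apply, Matrix.mul_apply, Finset.sum_eq_single i, Finset.sum_eq_single k]
  · simp [(hf k i).1, (hf k i).2]
  · intro j _ hj; simp [hj.symm]
  · simp
  · intro j _ hj; simp [hj]
  · simp

theorem EV.le_range_bracket (hf : F.EV f) (h : F.InT f (F.X f)) {U : Matrix κ ι R}
    (hU : F.EV U) : U ∈ LinearMap.range (F.bracket f f) := by
  obtain ⟨w, _, hw₂⟩ := h (fun k => ∑ i, U k i • F.gen f i) fun k => by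
    simp_rw [Finset.smul_sum, smul_smul, (hU k _).1]
  choose a ha using fun i => exists_gen (w i)
  have h1 : ∀ k, ∑ j, (U k j - ∑ i, f k i * a i j) • F.gen f j = 0 := by
    intro k
    simp_rw [sub_smul, Finset.sum_sub_distrib, Finset.sum_smul]
    rw [sub_eq_zero, hw₂, Finset.sum_comm]
    simp_rw [ha, Finset.smul_sum, smul_smul]
  choose d hd using fun k => (sum_gen_eq_zero hf).1 (h1 k)
  refine ⟨(Matrix.of a, -Matrix.of d), ?_⟩
  ext k j
  have h2 := congrArg (F.e₂ * ·) (hd k j)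
  simp only [sub_mul, mul_sub, Finset.sum_mul, Finset.mul_sum, ← mul_assoc, (hU k j).1,
    (hU k j).2, (hf k _).1] at h2
  rw [bracket_apply, Matrix.sub_apply, Matrix.mul_apply, Matrix.mul_apply, eq_comm]
  simp only [Matrix.map_apply, Matrix.of_apply, Matrix.neg_apply, mul_neg, neg_mul,
    Finset.sum_neg_distrib, sub_neg_eq_add, ← mul_assoc]
  rw [← h2]; abel

theorem exists_generic_bracket [Module.Finite K R] (hf : F.EV f) (h : F.InT f (F.X f))
    (Ψ : Matrix ι ι R × Matrix κ κ R →ₗ[K] Matrix κ ι R) (hΨ : ∀ x, F.EV (Ψ x)) :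
    ∃ p : Polynomial K, p.eval 0 ≠ 0 ∧ ∀ c : K, p.eval c ≠ 0 → ∃ x,
      F.bracket f f x + c • Ψ x = 0 ∧ (x.1.map F.ε₁).det ≠ 0 := by
  refine exists_generic_solution (F.bracket f f) Ψ ?_
    (F.ε₁.toLinearMap.mapMatrix ∘ₗ LinearMap.fst K _ _) (1, 1) (bracket_one hf) ?_
  · rintro _ ⟨x, rfl⟩
    exact hf.le_range_bracket h (hΨ x)
  · simp [Matrix.map_one]

theorem EV.mul_map (hf : F.EV f) (a : Matrix ι ι R) : F.EV (f * a.map (· * F.e₁)) := by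
  intro k i
  simp only [Matrix.mul_apply, Matrix.map_apply]
  constructor
  · simp_rw [Finset.mul_sum, ← mul_assoc, (hf k _).1]
  · simp_rw [Finset.sum_mul, mul_assoc, F.mul₁₁]

theorem EV.map_mul (hf : F.EV f) (a : Matrix κ κ R) : F.EV (a.map (F.e₂ * ·) * f) := by
  intro k i
  simp only [Matrix.mul_apply, Matrix.map_apply]
  constructor
  · simp_rw [Finset.mul_sum, ← mul_assoc, F.mul₂₂]
  · simp_rw [Finset.sum_mul, mul_assoc, (hf _ i).2]

theorem EV.neg (hf : F.EV f) : F.EV (-f) := fun k i =>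
  ⟨by simp [(hf k i).1], by simp [(hf k i).2]⟩

theorem EV.sub {g : Matrix κ ι R} (hf : F.EV f) (hg : F.EV g) : F.EV (g - f) := fun k i =>
  ⟨by simp [mul_sub, (hf k i).1, (hg k i).1], by simp [sub_mul, (hf k i).2, (hg k i).2]⟩

theorem EV.add_smul {g : Matrix κ ι R} (hf : F.EV f) (hg : F.EV g) (c : K) :
    F.EV (f + c • g) := fun k i =>
  ⟨by simp [mul_add, (hf k i).1, (hg k i).1], by simp [add_mul, (hf k i).2, (hg k i).2]⟩

/-- A presentation whose cokernel is rigid is isomorphic to its generic deformations. -/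
theorem exists_generic_equiv [Module.Finite K R] (hJ : Nak F.J) (hf : F.EV f)
    (h : F.InT f (F.X f)) {g : Matrix κ ι R} (hg : F.EV g) :
    ∃ p : Polynomial K, p.eval 0 ≠ 0 ∧ ∀ c : K, p.eval c ≠ 0 →
      Nonempty (F.X f ≃ₗ[R] F.X (f + c • g)) := by
  obtain ⟨p, hp₀, hp⟩ := exists_generic_bracket hf h
    (F.bracket 0 g)
    fun x => by simpa [bracket_apply] using (hg.map_mul x.2).neg
  obtain ⟨q, hq₀, hq⟩ := exists_generic_bracket hf h
    (F.bracket g 0)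
    fun x => by simpa [bracket_apply] using hg.mul_map x.1
  refine ⟨p * q, by simp [hp₀, hq₀], fun c hc => ?_⟩
  rw [Polynomial.eval_mul] at hc
  obtain ⟨x, hx, hx'⟩ := hp c (left_ne_zero_of_mul hc)
  obtain ⟨y, hy, hy'⟩ := hq c (right_ne_zero_of_mul hc)
  have hε : ∀ a : Matrix ι ι R, (a.map (· * F.e₁)).map F.ε₁ = a.map F.ε₁ := by
    intro a; ext; simp [F.ε₁₁]
  obtain ⟨φ, hφ⟩ := exists_hom (F := F) hf (x.1.map (· * F.e₁)) (x.2.map (F.e₂ * ·))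
    (g := f + c • g) (by
      simp only [bracket_apply, Matrix.zero_mul, zero_sub] at hx
      rw [Matrix.mul_add, Matrix.mul_smul, ← sub_eq_zero, ← hx, smul_neg]
      abel)
  obtain ⟨ψ, hψ⟩ := exists_hom (F := F) (hf.add_smul hg c) (y.1.map (· * F.e₁))
    (y.2.map (F.e₂ * ·)) (g := f) (by
      simp only [bracket_apply, Matrix.mul_zero, sub_zero] at hy
      rw [Matrix.add_mul, Matrix.smul_mul, ← sub_eq_zero, ← hy]
      abel)
  have hφs := surjective_of_det hJ _ hφ (by rwa [hε])
  have hψs := surjective_of_det hJ _ hψ (by rwa [hε])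
  have : IsNoetherian R R := isNoetherian_of_tower K inferInstance
  have hinj : Function.Injective (ψ ∘ₗ φ) :=
    IsNoetherian.injective_of_surjective_endomorphism _ (hψs.comp hφs)
  exact ⟨LinearEquiv.ofBijective φ ⟨fun a b hab => hinj (by simp [hab]), hφs⟩⟩

/-- Rigid cokernels are determined by the size of their presentation. -/
theorem nonempty_equiv_of_inT [Infinite K] [Module.Finite K R] (hJ : Nak F.J) (hf : F.EV f)
    (h : F.InT f (F.X f)) {g : Matrix κ ι R} (hg : F.EV g) (h' : F.InT g (F.X g)) :
    Nonempty (F.X f ≃ₗ[R] F.X g) := by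
  obtain ⟨p, hp₀, hp⟩ := exists_generic_equiv hJ hf h (hf.sub hg)
  obtain ⟨q, hq₀, hq⟩ := exists_generic_equiv hJ hg h' (hg.sub hf)
  have hne : p * q.comp (1 - Polynomial.X) ≠ 0 := by
    refine mul_ne_zero (fun h => hp₀ (by simp [h])) fun h => hq₀ ?_
    have := congrArg (Polynomial.eval 1) h
    simpa [Polynomial.eval_comp] using this
  obtain ⟨c, hc⟩ : ∃ c, (p * q.comp (1 - Polynomial.X)).eval c ≠ 0 := by
    by_contra! hall
    exact hne (Polynomial.funext fun c => by simpa using hall c)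
  simp only [Polynomial.eval_mul, Polynomial.eval_comp, Polynomial.eval_sub, Polynomial.eval_one,
    Polynomial.eval_X] at hc
  obtain ⟨e⟩ := hp c (left_ne_zero_of_mul hc)
  obtain ⟨e'⟩ := hq (1 - c) (right_ne_zero_of_mul hc)
  have : f + c • (g - f) = g + (1 - c) • (f - g) := by
    rw [sub_smul, one_smul, smul_sub, smul_sub]; abel
  exact ⟨e.trans ((LinearEquiv.cast this).trans e'.symm)⟩

end generic

end Frame

section Decomp

variable {R : Type} [Ring R] {M N : Type} [AddCommGroup M] [Module R M] [AddCommGroup N]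
  [Module R N]

theorem IsIndecModule.congr (h : IsIndecModule R M) (e : M ≃ₗ[R] N) : IsIndecModule R N := by
  have := h.1
  refine ⟨e.symm.toEquiv.nontrivial, fun N₁ N₂ hN => ?_⟩
  have h2 := h.2 (N₁.map e.symm.toLinearMap) (N₂.map e.symm.toLinearMap) (by
    have := hN.map (Submodule.orderIsoMapComap e.symm)
    exact this)
  simpa [Submodule.map_eq_bot_iff] using h2

theorem exists_equiv_of_isInternal {k : ℕ} {N : Fin k → Submodule R M}
    (h : DirectSum.IsInternal N) : Nonempty (M ≃ₗ[R] ∀ i, N i) :=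
  ⟨(LinearEquiv.ofBijective (DirectSum.coeLinearMap N) h).symm.trans
    (DirectSum.linearEquivFunOnFintype R (Fin k) fun i => N i)⟩

theorem exists_isInternal {k : ℕ} {Z : Fin k → Type} [∀ i, AddCommGroup (Z i)]
    [∀ i, Module R (Z i)] (e : M ≃ₗ[R] ∀ i, Z i) :
    ∃ N : Fin k → Submodule R M, DirectSum.IsInternal N ∧ ∀ i, Nonempty (Z i ≃ₗ[R] N i) := by
  let s : ∀ i, Z i →ₗ[R] M := fun i => e.symm.toLinearMap ∘ₗ LinearMap.single R Z i
  have hs : ∀ i, Function.Injective (s i) := fun i =>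
    e.symm.injective.comp (Pi.single_injective i)
  let E : ∀ i, Z i ≃ₗ[R] LinearMap.range (s i) := fun i => LinearEquiv.ofInjective (s i) (hs i)
  refine ⟨fun i => LinearMap.range (s i), ?_, fun i => ⟨E i⟩⟩
  let G := (LinearEquiv.piCongrRight E).trans
    (DirectSum.linearEquivFunOnFintype R (Fin k) fun i => LinearMap.range (s i)).symm
  have hG : ∀ z, DirectSum.coeLinearMap (fun i => LinearMap.range (s i)) (G z) = e.symm z := by
    suffices DirectSum.coeLinearMap (fun i => LinearMap.range (s i)) ∘ₗ G.toLinearMap =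
      e.symm.toLinearMap from fun z => LinearMap.congr_fun this z
    refine LinearMap.pi_ext' fun i => LinearMap.ext fun x => ?_
    have : G (Pi.single i x) = DirectSum.lof R _ (fun i => LinearMap.range (s i)) i (E i x) := by
      simp only [G, LinearEquiv.trans_apply]
      rw [LinearEquiv.symm_apply_eq, DirectSum.linearEquivFunOnFintype_lof]
      funext j
      by_cases h : j = i
      · subst h; simp
      · simp [h]
    change DirectSum.coeLinearMap _ (G (Pi.single i x)) = _
    rw [this, DirectSum.coeLinearMap_lof]
    rfl
  have : (DirectSum.coeLinearMap fun i => LinearMap.range (s i)) =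
      e.symm.toLinearMap ∘ₗ G.symm.toLinearMap := by
    ext1 i
    refine LinearMap.ext fun x => ?_
    simp only [LinearMap.comp_apply, LinearEquiv.coe_coe]
    rw [← hG, LinearEquiv.apply_symm_apply]
  change Function.Bijective (DirectSum.coeLinearMap fun i => LinearMap.range (s i))
  rw [this]
  exact e.symm.bijective.comp G.symm.bijective

theorem RigidTo.pi {o : Type} [Fintype o] [DecidableEq o] {M : o → Type}
    [∀ i, AddCommGroup (M i)] [∀ i, Module R (M i)] (h : ∀ i, RigidTo R (M i) N) :
    RigidTo R (∀ i, M i) N := by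
  let g : ∀ i, (M i →₀ R) →ₗ[R] M i := fun i => Finsupp.linearCombination R id
  have hg : ∀ i, Function.Surjective (g i) := fun i x => ⟨Finsupp.single x 1, by simp [g]⟩
  refine rigidTo_of_retract LinearMap.id LinearMap.id rfl (P₀ := ∀ i, M i →₀ R)
    (LinearMap.piMap g) (fun x => ?_) fun k => ?_
  · choose y hy using fun i => hg i (x i)
    exact ⟨y, funext hy⟩
  · have hmem : ∀ i (x : LinearMap.ker (g i)), Pi.single i x.1 ∈ LinearMap.ker (LinearMap.piMap g) := by
      intro i x
      rw [LinearMap.mem_ker]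
      funext j
      by_cases hj : j = i
      · subst hj; simp
      · simp [hj]
    choose k' hk' using fun i => h i (M i →₀ R) (g i) (hg i)
      (k ∘ₗ (LinearMap.single R (fun i => M i →₀ R) i ∘ₗ (LinearMap.ker (g i)).subtype).codRestrict _
        (hmem i))
    refine ⟨LinearMap.lsum R (fun i => M i →₀ R) ℕ k', fun x => ?_⟩
    have hx : ∀ i, g i (x.1 i) = 0 := fun i => congrFun x.2 i
    have h1 : x = ∑ i, (⟨Pi.single i (x.1 i), hmem i ⟨x.1 i, hx i⟩⟩ :
        LinearMap.ker (LinearMap.piMap g)) := by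
      ext1
      rw [AddSubmonoidClass.coe_finsetSum]
      exact (Finset.univ_sum_single x.1).symm
    conv_rhs => rw [h1, map_sum]
    rw [LinearMap.lsum_apply, LinearMap.sum_apply]
    exact Finset.sum_congr rfl fun i _ => hk' i ⟨x.1 i, hx i⟩

end Decomp

section Classes

variable {R : Type} [Ring R] {A : Type} [DecidableEq A] {Z : A → Type}
  [∀ a, AddCommGroup (Z a)] [∀ a, Module R (Z a)]

/-- No `Z b` is a direct summand of a power of another `Z a`. -/
def Separated (R : Type) [Ring R] {A : Type} (Z : A → Type) [∀ a, AddCommGroup (Z a)]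
    [∀ a, Module R (Z a)] : Prop :=
  ∀ (a b : A) (k : ℕ) (i : Z b →ₗ[R] (Fin k → Z a)) (p : (Fin k → Z a) →ₗ[R] Z b),
    p ∘ₗ i = LinearMap.id → a = b

theorem Separated.eq_of_equiv (h : Separated R Z) {a b : A} (e : Z a ≃ₗ[R] Z b) : a = b := by
  refine h a b 1 (LinearMap.pi fun _ => e.symm.toLinearMap) (e.toLinearMap ∘ₗ LinearMap.proj 0) ?_
  ext x; simp

theorem exists_sum_decomp (h : Separated R Z) (hi : ∀ a, IsIndecModule R (Z a)) {M : ModuleCat.{0} R}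
    {k : ℕ} (s : Fin k → A) (hs : Function.Injective s) (e : M ≃ₗ[R] ∀ i, Z (s i)) :
    IsBasicModuleCat R M ∧ HasIndecClassCount R M k := by
  obtain ⟨N, hN, hN'⟩ := exists_isInternal e
  have hne : ∀ i j, Nonempty (N i ≃ₗ[R] N j) → i = j := fun i j ⟨f⟩ =>
    hs (h.eq_of_equiv (((hN' i).some.trans f).trans (hN' j).some.symm))
  refine ⟨⟨k, N, hN, fun i => (hi _).congr (hN' i).some, fun i j hij => ?_⟩,
    ⟨k, N, hN, fun i => (hi _).congr (hN' i).some, id, Function.surjective_id, fun i j => ?_⟩⟩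
  · by_contra hc
    exact hij (hne i j (not_isEmpty_iff.1 hc))
  · exact ⟨by rintro rfl; exact ⟨LinearEquiv.refl _ _⟩, hne i j⟩

/-- Every indecomposable summand of `M` is one of the `Z a`. -/
def SummandsIn (R : Type) [Ring R] {A : Type} (Z : A → Type) [∀ a, AddCommGroup (Z a)]
    [∀ a, Module R (Z a)] (M : Type) [AddCommGroup M] [Module R M] : Prop :=
  ∀ (N : Type) [AddCommGroup N] [Module R N] (i : N →ₗ[R] M) (p : M →ₗ[R] N),
    p ∘ₗ i = LinearMap.id → IsIndecModule R N → ∃ a, Nonempty (Z a ≃ₗ[R] N)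

theorem SummandsIn.exists_equiv {M : Type} [AddCommGroup M] [Module R M] (h : SummandsIn R Z M)
    {k : ℕ} {N : Fin k → Submodule R M} (hN : DirectSum.IsInternal N)
    (hi : ∀ i, IsIndecModule R (N i)) :
    ∃ a : Fin k → A, (∀ i, Nonempty (Z (a i) ≃ₗ[R] N i)) ∧ Nonempty (M ≃ₗ[R] ∀ i, Z (a i)) := by
  obtain ⟨e⟩ := exists_equiv_of_isInternal hN
  choose a ha using fun i => h (N i) (e.symm.toLinearMap ∘ₗ LinearMap.single R (fun i => N i) i)
    (LinearMap.proj i ∘ₗ e.toLinearMap) (by ext x; simp) (hi i)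
  exact ⟨a, ha, ⟨e.trans (LinearEquiv.piCongrRight fun i => (ha i).some.symm)⟩⟩

theorem HasIndecClassCount.exists_equiv {M : ModuleCat.{0} R} (hsep : Separated R Z)
    (h : SummandsIn R Z M) {p : ℕ} (hp : HasIndecClassCount R M p) :
    ∃ (k : ℕ) (a : Fin k → A), Nonempty (M ≃ₗ[R] ∀ i, Z (a i)) ∧
      (Finset.univ.image a).card = p := by
  obtain ⟨k, N, hN, hi, c, hc, hcc⟩ := hp
  obtain ⟨a, ha, e⟩ := h.exists_equiv hN hi
  refine ⟨k, a, e, ?_⟩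
  have hac : ∀ i j, a i = a j ↔ c i = c j := by
    intro i j
    rw [hcc]
    refine ⟨fun h => ⟨?_⟩, fun ⟨f⟩ => hsep.eq_of_equiv (((ha i).some.trans f).trans (ha j).some.symm)⟩
    have e1 : Z (a i) ≃ₗ[R] Z (a j) := h ▸ LinearEquiv.refl R (Z (a i))
    exact ((ha i).some.symm.trans e1).trans (ha j).some
  choose g hg using hc
  have : Finset.univ.image a = Finset.univ.image (a ∘ g) := by
    ext x
    simp only [Finset.mem_image, Finset.mem_univ, true_and, Function.comp_apply]
    refine ⟨?_, fun ⟨j, hj⟩ => ⟨g j, hj⟩⟩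
    rintro ⟨i, rfl⟩
    exact ⟨c i, (hac _ _).2 (hg _)⟩
  rw [this, Finset.card_image_of_injective, Finset.card_univ, Fintype.card_fin]
  intro x y hxy
  have := (hac _ _).1 hxy
  rwa [hg, hg] at this

theorem IsBasicModuleCat.exists_equiv {M : ModuleCat.{0} R}
    (h : SummandsIn R Z M) (hp : IsBasicModuleCat R M) :
    ∃ (k : ℕ) (a : Fin k → A), Function.Injective a ∧ Nonempty (M ≃ₗ[R] ∀ i, Z (a i)) := by
  obtain ⟨k, N, hN, hi, hc⟩ := hp
  obtain ⟨a, ha, e⟩ := h.exists_equiv hN hi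
  refine ⟨k, a, fun i j hij => ?_, e⟩
  by_contra hne
  have e1 : Z (a i) ≃ₗ[R] Z (a j) := hij ▸ LinearEquiv.refl R (Z (a i))
  exact (hc i j hne).false (((ha i).some.symm.trans e1).trans (ha j).some)

/-- The isomorphism class of a summand of `∏ Z (a i)` occurs among the `a i` when the latter take
at most one value. -/
theorem Separated.mem_of_retract (hsep : Separated R Z) (hi : ∀ a, IsIndecModule R (Z a)) {k : ℕ}
    {a : Fin k → A} {b : A} (i : Z b →ₗ[R] ∀ j, Z (a j)) (p : (∀ j, Z (a j)) →ₗ[R] Z b)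
    (hpi : p ∘ₗ i = LinearMap.id) (hc : (Finset.univ.image a).card ≤ 1) :
    b ∈ Finset.univ.image a := by
  rcases Nat.eq_zero_or_pos k with rfl | hk
  · have := (hi b).1
    obtain ⟨x, y, hxy⟩ := exists_pair_ne (Z b)
    refine absurd ?_ hxy
    have h1 := LinearMap.congr_fun hpi x
    have h2 := LinearMap.congr_fun hpi y
    simp only [LinearMap.comp_apply, LinearMap.id_apply] at h1 h2
    rw [← h1, ← h2, Subsingleton.elim (i x) (i y)]
  · rw [Finset.card_le_one] at hc
    have h0 : ∀ j, a j = a ⟨0, hk⟩ := fun j => hc _ (by simp) _ (by simp)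
    obtain ⟨x, rfl⟩ : ∃ x, a = fun _ => x := ⟨_, funext h0⟩
    have := hsep _ b k i p hpi
    rw [← this]
    exact Finset.mem_image.2 ⟨⟨0, hk⟩, Finset.mem_univ _, rfl⟩

/-- Two decompositions into the `Z a` have the same support if the supports together have at most
two elements. -/
theorem Separated.image_eq (hsep : Separated R Z) (hi : ∀ a, IsIndecModule R (Z a)) {k l : ℕ}
    {a : Fin k → A} {b : Fin l → A} (e : (∀ j, Z (a j)) ≃ₗ[R] ∀ j, Z (b j))
    (hc : (Finset.univ.image a ∪ Finset.univ.image b).card ≤ 2) :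
    Finset.univ.image a = Finset.univ.image b := by
  have key : ∀ {k l : ℕ} {a : Fin k → A} {b : Fin l → A} (e : (∀ j, Z (a j)) ≃ₗ[R] ∀ j, Z (b j)),
      (Finset.univ.image a ∪ Finset.univ.image b).card ≤ 2 →
      Finset.univ.image a ⊆ Finset.univ.image b := by
    intro k l a b e hc x hx
    by_contra hxb
    obtain ⟨i, -, rfl⟩ := Finset.mem_image.1 hx
    refine hxb (hsep.mem_of_retract hi (e.toLinearMap ∘ₗ LinearMap.single R (fun j => Z (a j)) i)
      (LinearMap.proj i ∘ₗ e.symm.toLinearMap) (by ext x; simp) ?_)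
    have h1 : (Finset.univ.image b) ⊂ (Finset.univ.image a ∪ Finset.univ.image b) :=
      ⟨Finset.subset_union_right, fun h => hxb (h (Finset.mem_union_left _ hx))⟩
    have := Finset.card_lt_card h1
    omega
  exact (key e hc).antisymm (key e.symm (by rwa [Finset.union_comm]))

end Classes

section Assembly

variable {m n : ℕ}

/-- The position of a label when both chains are laid out in one line. -/
def pos : Fin (m + 1) ⊕ Fin (n + 1) → ℕ
  | .inl i => i
  | .inr j => m + n + 1 - j

/-- Labels that are equal or neighbours in the line. -/
def Adj (a b : Fin (m + 1) ⊕ Fin (n + 1)) : Prop := pos a ≤ pos b + 1 ∧ pos b ≤ pos a + 1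

theorem pos_injective : Function.Injective (pos : Fin (m + 1) ⊕ Fin (n + 1) → ℕ) := by
  rintro (i | i) (j | j) h <;> simp only [pos] at h
  · exact congrArg _ (Fin.ext h)
  · omega
  · omega
  · exact congrArg _ (Fin.ext (by omega))

/-- The greatest label of the first chain. -/
def top₁ : Fin (m + 1) ⊕ Fin (n + 1) := .inl (Fin.last m)
/-- The greatest label of the second chain. -/
def top₂ : Fin (m + 1) ⊕ Fin (n + 1) := .inr (Fin.last n)

theorem card_clique {C : Finset (Fin (m + 1) ⊕ Fin (n + 1))} (h : ∀ a ∈ C, ∀ b ∈ C, Adj a b) :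
    C.card ≤ 2 := by
  rcases C.eq_empty_or_nonempty with rfl | hC
  · simp
  obtain ⟨a, ha, hmin⟩ := C.exists_min_image pos hC
  have : (C.image pos) ⊆ {pos a, pos a + 1} := by
    intro x hx
    obtain ⟨b, hb, rfl⟩ := Finset.mem_image.1 hx
    have h1 := (h a ha b hb).2
    have h2 := hmin b hb
    simp only [Finset.mem_insert, Finset.mem_singleton]
    omega
  rw [← Finset.card_image_of_injective C pos_injective]
  exact (Finset.card_le_card this).trans Finset.card_le_two

open Classical in
/-- The labels of the indecomposable summands of the support `τ`-tilting modules. -/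
def summandSet : WithTop (WithBot (Fin (m + 1) ⊕ Fin (n + 1))) →
    Finset (Fin (m + 1) ⊕ Fin (n + 1))
  | none => {top₁, top₂}
  | some none => ∅
  | some (some (.inl i)) => Finset.univ.filter fun b =>
      ∃ j : Fin (m + 1), b = .inl j ∧ (j.val = i ∨ j.val + 1 = i)
  | some (some (.inr i)) => Finset.univ.filter fun b =>
      ∃ j : Fin (n + 1), b = .inr j ∧ (j.val = i ∨ j.val + 1 = i)

open Classical in
/-- The labels of the summands of the projective part of the support `τ`-tilting pairs. -/
def projSet : WithTop (WithBot (Fin (m + 1) ⊕ Fin (n + 1))) →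
    Finset (Fin (m + 1) ⊕ Fin (n + 1))
  | none => ∅
  | some none => {top₁, top₂}
  | some (some (.inl i)) => if i = 0 then {top₂} else ∅
  | some (some (.inr i)) => if i = 0 then {top₁} else ∅

theorem projSet_subset (x : WithTop (WithBot (Fin (m + 1) ⊕ Fin (n + 1)))) {a}
    (ha : a ∈ projSet x) : a = top₁ ∨ a = top₂ := by
  rcases x with _ | _ | i | i
  · simp [projSet] at ha
  · simpa [projSet] using ha
  · simp only [projSet] at ha
    split_ifs at ha
    · exact Or.inr (by simpa using ha)
    · simp at ha
  · simp only [projSet] at ha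
    split_ifs at ha
    · exact Or.inl (by simpa using ha)
    · simp at ha

theorem summandSet_inl_zero :
    summandSet (some (some (.inl 0)) : WithTop (WithBot (Fin (m + 1) ⊕ Fin (n + 1)))) =
      {.inl 0} := by
  ext b
  simp only [summandSet, Finset.mem_filter, Finset.mem_univ, true_and, Finset.mem_singleton]
  refine ⟨?_, fun h => ⟨0, h, Or.inl rfl⟩⟩
  rintro ⟨j, rfl, h | h⟩
  · exact congrArg _ (Fin.ext h)
  · simp at h

theorem summandSet_inr_zero :
    summandSet (some (some (.inr 0)) : WithTop (WithBot (Fin (m + 1) ⊕ Fin (n + 1)))) =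
      {.inr 0} := by
  ext b
  simp only [summandSet, Finset.mem_filter, Finset.mem_univ, true_and, Finset.mem_singleton]
  refine ⟨?_, fun h => ⟨0, h, Or.inl rfl⟩⟩
  rintro ⟨j, rfl, h | h⟩
  · exact congrArg _ (Fin.ext h)
  · simp at h

theorem summandSet_inl_succ {i j : Fin (m + 1)} (h : j.val + 1 = i) :
    summandSet (some (some (.inl i)) : WithTop (WithBot (Fin (m + 1) ⊕ Fin (n + 1)))) =
      {.inl i, .inl j} := by
  ext b
  simp only [summandSet, Finset.mem_filter, Finset.mem_univ, true_and, Finset.mem_singleton,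
    Finset.mem_insert]
  constructor
  · rintro ⟨k, rfl, h' | h'⟩
    · exact Or.inl (congrArg _ (Fin.ext h'))
    · exact Or.inr (congrArg _ (Fin.ext (by omega)))
  · rintro (rfl | rfl)
    · exact ⟨i, rfl, Or.inl rfl⟩
    · exact ⟨j, rfl, Or.inr h⟩

theorem summandSet_inr_succ {i j : Fin (n + 1)} (h : j.val + 1 = i) :
    summandSet (some (some (.inr i)) : WithTop (WithBot (Fin (m + 1) ⊕ Fin (n + 1)))) =
      {.inr i, .inr j} := by
  ext b
  simp only [summandSet, Finset.mem_filter, Finset.mem_univ, true_and, Finset.mem_singleton,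
    Finset.mem_insert]
  constructor
  · rintro ⟨k, rfl, h' | h'⟩
    · exact Or.inl (congrArg _ (Fin.ext h'))
    · exact Or.inr (congrArg _ (Fin.ext (by omega)))
  · rintro (rfl | rfl)
    · exact ⟨i, rfl, Or.inl rfl⟩
    · exact ⟨j, rfl, Or.inr h⟩

theorem summandSet_adj (x : WithTop (WithBot (Fin (m + 1) ⊕ Fin (n + 1)))) :
    ∀ a ∈ summandSet x, ∀ b ∈ summandSet x, Adj a b := by
  rcases x with _ | _ | i | i
  · simp only [summandSet, Finset.mem_insert, Finset.mem_singleton]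
    rintro a (rfl | rfl) b (rfl | rfl) <;> simp [Adj, pos, top₁, top₂] <;> omega
  · simp [summandSet]
  · simp only [summandSet, Finset.mem_filter, Finset.mem_univ, true_and]
    rintro a ⟨j, rfl, hj⟩ b ⟨k, rfl, hk⟩
    simp only [Adj, pos]
    omega
  · simp only [summandSet, Finset.mem_filter, Finset.mem_univ, true_and]
    rintro a ⟨j, rfl, hj⟩ b ⟨k, rfl, hk⟩
    simp only [Adj, pos]
    omega

theorem card_summandSet_add (x : WithTop (WithBot (Fin (m + 1) ⊕ Fin (n + 1)))) :
    (summandSet x).card + (projSet x).card = 2 := by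
  have htop : ({top₁, top₂} : Finset (Fin (m + 1) ⊕ Fin (n + 1))).card = 2 := by
    rw [Finset.card_pair]; simp [top₁, top₂]
  rcases x with _ | _ | i | i
  · simpa [summandSet, projSet] using htop
  · simpa [summandSet, projSet] using htop
  · by_cases hi : i = 0
    · subst hi
      rw [summandSet_inl_zero]
      simp [projSet]
    · have : i.val ≠ 0 := fun h => hi (Fin.ext h)
      rw [summandSet_inl_succ (j := ⟨i.val - 1, by omega⟩) (by simp; omega), Finset.card_pair]
      · simp [projSet, hi]
      · simp [Fin.ext_iff]; omega
  · by_cases hi : i = 0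
    · subst hi
      rw [summandSet_inr_zero]
      simp [projSet]
    · have : i.val ≠ 0 := fun h => hi (Fin.ext h)
      rw [summandSet_inr_succ (j := ⟨i.val - 1, by omega⟩) (by simp; omega), Finset.card_pair]
      · simp [projSet, hi]
      · simp [Fin.ext_iff]; omega

theorem exists_summandSet_eq {C : Finset (Fin (m + 1) ⊕ Fin (n + 1))}
    (h : ∀ a ∈ C, ∀ b ∈ C, Adj a b) (hC : C.card = 2) : ∃ x, summandSet x = C := by
  obtain ⟨a, b, hab, rfl⟩ := Finset.card_eq_two.1 hC
  have hadj : Adj a b := h a (by simp) b (by simp)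
  have key : ∀ a b : Fin (m + 1) ⊕ Fin (n + 1), pos a + 1 = pos b → ∃ x, summandSet x = {a, b} := by
    rintro (i | i) (j | j) hij <;> simp only [pos] at hij
    · exact ⟨some (some (.inl j)), by rw [summandSet_inl_succ hij, Finset.pair_comm]⟩
    · refine ⟨none, ?_⟩
      rw [show i = Fin.last m from Fin.ext (by simp; omega),
        show j = Fin.last n from Fin.ext (by simp; omega)]
      rfl
    · omega
    · exact ⟨some (some (.inr i)), summandSet_inr_succ (by omega)⟩
  have hne : pos a ≠ pos b := fun h => hab (pos_injective h)
  rcases lt_or_gt_of_ne hne with h' | h'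
  · exact key a b (by have := hadj.2; omega)
  · rw [Finset.pair_comm]
    exact key b a (by have := hadj.1; omega)

/-- The list of properties of a family of modules labelled by two chains which makes it the
family of all indecomposable `τ`-rigid modules, with the expected combinatorics. -/
structure TwoChains (R : Type) [Ring R] (Z : Fin (m + 1) ⊕ Fin (n + 1) → Type)
    [∀ a, AddCommGroup (Z a)] [∀ a, Module R (Z a)] : Prop where
  indec : ∀ a, IsIndecModule R (Z a)
  fac_iff : ∀ a b, Fac R (Z a) (Z b) ↔ b ≤ a
  separated : Separated R Z
  tauRigid : ∀ C : Finset (Fin (m + 1) ⊕ Fin (n + 1)), (∀ a ∈ C, ∀ b ∈ C, Adj a b) →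
    IsTauRigidCat R (ModuleCat.of R (∀ a : C, Z a))
  adj_of_comp : ∀ a b, Comp R (Z a) (Z b) → Comp R (Z b) (Z a) → Adj a b
  exhaust : ∀ (N : Type) [AddCommGroup N] [Module R N], Module.Finite R N → IsIndecModule R N →
    Comp R N N → ∃ a, Nonempty (Z a ≃ₗ[R] N)
  regular : Nonempty (R ≃ₗ[R] (Z top₁ × Z top₂))
  projective : ∀ a, Module.Projective R (Z a) → a = top₁ ∨ a = top₂
  hom_top₂ : ∀ a, (∀ f : Z top₂ →ₗ[R] Z a, f = 0) ↔ a = .inl 0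
  hom_top₁ : ∀ a, (∀ f : Z top₁ →ₗ[R] Z a, f = 0) ↔ a = .inr 0

namespace TwoChains

variable {R : Type} [Ring R] {Z : Fin (m + 1) ⊕ Fin (n + 1) → Type}
  [∀ a, AddCommGroup (Z a)] [∀ a, Module R (Z a)] (H : TwoChains R Z)

include H

theorem projective_top₁ : Module.Projective R (Z top₁) := by
  obtain ⟨e⟩ := H.regular
  exact Module.Projective.of_split (e.symm.toLinearMap ∘ₗ LinearMap.inl R _ _)
    (LinearMap.fst R _ _ ∘ₗ e.toLinearMap) (by ext x; simp)

theorem projective_top₂ : Module.Projective R (Z top₂) := by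
  obtain ⟨e⟩ := H.regular
  exact Module.Projective.of_split (e.symm.toLinearMap ∘ₗ LinearMap.inr R _ _)
    (LinearMap.snd R _ _ ∘ₗ e.toLinearMap) (by ext x; simp)

theorem finite (a) : Module.Finite R (Z a) := by
  have h := (H.tauRigid {a} (by simp [Adj])).1
  exact Module.Finite.of_surjective
    (LinearMap.proj (⟨a, by simp⟩ : ({a} : Finset (Fin (m + 1) ⊕ Fin (n + 1)))) :
      (∀ b : ({a} : Finset (Fin (m + 1) ⊕ Fin (n + 1))), Z b) →ₗ[R] _)
    (LinearMap.proj_surjective _)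

end TwoChains

end Assembly

section Assembly

variable {m n : ℕ}

namespace TwoChains

variable {R : Type} [Ring R] {Z : Fin (m + 1) ⊕ Fin (n + 1) → Type}
  [∀ a, AddCommGroup (Z a)] [∀ a, Module R (Z a)] (H : TwoChains R Z)

/-- The support `τ`-tilting module with a given label. -/
abbrev module (R : Type) [Ring R] (Z : Fin (m + 1) ⊕ Fin (n + 1) → Type)
    [∀ a, AddCommGroup (Z a)] [∀ a, Module R (Z a)]
    (C : Finset (Fin (m + 1) ⊕ Fin (n + 1))) : ModuleCat.{0} R :=
  ModuleCat.of R (∀ a : C, Z a)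

theorem nonempty_equiv_module {M : Type} [AddCommGroup M] [Module R M] {k : ℕ}
    {a : Fin k → Fin (m + 1) ⊕ Fin (n + 1)} (ha : Function.Injective a)
    (e : M ≃ₗ[R] ∀ i, Z (a i)) : Nonempty (M ≃ₗ[R] module R Z (Finset.univ.image a)) := by
  let σ : Fin k ≃ (Finset.univ.image a : Finset _) :=
    Equiv.ofBijective (fun i => ⟨a i, Finset.mem_image_of_mem _ (Finset.mem_univ _)⟩)
      ⟨fun i j h => ha (congrArg Subtype.val h), fun ⟨b, hb⟩ => by
        obtain ⟨i, -, rfl⟩ := Finset.mem_image.1 hb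
        exact ⟨i, rfl⟩⟩
  exact ⟨e.trans (LinearEquiv.piCongrLeft R (fun b : (Finset.univ.image a : Finset _) => Z b) σ)⟩

include H

theorem basic_module (C : Finset (Fin (m + 1) ⊕ Fin (n + 1))) :
    IsBasicModuleCat R (module R Z C) ∧ HasIndecClassCount R (module R Z C) C.card := by
  refine exists_sum_decomp H.separated H.indec (fun i => (C.equivFin.symm i).1)
    (Subtype.val_injective.comp C.equivFin.symm.injective) ?_
  exact (LinearEquiv.piCongrLeft R (fun b : C => Z b) C.equivFin.symm).symm

theorem count_regular_iff (r : ℕ) : HasIndecClassCount R (ModuleCat.of R R) r ↔ r = 2 := by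
  obtain ⟨e⟩ := H.regular
  have hinj : Function.Injective ![(top₁ : Fin (m + 1) ⊕ Fin (n + 1)), top₂] := by
    intro i j
    fin_cases i <;> fin_cases j <;> simp [top₁, top₂]
  have e' : R ≃ₗ[R] ∀ i, Z (![top₁, top₂] i) :=
    e.trans (LinearEquiv.piFinTwo R fun i => Z (![top₁, top₂] i)).symm
  refine ⟨fun h => ?_, ?_⟩
  · obtain ⟨k, a, ⟨ea⟩, rfl⟩ := h.exists_equiv (Z := Z) H.separated fun N _ _ i p hpi hN => by
      have hp : Module.Projective R N := Module.Projective.of_split (M := R) i p hpi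
      have hf : Module.Finite R N := Module.Finite.of_surjective p fun x => ⟨i x, LinearMap.congr_fun hpi x⟩
      exact H.exhaust N hf hN fun Y _ _ _ => RigidTo.of_projective
    have htop : ∀ i, a i = top₁ ∨ a i = top₂ := fun i => H.projective _ <|
      Module.Projective.of_split (M := R) (ea.symm.toLinearMap ∘ₗ LinearMap.single R (fun i => Z (a i)) i)
        (LinearMap.proj i ∘ₗ ea.toLinearMap) (by ext x; simp)
    have himg : Finset.univ.image ![(top₁ : Fin (m + 1) ⊕ Fin (n + 1)), top₂] = {top₁, top₂} := by
      ext x; simp [eq_comm]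
    have := H.separated.image_eq H.indec (e'.symm.trans ea) (by
      rw [himg]
      refine (Finset.card_le_card (t := {top₁, top₂}) ?_).trans Finset.card_le_two
      refine Finset.union_subset subset_rfl fun x hx => ?_
      obtain ⟨i, -, rfl⟩ := Finset.mem_image.1 hx
      simpa using htop i)
    rw [← this, Finset.card_image_of_injective _ hinj]
    rfl
  · rintro rfl
    exact (exists_sum_decomp (M := ModuleCat.of R R) H.separated H.indec _ hinj e').2

theorem supportTauTilting_module (x) :
    IsSupportTauTiltingCat R (module R Z (summandSet x)) ∧
      IsBasicModuleCat R (module R Z (summandSet x)) := by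
  refine ⟨⟨H.tauRigid _ (summandSet_adj x), module R Z (projSet x), _, _, 2, ?_, ?_, ?_,
    (H.basic_module _).2, (H.basic_module _).2, (H.count_regular_iff 2).2 rfl,
    card_summandSet_add x⟩, (H.basic_module _).1⟩
  · have := H.finite
    infer_instance
  · have : ∀ a : projSet x, Module.Projective R (Z a) := fun a => by
      rcases projSet_subset x a.2 with h | h <;> rw [h]
      exacts [H.projective_top₁, H.projective_top₂]
    have e := DirectSum.linearEquivFunOnFintype R (projSet x) fun a => Z a
    exact Module.Projective.of_equiv e
  · intro f
    have hz : ∀ a ∈ projSet x, ∀ b ∈ summandSet x, ∀ g : Z a →ₗ[R] Z b, g = 0 := by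
      rcases x with _ | _ | i | i
      · simp [projSet]
      · simp [summandSet]
      · intro a ha b hb
        simp only [projSet] at ha
        split_ifs at ha with hi
        · subst hi
          rw [summandSet_inl_zero, Finset.mem_singleton] at hb
          rw [Finset.mem_singleton] at ha
          subst ha hb
          exact (H.hom_top₂ _).2 rfl
        · simp at ha
      · intro a ha b hb
        simp only [projSet] at ha
        split_ifs at ha with hi
        · subst hi
          rw [summandSet_inr_zero, Finset.mem_singleton] at hb
          rw [Finset.mem_singleton] at ha
          subst ha hb
          exact (H.hom_top₁ _).2 rfl
        · simp at ha
    refine LinearMap.pi_ext' fun a => ?_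
    refine LinearMap.ext fun y => funext fun b => ?_
    exact LinearMap.congr_fun (hz a a.2 b b.2 (LinearMap.proj b ∘ₗ f ∘ₗ
      LinearMap.single R (fun c : projSet x => Z c) a)) y

theorem exists_equiv_module {M : ModuleCat.{0} R} (hM : IsSupportTauTiltingCat R M)
    (hb : IsBasicModuleCat R M) : ∃ x, Nonempty (M ≃ₗ[R] module R Z (summandSet x)) := by
  obtain ⟨hrig, P, p, q, r, hPf, hPp, hhom, hp, hq, hr, hpq⟩ := hM
  rw [(H.count_regular_iff r).1 hr] at hpq
  have hcomp := comp_of_isTauRigidCat hrig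
  have hfin := hrig.1
  have hsM : SummandsIn R Z M := fun N _ _ i pr hpi hN =>
    H.exhaust N (Module.Finite.of_surjective pr fun x => ⟨i x, LinearMap.congr_fun hpi x⟩) hN
      (hcomp.retract i pr hpi (Fac.of_surjective pr fun x => ⟨i x, LinearMap.congr_fun hpi x⟩))
  have hsP : SummandsIn R Z P := fun N _ _ i pr hpi hN => by
    have hp : Module.Projective R N := Module.Projective.of_split i pr hpi
    exact H.exhaust N (Module.Finite.of_surjective pr fun x => ⟨i x, LinearMap.congr_fun hpi x⟩) hN
      fun Y _ _ _ => RigidTo.of_projective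
  obtain ⟨k, a, ⟨ea⟩, hka⟩ := hp.exists_equiv H.separated hsM
  obtain ⟨l, b, ⟨eb⟩, hlb⟩ := hq.exists_equiv H.separated hsP
  obtain ⟨k', a', hinj, ⟨ea'⟩⟩ := hb.exists_equiv hsM
  have hretr : ∀ c ∈ Finset.univ.image a ∪ Finset.univ.image a',
      ∃ (i : Z c →ₗ[R] M) (pr : M →ₗ[R] Z c), pr ∘ₗ i = LinearMap.id := by
    intro c hc
    rcases Finset.mem_union.1 hc with hc | hc <;> obtain ⟨i, -, rfl⟩ := Finset.mem_image.1 hc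
    · exact ⟨ea.symm.toLinearMap ∘ₗ LinearMap.single R (fun i => Z (a i)) i,
        LinearMap.proj i ∘ₗ ea.toLinearMap, by ext x; simp⟩
    · exact ⟨ea'.symm.toLinearMap ∘ₗ LinearMap.single R (fun i => Z (a' i)) i,
        LinearMap.proj i ∘ₗ ea'.toLinearMap, by ext x; simp⟩
  have hadj : ∀ c ∈ Finset.univ.image a ∪ Finset.univ.image a',
      ∀ d ∈ Finset.univ.image a ∪ Finset.univ.image a', Adj c d := by
    intro c hc d hd
    obtain ⟨i, pr, h⟩ := hretr c hc
    obtain ⟨i', pr', h'⟩ := hretr d hd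
    exact H.adj_of_comp c d
      (hcomp.retract i pr h (Fac.of_surjective pr' fun x => ⟨i' x, LinearMap.congr_fun h' x⟩))
      (hcomp.retract i' pr' h' (Fac.of_surjective pr fun x => ⟨i x, LinearMap.congr_fun h x⟩))
  have himg := H.separated.image_eq H.indec (ea.symm.trans ea') (card_clique hadj)
  obtain ⟨E⟩ := nonempty_equiv_module hinj ea'
  suffices h : ∃ x, summandSet x = Finset.univ.image a' by
    obtain ⟨x, hx⟩ := h
    exact ⟨x, by rw [hx]; exact ⟨E⟩⟩
  rw [← himg]
  have hadj' : ∀ c ∈ Finset.univ.image a, ∀ d ∈ Finset.univ.image a, Adj c d := fun c hc d hd =>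
    hadj c (Finset.mem_union_left _ hc) d (Finset.mem_union_left _ hd)
  have hle := card_clique hadj'
  have hcases : p = 2 ∨ p = 1 ∨ p = 0 := by omega
  rcases hcases with rfl | rfl | rfl
  · exact exists_summandSet_eq hadj' hka
  · obtain ⟨u, hu⟩ := Finset.card_eq_one.1 hka
    obtain ⟨t, ht⟩ := Finset.card_eq_one.1 (hlb.trans (by omega))
    obtain ⟨i, -, rfl⟩ := Finset.mem_image.1 (hu ▸ Finset.mem_singleton_self u)
    obtain ⟨j, -, rfl⟩ := Finset.mem_image.1 (ht ▸ Finset.mem_singleton_self t)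
    have hz : ∀ f : Z (b j) →ₗ[R] Z (a i), f = 0 := by
      intro f
      have h0 := hhom (ea.symm.toLinearMap ∘ₗ LinearMap.single R (fun i => Z (a i)) i ∘ₗ f ∘ₗ
        LinearMap.proj j ∘ₗ eb.toLinearMap)
      ext x
      have h1 := LinearMap.congr_fun h0 (eb.symm (Pi.single j x))
      simpa using congrFun (congrArg ea h1) i
    have hpb : Module.Projective R (Z (b j)) :=
      Module.Projective.of_split (M := P) (eb.symm.toLinearMap ∘ₗ LinearMap.single R (fun i => Z (b i)) j)
        (LinearMap.proj j ∘ₗ eb.toLinearMap) (by ext x; simp)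
    rw [hu]
    rcases H.projective _ hpb with h | h
    · rw [h] at hz
      exact ⟨_, by rw [(H.hom_top₁ _).1 hz]; exact summandSet_inr_zero⟩
    · rw [h] at hz
      exact ⟨_, by rw [(H.hom_top₂ _).1 hz]; exact summandSet_inl_zero⟩
  · exact ⟨some none, (Finset.card_eq_zero.1 hka).symm⟩

theorem fac_module_iff (a b : WithTop (WithBot (Fin (m + 1) ⊕ Fin (n + 1)))) :
    Fac R (module R Z (summandSet b)) (module R Z (summandSet a)) ↔ a ≤ b := by
  have hmem : ∀ c : Fin (m + 1) ⊕ Fin (n + 1), c ∈ summandSet (some (some c)) := by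
    rintro (i | i) <;> simp [summandSet]
  have hle : ∀ c : Fin (m + 1) ⊕ Fin (n + 1), ∀ d ∈ summandSet (some (some c)), d ≤ c := by
    rintro (i | i) d hd <;>
      · simp only [summandSet, Finset.mem_filter, Finset.mem_univ, true_and] at hd
        obtain ⟨j, rfl, hj⟩ := hd
        simp only [Sum.inl_le_inl_iff, Sum.inr_le_inr_iff, Fin.le_def]
        omega
  have down : ∀ c, Fac R (Z c) (module R Z (summandSet (some (some c)))) := fun c =>
    Fac.pi fun d => (H.fac_iff _ _).2 (hle c d d.2)
  have up : ∀ x, ∀ c ∈ summandSet x, Fac R (module R Z (summandSet x)) (Z c) := fun x c hc =>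
    fac_proj (Y := fun d : summandSet x => Z d) ⟨c, hc⟩
  have htop : ∀ c, Fac R (module R Z (summandSet none)) (Z c) := by
    rintro (i | i)
    · exact (up none top₁ (by simp [summandSet])).trans
        ((H.fac_iff _ _).2 (Sum.inl_le_inl_iff.2 (Fin.le_last _)))
    · exact (up none top₂ (by simp [summandSet])).trans
        ((H.fac_iff _ _).2 (Sum.inr_le_inr_iff.2 (Fin.le_last _)))
  have hbot : ∀ c, ¬ Fac R (module R Z (summandSet (some none))) (Z c) := by
    rintro c ⟨k, g, hg⟩
    have := (H.indec c).1
    have hs : Subsingleton (module R Z (summandSet (some none))) := by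
      have : IsEmpty (summandSet (some none) : Finset (Fin (m + 1) ⊕ Fin (n + 1))) := by
        simp only [summandSet]
        infer_instance
      change Subsingleton (∀ a : (summandSet (some none) : Finset (Fin (m + 1) ⊕ Fin (n + 1))), Z a)
      infer_instance
    exact not_subsingleton (Z c) hg.subsingleton
  have hbotmem : ∀ d, d ∉ summandSet (some none : WithTop (WithBot (Fin (m + 1) ⊕ Fin (n + 1)))) :=
    fun d => by simp [summandSet]
  have ht₁ : top₁ ∈ summandSet (none : WithTop (WithBot (Fin (m + 1) ⊕ Fin (n + 1)))) := by
    simp [summandSet]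
  have ht₂ : top₂ ∈ summandSet (none : WithTop (WithBot (Fin (m + 1) ⊕ Fin (n + 1)))) := by
    simp [summandSet]
  induction a using WithTop.recTopCoe with
  | top =>
    induction b using WithTop.recTopCoe with
    | top => exact iff_of_true Fac.refl le_rfl
    | coe b =>
      refine iff_of_false (fun h => ?_) (WithTop.not_top_le_coe _)
      induction b using WithBot.recBotCoe with
      | bot => exact hbot top₁ (h.trans (up none top₁ ht₁))
      | coe b =>
        have h1 := (H.fac_iff _ _).1 (((down b).trans h).trans (up none top₁ ht₁))
        have h2 := (H.fac_iff _ _).1 (((down b).trans h).trans (up none top₂ ht₂))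
        rcases b with i | i
        · exact Sum.not_inr_le_inl h2
        · exact Sum.not_inl_le_inr h1
  | coe a =>
    induction a using WithBot.recBotCoe with
    | bot => exact iff_of_true (Fac.pi fun d => absurd d.2 (hbotmem _)) bot_le
    | coe a =>
      induction b using WithTop.recTopCoe with
      | top => exact iff_of_true (Fac.pi fun d => htop d) le_top
      | coe b =>
        induction b using WithBot.recBotCoe with
        | bot =>
          refine iff_of_false (fun h => hbot a (h.trans (up (some (some a)) _ (hmem a)))) ?_
          rw [WithTop.coe_le_coe]
          exact WithBot.not_coe_le_bot a
        | coe b =>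
          rw [WithTop.coe_le_coe, WithBot.coe_le_coe, ← H.fac_iff]
          exact ⟨fun h => ((down b).trans h).trans (up (some (some a)) _ (hmem a)),
            fun h => ((up (some (some b)) _ (hmem b)).trans h).trans (down a)⟩

end TwoChains

theorem TwoChains.tauTiltingData {Λ : Type} [Ring Λ] {Z : Fin (m + 1) ⊕ Fin (n + 1) → Type}
    [∀ a, AddCommGroup (Z a)] [∀ a, Module Λᵐᵒᵖ (Z a)] (H : TwoChains Λᵐᵒᵖ Z) :
    TauTiltingData Λ (m + n + 4) (m + 1) (n + 1) := by
  have hT := fun x => H.supportTauTilting_module x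
  have hinj : ∀ x y, Nonempty (module Λᵐᵒᵖ Z (summandSet x) ≃ₗ[Λᵐᵒᵖ] module Λᵐᵒᵖ Z (summandSet y)) →
      x = y := fun x y ⟨e⟩ => le_antisymm ((H.fac_module_iff x y).1 (Fac.of_equiv e.symm))
        ((H.fac_module_iff y x).1 (Fac.of_equiv e))
  have hex : ∀ M : RMod Λ, IsBasicSupportTauTilting Λ M →
      ∃ x, Nonempty (M ≃ₗ[Λᵐᵒᵖ] module Λᵐᵒᵖ Z (summandSet x)) := fun M hM =>
    H.exists_equiv_module hM.1 hM.2
  have hcard : Fintype.card (WithTop (WithBot (Fin (m + 1) ⊕ Fin (n + 1)))) = m + n + 4 := by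
    change Fintype.card (Option (Option (Fin (m + 1) ⊕ Fin (n + 1)))) = _
    simp only [Fintype.card_option, Fintype.card_sum, Fintype.card_fin]
    omega
  have σ : Fin (m + n + 4) ≃ WithTop (WithBot (Fin (m + 1) ⊕ Fin (n + 1))) :=
    (Fintype.equivFinOfCardEq hcard).symm
  have hcount : SupportTauTiltingCount Λ (m + n + 4) :=
    ⟨fun i => module Λᵐᵒᵖ Z (summandSet (σ i)), fun i => hT _,
      fun i j h => σ.injective (hinj _ _ h), fun M hM => by
        obtain ⟨x, hx⟩ := hex M hM
        exact ⟨σ.symm x, by beta_reduce; rw [σ.apply_symm_apply]; exact hx⟩⟩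
  exact ⟨⟨_, hcount.choose, hcount.choose_spec.2.2⟩, hcount,
    fun x => module Λᵐᵒᵖ Z (summandSet x), hT, hinj, hex, fun x y =>
      ((facLE_iff _ _).trans (H.fac_module_iff x y)).symm⟩

end Assembly

namespace Frame

variable {K R : Type} [Field K] [Ring R] [Algebra K R]

/-- A chain of two-term presentations `(Re₂)^(b i) → (Re₁)^(c i)`, `i ≤ m + 1`, running from `Re₁`
to the shifted `Re₂`, with consecutive ones compatible. -/
structure Chain (F : Frame K R) (m : ℕ) (b c : ℕ → ℕ)
    (f : ∀ i, Matrix (Fin (b i)) (Fin (c i)) R) : Prop where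
  b_zero : b 0 = 0
  c_zero : c 0 = 1
  b_last : b (m + 1) = 1
  c_last : c (m + 1) = 0
  ev : ∀ i ≤ m + 1, F.EV (f i)
  det : ∀ i ≤ m, b (i + 1) * c i = b i * c (i + 1) + 1
  inT_succ : ∀ i ≤ m, F.InT (f (i + 1)) (F.X (f i))
  fac : ∀ i < m, Fac R (F.X (f i)) (F.X (f (i + 1)))
  not_inT : ∀ i < m, ¬ F.InT (f (i + 2)) (F.X (f i))
  min : ∃ I : Ideal R, Nak I ∧ ∀ i ≤ m, F.Min I (f i)
  indec : ∀ i ≤ m, IsIndecModule R (F.X (f i))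

namespace Chain

variable {F : Frame K R} {m : ℕ} {b c : ℕ → ℕ} {f : ∀ i, Matrix (Fin (b i)) (Fin (c i)) R}
  (H : F.Chain m b c f)

include H

theorem c_pos {i : ℕ} (hi : i ≤ m) : 0 < c i := by
  have := H.det i hi
  exact Nat.pos_of_ne_zero fun h => by rw [h] at this; omega

theorem b_pos {i : ℕ} (hi : i ≤ m) : 0 < b (i + 1) := by
  have := H.det i hi
  exact Nat.pos_of_ne_zero fun h => by rw [h] at this; omega

theorem fac_le {i j : ℕ} (hij : i ≤ j) (hj : j ≤ m) : Fac R (F.X (f i)) (F.X (f j)) := by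
  induction j, hij using Nat.le_induction with
  | base => exact Fac.refl
  | succ j hij ih => exact (ih (by omega)).trans (H.fac j (by omega))

theorem inT_iff {i j : ℕ} (hi : i ≤ m) (hj : j ≤ m + 1) : F.InT (f j) (F.X (f i)) ↔ j ≤ i + 1 := by
  constructor
  · intro h
    by_contra hlt
    obtain ⟨k, rfl⟩ : ∃ k, j = k + 2 := ⟨j - 2, by omega⟩
    exact H.not_inT k (by omega) (h.fac (H.fac_le (by omega) (by omega)))
  · intro h
    rcases Nat.lt_or_ge i j with h' | h'
    · obtain rfl : j = i + 1 := by omega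
      exact H.inT_succ i hi
    · refine InT.fac ?_ (H.fac_le h' hi)
      cases j with
      | zero =>
        have : IsEmpty (Fin (b 0)) := by rw [H.b_zero]; infer_instance
        exact fun _ _ => ⟨0, fun _ => smul_zero _, isEmptyElim⟩
      | succ j => exact (H.inT_succ j (by omega)).fac (H.fac j (by omega))

theorem fac_iff {i j : ℕ} (hi : i ≤ m) (hj : j ≤ m) : Fac R (F.X (f i)) (F.X (f j)) ↔ i ≤ j := by
  refine ⟨fun h => ?_, fun h => H.fac_le h hj⟩
  by_contra hlt
  have := (H.inT_iff hj (by omega : i + 1 ≤ m + 1)).1 (((H.inT_iff hi (by omega)).2 le_rfl).fac h)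
  omega

theorem inT_of_comp {i : ℕ} (hi : i ≤ m) {N : Type} [AddCommGroup N] [Module R N]
    (h : Comp R (F.X (f i)) N) : F.InT (f i) N := by
  obtain ⟨I, hI, hmin⟩ := H.min
  exact Frame.inT_of_comp hI (H.ev i (by omega)) (hmin i hi) h

theorem e₂_smul_eq_zero_iff {i : ℕ} (hi : i ≤ m) :
    (∀ x : F.X (f i), F.e₂ • x = 0) ↔ i = m := by
  have h1 := H.inT_iff hi (le_refl (m + 1))
  rw [show (i = m) ↔ (m + 1 ≤ i + 1) by omega, ← h1]
  have hemp : IsEmpty (Fin (c (m + 1))) := by rw [H.c_last]; infer_instance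
  constructor
  · intro h u hu
    exact ⟨fun _ => 0, fun _ => smul_zero _, fun k => by rw [← hu, h]; simp⟩
  · intro h x
    obtain ⟨w, -, hw⟩ := h (fun _ => F.e₂ • x) fun _ => by rw [smul_smul, F.mul₂₂]
    simpa using hw ⟨0, by rw [H.b_last]; exact one_pos⟩

theorem gen_ne_zero {i : ℕ} (hi : i ≤ m) (j) : F.gen (f i) j ≠ 0 := fun h =>
  gen_notMem (H.ev i (by omega)) j (by rw [h]; exact Submodule.zero_mem _)

theorem hom_zero_iff {N : Type} [AddCommGroup N] [Module R N] :
    (∀ φ : F.X (f 0) →ₗ[R] N, φ = 0) ↔ ∀ x : N, F.e₁ • x = 0 := by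
  have hb : IsEmpty (Fin (b 0)) := by rw [H.b_zero]; infer_instance
  constructor
  · intro h x
    have h1 := lift_gen (F := F) (f := f 0) (fun _ => F.e₁ • x)
      (fun _ => by rw [smul_smul, F.mul₁₁]) isEmptyElim ⟨0, by rw [H.c_zero]; exact one_pos⟩
    rw [← h1]
    exact LinearMap.congr_fun (h _) _
  · refine fun h φ => hom_ext fun i => ?_
    rw [← e₁_gen, map_smul, h, LinearMap.zero_apply]

theorem finite (i : ℕ) : Module.Finite R (F.X (f i)) := inferInstance

theorem projective_zero : Module.Projective R (F.X (f 0)) := by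
  have h0 : IsEmpty (Fin (b 0)) := by rw [H.b_zero]; infer_instance
  refine Module.Projective.of_split (M := Fin (c 0) → R)
    (F.lift (fun i => Pi.single i F.e₁) (fun i => by
      rw [← Pi.single_smul, smul_eq_mul, F.mul₁₁]) isEmptyElim) (F.rel (f 0)).mkQ ?_
  refine hom_ext fun i => ?_
  rw [LinearMap.comp_apply, lift_gen, LinearMap.id_apply]
  have : (Pi.single i F.e₁ : Fin (c 0) → R) = F.e₁ • Pi.single i 1 := by
    rw [← Pi.single_smul, smul_eq_mul, mul_one]
  rw [this, map_smul]
  exact e₁_gen i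

theorem tauRigid_pi {o : Type} [DecidableEq o] [Fintype o] (k : o → ℕ) (hk : ∀ x, k x ≤ m)
    (hadj : ∀ x y, k x ≤ k y + 1) : IsTauRigidCat R (ModuleCat.of R (∀ x, F.X (f (k x)))) := by
  have e : F.X (Matrix.blockDiagonal' fun x => f (k x)) ≃ₗ[R] ∀ x, F.X (f (k x)) := blockEquiv
  refine (isTauRigidCat_X (EV.blockDiagonal' fun x => H.ev _ ((hk x).trans (by omega)))
    (InT.blockDiagonal' fun x => ?_)).congr e
  have h : ∀ y, F.InT (f (k x)) (F.X (f (k y))) := fun y =>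
    (H.inT_iff (hk y) ((hk x).trans (by omega))).2 (hadj x y)
  intro u hu
  choose w hw₁ hw₂ using fun y => h y (fun j => e (u j) y) fun j => by
    rw [← Pi.smul_apply, ← map_smul, hu]
  refine ⟨fun i => e.symm fun y => w y i, fun i => ?_, fun j => e.injective (funext fun y => ?_)⟩
  · rw [← map_smul]
    congr 1
    funext y
    exact hw₁ y i
  · rw [hw₂, map_sum, Finset.sum_apply]
    exact Finset.sum_congr rfl fun i _ => by simp

theorem comp_of_adj {i j : ℕ} (hi : i ≤ m) (hj : j ≤ m) (h₁ : i ≤ j + 1) (h₂ : j ≤ i + 1) :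
    Comp R (F.X (f i)) (F.X (f j)) := by
  have := comp_of_isTauRigidCat (H.tauRigid_pi (fun x : Bool => cond x i j) (by simp [hi, hj])
    (by simp [h₁, h₂]))
  exact this.retract (LinearMap.single R (fun x : Bool => F.X (f (cond x i j))) true)
    (LinearMap.proj true) (by ext x; simp) (fac_proj (Y := fun x : Bool => F.X (f (cond x i j))) false)

variable {n : ℕ} {b' c' : ℕ → ℕ} {g : ∀ i, Matrix (Fin (b' i)) (Fin (c' i)) R}
  (G : F.swap.Chain n b' c' g)

include G

theorem not_inT_swap {i j : ℕ} (hi : i ≤ m) (hj : j ≤ n) : ¬ F.InT (f (i + 1)) (F.swap.X (g j)) := by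
  intro h
  let x : Fin (c' j) := ⟨0, G.c_pos hj⟩
  obtain ⟨w, -, hw⟩ := h (fun _ => F.swap.gen (g j) x) fun _ => e₁_gen x
  refine gen_notMem (G.ev j (by omega)) x ?_
  rw [hw ⟨0, H.b_pos hi⟩, J_swap]
  exact Submodule.sum_mem _ fun k _ => Submodule.smul_mem_smul (H.ev _ (by omega) _ _).mem_J trivial

theorem not_fac_swap {i j : ℕ} (hj : j ≤ n) : ¬ Fac R (F.X (f i)) (F.swap.X (g j)) := by
  rintro ⟨k, φ, hφ⟩
  let x : Fin (c' j) := ⟨0, G.c_pos hj⟩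
  obtain ⟨y, hy⟩ := hφ (F.swap.gen (g j) x)
  refine gen_notMem (G.ev j (by omega)) x ?_
  have h1 : F.e₂ • F.swap.gen (g j) x = F.swap.gen (g j) x := e₁_gen x
  rw [← h1, ← hy, ← map_smul, J_swap]
  have h2 : F.e₂ • y = ∑ l, Pi.single l (F.e₂ • y l) := (Finset.univ_sum_single _).symm
  rw [h2, map_sum]
  refine Submodule.sum_mem _ fun l _ => ?_
  have h3 := e₂_smul_mem (y l)
  have h4 : F.J • (⊤ : Submodule R (F.X (f i))) ≤
      (F.J • (⊤ : Submodule R (F.swap.X (g j)))).comap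
        (φ ∘ₗ LinearMap.single R (fun _ => F.X (f i)) l) := by
    rw [Submodule.smul_le]
    intro r hr z _
    rw [Submodule.mem_comap, map_smul]
    exact Submodule.smul_mem_smul hr trivial
  exact h4 h3

theorem eq_zero_of_comp {i j : ℕ} (hi : i ≤ m) (hj : j ≤ n)
    (h : Comp R (F.X (f i)) (F.swap.X (g j))) : i = 0 := by
  rcases i with _ | i
  · rfl
  · exact absurd (H.inT_of_comp (by omega) h) (H.not_inT_swap G (by omega) hj)

theorem eq_zero_of_projective {i : ℕ} (hi : i ≤ m) (h : Module.Projective R (F.X (f i))) : i = 0 :=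
  H.eq_zero_of_comp G hi (Nat.zero_le n) fun _ _ _ _ => RigidTo.of_projective

theorem separated {i j : ℕ} (hi : i ≤ m) (hj : j ≤ m) (k : ℕ)
    (s : F.X (f j) →ₗ[R] (Fin k → F.X (f i))) (p : (Fin k → F.X (f i)) →ₗ[R] F.X (f j))
    (hps : p ∘ₗ s = LinearMap.id) : i = j := by
  have hle : i ≤ j := (H.fac_iff hi hj).1 ⟨k, p, fun x => ⟨s x, LinearMap.congr_fun hps x⟩⟩
  refine le_antisymm hle ?_
  rcases i with _ | i
  · have := H.projective_zero
    have := Module.Projective.of_equiv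
      (DirectSum.linearEquivFunOnFintype R (Fin k) fun _ => F.X (f 0))
    exact (H.eq_zero_of_projective G hj (Module.Projective.of_split s p hps)).le
  · have h1 : Comp R (F.X (f j)) (F.X (f i)) := fun Y _ _ hY =>
      (RigidTo.pi fun _ : Fin k => H.comp_of_adj hi (by omega : i ≤ m) le_rfl (by omega) Y hY).retract
        s p hps
    exact (H.inT_iff (by omega) (by omega)).1 (H.inT_of_comp (by omega) h1)

theorem nonempty_regular_equiv : Nonempty (R ≃ₗ[R] (F.X (f 0) × F.swap.X (g 0))) := by
  have hb : IsEmpty (Fin (b 0)) := by rw [H.b_zero]; infer_instance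
  have hb' : IsEmpty (Fin (b' 0)) := by rw [G.b_zero]; infer_instance
  let x : Fin (c 0) := ⟨0, by rw [H.c_zero]; exact one_pos⟩
  let y : Fin (c' 0) := ⟨0, by rw [G.c_zero]; exact one_pos⟩
  have hx : ∀ i, i = x := fun i => Fin.ext (by have := i.2; have := H.c_zero; simp only [x]; omega)
  have hy : ∀ i, i = y := fun i => Fin.ext (by have := i.2; have := G.c_zero; simp only [y]; omega)
  let φ : R →ₗ[R] F.X (f 0) × F.swap.X (g 0) :=
    LinearMap.toSpanSingleton R _ (F.gen (f 0) x, F.swap.gen (g 0) y)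
  let ψ : F.X (f 0) × F.swap.X (g 0) →ₗ[R] R := LinearMap.coprod
    (F.lift (fun _ => F.e₁) (fun _ => F.mul₁₁) isEmptyElim)
    (F.swap.lift (fun _ => F.e₂) (fun _ => F.mul₂₂) isEmptyElim)
  have h3 : F.swap.lift (f := g 0) (N := R) (fun _ => F.e₂) (fun _ => F.mul₂₂) isEmptyElim
      (F.swap.gen (g 0) y) = F.e₂ := lift_gen _ _ _ y
  refine ⟨LinearEquiv.ofLinearMap φ ψ ?_ ?_⟩
  · refine LinearMap.prod_ext (hom_ext fun i => ?_) (hom_ext fun i => ?_)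
    · rw [hx i]
      have h2 : F.e₁ • F.swap.gen (g 0) y = 0 := e₂_gen (F := F.swap) y
      simp [φ, ψ, LinearMap.toSpanSingleton_apply, e₁_gen, h2]
    · rw [hy i]
      have h2 : F.e₂ • F.swap.gen (g 0) y = F.swap.gen (g 0) y := e₁_gen (F := F.swap) y
      simp [φ, ψ, LinearMap.toSpanSingleton_apply, e₂_gen, h2, h3]
  · ext
    simp [φ, ψ, LinearMap.toSpanSingleton_apply, h3, F.add]

end Chain

section Family

/-- The modules of two chains. -/
def chainFamily (F : Frame K R) {m n : ℕ} {b c b' c' : ℕ → ℕ}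
    (f : ∀ i, Matrix (Fin (b i)) (Fin (c i)) R) (g : ∀ i, Matrix (Fin (b' i)) (Fin (c' i)) R) :
    Fin (m + 1) ⊕ Fin (n + 1) → Type
  | .inl i => F.X (f (m - i))
  | .inr j => F.swap.X (g (n - j))

variable {F : Frame K R} {m n : ℕ} {b c b' c' : ℕ → ℕ}
    {f : ∀ i, Matrix (Fin (b i)) (Fin (c i)) R} {g : ∀ i, Matrix (Fin (b' i)) (Fin (c' i)) R}

instance : ∀ a : Fin (m + 1) ⊕ Fin (n + 1), AddCommGroup (F.chainFamily f g a)
  | .inl i => inferInstanceAs (AddCommGroup (F.X (f (m - i))))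
  | .inr j => inferInstanceAs (AddCommGroup (F.swap.X (g (n - j))))

instance : ∀ a : Fin (m + 1) ⊕ Fin (n + 1), Module R (F.chainFamily f g a)
  | .inl i => inferInstanceAs (Module R (F.X (f (m - i))))
  | .inr j => inferInstanceAs (Module R (F.swap.X (g (n - j))))

theorem twoChains (H : F.Chain m b c f) (G : F.swap.Chain n b' c' g)
    (hex : ∀ (N : Type) [AddCommGroup N] [Module R N], Module.Finite R N → IsIndecModule R N →
      Comp R N N → (∃ i ≤ m, Nonempty (F.X (f i) ≃ₗ[R] N)) ∨
        ∃ j ≤ n, Nonempty (F.swap.X (g j) ≃ₗ[R] N)) :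
    TwoChains R (F.chainFamily f g : Fin (m + 1) ⊕ Fin (n + 1) → Type) := by
  have H' : F.swap.swap.Chain m b c f := H
  have hproj : ∀ a : Fin (m + 1) ⊕ Fin (n + 1), Module.Projective R (F.chainFamily f g a) →
      a = top₁ ∨ a = top₂ := by
    rintro (i | j) h
    · have := H.eq_zero_of_projective G (Nat.sub_le m i) h
      exact Or.inl (congrArg Sum.inl (Fin.ext (by simp; omega)))
    · have := G.eq_zero_of_projective H' (Nat.sub_le n j) h
      exact Or.inr (congrArg Sum.inr (Fin.ext (by simp; omega)))
  have hproj₁ : Module.Projective R (F.chainFamily f g (top₁ : Fin (m + 1) ⊕ Fin (n + 1))) := by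
    have := H.projective_zero
    rwa [← Nat.sub_self m] at this
  have hproj₂ : Module.Projective R (F.chainFamily f g (top₂ : Fin (m + 1) ⊕ Fin (n + 1))) := by
    have := G.projective_zero
    rwa [← Nat.sub_self n] at this
  have hfin : ∀ a : Fin (m + 1) ⊕ Fin (n + 1), Module.Finite R (F.chainFamily f g a) := by
    rintro (i | j)
    exacts [H.finite _, G.finite _]
  refine ⟨?_, ?_, ?_, ?_, ?_, ?_, ?_, hproj, ?_, ?_⟩
  · rintro (i | j)
    exacts [H.indec _ (Nat.sub_le m i), G.indec _ (Nat.sub_le n j)]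
  · rintro (i | i) (j | j)
    · rw [Sum.inl_le_inl_iff, Fin.le_def]
      exact (H.fac_iff (Nat.sub_le m i) (Nat.sub_le m j)).trans (by omega)
    · exact iff_of_false (H.not_fac_swap G (Nat.sub_le n j)) Sum.not_inr_le_inl
    · exact iff_of_false (G.not_fac_swap H' (Nat.sub_le m j)) Sum.not_inl_le_inr
    · rw [Sum.inr_le_inr_iff, Fin.le_def]
      exact (G.fac_iff (Nat.sub_le n i) (Nat.sub_le n j)).trans (by omega)
  · rintro (i | i) (j | j) k s p hps
    · have := H.separated G (Nat.sub_le m i) (Nat.sub_le m j) k s p hps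
      exact congrArg Sum.inl (Fin.ext (by omega))
    · exact absurd ⟨k, p, fun x => ⟨s x, LinearMap.congr_fun hps x⟩⟩ (H.not_fac_swap G (Nat.sub_le n j))
    · exact absurd ⟨k, p, fun x => ⟨s x, LinearMap.congr_fun hps x⟩⟩ (G.not_fac_swap H' (Nat.sub_le m j))
    · have := G.separated H' (Nat.sub_le n i) (Nat.sub_le n j) k s p hps
      exact congrArg Sum.inr (Fin.ext (by omega))
  · intro C hC
    by_cases h₁ : ∀ a ∈ C, ∃ i, a = .inl i
    · let k : C → ℕ := fun a => Sum.elim (fun i : Fin (m + 1) => m - i.val) (fun _ => 0) a.1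
      refine (H.tauRigid_pi k (fun a => ?_) fun a a' => ?_).congr
        (LinearEquiv.piCongrRight fun a => ?_)
      · obtain ⟨i | j, ha⟩ := a
        exacts [Nat.sub_le m i, Nat.zero_le m]
      · have := hC a a.2 a' a'.2
        obtain ⟨i, hi⟩ := h₁ a a.2
        obtain ⟨i', hi'⟩ := h₁ a' a'.2
        simp only [k, hi, hi', Adj, pos, Sum.elim_inl] at this ⊢
        omega
      · obtain ⟨i | j, ha⟩ := a
        · exact LinearEquiv.refl R (F.X (f (m - i)))
        · exact absurd (h₁ _ ha) (by simp)
    by_cases h₂ : ∀ a ∈ C, ∃ i, a = .inr i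
    · let k : C → ℕ := fun a => Sum.elim (fun _ => 0) (fun i : Fin (n + 1) => n - i.val) a.1
      refine (G.tauRigid_pi k (fun a => ?_) fun a a' => ?_).congr
        (LinearEquiv.piCongrRight fun a => ?_)
      · obtain ⟨i | j, ha⟩ := a
        exacts [Nat.zero_le n, Nat.sub_le n j]
      · have := hC a a.2 a' a'.2
        obtain ⟨i, hi⟩ := h₂ a a.2
        obtain ⟨i', hi'⟩ := h₂ a' a'.2
        simp only [k, hi, hi', Adj, pos, Sum.elim_inr] at this ⊢
        omega
      · obtain ⟨i | j, ha⟩ := a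
        · exact absurd (h₂ _ ha) (by simp)
        · exact LinearEquiv.refl R (F.swap.X (g (n - j)))
    push Not at h₁ h₂
    obtain ⟨a₁, ha₁, h₁⟩ := h₁
    obtain ⟨a₂, ha₂, h₂⟩ := h₂
    have hP : ∀ a : C, Module.Projective R (F.chainFamily f g a.1) := by
      rintro ⟨a, ha⟩
      have key : a = top₁ ∨ a = top₂ := by
        have e₁ := hC a ha a₁ ha₁
        have e₂ := hC a ha a₂ ha₂
        rcases a with i | i
        · rcases a₁ with j | j
          · exact absurd rfl (h₁ j)
          · simp only [Adj, pos] at e₁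
            exact Or.inl (congrArg Sum.inl (Fin.ext (by simp; omega)))
        · rcases a₂ with j | j
          · simp only [Adj, pos] at e₂
            exact Or.inr (congrArg Sum.inr (Fin.ext (by simp; omega)))
          · exact absurd rfl (h₂ j)
      rcases key with rfl | rfl
      exacts [hproj₁, hproj₂]
    have := Module.Projective.of_equiv
      (DirectSum.linearEquivFunOnFintype R C fun a => F.chainFamily f g a.1)
    have hF : Module.Finite R (∀ a : C, F.chainFamily f g a.1) := Module.Finite.pi
    exact isTauRigidCat_of_projective (hM := hF) _
  · rintro (i | i) (j | j) h₁ h₂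
    · have := (H.inT_iff (Nat.sub_le m j) (by omega)).1 (H.inT_of_comp (by omega) h₁)
      have := (H.inT_iff (Nat.sub_le m i) (by omega)).1 (H.inT_of_comp (by omega) h₂)
      simp only [Adj, pos]
      omega
    · have := H.eq_zero_of_comp G (Nat.sub_le m i) (Nat.sub_le n j) h₁
      have := G.eq_zero_of_comp H' (Nat.sub_le n j) (Nat.sub_le m i) h₂
      simp only [Adj, pos]
      omega
    · have := G.eq_zero_of_comp H' (Nat.sub_le n i) (Nat.sub_le m j) h₁
      have := H.eq_zero_of_comp G (Nat.sub_le m j) (Nat.sub_le n i) h₂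
      simp only [Adj, pos]
      omega
    · have := (G.inT_iff (Nat.sub_le n j) (by omega)).1 (G.inT_of_comp (by omega) h₁)
      have := (G.inT_iff (Nat.sub_le n i) (by omega)).1 (G.inT_of_comp (by omega) h₂)
      simp only [Adj, pos]
      omega
  · intro N _ _ h₁ h₂ h₃
    rcases hex N h₁ h₂ h₃ with ⟨i, hi, h⟩ | ⟨j, hj, h⟩
    · refine ⟨.inl ⟨m - i, by omega⟩, ?_⟩
      have : m - (m - i) = i := by omega
      rw [← this] at h
      exact h
    · refine ⟨.inr ⟨n - j, by omega⟩, ?_⟩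
      have : n - (n - j) = j := by omega
      rw [← this] at h
      exact h
  · have := H.nonempty_regular_equiv G
    change Nonempty (R ≃ₗ[R] (F.X (f (m - m)) × F.swap.X (g (n - n))))
    rwa [Nat.sub_self, Nat.sub_self]
  · have key : ∀ (N : Type) [AddCommGroup N] [Module R N],
        (∀ φ : F.swap.X (g (n - n)) →ₗ[R] N, φ = 0) ↔ ∀ x : N, F.e₂ • x = 0 := fun N _ _ => by
      rw [Nat.sub_self]
      exact G.hom_zero_iff
    rintro (i | j)
    · refine (key _).trans ((H.e₂_smul_eq_zero_iff (Nat.sub_le m i)).trans ?_)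
      rw [Sum.inl.injEq, Fin.ext_iff, Fin.val_zero]
      omega
    · refine iff_of_false (fun h => ?_) (by simp)
      refine G.gen_ne_zero (Nat.sub_le n j) ⟨0, G.c_pos (Nat.sub_le n j)⟩ ?_
      rw [← e₁_gen]
      exact (key _).1 h _
  · have key : ∀ (N : Type) [AddCommGroup N] [Module R N],
        (∀ φ : F.X (f (m - m)) →ₗ[R] N, φ = 0) ↔ ∀ x : N, F.e₁ • x = 0 := fun N _ _ => by
      rw [Nat.sub_self]
      exact H.hom_zero_iff
    rintro (i | j)
    · refine iff_of_false (fun h => ?_) (by simp)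
      refine H.gen_ne_zero (Nat.sub_le m i) ⟨0, H.c_pos (Nat.sub_le m i)⟩ ?_
      rw [← e₁_gen]
      exact (key _).1 h _
    · refine (key _).trans ((G.e₂_smul_eq_zero_iff (Nat.sub_le n j)).trans ?_)
      rw [Sum.inr.injEq, Fin.ext_iff, Fin.val_zero]
      omega

end Family

end Frame

namespace Frame

variable {K R : Type} [Field K] [Ring R] [Algebra K R] {F : Frame K R}
  {M : Type} [AddCommGroup M] [Module R M]

theorem mul_e₁_sub_mem (r : R) : r * F.e₁ - algebraMap K R (F.ε₁ r) * F.e₁ ∈ F.J :=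
  mem_J_of_e₁ (by rw [sub_mul, mul_assoc, mul_assoc, F.mul₁₁]) (by simp [F.ε₁₁])

theorem span_drop (hJ : Nak F.J) {c d : ℕ} {x : Fin (c + 1) → M} {y : Fin d → M}
    (hx : ∀ i, F.e₁ • x i = x i)
    (hspan : Submodule.span R (Set.range x ∪ Set.range y) = ⊤) {r : Fin (c + 1) → R}
    {s : Fin d → R} (h : ∑ i, r i • x i + ∑ j, s j • y j = 0) {i : Fin (c + 1)}
    (hi : F.ε₁ (r i) ≠ 0) :
    Submodule.span R (Set.range (x ∘ i.succAbove) ∪ Set.range y) = ⊤ := by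
  set T := Submodule.span R (Set.range (x ∘ i.succAbove) ∪ Set.range y) with hT
  have hy : ∀ j, y j ∈ T := fun j => Submodule.subset_span (Or.inr ⟨j, rfl⟩)
  have hx' : ∀ j, x (i.succAbove j) ∈ T := fun j => Submodule.subset_span (Or.inl ⟨j, rfl⟩)
  refine eq_top_iff.2 (hJ M _ _ ?_)
  rw [← hspan, Submodule.span_le, hspan]
  rintro _ (⟨k, rfl⟩ | ⟨j, rfl⟩)
  · rcases Fin.eq_self_or_eq_succAbove i k with rfl | ⟨j, rfl⟩
    · rw [Fin.sum_univ_succAbove _ k] at h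
      have h1 : r k • x k ∈ T := by
        have : r k • x k = -(∑ j, r (k.succAbove j) • x (k.succAbove j) + ∑ j, s j • y j) := by
          rw [eq_neg_iff_add_eq_zero, ← add_assoc, h]
        rw [this]
        exact Submodule.neg_mem _ (Submodule.add_mem _
          (Submodule.sum_mem _ fun j _ => Submodule.smul_mem _ _ (hx' j))
          (Submodule.sum_mem _ fun j _ => Submodule.smul_mem _ _ (hy j)))
      have h2 : x k = algebraMap K R (F.ε₁ (r k))⁻¹ • (r k • x k -
          (r k * F.e₁ - algebraMap K R (F.ε₁ (r k)) * F.e₁) • x k) := by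
        rw [sub_smul, mul_smul, mul_smul, hx, sub_sub_cancel, smul_smul, ← map_mul,
          inv_mul_cancel₀ hi, map_one, one_smul]
      rw [h2]
      refine Submodule.smul_mem _ _ (Submodule.sub_mem _ (Submodule.mem_sup_left h1)
        (Submodule.mem_sup_right (Submodule.smul_mem_smul (mul_e₁_sub_mem _) trivial)))
    · exact Submodule.mem_sup_left (hx' j)
  · exact Submodule.mem_sup_left (hy j)

variable (F) in
/-- Minimal homogeneous generators. -/
structure Gens {c d : ℕ} (x : Fin c → M) (y : Fin d → M) : Prop where
  e₁ : ∀ i, F.e₁ • x i = x i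
  e₂ : ∀ j, F.e₂ • y j = y j
  span : Submodule.span R (Set.range x ∪ Set.range y) = ⊤
  relation : ∀ (r : Fin c → R) (s : Fin d → R), ∑ i, r i • x i + ∑ j, s j • y j = 0 →
    (∀ i, F.ε₁ (r i) = 0) ∧ ∀ j, F.ε₂ (s j) = 0

theorem Gens.swap {c d : ℕ} {x : Fin c → M} {y : Fin d → M} (h : F.Gens x y) :
    F.swap.Gens y x :=
  ⟨h.e₂, h.e₁, by rw [Set.union_comm]; exact h.span, fun r s hrs =>
    (h.relation s r (by rw [add_comm]; exact hrs)).symm⟩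

variable (F) in
theorem exists_gens [Module.Finite R M] (hJ : Nak F.J) :
    ∃ (c d : ℕ) (x : Fin c → M) (y : Fin d → M), F.Gens x y := by
  classical
  have hex : ∃ n c d : ℕ, c + d = n ∧ ∃ (x : Fin c → M) (y : Fin d → M),
      (∀ i, F.e₁ • x i = x i) ∧ (∀ j, F.e₂ • y j = y j) ∧
      Submodule.span R (Set.range x ∪ Set.range y) = ⊤ := by
    obtain ⟨n, s, hs⟩ := Module.Finite.exists_fin (R := R) (M := M)
    refine ⟨n + n, n, n, rfl, fun i => F.e₁ • s i, fun i => F.e₂ • s i,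
      fun i => by rw [smul_smul, F.mul₁₁], fun i => by rw [smul_smul, F.mul₂₂], ?_⟩
    rw [eq_top_iff, ← hs, Submodule.span_le]
    rintro _ ⟨i, rfl⟩
    rw [← F.e₁_add_smul (s i)]
    exact Submodule.add_mem _ (Submodule.subset_span (Or.inl ⟨i, rfl⟩))
      (Submodule.subset_span (Or.inr ⟨i, rfl⟩))
  obtain ⟨c, d, hcd, x, y, hx, hy, hspan⟩ := Nat.find_spec hex
  refine ⟨c, d, x, y, hx, hy, hspan, fun r s h => ⟨fun i => ?_, fun j => ?_⟩⟩
  · by_contra hi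
    obtain ⟨c, rfl⟩ : ∃ c', c = c' + 1 := ⟨c - 1, by have := i.2; omega⟩
    exact Nat.find_min hex (m := c + d) (by omega) ⟨c, d, rfl, _, y, fun j => hx _, hy,
      span_drop hJ hx hspan h hi⟩
  · by_contra hj
    obtain ⟨d, rfl⟩ : ∃ d', d = d' + 1 := ⟨d - 1, by have := j.2; omega⟩
    refine Nat.find_min hex (m := c + d) (by omega) ⟨c, d, rfl, x, y ∘ j.succAbove, hx,
      fun j => hy _, ?_⟩
    rw [Set.union_comm] at hspan ⊢
    exact span_drop (F := F.swap) (by rwa [J_swap]) hy hspan (by rw [add_comm]; exact h) hj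

theorem Gens.exists_sum {c d : ℕ} {x : Fin c → M} {y : Fin d → M} (h : F.Gens x y) (z : M) :
    ∃ (r : Fin c → R) (s : Fin d → R), z = ∑ i, r i • x i + ∑ j, s j • y j := by
  have hz : z ∈ Submodule.span R (Set.range x ∪ Set.range y) := by rw [h.span]; trivial
  rw [Submodule.span_union, Submodule.mem_sup] at hz
  obtain ⟨a, ha, b, hb, rfl⟩ := hz
  obtain ⟨r, rfl⟩ := (Submodule.mem_span_range_iff_exists_fun R).1 ha
  obtain ⟨s, rfl⟩ := (Submodule.mem_span_range_iff_exists_fun R).1 hb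
  exact ⟨r, s, rfl⟩

/-- The simple module at the first vertex. -/
def S (_ : Frame K R) : Type := K

instance : AddCommGroup F.S := inferInstanceAs (AddCommGroup K)
instance : Module R F.S := Module.compHom K (F.ε₁ : R →+* K)

theorem smul_S (r : R) (z : K) : r • (show F.S from z) = (show F.S from F.ε₁ r * z) := rfl

theorem e₂_smul_S (z : F.S) : F.e₂ • z = 0 := by
  have h : F.ε₁ F.e₂ * (show K from z) = 0 := by rw [ε₁₂, zero_mul]
  exact h

theorem Gens.exists_functional {c d : ℕ} {x : Fin c → M} {y : Fin d → M} (h : F.Gens x y)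
    (i : Fin c) : ∃ φ : M →ₗ[R] F.S, φ (x i) = (1 : K) := by
  let π : ((Fin c → R) × (Fin d → R)) →ₗ[R] M :=
    LinearMap.coprod (Fintype.linearCombination R x) (Fintype.linearCombination R y)
  have hπ : ∀ r s, π (r, s) = ∑ i, r i • x i + ∑ j, s j • y j := fun r s => by
    simp [π, Fintype.linearCombination_apply]
  have hsurj : Function.Surjective π := fun z => by
    obtain ⟨r, s, rfl⟩ := h.exists_sum z
    exact ⟨(r, s), hπ r s⟩
  let q : ((Fin c → R) × (Fin d → R)) →ₗ[R] F.S :=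
    { toFun := fun p => (F.ε₁ (p.1 i) : K)
      map_add' := fun a b => map_add F.ε₁ _ _
      map_smul' := fun a b => map_mul F.ε₁ _ _ }
  have hle : LinearMap.ker π ≤ LinearMap.ker q := fun p hp =>
    (h.relation p.1 p.2 ((hπ _ _).symm.trans hp)).1 i
  refine ⟨(LinearMap.ker π).liftQ q hle ∘ₗ
    (LinearMap.quotKerEquivOfSurjective π hsurj).symm.toLinearMap, ?_⟩
  have h1 : x i = π (Pi.single i 1, 0) := by
    rw [hπ, Finset.sum_eq_single i]
    · simp
    · intro j _ hj; simp [hj]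
    · simp
  rw [LinearMap.comp_apply, LinearEquiv.coe_coe, h1]
  have h2 : (LinearMap.quotKerEquivOfSurjective π hsurj).symm (π (Pi.single i 1, 0)) =
      (LinearMap.ker π).mkQ (Pi.single i 1, 0) := by
    rw [LinearEquiv.symm_apply_eq]; rfl
  rw [h2, Submodule.mkQ_apply, Submodule.liftQ_apply]
  change F.ε₁ ((Pi.single i 1 : Fin c → R) i) = 1
  rw [Pi.single_eq_same, map_one]

variable (F) in
theorem projective_X_of_isEmpty {κ ι : Type} [Fintype κ] [Fintype ι] [DecidableEq ι] [IsEmpty κ]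
    (f : Matrix κ ι R) : Module.Projective R (F.X f) := by
  refine Module.Projective.of_split (M := ι → R)
    (F.lift (fun i => Pi.single i F.e₁) (fun i => by
      rw [← Pi.single_smul, smul_eq_mul, F.mul₁₁]) isEmptyElim) (F.rel f).mkQ ?_
  refine hom_ext fun i => ?_
  rw [LinearMap.comp_apply, lift_gen, LinearMap.id_apply]
  have : (Pi.single i F.e₁ : ι → R) = F.e₁ • Pi.single i 1 := by
    rw [← Pi.single_smul, smul_eq_mul, mul_one]
  rw [this, map_smul]
  exact e₁_gen i

theorem Gens.fac_S {c d : ℕ} {x : Fin c → M} {y : Fin d → M} (h : F.Gens x y)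
    (hc : 0 < c) : Fac R M F.S := by
  obtain ⟨φ, hφ⟩ := h.exists_functional ⟨0, hc⟩
  refine Fac.of_surjective φ fun z => ⟨algebraMap K R (show K from z) • x ⟨0, hc⟩, ?_⟩
  rw [map_smul, hφ]
  refine (smul_S _ 1).trans ?_
  rw [AlgHom.commutes]
  exact mul_one (show K from z)

variable (F) in
/-- The projective module `(Re₁)^c × (Re₂)^d`. -/
abbrev Proj (c d : ℕ) : Type :=
  F.X (0 : Matrix (Fin 0) (Fin c) R) × F.swap.X (0 : Matrix (Fin 0) (Fin d) R)

instance (c d : ℕ) : Module.Projective R (F.Proj c d) := by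
  have := F.projective_X_of_isEmpty (0 : Matrix (Fin 0) (Fin c) R)
  have := F.swap.projective_X_of_isEmpty (0 : Matrix (Fin 0) (Fin d) R)
  infer_instance

namespace Gens

variable {c d : ℕ} {x : Fin c → M} {y : Fin d → M} (h : F.Gens x y)

/-- The projective cover given by minimal homogeneous generators. -/
def cover : F.Proj c d →ₗ[R] M :=
  LinearMap.coprod (F.lift x h.e₁ isEmptyElim) (F.swap.lift y h.e₂ isEmptyElim)

theorem cover_sum (r : Fin c → R) (s : Fin d → R) :
    h.cover (∑ i, r i • F.gen 0 i, ∑ j, s j • F.swap.gen 0 j) =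
      ∑ i, r i • x i + ∑ j, s j • y j := by
  have h1 : ∀ j, F.swap.lift y h.e₂ isEmptyElim (F.swap.gen (0 : Matrix (Fin 0) (Fin d) R) j) = y j :=
    lift_gen _ _ _
  simp [cover, h1]

theorem cover_surjective : Function.Surjective h.cover := fun z => by
  obtain ⟨r, s, rfl⟩ := h.exists_sum z
  exact ⟨_, h.cover_sum r s⟩

theorem map_ker_cover {z : F.Proj c d} (hz : h.cover z = 0) (φ : F.Proj c d →ₗ[R] F.S) :
    φ z = 0 := by
  obtain ⟨z₁, z₂⟩ := z
  obtain ⟨r, rfl⟩ := exists_gen z₁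
  obtain ⟨s, rfl⟩ := exists_gen z₂
  have hr := (h.relation r s (by rw [← h.cover_sum]; exact hz)).1
  have h1 : ∀ z : F.Proj c d, φ z = φ (z.1, 0) + φ (0, z.2) := fun z => by
    rw [← map_add, Prod.mk_add_mk, add_zero, zero_add]
  rw [h1]
  have h2 : φ (∑ i, r i • F.gen 0 i, 0) = 0 := by
    change (φ ∘ₗ LinearMap.inl R _ _) (∑ i, r i • F.gen 0 i) = 0
    rw [map_sum]
    refine Finset.sum_eq_zero fun i _ => ?_
    rw [map_smul]
    have : ∀ a : K, F.ε₁ (r i) * a = 0 := fun a => by rw [hr, zero_mul]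
    exact this _
  have h3 : φ (0, ∑ j, s j • F.swap.gen 0 j) = 0 := by
    change (φ ∘ₗ LinearMap.inr R _ _) (∑ j, s j • F.swap.gen 0 j) = 0
    rw [map_sum]
    refine Finset.sum_eq_zero fun j _ => ?_
    have : F.e₂ • F.swap.gen (0 : Matrix (Fin 0) (Fin d) R) j = F.swap.gen 0 j := e₁_gen j
    rw [map_smul, ← this, map_smul, e₂_smul_S, smul_zero]
  rw [h2, h3, add_zero]

theorem ker_gens (hM : Comp R M M) (hc : 0 < c) {c' d' : ℕ} {x' : Fin c' → LinearMap.ker h.cover}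
    {y' : Fin d' → LinearMap.ker h.cover} (h' : F.Gens x' y') : c' = 0 := by
  by_contra hc'
  obtain ⟨φ, hφ⟩ := h'.exists_functional ⟨0, Nat.pos_of_ne_zero hc'⟩
  obtain ⟨ψ, hψ⟩ := hM F.S (h.fac_S hc) _ h.cover h.cover_surjective φ
  have h1 := hψ (x' ⟨0, Nat.pos_of_ne_zero hc'⟩)
  rw [h.map_ker_cover (x' _).2, hφ] at h1
  exact zero_ne_one (α := K) h1

include h in
/-- A rigid module with top concentrated at the first vertex has a presentation by a matrix. -/
theorem exists_presentation [IsNoetherianRing R] (hJ : Nak F.J) (hM : Comp R M M) (hc : 0 < c)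
    (hd : d = 0) : ∃ (b : ℕ) (f : Matrix (Fin b) (Fin c) R), F.EV f ∧ F.InT f (F.X f) ∧
      Nonempty (F.X f ≃ₗ[R] M) := by
  subst hd
  have : Module.Finite R (LinearMap.ker h.cover) := inferInstance
  obtain ⟨c', b, x', y', h'⟩ := F.exists_gens (M := LinearMap.ker h.cover) hJ
  obtain rfl := h.ker_gens hM hc h'
  choose r hr using fun k => exists_gen (y' k).1.1
  let f : Matrix (Fin b) (Fin c) R := fun k i => F.e₂ * r k i * F.e₁
  have hf : F.EV f := fun k i => ⟨by simp only [f, ← mul_assoc, F.mul₂₂], by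
    simp only [f, mul_assoc, F.mul₁₁]⟩
  have hy' : ∀ k, (y' k).1 = (∑ i, f k i • F.gen 0 i, 0) := fun k => by
    have h1 : F.e₂ • (y' k).1 = (y' k).1 := congrArg Subtype.val (h'.e₂ k)
    refine Prod.ext ?_ ?_
    · rw [← h1, Prod.smul_fst, hr, Finset.smul_sum]
      exact Finset.sum_congr rfl fun i _ => by
        simp only [f]
        rw [mul_smul, mul_smul, e₁_gen]
    · obtain ⟨s, hs⟩ := exists_gen (y' k).1.2
      rw [hs]
      simp
  have hcov : ∀ t : Fin c → R, h.cover (∑ i, t i • F.gen 0 i, 0) = ∑ i, t i • x i := fun t => by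
    have := h.cover_sum t isEmptyElim
    simpa using this
  have hrel : ∀ k, ∑ i, f k i • x i = 0 := fun k => by
    have := (y' k).2
    rw [LinearMap.mem_ker, hy', hcov] at this
    exact this
  let φ : F.X f →ₗ[R] M := F.lift x h.e₁ hrel
  have hφ : ∀ t : Fin c → R, φ (∑ i, t i • F.gen f i) = ∑ i, t i • x i := fun t => by
    simp [φ]
  have hinj : Function.Injective φ := by
    rw [injective_iff_map_eq_zero]
    intro z hz
    obtain ⟨t, rfl⟩ := exists_gen z
    rw [hφ] at hz
    obtain ⟨a, s, ha⟩ := h'.exists_sum ⟨(∑ i, t i • F.gen 0 i, 0), (hcov t).trans hz⟩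
    have h1 : ∑ i, t i • F.gen (0 : Matrix (Fin 0) (Fin c) R) i =
        ∑ k, s k • ∑ i, f k i • F.gen 0 i := by
      have := congrArg (fun z => z.1.1) ha
      simp only [Finset.univ_eq_empty, Finset.sum_empty, zero_add] at this
      rw [this, AddSubmonoidClass.coe_finsetSum, Prod.fst_sum]
      exact Finset.sum_congr rfl fun k _ => by
        rw [SetLike.val_smul, Prod.smul_fst, hy']
    let q : F.X (0 : Matrix (Fin 0) (Fin c) R) →ₗ[R] F.X f := lift (F.gen f) e₁_gen isEmptyElim
    have h2 := congrArg q h1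
    simpa [q, row_gen] using h2
  have hsurj : Function.Surjective φ := fun z => by
    obtain ⟨t, s, rfl⟩ := h.exists_sum z
    exact ⟨_, (hφ t).trans (by simp)⟩
  let e := LinearEquiv.ofBijective φ ⟨hinj, hsurj⟩
  refine ⟨b, f, hf, inT_of_comp hJ hf (fun t ht k => ?_) (hM.congr e.symm e.symm), ⟨e⟩⟩
  refine mem_J_of_e₂ (by rw [mul_assoc, F.mul₂₂]) ?_
  rw [map_mul, F.ε₂₂, mul_one]
  refine (h'.relation isEmptyElim t ?_).2 k
  refine Subtype.ext (Prod.ext ?_ ?_)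
  · have : ∑ k, t k • ∑ i, f k i • F.gen (0 : Matrix (Fin 0) (Fin c) R) i = 0 := by
      simp_rw [Finset.smul_sum, smul_smul]
      rw [Finset.sum_comm]
      simp_rw [← Finset.sum_smul, ht, zero_smul]
      exact Finset.sum_const_zero
    simp only [Finset.univ_eq_empty, Finset.sum_empty, zero_add]
    rw [AddSubmonoidClass.coe_finsetSum, Prod.fst_sum]
    refine (Finset.sum_congr rfl fun k _ => ?_).trans this
    rw [SetLike.val_smul, Prod.smul_fst, hy']
  · simp only [Finset.univ_eq_empty, Finset.sum_empty, zero_add]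
    rw [AddSubmonoidClass.coe_finsetSum, Prod.snd_sum]
    refine Finset.sum_eq_zero fun k _ => ?_
    rw [SetLike.val_smul, Prod.smul_snd, hy', smul_zero]

end Gens

variable (F) in
/-- Rigid indecomposable modules are presented by matrices with entries in one of the two
off-diagonal corners. -/
theorem exists_presentation [IsNoetherianRing R] (hJ : Nak F.J) [Module.Finite R M]
    (hI : IsIndecModule R M) (hM : Comp R M M) :
    (∃ (b c : ℕ) (f : Matrix (Fin b) (Fin c) R), F.EV f ∧ F.InT f (F.X f) ∧
      Nonempty (F.X f ≃ₗ[R] M)) ∨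
    ∃ (b c : ℕ) (f : Matrix (Fin b) (Fin c) R), F.swap.EV f ∧ F.swap.InT f (F.swap.X f) ∧
      Nonempty (F.swap.X f ≃ₗ[R] M) := by
  obtain ⟨c, d, x, y, h⟩ := F.exists_gens (M := M) hJ
  have hJ' : Nak F.swap.J := by rwa [J_swap]
  have := hI.1
  rcases Nat.eq_zero_or_pos c with hc | hc <;> rcases Nat.eq_zero_or_pos d with hd | hd
  · subst hc hd
    obtain ⟨z, hz⟩ := exists_ne (0 : M)
    obtain ⟨r, s, rfl⟩ := h.exists_sum z
    simp at hz
  · obtain ⟨b, f, hf⟩ := h.swap.exists_presentation hJ' hM hd hc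
    exact Or.inr ⟨b, d, f, hf⟩
  · obtain ⟨b, f, hf⟩ := h.exists_presentation hJ hM hc hd
    exact Or.inl ⟨b, c, f, hf⟩
  · exfalso
    obtain ⟨c', d', x', y', h'⟩ := F.exists_gens (M := LinearMap.ker h.cover) hJ
    obtain rfl := h.ker_gens hM hc h'
    have hd' : d' = 0 := by
      by_contra hne
      obtain ⟨φ, hφ⟩ := h'.swap.exists_functional ⟨0, Nat.pos_of_ne_zero hne⟩
      obtain ⟨ψ, hψ⟩ := hM F.swap.S (h.swap.fac_S hd) _ h.cover h.cover_surjective φ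
      have h1 := hψ (y' ⟨0, Nat.pos_of_ne_zero hne⟩)
      have h0 := (y' ⟨0, Nat.pos_of_ne_zero hne⟩).2
      have h2 : ψ (y' ⟨0, Nat.pos_of_ne_zero hne⟩).1 = 0 :=
        h.swap.map_ker_cover (z := ((y' ⟨0, Nat.pos_of_ne_zero hne⟩).1.2,
          (y' ⟨0, Nat.pos_of_ne_zero hne⟩).1.1)) ((add_comm _ _).trans h0)
          (ψ ∘ₗ (LinearEquiv.prodComm R (F.swap.X 0) (F.X 0)).toLinearMap)
      rw [h2, hφ] at h1
      exact zero_ne_one (α := K) h1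
    subst hd'
    have hinj : Function.Injective h.cover := by
      rw [injective_iff_map_eq_zero]
      intro z hz
      obtain ⟨r, s, hrs⟩ := h'.exists_sum ⟨z, hz⟩
      simpa using congrArg Subtype.val hrs
    let e := LinearEquiv.ofBijective h.cover ⟨hinj, h.cover_surjective⟩
    have hI' := hI.congr e.symm
    rcases hI'.2 _ _ (LinearMap.isCompl_range_inl_inr) with h0 | h0
    · have h1 : ((F.gen 0 ⟨0, hc⟩, 0) : F.Proj c d) = 0 := by
        rw [← Submodule.mem_bot R, ← h0]
        exact ⟨_, rfl⟩
      exact gen_notMem (F := F) (f := (0 : Matrix (Fin 0) (Fin c) R)) (fun k => k.elim0) ⟨0, hc⟩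
        (by rw [(Prod.mk.inj h1).1]; exact zero_mem _)
    · have h1 : ((0, F.swap.gen 0 ⟨0, hd⟩) : F.Proj c d) = 0 := by
        rw [← Submodule.mem_bot R, ← h0]
        exact ⟨_, rfl⟩
      exact gen_notMem (F := F.swap) (f := (0 : Matrix (Fin 0) (Fin d) R)) (fun k => k.elim0)
        ⟨0, hd⟩ (by rw [(Prod.mk.inj h1).2]; exact zero_mem _)

end Frame

/-- An indecomposable module that is a finite product is isomorphic to one of the factors. -/
theorem IsIndecModule.exists_equiv_of_pi {R N o : Type} [Ring R] [AddCommGroup N] [Module R N]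
    [DecidableEq o] [Finite o] {Y : o → Type} [∀ x, AddCommGroup (Y x)] [∀ x, Module R (Y x)]
    (h : IsIndecModule R N) (e : N ≃ₗ[R] ∀ x, Y x) :
    ∃ x, Nonempty (Y x ≃ₗ[R] N) ∧ Nontrivial (Y x) := by
  have := h.1
  obtain ⟨x, hx⟩ : ∃ x, Nontrivial (Y x) := by
    by_contra! hall
    exact not_subsingleton N e.toEquiv.subsingleton
  let s : Y x →ₗ[R] N := e.symm.toLinearMap ∘ₗ LinearMap.single R Y x
  let p : N →ₗ[R] Y x := LinearMap.proj x ∘ₗ e.toLinearMap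
  have hps : ∀ y, p (s y) = y := fun y => by simp [p, s]
  have hid : IsIdempotentElem (s ∘ₗ p : N →ₗ[R] N) := LinearMap.ext fun y => by
    change s (p (s (p y))) = s (p y)
    rw [hps]
  refine ⟨x, ⟨LinearEquiv.ofBijective s ⟨fun a b hab => by rw [← hps a, hab, hps], fun y => ?_⟩⟩, hx⟩
  rcases h.2 _ _ (LinearMap.IsIdempotentElem.isCompl hid) with h' | h'
  · obtain ⟨a, ha⟩ := exists_ne (0 : Y x)
    refine absurd ?_ ha
    have : s a ∈ LinearMap.range (s ∘ₗ p) := ⟨s a, by simp [hps]⟩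
    rw [h', Submodule.mem_bot] at this
    rw [← hps a, this, map_zero]
  · refine ⟨p y, ?_⟩
    have : y - s (p y) ∈ LinearMap.ker (s ∘ₗ p) := by simp [hps]
    rw [h', Submodule.mem_bot, sub_eq_zero] at this
    exact this.symm

namespace Frame

variable {K R : Type} [Field K] [Ring R] [Algebra K R] {F : Frame K R}
  {κ ι κ' ι' : Type} [Fintype κ] [Fintype ι] [DecidableEq ι] [Fintype κ'] [Fintype ι']
  [DecidableEq ι'] {f : Matrix κ ι R} {N : Type} [AddCommGroup N] [Module R N]

theorem InT.submatrix (h : F.InT f N) (a : κ' ≃ κ) (b : ι' ≃ ι) : F.InT (f.submatrix a b) N := by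
  intro u hu
  obtain ⟨w, hw₁, hw₂⟩ := h (u ∘ a.symm) fun k => hu _
  refine ⟨w ∘ b, fun i => hw₁ _, fun k => ?_⟩
  have := hw₂ (a k)
  simp only [Function.comp_apply, Equiv.symm_apply_apply] at this
  rw [this]
  exact (Equiv.sum_comp b fun i => f (a k) i • w i).symm

theorem InT.pi {o : Type} {Y : o → Type} [∀ x, AddCommGroup (Y x)] [∀ x, Module R (Y x)]
    (h : ∀ x, F.InT f (Y x)) : F.InT f (∀ x, Y x) := by
  intro u hu
  choose w hw₁ hw₂ using fun x => h x (fun k => u k x) fun k => congrFun (hu k) x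
  refine ⟨fun i x => w x i, fun i => funext fun x => hw₁ x i, fun k => funext fun x => ?_⟩
  rw [hw₂, Finset.sum_apply]
  rfl

namespace Chain

variable {m : ℕ} {b c : ℕ → ℕ} {f : ∀ i, Matrix (Fin (b i)) (Fin (c i)) R}
  (H : F.Chain m b c f)

include H

theorem exists_cone (B C : ℕ) :
    ∃ i ≤ m, ∃ p q, B = p * b i + q * b (i + 1) ∧ C = p * c i + q * c (i + 1) := by
  have hdet : ∀ i ≤ m, (b (i + 1) * c i : ℤ) = b i * c (i + 1) + 1 := fun i hi => by
    exact_mod_cast H.det i hi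
  let s : ℕ → ℤ := fun i => B * c i - C * b i
  obtain ⟨i, hi, h₀, h₁⟩ : ∃ i ≤ m, 0 ≤ s i ∧ s (i + 1) ≤ 0 := by
    by_contra! hall
    have key : ∀ i ≤ m + 1, 0 ≤ s i := by
      intro i
      induction i with
      | zero => intro _; simp [s, H.b_zero, H.c_zero]
      | succ i ih => intro hi; exact (hall i (by omega) (ih (by omega))).le
    have := hall m le_rfl (key m (by omega))
    simp [s, H.b_last, H.c_last] at this
    omega
  obtain ⟨q, hq⟩ := Int.eq_ofNat_of_zero_le h₀
  obtain ⟨p, hp⟩ := Int.eq_ofNat_of_zero_le (neg_nonneg.2 h₁)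
  refine ⟨i, hi, p, q, ?_, ?_⟩ <;> zify <;> rw [← hp, ← hq] <;> simp only [s]
  · linear_combination (-(B : ℤ)) * hdet i hi
  · linear_combination (-(C : ℤ)) * hdet i hi

theorem inT_of_le_succ {i j : ℕ} (hi : i ≤ m + 1) (hj : j ≤ m + 1) (h : j ≤ i + 1) :
    F.InT (f j) (F.X (f i)) := by
  rcases Nat.lt_or_ge m i with hm | hm
  · have hc : IsEmpty (Fin (c i)) := by
      rw [show i = m + 1 by omega, H.c_last]; infer_instance
    exact fun u _ => ⟨fun _ => 0, fun _ => smul_zero _, fun k => Subsingleton.elim _ _⟩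
  · exact (H.inT_iff hm hj).2 h

theorem exists_equiv [Infinite K] [Module.Finite K R] (hJ : Nak F.J) {B C : ℕ}
    {g : Matrix (Fin B) (Fin C) R} (hg : F.EV g) (h : F.InT g (F.X g)) (hN : IsIndecModule R N)
    (e : F.X g ≃ₗ[R] N) : ∃ i ≤ m, Nonempty (F.X (f i) ≃ₗ[R] N) := by
  obtain ⟨i, hi, p, q, hB, hC⟩ := H.exists_cone B C
  let k : Fin p ⊕ Fin q → ℕ := Sum.elim (fun _ => i) fun _ => i + 1
  have hk : ∀ x, i ≤ k x ∧ k x ≤ i + 1 := by rintro (x | x) <;> simp [k]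
  let d := Matrix.blockDiagonal' fun x => f (k x)
  let a : Fin B ≃ Σ x, Fin (b (k x)) := Fintype.equivOfCardEq (by simp [k, hB])
  let a' : Fin C ≃ Σ x, Fin (c (k x)) := Fintype.equivOfCardEq (by simp [k, hC])
  have hd : F.EV d := EV.blockDiagonal' fun x => H.ev _ (by have := hk x; omega)
  have e' : F.X d ≃ₗ[R] ∀ x, F.X (f (k x)) := blockEquiv
  have e'' : F.X (d.submatrix a a') ≃ₗ[R] F.X d := reindexEquiv a a'
  have hT : F.InT d (F.X d) := by
    refine (InT.blockDiagonal' fun x => InT.pi fun y => H.inT_of_le_succ ?_ ?_ ?_).fac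
      (Fac.of_equiv e'.symm)
    all_goals have := hk x; have := hk y; omega
  obtain ⟨e₀⟩ := nonempty_equiv_of_inT hJ (fun x y => hd _ _)
    ((hT.submatrix a a').fac (Fac.of_equiv e''.symm)) hg h
  obtain ⟨x, he, hx⟩ := hN.exists_equiv_of_pi (e.symm.trans (e₀.symm.trans (e''.trans e')))
  refine ⟨k x, ?_, he⟩
  by_contra hlt
  have hc : IsEmpty (Fin (c (k x))) := by
    rw [show k x = m + 1 by have := hk x; omega, H.c_last]; infer_instance
  exact not_subsingleton (F.X (f (k x))) inferInstance

variable {n : ℕ} {b' c' : ℕ → ℕ} {g : ∀ i, Matrix (Fin (b' i)) (Fin (c' i)) R}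

theorem twoChains [Infinite K] [Module.Finite K R] (hJ : Nak F.J) (G : F.swap.Chain n b' c' g) :
    TwoChains R (F.chainFamily f g : Fin (m + 1) ⊕ Fin (n + 1) → Type) := by
  have : IsNoetherianRing R := isNoetherian_of_tower K inferInstance
  refine Frame.twoChains H G fun N _ _ _ hN hN' => ?_
  rcases F.exists_presentation hJ hN hN' with ⟨B, C, f', hf, hT, ⟨e⟩⟩ | ⟨B, C, f', hf, hT, ⟨e⟩⟩
  · exact Or.inl (H.exists_equiv hJ hf hT hN e)
  · exact Or.inr (G.exists_equiv (by rwa [J_swap]) hf hT hN e)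

end Chain
end Frame

namespace Frame

variable {K R : Type} [Field K] [Ring R] [Algebra K R] {F : Frame K R}
  {κ ι κ' ι' : Type} [Fintype κ] [Fintype ι] [DecidableEq ι] [Fintype κ'] [Fintype ι']
  [DecidableEq ι'] {f : Matrix κ ι R} {g : Matrix κ' ι' R} {N : Type} [AddCommGroup N] [Module R N]

variable (F) in
/-- The family `v` spans `e₂Re₁` over the centre of `R`. -/
structure Spans {d : ℕ} (v : Fin d → R) : Prop where
  isV : ∀ l, F.IsV (v l)
  span : ∀ x, F.IsV x → ∃ a : Fin d → R, (∀ l, a l ∈ Subring.center R) ∧ x = ∑ l, a l * v l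

theorem Spans.inT {d : ℕ} {v : Fin d → R} [DecidableEq κ] (hv : F.Spans v) (hf : F.EV f)
    (H : ∀ k l j, ∃ w : ι → F.X g, ∀ k',
      (Pi.single k (v l • F.gen g j) : κ → F.X g) k' = ∑ i, f k' i • w i) :
    F.InT f (F.X g) := by
  refine InT.of_exists hf fun u hu => ?_
  choose r hr using fun k => exists_gen (u k)
  have hV : ∀ k j, F.IsV (F.e₂ * r k j * F.e₁) := fun k j =>
    ⟨by simp only [← mul_assoc, F.mul₂₂], by rw [mul_assoc, F.mul₁₁]⟩
  choose a ha₁ ha₂ using fun k j => hv.span _ (hV k j)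
  choose w hw using H
  refine ⟨fun i => ∑ p : κ × ι' × Fin d, a p.1 p.2.1 p.2.2 • w p.1 p.2.2 p.2.1 i, fun k' => ?_⟩
  calc u k' = ∑ j, (F.e₂ * r k' j * F.e₁) • F.gen g j := by
        rw [← hu, hr, Finset.smul_sum]
        exact Finset.sum_congr rfl fun j _ => by rw [mul_smul, e₁_gen, mul_smul]
    _ = ∑ j, ∑ l, a k' j l • v l • F.gen g j := by
        refine Finset.sum_congr rfl fun j _ => ?_
        rw [ha₂, Finset.sum_smul]
        simp_rw [mul_smul]
    _ = ∑ k, ∑ j, ∑ l, a k j l • (Pi.single k (v l • F.gen g j) : κ → F.X g) k' := by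
        rw [Finset.sum_eq_single k']
        · simp
        · intro k _ hk
          simp [hk.symm]
        · simp
    _ = ∑ p : κ × ι' × Fin d, a p.1 p.2.1 p.2.2 •
        (Pi.single p.1 (v p.2.2 • F.gen g p.2.1) : κ → F.X g) k' := by
        simp_rw [Fintype.sum_prod_type]
    _ = _ := by
        simp_rw [hw, Finset.smul_sum]
        rw [Finset.sum_comm]
        refine Finset.sum_congr rfl fun i _ => Finset.sum_congr rfl fun p _ => ?_
        rw [smul_smul, smul_smul, Subring.mem_center_iff.1 (ha₁ p.1 p.2.1 p.2.2) (f k' i)]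

theorem fac_of_maps {s : Type} [Fintype s] (w : s → ι → N) (h₁ : ∀ a i, F.e₁ • w a i = w a i)
    (h₂ : ∀ a k, ∑ i, f k i • w a i = 0) (y : Type) (x : y → N) (hx : Submodule.span R (Set.range x) = ⊤)
    (H : ∀ j, ∃ a i, w a i = x j) : Fac R (F.X f) N := by
  refine Fac.of_family (fun a => lift (w a) (h₁ a) (h₂ a)) ?_
  rw [eq_top_iff, ← hx, Submodule.span_le]
  rintro _ ⟨j, rfl⟩
  obtain ⟨a, i, h⟩ := H j
  exact Submodule.mem_iSup_of_mem a ⟨F.gen f i, by rw [lift_gen, h]⟩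

theorem eq_zero_of_idempotent (hJ : Nak F.J) {φ : F.X f →ₗ[R] F.X f} (hφ : ∀ x, φ (φ x) = φ x)
    {a : Matrix ι ι R} (ha : ∀ i, φ (F.gen f i) = ∑ j, a i j • F.gen f j) (haJ : ∀ i j, a i j ∈ F.J) :
    φ = 0 := by
  rw [← LinearMap.range_eq_bot, eq_bot_iff]
  refine hJ _ _ _ (le_trans ?_ le_sup_right)
  rintro _ ⟨x, rfl⟩
  obtain ⟨r, rfl⟩ := exists_gen x
  rw [map_sum]
  refine Submodule.sum_mem _ fun i _ => ?_
  rw [map_smul, ← hφ, ha, map_sum]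
  refine Submodule.smul_mem _ _ (Submodule.sum_mem _ fun j _ => ?_)
  rw [map_smul]
  exact J_smul (haJ i j) ⟨_, rfl⟩

theorem isIndecModule_X [Nonempty ι] (hJ : Nak F.J) (hf : F.EV f)
    (H : ∀ (a : Matrix ι ι R) (d : Matrix κ κ R), f * a = d * f →
      IsIdempotentElem (a.map F.ε₁) → a.map F.ε₁ = 0 ∨ a.map F.ε₁ = 1) :
    IsIndecModule R (F.X f) := by
  let i₀ : ι := Classical.arbitrary ι
  have h₀ : F.gen f i₀ ≠ 0 := fun h => gen_notMem hf i₀ (by rw [h]; exact Submodule.zero_mem _)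
  refine ⟨⟨_, _, h₀⟩, fun N₁ N₂ hN => ?_⟩
  let φ : F.X f →ₗ[R] F.X f := (N₁.projection N₂ hN)
  have hφ : ∀ x, φ (φ x) = φ x := fun x => LinearMap.congr_fun (Submodule.isIdempotentElem_projection hN) x
  choose r hr using fun i => exists_gen (φ (F.gen f i))
  let a : Matrix ι ι R := fun i j => F.e₁ * r i j * F.e₁
  have ha : ∀ i, φ (F.gen f i) = ∑ j, a i j • F.gen f j := fun i => by
    rw [← e₁_gen i, map_smul, hr, Finset.smul_sum]
    exact Finset.sum_congr rfl fun j _ => by simp only [a]; rw [mul_smul, mul_smul, e₁_gen]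
  have hae : ∀ i j, a i j * F.e₁ = a i j := fun i j => by simp only [a]; rw [mul_assoc, F.mul₁₁]
  have hd : ∀ k, ∃ c : κ → R, ∀ j, (f * a) k j = ∑ l, c l * f l j := fun k => by
    have h1 : ∑ j, (f * a) k j • F.gen f j = 0 := by
      have := congrArg φ (row_gen (F := F) (f := f) k)
      rw [map_zero, map_sum] at this
      rw [← this]
      simp_rw [map_smul, ha, Matrix.mul_apply, Finset.sum_smul, Finset.smul_sum, smul_smul]
      exact Finset.sum_comm
    obtain ⟨c, hc⟩ := (sum_gen_eq_zero hf).1 h1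
    refine ⟨c, fun j => ?_⟩
    rw [← hc, Matrix.mul_apply, Finset.sum_mul]
    simp_rw [mul_assoc, hae]
  choose d hd using hd
  have hid : IsIdempotentElem (a.map F.ε₁) := by
    ext i l
    have h1 : ∑ l, ((a * a) i l - a i l) • F.gen f l = 0 := by
      have := hφ (F.gen f i)
      rw [ha, map_sum] at this
      simp_rw [sub_smul, Finset.sum_sub_distrib]
      rw [sub_eq_zero, ← this]
      simp_rw [map_smul, ha, Matrix.mul_apply, Finset.sum_smul, Finset.smul_sum, smul_smul]
      exact Finset.sum_comm
    obtain ⟨c, hc⟩ := (sum_gen_eq_zero hf).1 h1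
    have := congrArg F.ε₁ (hc l)
    rw [map_mul, F.ε₁₁, mul_one, map_sub, map_sum,
      Finset.sum_eq_zero fun k _ => by rw [map_mul, (hf k l).ε₁, mul_zero], sub_eq_zero] at this
    rw [Matrix.map_apply, ← this, Matrix.mul_apply, Matrix.mul_apply, map_sum]
    simp
  rcases H a d (Matrix.ext fun k j => hd k j) hid with h | h
  · left
    have := eq_zero_of_idempotent hJ hφ ha fun i j =>
      mem_J_of_e₁ (hae i j) (congrFun (congrFun h i) j)
    rw [← Submodule.range_projection hN]
    exact LinearMap.range_eq_bot.2 this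
  · right
    have := eq_zero_of_idempotent (φ := LinearMap.id - φ) (a := fun i j => (if i = j then F.e₁ else 0) - a i j)
      hJ (fun x => by simp [hφ]) (fun i => by
        simp [sub_smul, Finset.sum_sub_distrib, ← ha, ite_smul, e₁_gen]) fun i j =>
      mem_J_of_e₁ (by
        rw [sub_mul, hae]
        split_ifs <;> simp [F.mul₁₁]) (by
        have := congrFun (congrFun h i) j
        rw [Matrix.map_apply, Matrix.one_apply] at this
        rw [map_sub, this]
        split_ifs <;> simp [F.ε₁₁])
    rw [← Submodule.ker_projection hN, eq_bot_iff]
    intro x hx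
    have h1 := LinearMap.congr_fun this x
    rw [LinearMap.sub_apply, LinearMap.mem_ker.1 hx] at h1
    simpa using h1

/-- A presentation whose commuting scalar matrices have a single eigenvalue is indecomposable. -/
theorem isIndecModule_X_of_det [Nonempty ι] (hJ : Nak F.J) (hf : F.EV f)
    (H : ∀ (a : Matrix ι ι R) (d : Matrix κ κ R), f * a = d * f →
      ∃ (c : K) (n : ℕ), (a.map F.ε₁).det = c ^ n ∧ (1 - a.map F.ε₁).det = (1 - c) ^ n) :
    IsIndecModule R (F.X f) :=
  isIndecModule_X hJ hf fun a d had hid => by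
    obtain ⟨c, n, h₁, h₂⟩ := H a d had
    by_cases hc : c = 0
    · have hu : IsUnit (1 - a.map F.ε₁) := (Matrix.isUnit_iff_isUnit_det _).2 (by simp [h₂, hc])
      exact Or.inl (sub_eq_self.1 ((IsIdempotentElem.iff_eq_one_of_isUnit hu).1 hid.one_sub))
    · have hu : IsUnit (a.map F.ε₁) := (Matrix.isUnit_iff_isUnit_det _).2 (by simp [h₁, hc])
      exact Or.inr ((IsIdempotentElem.iff_eq_one_of_isUnit hu).1 hid)

theorem isIndecModule_X_unique [Unique ι] (hJ : Nak F.J) (hf : F.EV f) : IsIndecModule R (F.X f) :=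
  isIndecModule_X_of_det hJ hf fun a _ _ => ⟨F.ε₁ (a default default), 1, by simp, by simp⟩

theorem InT.of_e₂ (h : ∀ x : N, F.e₂ • x = 0) : F.InT f N :=
  fun u hu => ⟨fun _ => 0, fun _ => smul_zero _, fun k => by rw [← hu, h]; simp⟩

theorem Spans.e₂_smul {d : ℕ} {v : Fin d → R} (hv : F.Spans v)
    (H : ∀ l j, v l • F.gen g j = 0) (x : F.X g) : F.e₂ • x = 0 := by
  obtain ⟨r, rfl⟩ := exists_gen x
  rw [Finset.smul_sum]
  refine Finset.sum_eq_zero fun j _ => ?_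
  obtain ⟨a, -, ha⟩ := hv.span (F.e₂ * r j * F.e₁)
    ⟨by simp only [← mul_assoc, F.mul₂₂], by rw [mul_assoc, F.mul₁₁]⟩
  rw [← e₁_gen j, smul_smul, smul_smul, ha, Finset.sum_smul]
  exact Finset.sum_eq_zero fun l _ => by rw [mul_smul, H, smul_zero]

theorem Min.of_ε₂ (h : ∀ c : κ → R, (∀ i, ∑ k, c k * f k i = 0) → ∀ k, F.ε₂ (c k) = 0) :
    F.Min F.J f := fun c hc k =>
  mem_J_of_e₂ (by rw [mul_assoc, F.mul₂₂]) (by rw [map_mul, h c hc k, zero_mul])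

variable (F) in
/-- There is a chain with `m + 1` modules. -/
def HasChain (m : ℕ) : Prop :=
  ∃ (b c : ℕ → ℕ) (f : ∀ i, Matrix (Fin (b i)) (Fin (c i)) R), F.Chain m b c f

end Frame

namespace Frame

variable {K R : Type} [Field K] [Ring R] [Algebra K R] {F : Frame K R}
  {κ ι κ' ι' : Type} [Fintype κ] [Fintype ι] [DecidableEq ι] [Fintype κ'] [Fintype ι']
  [DecidableEq ι'] {f : Matrix κ ι R} {g : Matrix κ' ι' R} {v : ℕ → R} {t : R} {d : ℕ}

theorem isV_zero : F.IsV 0 := ⟨mul_zero _, zero_mul _⟩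

variable (F) in
/-- Functionals detecting the coefficients of `v l = v 0 * t ^ l` in `e₂Re₁`, for `l < d`. -/
structure LData (v : ℕ → R) (d : ℕ) : Prop where
  exists_data : ∃ ψ θ : ℕ → R →ₗ[K] K, θ 0 = F.ε₁.toLinearMap ∧
    (∀ l < d, ∀ k < d, ∀ c, ψ l (c * v k) = if k = l then F.ε₂ c else 0) ∧
    ∀ l < d, ∀ k < d, ∀ a, ψ l (v k * a) = if k ≤ l then θ (l - k) a else 0

variable (F) in
/-- Functionals detecting the coefficients of `v l = t ^ l * v 0` in `e₂Re₁`, for `l < d`. -/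
structure RData (v : ℕ → R) (d : ℕ) : Prop where
  exists_data : ∃ ψ θ : ℕ → R →ₗ[K] K, θ 0 = F.ε₂.toLinearMap ∧
    (∀ l < d, ∀ k < d, ∀ a, ψ l (v k * a) = if k = l then F.ε₁ a else 0) ∧
    ∀ l < d, ∀ k < d, ∀ c, ψ l (c * v k) = if k ≤ l then θ (l - k) c else 0

theorem e₂_smul_v {M : Type} [AddCommGroup M] [Module R M] {x : R} (hx : F.IsV x) (y : M) :
    F.e₂ • x • y = x • y := by rw [smul_smul, hx.1]

section elementary

theorem not_inT_isEmpty [IsEmpty ι] {N : Type} [AddCommGroup N] [Module R N] [Nonempty κ]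
    {x : R} (hx : F.IsV x) {y : N} (h : x • y ≠ 0) : ¬ F.InT f N := fun H => by
  obtain ⟨w, -, hw⟩ := H (fun _ => x • y) fun _ => e₂_smul_v hx y
  have := hw (Classical.arbitrary κ)
  rw [Fintype.sum_empty] at this
  exact h this

/-- The presentation of the projective `Re₁`. -/
abbrev M₀ (R : Type) : Matrix (Fin 0) (Fin 1) R := fun i => i.elim0

/-- The presentation of the shifted projective `Re₂`. -/
abbrev M₁ (R : Type) : Matrix (Fin 1) (Fin 0) R := fun _ i => i.elim0

theorem ev_M₀ : F.EV (M₀ R) := fun k => k.elim0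

theorem ev_M₁ : F.EV (M₁ R) := fun _ i => i.elim0

theorem ev_single {x : R} (h : F.IsV x) : F.EV !![x] := fun k i => by
  fin_cases k; fin_cases i; simpa using h

/-- Solvability of `v 0 * w = u`, when `v l = v 0 * t ^ l`. -/
theorem Spans.inT_single_left (hv : F.Spans fun l : Fin d => v l)
    (ht : ∀ l < d, v l = v 0 * t ^ l) (h₀ : F.IsV (v 0)) : F.InT !![v 0] (F.X g) := by
  refine hv.inT (ev_single h₀) fun k l j => ⟨fun _ => t ^ (l : ℕ) • F.gen g j, fun k' => ?_⟩
  rw [Subsingleton.elim k k', Pi.single_eq_same, ht l l.2]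
  fin_cases k'
  simp [smul_smul]

end elementary

theorem fac_of_gen {w : ι → F.X g} (h₁ : ∀ i, F.e₁ • w i = w i) (h₂ : ∀ k, ∑ i, f k i • w i = 0)
    (H : ∀ j, ∃ i, w i = F.gen g j) : Fac R (F.X f) (F.X g) :=
  fac_of_maps (s := Unit) (fun _ => w) (fun _ => h₁) (fun _ => h₂) _ _ span_gen
    fun j => (H j).elim fun i hi => ⟨(), i, hi⟩

theorem fac_M₀ : Fac R (F.X (M₀ R)) (F.X g) :=
  fac_of_maps (fun a _ => F.gen g a) (fun a _ => e₁_gen a) (fun _ k => k.elim0) _ _ span_gen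
    fun j => ⟨j, 0, rfl⟩

/-- The conditions on a single presentation in a chain. -/
structure Node (F : Frame K R) (I : Ideal R) (f : Matrix κ ι R) : Prop where
  ev : F.EV f
  min : F.Min I f
  indec : IsIndecModule R (F.X f)

theorem Node.proj {I : Ideal R} (h : IsIndecModule R (F.X (M₀ R))) : F.Node I (M₀ R) :=
  ⟨ev_M₀, fun _ _ => isEmptyElim, h⟩

/-- Assemble a chain with three modules. -/
theorem chain_two {b₁ b₂ c₁ c₂ : ℕ} {f₁ : Matrix (Fin b₁) (Fin c₁) R}
    {f₂ : Matrix (Fin b₂) (Fin c₂) R} (hJ : Nak F.J)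
    (d₀ : b₁ * 1 = 0 * c₁ + 1) (d₁ : b₂ * c₁ = b₁ * c₂ + 1) (d₂ : 1 * c₂ = b₂ * 0 + 1)
    (N₁ : F.Node F.J f₁) (N₂ : F.Node F.J f₂) (s₀ : F.InT f₁ (F.X (M₀ R)))
    (s₁ : F.InT f₂ (F.X f₁)) (s₂ : F.InT (M₁ R) (F.X f₂))
    (n₀ : ¬ F.InT f₂ (F.X (M₀ R))) (n₁ : ¬ F.InT (M₁ R) (F.X f₁))
    (q₁ : Fac R (F.X f₁) (F.X f₂)) : F.HasChain 2 := by
  let b : ℕ → ℕ | 0 => 0 | 1 => b₁ | 2 => b₂ | _ + 3 => 1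
  let c : ℕ → ℕ | 0 => 1 | 1 => c₁ | 2 => c₂ | _ + 3 => 0
  let f : ∀ i, Matrix (Fin (b i)) (Fin (c i)) R
    | 0 => M₀ R | 1 => f₁ | 2 => f₂ | _ + 3 => M₁ R
  have q₀ : Fac R (F.X (M₀ R)) (F.X f₁) := fac_M₀
  have ev : F.EV (M₁ R) := ev_M₁
  obtain ⟨e₀, m₀, h₀⟩ := Node.proj (I := F.J) (isIndecModule_X_unique hJ (ev_M₀ (F := F)))
  obtain ⟨⟨e₁, m₁, h₁⟩, ⟨e₂, m₂, h₂⟩⟩ := And.intro N₁ N₂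
  refine ⟨b, c, f, rfl, rfl, rfl, rfl, ?_, ?_, ?_, ?_, ?_, ⟨_, hJ, ?_⟩, ?_⟩ <;>
    rintro (_ | _ | _ | _ | i) hi <;> first | assumption | omega

/-- Assemble a chain with five modules. -/
theorem chain_four {b₁ b₂ b₃ b₄ c₁ c₂ c₃ c₄ : ℕ} {f₁ : Matrix (Fin b₁) (Fin c₁) R}
    {f₂ : Matrix (Fin b₂) (Fin c₂) R} {f₃ : Matrix (Fin b₃) (Fin c₃) R}
    {f₄ : Matrix (Fin b₄) (Fin c₄) R} (hJ : Nak F.J)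
    (d₀ : b₁ * 1 = 0 * c₁ + 1) (d₁ : b₂ * c₁ = b₁ * c₂ + 1) (d₂ : b₃ * c₂ = b₂ * c₃ + 1)
    (d₃ : b₄ * c₃ = b₃ * c₄ + 1) (d₄ : 1 * c₄ = b₄ * 0 + 1)
    (N₁ : F.Node F.J f₁) (N₂ : F.Node F.J f₂) (N₃ : F.Node F.J f₃) (N₄ : F.Node F.J f₄)
    (s₀ : F.InT f₁ (F.X (M₀ R))) (s₁ : F.InT f₂ (F.X f₁))
    (s₂ : F.InT f₃ (F.X f₂)) (s₃ : F.InT f₄ (F.X f₃)) (s₄ : F.InT (M₁ R) (F.X f₄))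
    (n₀ : ¬ F.InT f₂ (F.X (M₀ R))) (n₁ : ¬ F.InT f₃ (F.X f₁)) (n₂ : ¬ F.InT f₄ (F.X f₂))
    (n₃ : ¬ F.InT (M₁ R) (F.X f₃)) (q₁ : Fac R (F.X f₁) (F.X f₂))
    (q₂ : Fac R (F.X f₂) (F.X f₃)) (q₃ : Fac R (F.X f₃) (F.X f₄)) : F.HasChain 4 := by
  let b : ℕ → ℕ | 0 => 0 | 1 => b₁ | 2 => b₂ | 3 => b₃ | 4 => b₄ | _ + 5 => 1
  let c : ℕ → ℕ | 0 => 1 | 1 => c₁ | 2 => c₂ | 3 => c₃ | 4 => c₄ | _ + 5 => 0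
  let f : ∀ i, Matrix (Fin (b i)) (Fin (c i)) R
    | 0 => M₀ R | 1 => f₁ | 2 => f₂ | 3 => f₃ | 4 => f₄ | _ + 5 => M₁ R
  have q₀ : Fac R (F.X (M₀ R)) (F.X f₁) := fac_M₀
  have ev : F.EV (M₁ R) := ev_M₁
  obtain ⟨e₀, m₀, h₀⟩ := Node.proj (I := F.J) (isIndecModule_X_unique hJ (ev_M₀ (F := F)))
  obtain ⟨⟨e₁, m₁, h₁⟩, ⟨e₂, m₂, h₂⟩⟩ := And.intro N₁ N₂
  obtain ⟨⟨e₃, m₃, h₃⟩, ⟨e₄, m₄, h₄⟩⟩ := And.intro N₃ N₄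
  refine ⟨b, c, f, rfl, rfl, rfl, rfl, ?_, ?_, ?_, ?_, ?_, ⟨_, hJ, ?_⟩, ?_⟩ <;>
    rintro (_ | _ | _ | _ | _ | _ | i) hi <;> first | assumption | omega

theorem hasChain0 (hJ : Nak F.J) (hV : ∀ x, F.IsV x → x = 0) : F.HasChain 0 := by
  let b : ℕ → ℕ | 0 => 0 | _ + 1 => 1
  let c : ℕ → ℕ | 0 => 1 | _ + 1 => 0
  let f : ∀ i, Matrix (Fin (b i)) (Fin (c i)) R | 0 => M₀ R | _ + 1 => M₁ R
  have ev : F.EV (M₁ R) := ev_M₁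
  obtain ⟨e₀, m₀, h₀⟩ := Node.proj (I := F.J) (isIndecModule_X_unique hJ (ev_M₀ (F := F)))
  have s₀ : F.InT (M₁ R) (F.X (M₀ R)) :=
    InT.of_e₂ (Spans.e₂_smul (d := 0) (v := fun l => l.elim0)
      ⟨fun l => l.elim0, fun x hx => ⟨fun l => l.elim0, fun l => l.elim0, by simpa using hV x hx⟩⟩
      fun l => l.elim0)
  refine ⟨b, c, f, rfl, rfl, rfl, rfl, ?_, ?_, ?_, ?_, ?_, ⟨_, hJ, ?_⟩, ?_⟩ <;>
    rintro (_ | _ | i) hi <;> first | assumption | omega | rfl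

/-- `v` generates `e₂Re₁` both as a left and as a right module. -/
structure Cyclic (F : Frame K R) (v : R) : Prop where
  isV : F.IsV v
  left : ∀ x, F.IsV x → ∃ a, x = a * v
  right : ∀ x, F.IsV x → ∃ a, x = v * a

theorem isV_corner (r : R) : F.IsV (F.e₂ * r * F.e₁) :=
  ⟨by simp only [← mul_assoc, F.mul₂₂], by rw [mul_assoc, F.mul₁₁]⟩

theorem e₂_smul_sum_gen (r : ι → R) :
    F.e₂ • ∑ j, r j • F.gen f j = ∑ j, (F.e₂ * r j * F.e₁) • F.gen f j := by
  rw [Finset.smul_sum]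
  exact Finset.sum_congr rfl fun j _ => by rw [mul_smul, e₁_gen, mul_smul]

theorem Cyclic.inT {x : R} (hx : F.Cyclic x) : F.InT !![x] (F.X g) := by
  refine InT.of_exists (ev_single hx.isV) fun u hu => ?_
  obtain ⟨r, hr⟩ := exists_gen (u 0)
  choose a ha using fun j => hx.right _ (F.isV_corner (r j))
  refine ⟨fun _ => ∑ j, a j • F.gen g j, fun k => ?_⟩
  rw [Fin.fin_one_eq_zero k, ← hu, hr, e₂_smul_sum_gen]
  simp [Finset.smul_sum, smul_smul, ha]

theorem Cyclic.e₂_smul {x : R} (hx : F.Cyclic x) (y : F.X !![x]) : F.e₂ • y = 0 := by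
  obtain ⟨r, rfl⟩ := exists_gen y
  rw [e₂_smul_sum_gen]
  refine Finset.sum_eq_zero fun j _ => ?_
  obtain ⟨a, ha⟩ := hx.left _ (F.isV_corner (r j))
  have := row_gen (F := F) (f := !![x]) 0
  rw [ha, mul_smul, Fin.fin_one_eq_zero j]
  have h : x • F.gen !![x] 0 = 0 := by simpa using this
  rw [h, smul_zero]

theorem exists_chain1 {I : Ideal R} {v : R} (hI : Nak I) (hmin : F.Min I !![v])
    (h₀ : IsIndecModule R (F.X (M₀ R))) (h₁ : IsIndecModule R (F.X !![v]))
    (hne : v ≠ 0) (hv : F.Cyclic v) :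
    ∃ (b c : ℕ → ℕ) (f : ∀ i, Matrix (Fin (b i)) (Fin (c i)) R), F.Chain 1 b c f ∧
      ∀ (N : Type) [AddCommGroup N] [Module R N], Nonempty (F.X (M₀ R) ≃ₗ[R] N) ∨
        Nonempty (F.X !![v] ≃ₗ[R] N) → ∃ i ≤ 1, Nonempty (F.X (f i) ≃ₗ[R] N) := by
  let b : ℕ → ℕ | 0 => 0 | _ + 1 => 1
  let c : ℕ → ℕ | 0 => 1 | 1 => 1 | _ + 2 => 0
  let f : ∀ i, Matrix (Fin (b i)) (Fin (c i)) R | 0 => M₀ R | 1 => !![v] | _ + 2 => M₁ R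
  have q₀ : Fac R (F.X (M₀ R)) (F.X !![v]) := fac_M₀
  have ev : F.EV (M₁ R) := ev_M₁
  have e₁ : F.EV !![v] := ev_single hv.isV
  obtain ⟨e₀, m₀, -⟩ := Node.proj (I := I) h₀
  have s₀ : F.InT !![v] (F.X (M₀ R)) := hv.inT
  have s₁ : F.InT (M₁ R) (F.X !![v]) := InT.of_e₂ hv.e₂_smul
  have n₀ : ¬ F.InT (M₁ R) (F.X (M₀ R)) :=
    not_inT_isEmpty hv.isV (y := F.gen (M₀ R) 0) fun h => hne <| by
      obtain ⟨c, hc⟩ := (sum_gen_eq_zero ev_M₀ (x := fun _ => v)).1 (by simpa using h)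
      rw [← hv.isV.2]
      simpa using hc 0
  refine ⟨b, c, f, ⟨rfl, rfl, rfl, rfl, ?_, ?_, ?_, ?_, ?_, ⟨I, hI, ?_⟩, ?_⟩,
    fun N _ _ h => h.elim (fun h => ⟨0, zero_le_one, h⟩) fun h => ⟨1, le_rfl, h⟩⟩ <;>
    rintro (_ | _ | _ | i) hi <;> first | assumption | omega | rfl

theorem LData.hasChain1 (h : F.LData v 1) (hJ : Nak F.J) (hv : F.Cyclic (v 0)) :
    F.HasChain 1 := by
  obtain ⟨ψ, θ, hθ, hl, hr⟩ := h
  have hmin : F.Min F.J !![v 0] := Min.of_ε₂ fun c hc k => by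
    have := congrArg (ψ 0) (hc 0)
    fin_cases k
    simpa [hl] using this
  obtain ⟨b, c, f, H, -⟩ := exists_chain1 hJ hmin (isIndecModule_X_unique hJ ev_M₀)
    (isIndecModule_X_unique hJ (ev_single hv.isV))
    (fun h0 => by simpa [h0] using hl 0 one_pos 0 one_pos 1) hv
  exact ⟨b, c, f, H⟩

theorem row_single {x : R} (j : Fin 1) : x • F.gen !![x] j = 0 := by
  have := row_gen (F := F) (f := !![x]) 0
  rw [Fin.fin_one_eq_zero j]
  simpa using this

theorem exists_coeff_single {x y : R} (hx : F.IsV x) (hy : F.IsV y)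
    (h : y • F.gen !![x] 0 = 0) : ∃ c, y = c * x := by
  obtain ⟨c, hc⟩ := (sum_gen_eq_zero (ev_single hx) (x := fun _ => y)).1 (by simpa using h)
  exact ⟨c 0, by simpa [hy.2] using hc 0⟩

theorem exists_coeff_M₀ {y : R} (h : y • F.gen (M₀ R) 0 = 0) : y * F.e₁ = 0 := by
  obtain ⟨c, hc⟩ := (sum_gen_eq_zero ev_M₀ (x := fun _ => y)).1 (by simpa using h)
  simpa using hc 0

/-- The chain of length two attached to `e₂Re₁` generated by `v 0` and `v 1 = v 0 * t`. -/
theorem LData.hasChain2 (h : F.LData v 2) (hJ : Nak F.J) (hv : F.Spans fun l : Fin 2 => v l)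
    (ht : v 1 = v 0 * t) {z₀ z₁ : R} (hz₁ : z₁ ∈ Subring.center R)
    (hz : v 1 * t = z₀ * v 0 + z₁ * v 1) : F.HasChain 2 := by
  obtain ⟨ψ, θ, hθ, hl, hr⟩ := h
  have hV : ∀ l < 2, F.IsV (v l) := fun l hl => hv.isV ⟨l, hl⟩
  have hp : ∀ l < 2, v l = v 0 * t ^ l := by
    intro l hl
    interval_cases l
    exacts [by simp, by simp [ht]]
  have e₁ : F.EV !![v 0] := ev_single (hV 0 (by norm_num))
  have e₂ : F.EV !![v 0; v 1] := fun k i => by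
    fin_cases i; fin_cases k
    exacts [hV 0 (by norm_num), hV 1 (by norm_num)]
  have hs {κ' ι' : Type} [Fintype κ'] [Fintype ι'] [DecidableEq ι'] {g : Matrix κ' ι' R} :
      F.InT !![v 0] (F.X g) := hv.inT_single_left hp (hV 0 (by norm_num))
  have hr₂ : ∀ l : Fin 2, v l • F.gen !![v 0; v 1] 0 = 0 := fun l => by
    have := row_gen (F := F) (f := !![v 0; v 1]) l
    fin_cases l <;> simpa using this
  have h₂ : ∀ x : F.X !![v 0; v 1], F.e₂ • x = 0 := hv.e₂_smul fun l j => by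
    rw [Fin.fin_one_eq_zero j, hr₂]
  have hψ : ∀ l < 2, ∀ k < 2, ψ l (v k) = if k = l then 1 else 0 := fun l hl' k hk => by
    simpa using hl l hl' k hk 1
  refine chain_two hJ rfl rfl rfl
    ⟨e₁, .of_ε₂ fun c hc k => ?_, isIndecModule_X_unique hJ e₁⟩
    ⟨e₂, .of_ε₂ fun c hc k => ?_, isIndecModule_X_unique hJ e₂⟩
    hs (hv.inT e₂ fun k l j => ?_) (.of_e₂ h₂) ?_ ?_
    (fac_of_gen e₁_gen (fun k => ?_) fun j => ⟨j, rfl⟩)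
  · have := congrArg (ψ 0) (hc 0)
    fin_cases k
    simpa [hl] using this
  · have h0 := hc 0
    simp only [Fin.sum_univ_two] at h0
    fin_cases k
    · simpa [hl] using congrArg (ψ 0) h0
    · simpa [hl] using congrArg (ψ 1) h0
  · rw [Fin.fin_one_eq_zero j]
    have h0 : v 0 • F.gen !![v 0] 0 = 0 := row_single 0
    have h1 : v 1 • t • F.gen !![v 0] 0 = z₁ • v 1 • F.gen !![v 0] 0 := by
      rw [smul_smul, hz, add_smul, mul_smul, h0, smul_zero, zero_add, mul_smul]
    have hc : v 1 • z₁ • F.gen !![v 0] 0 = z₁ • v 1 • F.gen !![v 0] 0 := by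
      rw [smul_smul, Subring.mem_center_iff.1 hz₁, mul_smul]
    have hc' : v 0 • z₁ • F.gen !![v 0] 0 = 0 := by
      rw [smul_smul, Subring.mem_center_iff.1 hz₁, mul_smul, h0, smul_zero]
    have h2 : v 0 • t • F.gen !![v 0] 0 = v 1 • F.gen !![v 0] 0 := by rw [smul_smul, ht]
    let x := F.gen !![v 0] 0
    refine ⟨fun _ => (![0, ![t • x - z₁ • x, x]] : Fin 2 → Fin 2 → F.X !![v 0]) l k, fun k' => ?_⟩
    fin_cases l <;> fin_cases k <;> fin_cases k' <;> simp [x, smul_sub, h0, h1, h2, hc, hc']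
  · intro H
    obtain ⟨w, hw₁, hw₂⟩ := H (fun k => if k = 0 then 0 else v 0 • F.gen _ 0) fun k => by
      split_ifs
      exacts [smul_zero _, e₂_smul_v (hV 0 (by norm_num)) _]
    obtain ⟨r, hr'⟩ := exists_gen (w 0)
    have h1 := hw₂ 1
    simp [hr', smul_smul] at h1
    rw [eq_comm, ← sub_eq_zero, ← sub_smul] at h1
    have := congrArg (ψ 0) (exists_coeff_M₀ h1)
    rw [sub_mul, (hV 0 (by norm_num)).2, mul_assoc, map_sub, hr 0 (by norm_num) 1 (by norm_num),
      hψ 0 (by norm_num) 0 (by norm_num)] at this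
    simp at this
  · refine not_inT_isEmpty (hV 1 (by norm_num)) (y := F.gen _ 0) fun h => ?_
    obtain ⟨c, hc⟩ := exists_coeff_single (hV 0 (by norm_num)) (hV 1 (by norm_num)) h
    have := congrArg (ψ 1) hc
    simp [hl, hψ] at this
  · simpa using hr₂ 0

/-- The chain of length four attached to `e₂Re₁` generated by `v l = v 0 * t ^ l`, `l ≤ 2`. -/
theorem LData.hasChain4 (h : F.LData v 3) (hJ : Nak F.J) (hv : F.Spans fun l : Fin 3 => v l)
    (h01 : v 0 * t = v 1) (h12 : v 1 * t = v 2) (h23 : v 2 * t = 0) : F.HasChain 4 := by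
  obtain ⟨ψ, θ, hθ, hl, hr⟩ := h
  have V0 : F.IsV (v 0) := hv.isV 0
  have V1 : F.IsV (v 1) := hv.isV 1
  have V2 : F.IsV (v 2) := hv.isV 2
  have hp : ∀ l < 3, v l = v 0 * t ^ l := by
    intro l hl
    interval_cases l
    exacts [by simp, by simp [h01], by rw [pow_two, ← mul_assoc, h01, h12]]
  have s01 : ∀ {N : Type} [AddCommGroup N] [Module R N] (x : N), v 0 • t • x = v 1 • x :=
    fun x => by rw [smul_smul, h01]
  have s12 : ∀ {N : Type} [AddCommGroup N] [Module R N] (x : N), v 1 • t • x = v 2 • x :=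
    fun x => by rw [smul_smul, h12]
  have s23 : ∀ {N : Type} [AddCommGroup N] [Module R N] (x : N), v 2 • t • x = 0 :=
    fun x => by rw [smul_smul, h23, zero_smul]
  let f₂ : Matrix (Fin 3) (Fin 2) R := !![v 0, 0; 0, v 0; v 1, v 2]
  let f₃ : Matrix (Fin 2) (Fin 1) R := !![v 0; v 1]
  let f₄ : Matrix (Fin 3) (Fin 1) R := !![v 0; v 1; v 2]
  have e₁ : F.EV !![v 0] := ev_single V0
  have e₂ : F.EV f₂ := fun k i => by
    fin_cases i <;> fin_cases k
    exacts [V0, isV_zero, V1, isV_zero, V0, V2]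
  have e₃ : F.EV f₃ := fun k i => by
    fin_cases i; fin_cases k
    exacts [V0, V1]
  have e₄ : F.EV f₄ := fun k i => by
    fin_cases i; fin_cases k
    exacts [V0, V1, V2]
  have r₁ : v 0 • F.gen !![v 0] 0 = 0 := row_single 0
  have r₂0 : v 0 • F.gen f₂ 0 = 0 := by
    simpa [f₂, Fin.sum_univ_two] using row_gen (F := F) (f := f₂) 0
  have r₂1 : v 0 • F.gen f₂ 1 = 0 := by
    simpa [f₂, Fin.sum_univ_two] using row_gen (F := F) (f := f₂) 1
  have r₂2 : v 2 • F.gen f₂ 1 = - v 1 • F.gen f₂ 0 := by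
    have := row_gen (F := F) (f := f₂) 2
    simp only [f₂, Fin.sum_univ_two] at this
    rw [neg_smul]
    exact eq_neg_of_add_eq_zero_right this
  have r₃0 : v 0 • F.gen f₃ 0 = 0 := by simpa [f₃] using row_gen (F := F) (f := f₃) 0
  have r₃1 : v 1 • F.gen f₃ 0 = 0 := by simpa [f₃] using row_gen (F := F) (f := f₃) 1
  have r₄0 : v 0 • F.gen f₄ 0 = 0 := by simpa [f₄] using row_gen (F := F) (f := f₄) 0
  have r₄1 : v 1 • F.gen f₄ 0 = 0 := by simpa [f₄] using row_gen (F := F) (f := f₄) 1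
  have r₄2 : v 2 • F.gen f₄ 0 = 0 := by simpa [f₄] using row_gen (F := F) (f := f₄) 2
  have hs {κ' ι' : Type} [Fintype κ'] [Fintype ι'] [DecidableEq ι'] {g : Matrix κ' ι' R} :
      F.InT !![v 0] (F.X g) := hv.inT_single_left hp V0
  have h₄ : ∀ x : F.X f₄, F.e₂ • x = 0 := hv.e₂_smul fun l j => by
    rw [Fin.fin_one_eq_zero j]
    fin_cases l
    exacts [r₄0, r₄1, r₄2]
  have hψ : ∀ l < 3, ∀ k < 3, ψ l (v k) = if k = l then 1 else 0 := fun l hl' k hk => by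
    simpa using hl l hl' k hk 1
  have T2 {κ' ι' : Type} [Fintype κ'] [Fintype ι'] [DecidableEq ι'] {g : Matrix κ' ι' R}
      (h0 : ∀ j, v 0 • F.gen g j = 0) : F.InT f₂ (F.X g) := by
    refine hv.inT e₂ fun k l j => ?_
    let x := F.gen g j
    refine ⟨(![![0, ![t • x, -x], ![t • t • x, 0]], ![0, ![0, t • x], ![0, t • t • x]],
      ![0, ![x, 0], ![0, x]]] : Fin 3 → Fin 3 → Fin 2 → F.X g) k l, fun k' => ?_⟩
    fin_cases k <;> fin_cases l <;> fin_cases k' <;>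
      simp [x, f₂, Fin.sum_univ_two, s01, s12, s23, h0]
  have T3 : F.InT f₃ (F.X f₂) := by
    refine hv.inT e₃ fun k l j => ?_
    let x := F.gen f₂
    refine ⟨fun _ => (![![0, ![-(t • t • x 1), t • x 1 + x 0], fun j => t • t • x j],
      ![0, x, ![t • x 0 + t • t • x 1, -x 0]]] : Fin 2 → Fin 3 → Fin 2 → F.X f₂) k l j,
      fun k' => ?_⟩
    fin_cases k <;> fin_cases l <;> fin_cases j <;> fin_cases k' <;>
      simp [x, f₃, s01, s12, s23, r₂0, r₂1, r₂2]
  have T4 : F.InT f₄ (F.X f₃) := by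
    refine hv.inT e₄ fun k l j => ?_
    let x := F.gen f₃ 0
    refine ⟨fun _ => (![0, 0, ![t • t • x, t • x, x]] : Fin 3 → Fin 3 → F.X f₃) l k, fun k' => ?_⟩
    rw [Fin.fin_one_eq_zero j]
    fin_cases l <;> fin_cases k <;> fin_cases k' <;> simp [x, f₄, s01, s12, s23, r₃0, r₃1]
  have q₁ : Fac R (F.X !![v 0]) (F.X f₂) :=
    fac_of_maps (fun a _ => F.gen f₂ a) (fun a _ => e₁_gen a)
      (fun a k => by fin_cases a <;> simp [r₂0, r₂1]) _ _ span_gen fun j => ⟨j, 0, rfl⟩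
  have q₂ : Fac R (F.X f₂) (F.X f₃) :=
    fac_of_gen (w := ![F.gen f₃ 0, 0]) (fun i => by fin_cases i <;> simp [e₁_gen])
      (fun k => by fin_cases k <;> simp [f₂, Fin.sum_univ_two, r₃0, r₃1]) fun j => ⟨0, by
        rw [Fin.fin_one_eq_zero j]; rfl⟩
  have q₃ : Fac R (F.X f₃) (F.X f₄) :=
    fac_of_gen e₁_gen (fun k => by fin_cases k <;> simp [f₃, r₄0, r₄1]) fun j => ⟨j, rfl⟩
  have S1 : F.InT f₂ (F.X !![v 0]) := T2 fun j => row_single j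
  refine chain_four hJ rfl rfl rfl rfl rfl
    ⟨e₁, .of_ε₂ fun c hc k => ?_, isIndecModule_X_unique hJ e₁⟩
    ⟨e₂, .of_ε₂ fun c hc k => ?_, isIndecModule_X_of_det hJ e₂ fun a d had => ?_⟩
    ⟨e₃, .of_ε₂ fun c hc k => ?_, isIndecModule_X_unique hJ e₃⟩
    ⟨e₄, .of_ε₂ fun c hc k => ?_, isIndecModule_X_unique hJ e₄⟩ hs S1 T3 T4 (.of_e₂ h₄)
    ?_ ?_ ?_ ?_ q₁ q₂ q₃
  · have := congrArg (ψ 0) (hc 0)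
    fin_cases k
    simpa [hl] using this
  · have h0 := hc 0
    have h1 := hc 1
    simp only [Fin.sum_univ_three] at h0 h1
    fin_cases k
    · simpa [hl, f₂] using congrArg (ψ 0) h0
    · simpa [hl, f₂] using congrArg (ψ 0) h1
    · simpa [hl, f₂] using congrArg (ψ 1) h0
  · have had' : ∀ k j l, ψ l ((f₂ * a) k j) = ψ l ((d * f₂) k j) := fun k j l => by rw [had]
    simp only [Matrix.mul_apply, Fin.sum_univ_two, Fin.sum_univ_three] at had'
    have E1 : F.ε₁ (a 0 1) = 0 := by simpa [f₂, hl, hr, hθ] using had' 2 1 1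
    have E2 : θ 1 (a 0 1) = 0 := by simpa [f₂, hl, hr, hθ] using had' 0 1 1
    have E3 : F.ε₁ (a 0 0) = F.ε₂ (d 2 2) := by simpa [f₂, hl, hr, hθ] using had' 2 0 1
    have E4 : F.ε₁ (a 1 1) = F.ε₂ (d 2 2) := by simpa [f₂, hl, hr, hθ, E2] using had' 2 1 2
    exact ⟨F.ε₂ (d 2 2), 2, by simp [Matrix.det_fin_two, E1, E3, E4, pow_succ],
      by simp [Matrix.det_fin_two, E1, E3, E4, pow_succ]⟩
  · have h0 := hc 0
    simp only [Fin.sum_univ_two] at h0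
    fin_cases k
    · simpa [hl, f₃] using congrArg (ψ 0) h0
    · simpa [hl, f₃] using congrArg (ψ 1) h0
  · have h0 := hc 0
    simp only [Fin.sum_univ_three] at h0
    fin_cases k
    · simpa [hl, f₄] using congrArg (ψ 0) h0
    · simpa [hl, f₄] using congrArg (ψ 1) h0
    · simpa [hl, f₄] using congrArg (ψ 2) h0
  · intro H
    obtain ⟨w, hw₁, hw₂⟩ := H (![0, 0, v 0 • F.gen _ 0]) fun k => by
      fin_cases k <;> simp [e₂_smul_v V0]
    obtain ⟨r, hr'⟩ := exists_gen (w 0)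
    obtain ⟨s, hs'⟩ := exists_gen (w 1)
    have h1 := hw₂ 2
    simp [hr', hs', smul_smul, f₂, Fin.sum_univ_two] at h1
    rw [← add_smul, eq_comm, ← sub_eq_zero, ← sub_smul] at h1
    have := congrArg (ψ 0) (exists_coeff_M₀ h1)
    rw [sub_mul, V0.2, add_mul, mul_assoc, mul_assoc] at this
    simp [hr, hψ] at this
  · intro H
    obtain ⟨w, hw₁, hw₂⟩ := H (![v 1 • F.gen _ 0, 0]) fun k => by
      fin_cases k <;> simp [e₂_smul_v V1]
    obtain ⟨r, hr'⟩ := exists_gen (w 0)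
    have h1 := hw₂ 0
    have h2 := hw₂ 1
    simp [hr', smul_smul, f₃] at h1 h2
    rw [eq_comm, ← sub_eq_zero, ← sub_smul] at h1
    obtain ⟨c, hc⟩ := (sum_gen_eq_zero e₁ (x := fun _ => v 0 * r 0 - v 1)).1 (by simpa using h1)
    obtain ⟨c', hc'⟩ := (sum_gen_eq_zero e₁ (x := fun _ => v 1 * r 0)).1 (by simpa using h2.symm)
    have h3 := congrArg (ψ 1) (hc 0)
    have h4 := congrArg (ψ 2) (hc' 0)
    rw [sub_mul, V1.2, mul_assoc] at h3
    rw [mul_assoc] at h4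
    simp [hr, hl, hψ] at h3 h4
    simp [h4] at h3
  · intro H
    obtain ⟨w, hw₁, hw₂⟩ := H (![0, 0, v 1 • F.gen _ 1]) fun k => by
      fin_cases k <;> simp [e₂_smul_v V1]
    obtain ⟨r, hr'⟩ := exists_gen (w 0)
    have h1 := hw₂ 2
    simp [hr', smul_smul, f₄, Fin.sum_univ_two] at h1
    obtain ⟨c, hc⟩ := (sum_gen_eq_zero e₂ (x := ![v 2 * r 0, v 2 * r 1 - v 1])).1 (by
      simp [Fin.sum_univ_two, sub_smul, h1])
    have h3 := congrArg (ψ 1) (hc 1)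
    simp only [Fin.sum_univ_three, Matrix.cons_val_one, Matrix.cons_val_zero, sub_mul, V1.2,
      mul_assoc] at h3
    simp [hr, hl, hψ, f₂] at h3
  · refine not_inT_isEmpty V2 (y := F.gen _ 0) fun h => ?_
    obtain ⟨c, hc⟩ := (sum_gen_eq_zero e₃ (x := fun _ => v 2)).1 (by simpa using h)
    have := congrArg (ψ 2) (hc 0)
    simp [hl, hψ, V2.2, Fin.sum_univ_two, f₃] at this

/-- The chain of length two attached to `e₂Re₁` generated by `v 0` and `v 1 = t * v 0`. -/
theorem RData.hasChain2 (h : F.RData v 2) (hJ : Nak F.J) (hv : F.Spans fun l : Fin 2 => v l)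
    (ht : v 1 = t * v 0) {z₀ z₁ : R} (hz₀ : z₀ ∈ Subring.center R) (hz₁ : z₁ ∈ Subring.center R)
    (hz : t * v 1 = z₀ * v 0 + z₁ * v 1) : F.HasChain 2 := by
  obtain ⟨ψ, θ, hθ, hr, hl⟩ := h
  have V0 : F.IsV (v 0) := hv.isV 0
  have V1 : F.IsV (v 1) := hv.isV 1
  let f₁ : Matrix (Fin 1) (Fin 2) R := !![v 0, v 1]
  have e₁ : F.EV f₁ := fun k i => by
    fin_cases i <;> fin_cases k
    exacts [V0, V1]
  have e₂ : F.EV !![v 0] := ev_single V0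
  have hψ : ∀ l < 2, ∀ k < 2, ψ l (v k) = if k = l then 1 else 0 := fun l hl' k hk => by
    simpa using hr l hl' k hk 1
  have r₁ : v 1 • F.gen f₁ 1 = - v 0 • F.gen f₁ 0 := by
    have := row_gen (F := F) (f := f₁) 0
    simp only [f₁, Fin.sum_univ_two] at this
    rw [neg_smul]
    exact eq_neg_of_add_eq_zero_right this
  have hc {z : R} (hz : z ∈ Subring.center R) {N : Type} [AddCommGroup N] [Module R N] (x : N) :
      v 0 • z • x = z • v 0 • x := by
    rw [smul_smul, Subring.mem_center_iff.1 hz, mul_smul]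
  have r₁' : v 1 • F.gen f₁ 0 = v 0 • (z₁ • F.gen f₁ 0 - z₀ • F.gen f₁ 1) := by
    have h1 := congrArg (t • ·) r₁
    simp only [neg_smul, smul_neg, smul_smul, ← ht, hz, add_smul] at h1
    rw [mul_smul, mul_smul, r₁, neg_smul, smul_neg] at h1
    rw [smul_sub, hc hz₀, hc hz₁]
    rw [← neg_eq_iff_eq_neg] at h1
    rw [← h1]
    abel
  have r₂ : v 0 • F.gen !![v 0] 0 = 0 := row_single 0
  have r₂' : v 1 • F.gen !![v 0] 0 = 0 := by rw [ht, mul_smul, r₂, smul_zero]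
  have h₂ : ∀ x : F.X !![v 0], F.e₂ • x = 0 := hv.e₂_smul fun l j => by
    rw [Fin.fin_one_eq_zero j]
    fin_cases l
    exacts [r₂, r₂']
  have T1 {κ' ι' : Type} [Fintype κ'] [Fintype ι'] [DecidableEq ι'] {g : Matrix κ' ι' R} :
      F.InT f₁ (F.X g) := hv.inT e₁ fun k l j => by
    refine ⟨Pi.single l (F.gen g j), fun k' => ?_⟩
    fin_cases k
    fin_cases k'
    fin_cases l <;> simp [f₁, Fin.sum_univ_two]
  have T2 : F.InT !![v 0] (F.X f₁) := hv.inT e₂ fun k l j => by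
    refine ⟨fun _ => (![F.gen f₁, ![z₁ • F.gen f₁ 0 - z₀ • F.gen f₁ 1, -F.gen f₁ 0]] :
      Fin 2 → Fin 2 → F.X f₁) l j, fun k' => ?_⟩
    fin_cases k
    fin_cases k'
    fin_cases l <;> fin_cases j <;> simp [r₁, r₁']
  have q₁ : Fac R (F.X f₁) (F.X !![v 0]) :=
    fac_of_gen (w := fun _ => F.gen _ 0) (fun _ => e₁_gen _)
      (fun k => by
        rw [Fin.fin_one_eq_zero k]
        simp [f₁, Fin.sum_univ_two, r₂, r₂']) fun j => ⟨0, by rw [Fin.fin_one_eq_zero j]⟩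
  refine chain_two hJ rfl rfl rfl
    ⟨e₁, .of_ε₂ fun c hc k => ?_, isIndecModule_X_of_det hJ e₁ fun a d had => ?_⟩
    ⟨e₂, .of_ε₂ fun c hc k => ?_, isIndecModule_X_unique hJ e₂⟩ T1 T2 (.of_e₂ h₂) ?_ ?_ q₁
  · have := congrArg (ψ 0) (hc 0)
    fin_cases k
    simpa [hl, hθ, f₁] using this
  · have had' : ∀ j l, ψ l ((f₁ * a) 0 j) = ψ l ((d * f₁) 0 j) := fun j l => by rw [had]
    simp only [Matrix.mul_apply, Fin.sum_univ_two, Fin.sum_univ_one] at had'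
    have E1 : F.ε₁ (a 0 1) = 0 := by simpa [f₁, hl, hr, hθ] using had' 1 0
    have E2 : F.ε₁ (a 0 0) = F.ε₂ (d 0 0) := by simpa [f₁, hl, hr, hθ] using had' 0 0
    have E3 : F.ε₁ (a 1 1) = F.ε₂ (d 0 0) := by simpa [f₁, hl, hr, hθ] using had' 1 1
    exact ⟨F.ε₂ (d 0 0), 2, by simp [Matrix.det_fin_two, E1, E2, E3, pow_succ],
      by simp [Matrix.det_fin_two, E1, E2, E3, pow_succ]⟩
  · have := congrArg (ψ 0) (hc 0)
    fin_cases k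
    simpa [hl, hθ] using this
  · intro H
    obtain ⟨w, hw₁, hw₂⟩ := H (fun _ => v 1 • F.gen _ 0) fun k => e₂_smul_v V1 _
    obtain ⟨r, hr'⟩ := exists_gen (w 0)
    have h1 := hw₂ 0
    simp [hr', smul_smul] at h1
    rw [eq_comm, ← sub_eq_zero, ← sub_smul] at h1
    have := congrArg (ψ 1) (exists_coeff_M₀ h1)
    rw [sub_mul, V1.2, mul_assoc] at this
    simp [hr, hψ] at this
  · refine not_inT_isEmpty V0 (y := F.gen _ 0) fun h => ?_
    obtain ⟨c, hc⟩ := (sum_gen_eq_zero e₁ (x := ![v 0, 0])).1 (by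
      simpa [Fin.sum_univ_two] using h)
    have h0 := congrArg (ψ 0) (hc 0)
    have h1 := congrArg (ψ 1) (hc 1)
    simp [hl, hψ, V0.2, f₁, hθ] at h0 h1
    exact one_ne_zero (h0.trans h1.symm)

/-- The chain of length four attached to `e₂Re₁` generated by `v l = t ^ l * v 0`, `l ≤ 2`. -/
theorem RData.hasChain4 (h : F.RData v 3) (hJ : Nak F.J) (hv : F.Spans fun l : Fin 3 => v l)
    (h01 : t * v 0 = v 1) (h12 : t * v 1 = v 2) (h23 : t * v 2 = 0) : F.HasChain 4 := by
  obtain ⟨ψ, θ, hθ, hr, hl⟩ := h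
  have V0 : F.IsV (v 0) := hv.isV 0
  have V1 : F.IsV (v 1) := hv.isV 1
  have V2 : F.IsV (v 2) := hv.isV 2
  have s01 : ∀ {N : Type} [AddCommGroup N] [Module R N] (x : N), t • v 0 • x = v 1 • x :=
    fun x => by rw [smul_smul, h01]
  have s12 : ∀ {N : Type} [AddCommGroup N] [Module R N] (x : N), t • v 1 • x = v 2 • x :=
    fun x => by rw [smul_smul, h12]
  have s23 : ∀ {N : Type} [AddCommGroup N] [Module R N] (x : N), t • v 2 • x = 0 :=
    fun x => by rw [smul_smul, h23, zero_smul]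
  have hψ : ∀ l < 3, ∀ k < 3, ψ l (v k) = if k = l then 1 else 0 := fun l hl' k hk => by
    simpa using hr l hl' k hk 1
  let f₁ : Matrix (Fin 1) (Fin 3) R := !![v 0, v 1, v 2]
  let f₂ : Matrix (Fin 1) (Fin 2) R := !![v 0, v 1]
  let f₃ : Matrix (Fin 2) (Fin 3) R := !![v 0, 0, v 1; 0, v 0, v 2]
  have e₁ : F.EV f₁ := fun k i => by
    fin_cases k; fin_cases i
    exacts [V0, V1, V2]
  have e₂ : F.EV f₂ := fun k i => by
    fin_cases k; fin_cases i
    exacts [V0, V1]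
  have e₃ : F.EV f₃ := fun k i => by
    fin_cases k <;> fin_cases i
    exacts [V0, isV_zero, V1, isV_zero, V0, V2]
  have e₄ : F.EV !![v 0] := ev_single V0
  have r₁ : v 2 • F.gen f₁ 2 = - v 0 • F.gen f₁ 0 - v 1 • F.gen f₁ 1 := by
    have := row_gen (F := F) (f := f₁) 0
    simp only [f₁, Fin.sum_univ_three, Matrix.cons_val, Matrix.of_apply] at this
    rw [neg_smul, ← sub_eq_zero, ← this]
    simp [f₁]
    abel
  have r₁' : v 2 • F.gen f₁ 1 = - v 1 • F.gen f₁ 0 := by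
    have := congrArg (t • ·) r₁
    simp only [s23, smul_sub, neg_smul, smul_neg, s01, s12] at this
    rw [neg_smul]
    exact (sub_eq_zero.1 this.symm).symm
  have r₁'' : v 2 • F.gen f₁ 0 = 0 := by
    have := congrArg (t • ·) r₁'
    simpa only [s23, neg_smul, smul_neg, s12, eq_comm, neg_eq_zero] using this
  have r₂ : v 1 • F.gen f₂ 1 = - v 0 • F.gen f₂ 0 := by
    have := row_gen (F := F) (f := f₂) 0
    simp only [f₂, Fin.sum_univ_two] at this
    rw [neg_smul]
    exact eq_neg_of_add_eq_zero_right this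
  have r₂' : v 2 • F.gen f₂ 1 = - v 1 • F.gen f₂ 0 := by
    simpa only [s12, neg_smul, smul_neg, s01] using congrArg (t • ·) r₂
  have r₂'' : v 2 • F.gen f₂ 0 = 0 := by
    have := congrArg (t • ·) r₂'
    simpa only [s23, neg_smul, smul_neg, s12, eq_comm, neg_eq_zero] using this
  have r₃ : v 1 • F.gen f₃ 2 = - v 0 • F.gen f₃ 0 := by
    have := row_gen (F := F) (f := f₃) 0
    simp [f₃, Fin.sum_univ_three] at this
    rw [neg_smul]
    exact eq_neg_of_add_eq_zero_right this
  have r₃' : v 2 • F.gen f₃ 2 = - v 0 • F.gen f₃ 1 := by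
    have := row_gen (F := F) (f := f₃) 1
    simp [f₃, Fin.sum_univ_three] at this
    rw [neg_smul]
    exact eq_neg_of_add_eq_zero_right this
  have r₃1 : v 1 • F.gen f₃ 1 = 0 := by
    have := congrArg (t • ·) r₃'
    simpa only [s23, neg_smul, smul_neg, s01, eq_comm, neg_eq_zero] using this
  have r₃21 : v 2 • F.gen f₃ 1 = 0 := by
    simpa only [s12, smul_zero] using congrArg (t • ·) r₃1
  have r₃0 : v 1 • F.gen f₃ 0 = v 0 • F.gen f₃ 1 := by
    have := congrArg (t • ·) r₃
    simp only [s12, neg_smul, smul_neg, s01] at this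
    rw [r₃', neg_smul, neg_inj] at this
    exact this.symm
  have r₃20 : v 2 • F.gen f₃ 0 = 0 := by
    have := congrArg (t • ·) r₃0
    simpa only [s12, s01, r₃1] using this
  have r₄ : v 0 • F.gen !![v 0] 0 = 0 := row_single 0
  have r₄' : v 1 • F.gen !![v 0] 0 = 0 := by rw [← h01, mul_smul, r₄, smul_zero]
  have r₄'' : v 2 • F.gen !![v 0] 0 = 0 := by rw [← h12, mul_smul, r₄', smul_zero]
  have h₄ : ∀ x : F.X !![v 0], F.e₂ • x = 0 := hv.e₂_smul fun l j => by
    rw [Fin.fin_one_eq_zero j]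
    fin_cases l
    exacts [r₄, r₄', r₄'']
  have T1 {κ' ι' : Type} [Fintype κ'] [Fintype ι'] [DecidableEq ι'] {g : Matrix κ' ι' R} :
      F.InT f₁ (F.X g) := hv.inT e₁ fun k l j => by
    refine ⟨Pi.single l (F.gen g j), fun k' => ?_⟩
    fin_cases k
    fin_cases k'
    fin_cases l <;> simp [f₁, Fin.sum_univ_three]
  have T2 : F.InT f₂ (F.X f₁) := hv.inT e₂ fun k l j => by
    let x := F.gen f₁
    refine ⟨(![fun j => ![x j, 0], fun j => ![0, x j], ![0, ![0, -x 0], ![-x 0, -x 1]]] :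
      Fin 3 → Fin 3 → Fin 2 → F.X f₁) l j, fun k' => ?_⟩
    fin_cases k
    fin_cases k'
    fin_cases l
    · simp [x, f₂]
    · simp [x, f₂]
    · fin_cases j <;> simp [x, f₂, r₁, r₁', r₁'', sub_eq_add_neg]
  have T3 : F.InT f₃ (F.X f₂) := hv.inT e₃ fun k l j => by
    let x := F.gen f₂
    refine ⟨(![![fun j => ![x j, 0, 0], ![![0, 0, x 0], ![-x 0, 0, 0]], ![0, ![0, 0, -x 0]]],
      ![fun j => ![0, x j, 0], ![![-x 0, 0, -x 1], ![0, -x 0, 0]], ![0, ![x 0, 0, x 1]]]] :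
      Fin 2 → Fin 3 → Fin 2 → Fin 3 → F.X f₂) k l j, fun k' => ?_⟩
    fin_cases k <;> fin_cases l <;> fin_cases j <;> fin_cases k' <;>
      simp [x, f₃, Fin.sum_univ_three, r₂, r₂', r₂'']
  have T4 : F.InT !![v 0] (F.X f₃) := hv.inT e₄ fun k l j => by
    fin_cases k
    let x := F.gen f₃
    refine ⟨fun _ => (![x, ![x 1, 0, -x 0], ![0, 0, -x 1]] : Fin 3 → Fin 3 → F.X f₃) l j,
      fun k' => ?_⟩
    fin_cases k'
    fin_cases l <;> fin_cases j <;> simp [x, r₃0, r₃1, r₃, r₃20, r₃21, r₃']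
  have q₁ : Fac R (F.X f₁) (F.X f₂) :=
    fac_of_gen (w := ![F.gen f₂ 0, F.gen f₂ 1, 0])
      (fun i => by fin_cases i <;> simp [e₁_gen])
      (fun k => by
        fin_cases k
        simp [f₁, Fin.sum_univ_three, r₂]) fun j => by
        fin_cases j
        exacts [⟨0, rfl⟩, ⟨1, rfl⟩]
  have q₂ : Fac R (F.X f₂) (F.X f₃) :=
    fac_of_maps (s := Bool)
      (fun a => cond a ![F.gen f₃ 0, F.gen f₃ 2] ![F.gen f₃ 1, -F.gen f₃ 0])
      (fun a i => by cases a <;> fin_cases i <;> simp [e₁_gen])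
      (fun a k => by
        fin_cases k
        cases a <;> simp [f₂, Fin.sum_univ_two, r₃, r₃0]) _ _ span_gen fun j => by
        fin_cases j
        exacts [⟨true, 0, rfl⟩, ⟨false, 0, rfl⟩, ⟨true, 1, rfl⟩]
  have q₃ : Fac R (F.X f₃) (F.X !![v 0]) :=
    fac_of_gen (w := fun _ => F.gen _ 0) (fun _ => e₁_gen _)
      (fun k => by fin_cases k <;> simp [f₃, Fin.sum_univ_three, r₄, r₄', r₄''])
      fun j => ⟨0, by rw [Fin.fin_one_eq_zero j]⟩
  refine chain_four hJ rfl rfl rfl rfl rfl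
    ⟨e₁, .of_ε₂ fun c hc k => ?_, isIndecModule_X_of_det hJ e₁ fun a d had => ?_⟩
    ⟨e₂, .of_ε₂ fun c hc k => ?_, isIndecModule_X_of_det hJ e₂ fun a d had => ?_⟩
    ⟨e₃, .of_ε₂ fun c hc k => ?_, isIndecModule_X_of_det hJ e₃ fun a d had => ?_⟩
    ⟨e₄, .of_ε₂ fun c hc k => ?_, isIndecModule_X_unique hJ e₄⟩ T1 T2 T3 T4 (.of_e₂ h₄)
    ?_ ?_ ?_ ?_ q₁ q₂ q₃
  · have := congrArg (ψ 0) (hc 0)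
    fin_cases k
    simpa [hl, hθ, f₁] using this
  · have had' : ∀ j l, ψ l ((f₁ * a) 0 j) = ψ l ((d * f₁) 0 j) := fun j l => by rw [had]
    simp only [Matrix.mul_apply, Fin.sum_univ_three, Fin.sum_univ_one] at had'
    have E01 : F.ε₁ (a 0 1) = 0 := by simpa [f₁, hl, hr, hθ] using had' 1 0
    have E02 : F.ε₁ (a 0 2) = 0 := by simpa [f₁, hl, hr, hθ] using had' 2 0
    have E12 : F.ε₁ (a 1 2) = 0 := by simpa [f₁, hl, hr, hθ] using had' 2 1
    have E00 : F.ε₁ (a 0 0) = F.ε₂ (d 0 0) := by simpa [f₁, hl, hr, hθ] using had' 0 0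
    have E11 : F.ε₁ (a 1 1) = F.ε₂ (d 0 0) := by simpa [f₁, hl, hr, hθ] using had' 1 1
    have E22 : F.ε₁ (a 2 2) = F.ε₂ (d 0 0) := by simpa [f₁, hl, hr, hθ] using had' 2 2
    exact ⟨F.ε₂ (d 0 0), 3, by simp [Matrix.det_fin_three, E01, E02, E12, E00, E11, E22, pow_succ],
      by simp [Matrix.det_fin_three, E01, E02, E12, E00, E11, E22, pow_succ]⟩
  · have := congrArg (ψ 0) (hc 0)
    fin_cases k
    simpa [hl, hθ, f₂] using this
  · have had' : ∀ j l, ψ l ((f₂ * a) 0 j) = ψ l ((d * f₂) 0 j) := fun j l => by rw [had]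
    simp only [Matrix.mul_apply, Fin.sum_univ_two, Fin.sum_univ_one] at had'
    have E1 : F.ε₁ (a 0 1) = 0 := by simpa [f₂, hl, hr, hθ] using had' 1 0
    have E2 : F.ε₁ (a 0 0) = F.ε₂ (d 0 0) := by simpa [f₂, hl, hr, hθ] using had' 0 0
    have E3 : F.ε₁ (a 1 1) = F.ε₂ (d 0 0) := by simpa [f₂, hl, hr, hθ] using had' 1 1
    exact ⟨F.ε₂ (d 0 0), 2, by simp [Matrix.det_fin_two, E1, E2, E3, pow_succ],
      by simp [Matrix.det_fin_two, E1, E2, E3, pow_succ]⟩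
  · fin_cases k
    · simpa [hl, hθ, f₃, Fin.sum_univ_two] using congrArg (ψ 0) (hc 0)
    · simpa [hl, hθ, f₃, Fin.sum_univ_two] using congrArg (ψ 0) (hc 1)
  · have had' : ∀ k j l, ψ l ((f₃ * a) k j) = ψ l ((d * f₃) k j) := fun k j l => by rw [had]
    simp only [Matrix.mul_apply, Fin.sum_univ_three, Fin.sum_univ_two] at had'
    have G00 : F.ε₁ (a 0 0) = F.ε₂ (d 0 0) := by simpa [f₃, hl, hr, hθ] using had' 0 0 0
    have G02 : F.ε₁ (a 0 2) = 0 := by simpa [f₃, hl, hr, hθ] using had' 0 2 0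
    have G10 : F.ε₁ (a 1 0) = F.ε₂ (d 1 0) := by simpa [f₃, hl, hr, hθ] using had' 1 0 0
    have G11 : F.ε₁ (a 1 1) = F.ε₂ (d 1 1) := by simpa [f₃, hl, hr, hθ] using had' 1 1 0
    have G12 : F.ε₁ (a 1 2) = 0 := by simpa [f₃, hl, hr, hθ] using had' 1 2 0
    have G22 : F.ε₁ (a 2 2) = F.ε₂ (d 0 0) := by simpa [f₃, hl, hr, hθ] using had' 0 2 1
    have G10' : 0 = θ 1 (d 1 0) := by simpa [f₃, hl, hr, hθ] using had' 1 0 1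
    have G10'' : 0 = F.ε₂ (d 1 0) := by simpa [f₃, hl, hr, hθ] using had' 1 2 1
    have G22' : F.ε₁ (a 2 2) = θ 1 (d 1 0) + F.ε₂ (d 1 1) := by
      simpa [f₃, hl, hr, hθ] using had' 1 2 2
    rw [← G10''] at G10
    rw [← G10', zero_add, ← G11] at G22'
    rw [← G00] at G22
    have G11' : F.ε₁ (a 1 1) = F.ε₁ (a 0 0) := by rw [← G22', G22]
    exact ⟨F.ε₁ (a 0 0), 3, by simp [Matrix.det_fin_three, G10, G02, G12, G11', G22, pow_succ],
      by simp [Matrix.det_fin_three, G10, G02, G12, G11', G22, pow_succ]⟩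
  · have := congrArg (ψ 0) (hc 0)
    fin_cases k
    simpa [hl, hθ] using this
  · intro H
    obtain ⟨w, hw₁, hw₂⟩ := H (fun _ => v 2 • F.gen _ 0) fun k => e₂_smul_v V2 _
    obtain ⟨r, hr'⟩ := exists_gen (w 0)
    obtain ⟨s, hs'⟩ := exists_gen (w 1)
    have h1 := hw₂ 0
    simp [hr', hs', smul_smul, f₂, Fin.sum_univ_two] at h1
    rw [← add_smul, eq_comm, ← sub_eq_zero, ← sub_smul] at h1
    have := congrArg (ψ 2) (exists_coeff_M₀ h1)
    rw [sub_mul, V2.2, add_mul, mul_assoc, mul_assoc] at this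
    simp [hr, hψ] at this
  · intro H
    obtain ⟨w, hw₁, hw₂⟩ := H (![0, v 1 • F.gen _ 2]) fun k => by
      fin_cases k <;> simp [e₂_smul_v V1]
    obtain ⟨r, hr'⟩ := exists_gen (w 1)
    obtain ⟨s, hs'⟩ := exists_gen (w 2)
    have h1 : v 0 • w 1 + v 2 • w 2 - v 1 • F.gen f₁ 2 = 0 := by
      simpa [f₃, Fin.sum_univ_three, sub_eq_zero] using (hw₂ 1).symm
    obtain ⟨c, hc⟩ := (sum_gen_eq_zero e₁ (x := fun j => v 0 * r j + v 2 * s j -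
      if j = 2 then v 1 else 0)).1 (by
        rw [← h1, hr', hs']
        simp [Fin.sum_univ_three, sub_smul, add_smul, smul_smul]
        abel)
    have := congrArg (ψ 1) (hc 2)
    simp [sub_mul, V1.2, add_mul, mul_assoc, hr, hl, hψ, f₁] at this
  · intro H
    obtain ⟨w, hw₁, hw₂⟩ := H (fun _ => v 1 • F.gen _ 0) fun k => e₂_smul_v V1 _
    obtain ⟨r, hr'⟩ := exists_gen (w 0)
    have h1 : v 0 • w 0 - v 1 • F.gen f₂ 0 = 0 := by
      simpa [sub_eq_zero] using (hw₂ 0).symm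
    obtain ⟨c, hc⟩ := (sum_gen_eq_zero e₂ (x := fun j => v 0 * r j -
      if j = 0 then v 1 else 0)).1 (by
        rw [← h1, hr']
        simp [Fin.sum_univ_two, sub_smul, smul_smul])
    have h2 := congrArg (ψ 1) (hc 0)
    have h3 := congrArg (ψ 2) (hc 1)
    simp [sub_mul, V1.2, mul_assoc, hr, hl, hψ, f₂] at h2 h3
    simp [← h3] at h2
  · refine not_inT_isEmpty V0 (y := F.gen _ 0) fun h => ?_
    obtain ⟨c, hc⟩ := (sum_gen_eq_zero e₃ (x := ![v 0, 0, 0])).1 (by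
      simpa [Fin.sum_univ_three] using h)
    have h0 := congrArg (ψ 0) (hc 0)
    have h1 := congrArg (ψ 1) (hc 2)
    simp [hl, hψ, V0.2, f₃, hθ, Fin.sum_univ_two] at h0 h1
    exact one_ne_zero (h0.trans h1.symm)

end Frame

open MulOpposite

section quiver

variable {K : Type} [Field K] {σ : Type} {s t : σ → Fin 2}
  {rels : Set (FreeAlgebra K (TPGen σ) × FreeAlgebra K (TPGen σ))}

local notation "Λ" => BoundQuiverAlgebra K σ s t rels

variable (K s t rels) in
/-- The quotient map from the free algebra. -/
def proj : FreeAlgebra K (TPGen σ) →ₐ[K] Λ := RingQuot.mkAlgHom K (QuivRel K σ s t rels)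

variable (K s t rels) in
/-- The vertex idempotents of a bound quiver algebra. -/
def vt (i : Fin 2) : Λ := proj K s t rels (vtx K i)

variable (K s t rels) in
/-- The arrows of a bound quiver algebra. -/
def aw (x : σ) : Λ := proj K s t rels (arr K x)

local notation "𝐞" => vt K s t rels
local notation "𝐚" => aw K s t rels

theorem proj_vtx (i : Fin 2) : proj K s t rels (vtx K i) = 𝐞 i := rfl

theorem proj_arr (x : σ) : proj K s t rels (arr K x) = 𝐚 x := rfl

theorem proj_rel {p q : FreeAlgebra K (TPGen σ)} (h : (p, q) ∈ rels) :
    proj K s t rels p = proj K s t rels q :=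
  RingQuot.mkAlgHom_rel K (QuivRel.rel (p, q) h)

theorem vt_mul_self (i : Fin 2) : 𝐞 i * 𝐞 i = 𝐞 i := by
  rw [vt, ← map_mul]
  exact RingQuot.mkAlgHom_rel K (QuivRel.idem i)

theorem vt_mul_of_ne {i j : Fin 2} (h : i ≠ j) : 𝐞 i * 𝐞 j = 0 := by
  rw [vt, vt, ← map_mul]
  exact (RingQuot.mkAlgHom_rel K (QuivRel.orth i j h)).trans (map_zero _)

theorem vt_add : 𝐞 0 + 𝐞 1 = 1 := by
  rw [vt, vt, ← map_add]
  exact (RingQuot.mkAlgHom_rel K QuivRel.vsum).trans (map_one _)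

theorem vt_add' (i : Fin 2) : 𝐞 i + 𝐞 (i + 1) = 1 := by
  fin_cases i
  exacts [vt_add, (add_comm _ _).trans vt_add]

theorem vt_mul_aw (x : σ) : 𝐞 (s x) * 𝐚 x = 𝐚 x := by
  rw [vt, aw, ← map_mul]
  exact RingQuot.mkAlgHom_rel K (QuivRel.src x)

theorem aw_mul_vt (x : σ) : 𝐚 x * 𝐞 (t x) = 𝐚 x := by
  rw [vt, aw, ← map_mul]
  exact RingQuot.mkAlgHom_rel K (QuivRel.tgt x)

theorem vt_mul_aw_of_ne {i : Fin 2} {x : σ} (h : i ≠ s x) :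
    𝐞 i * 𝐚 x = 0 := by
  rw [← vt_mul_aw, ← mul_assoc, vt_mul_of_ne h, zero_mul]

theorem aw_mul_vt_of_ne {i : Fin 2} {x : σ} (h : i ≠ t x) :
    𝐚 x * 𝐞 i = 0 := by
  rw [← aw_mul_vt, mul_assoc, vt_mul_of_ne h.symm, mul_zero]

theorem aw_mul_aw_of_ne {x y : σ} (h : t x ≠ s y) :
    𝐚 x * 𝐚 y = 0 := by
  rw [← aw_mul_vt, mul_assoc, vt_mul_aw_of_ne h, mul_zero]

/-- Generator induction. -/
theorem subalgebra_eq_top {S : Subalgebra K Λ} (hv : ∀ i, 𝐞 i ∈ S)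
    (ha : ∀ x, 𝐚 x ∈ S) (x : Λ) : x ∈ S := by
  obtain ⟨y, rfl⟩ := RingQuot.mkAlgHom_surjective K (QuivRel K σ s t rels) x
  change proj K s t rels y ∈ S
  induction y using FreeAlgebra.induction with
  | grade0 r => rw [AlgHom.commutes]; exact S.algebraMap_mem r
  | grade1 g =>
    cases g with
    | v i => exact hv i
    | ar x => exact ha x
  | mul a b ha hb => rw [map_mul]; exact S.mul_mem ha hb
  | add a b ha hb => rw [map_add]; exact S.add_mem ha hb

section lift
variable {B : Type} [Ring B] [Algebra K B]

/-- The map on the free algebra with prescribed values on the generators. -/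
def freeLift (v : Fin 2 → B) (a : σ → B) : FreeAlgebra K (TPGen σ) →ₐ[K] B :=
  FreeAlgebra.lift K fun | .v i => v i | .ar x => a x

@[simp] theorem freeLift_vtx (v : Fin 2 → B) (a : σ → B) (i : Fin 2) :
    freeLift (K := K) v a (vtx K i) = v i := FreeAlgebra.lift_ι_apply ..

@[simp] theorem freeLift_arr (v : Fin 2 → B) (a : σ → B) (x : σ) :
    freeLift (K := K) v a (arr K x) = a x := FreeAlgebra.lift_ι_apply ..

/-- The universal property of a bound quiver algebra. -/
theorem exists_lift (v : Fin 2 → B) (a : σ → B) (hv : ∀ i, v i * v i = v i)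
    (hv' : ∀ i j, i ≠ j → v i * v j = 0) (h1 : v 0 + v 1 = 1) (hs : ∀ x, v (s x) * a x = a x)
    (ht : ∀ x, a x * v (t x) = a x)
    (hr : ∀ p ∈ rels, freeLift (K := K) v a p.1 = freeLift v a p.2) :
    ∃ φ : Λ →ₐ[K] B, (∀ i, φ (𝐞 i) = v i) ∧ ∀ x, φ (𝐚 x) = a x := by
  have H : ∀ ⦃x y⦄, QuivRel K σ s t rels x y → freeLift (K := K) v a x = freeLift v a y := by
    intro x y h
    cases h with
    | idem i => simp [hv]
    | orth i j h => simp [hv' i j h]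
    | vsum => simp [h1]
    | src x => simp [hs]
    | tgt x => simp [ht]
    | rel p h => exact hr p h
  refine ⟨RingQuot.liftAlgHom K ⟨_, H⟩, fun i => ?_, fun x => ?_⟩
  · rw [vt, proj, RingQuot.liftAlgHom_mkAlgHom_apply, freeLift_vtx]
  · rw [aw, proj, RingQuot.liftAlgHom_mkAlgHom_apply, freeLift_arr]

end lift

/-- The relations have no constant term. -/
def IsAug (rels : Set (FreeAlgebra K (TPGen σ) × FreeAlgebra K (TPGen σ))) : Prop :=
  ∀ v : Fin 2 → K, ∀ p ∈ rels, freeLift v (fun _ => 0) p.1 = freeLift v (fun _ => 0) p.2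

theorem IsAug.exists_eps (h : IsAug rels) (i : Fin 2) : ∃ ε : Λ →ₐ[K] K,
    (∀ j, ε (𝐞 j) = if j = i then 1 else 0) ∧ ∀ x, ε (𝐚 x) = 0 := by
  refine exists_lift _ _ (fun j => ?_) (fun j k hjk => ?_) ?_ (fun x => mul_zero _)
    (fun x => zero_mul _) (h _)
  · split_ifs <;> simp
  · fin_cases i <;> fin_cases j <;> fin_cases k <;> simp at hjk ⊢
  · fin_cases i <;> simp

/-- The augmentation at a vertex. -/
def IsAug.eps (h : IsAug rels) (i : Fin 2) : Λ →ₐ[K] K := (h.exists_eps i).choose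

theorem IsAug.eps_vt (h : IsAug rels) (i j : Fin 2) :
    h.eps i (𝐞 j) = if j = i then 1 else 0 := (h.exists_eps i).choose_spec.1 j

theorem IsAug.eps_aw (h : IsAug rels) (i : Fin 2) (x : σ) : h.eps i (𝐚 x) = 0 :=
  (h.exists_eps i).choose_spec.2 x

variable (s t) in
/-- The frame on the opposite algebra, with the given first vertex. -/
def IsAug.frame (h : IsAug rels) (i : Fin 2) : Frame K (Λ)ᵐᵒᵖ where
  e₁ := op (𝐞 i)
  e₂ := op (𝐞 (i + 1))
  ε₁ := (h.eps i).fromOpposite fun _ _ => Commute.all _ _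
  ε₂ := (h.eps (i + 1)).fromOpposite fun _ _ => Commute.all _ _
  mul₁₂ := by rw [← op_mul, vt_mul_of_ne (by fin_cases i <;> decide), op_zero]
  mul₂₁ := by rw [← op_mul, vt_mul_of_ne (by fin_cases i <;> decide), op_zero]
  add := by rw [← op_add, vt_add', op_one]
  ε₁₁ := (h.eps_vt i i).trans (if_pos rfl)
  ε₂₂ := (h.eps_vt _ _).trans (if_pos rfl)

theorem IsAug.frame_swap (h : IsAug rels) (i : Fin 2) :
    (h.frame s t i).swap = h.frame s t (i + 1) := by
  fin_cases i <;> rfl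

/-- The last letter of a nonempty word. -/
def lastLetter : σ → List σ → σ
  | x, [] => x
  | _, y :: l => lastLetter y l

variable (K s t rels) in
/-- The product of the arrows in a nonempty word. -/
def word : σ → List σ → Λ
  | x, [] => 𝐚 x
  | x, y :: l => 𝐚 x * word y l

local notation "𝐰" => word K s t rels

theorem vt_mul_word (x : σ) (l : List σ) :
    𝐞 (s x) * 𝐰 x l = 𝐰 x l := by
  cases l with
  | nil => exact vt_mul_aw x
  | cons y l => rw [word, ← mul_assoc, vt_mul_aw]

theorem word_mul_vt (x : σ) (l : List σ) :
    𝐰 x l * 𝐞 (t (lastLetter x l)) = 𝐰 x l := by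
  induction l generalizing x with
  | nil => exact aw_mul_vt x
  | cons y l ih => rw [word, mul_assoc, lastLetter, ih]

theorem vt_mul_word_of_ne {i : Fin 2} {x : σ} {l : List σ} (h : i ≠ s x) :
    𝐞 i * 𝐰 x l = 0 := by
  rw [← vt_mul_word, ← mul_assoc, vt_mul_of_ne h, zero_mul]

theorem word_mul_vt_of_ne {i : Fin 2} {x : σ} {l : List σ} (h : i ≠ t (lastLetter x l)) :
    𝐰 x l * 𝐞 i = 0 := by
  rw [← word_mul_vt, mul_assoc, vt_mul_of_ne h.symm, mul_zero]

theorem word_mul_aw_of_ne {x y : σ} {l : List σ} (h : t (lastLetter x l) ≠ s y) :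
    𝐰 x l * 𝐚 y = 0 := by
  rw [← word_mul_vt, mul_assoc, vt_mul_aw_of_ne h, mul_zero]

/-- The span of a list of words, modulo `z`. -/
def wspan (z : Λ) (ws : List (σ × List σ)) : Submodule K Λ :=
  Submodule.span K {q | ∃ w ∈ ws, 𝐰 w.1 w.2 = q} ⊔
    LinearMap.range (LinearMap.mulLeft K z)

theorem word_mem_wspan {z : Λ} {ws : List (σ × List σ)} {w : σ × List σ} (h : w ∈ ws) :
    𝐰 w.1 w.2 ∈ wspan z ws :=
  Submodule.mem_sup_left (Submodule.subset_span ⟨w, h, rfl⟩)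

theorem mul_mem_wspan {z : Λ} {ws : List (σ × List σ)} (y : Λ) : z * y ∈ wspan z ws :=
  Submodule.mem_sup_right ⟨y, rfl⟩

theorem wspan_induction {z : Λ} {ws : List (σ × List σ)} {P : Submodule K Λ}
    (h₁ : ∀ w ∈ ws, 𝐰 w.1 w.2 ∈ P) (h₂ : ∀ y, z * y ∈ P) : wspan z ws ≤ P := by
  refine sup_le (Submodule.span_le.2 ?_) ?_
  · rintro _ ⟨w, hw, rfl⟩
    exact h₁ w hw
  · rintro _ ⟨y, rfl⟩
    exact h₂ y

theorem wspan_mono {z : Λ} {ws ws' : List (σ × List σ)} (h : ws ⊆ ws') :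
    wspan z ws ≤ wspan z ws' :=
  wspan_induction (fun _ hw => word_mem_wspan (h hw)) mul_mem_wspan

/-- Multiplying a word by an arrow gives a combination of later words, modulo `z`. -/
def Later (z : Λ) : List (σ × List σ) → Prop
  | [] => True
  | w :: ws => (∀ y, t (lastLetter w.1 w.2) = s y →
      𝐰 w.1 w.2 * 𝐚 y ∈ wspan z ws) ∧ Later z ws

theorem mul_mem_wspan_of_word {z a q : Λ} {ws ws' : List (σ × List σ)}
    (h : ∀ w ∈ ws, 𝐰 w.1 w.2 * a ∈ wspan z ws') (hq : q ∈ wspan z ws) :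
    q * a ∈ wspan z ws' := by
  refine wspan_induction (P := (wspan z ws').comap (LinearMap.mulRight K a)) h (fun y => ?_) hq
  rw [Submodule.mem_comap, LinearMap.mulRight_apply, mul_assoc]
  exact mul_mem_wspan _

theorem mul_vt_mem_wspan {z : Λ} {ws : List (σ × List σ)} {q : Λ} (hq : q ∈ wspan z ws)
    (i : Fin 2) : q * 𝐞 i ∈ wspan z ws := by
  refine mul_mem_wspan_of_word (fun w hw => ?_) hq
  by_cases h : i = t (lastLetter w.1 w.2)
  · rw [h, word_mul_vt]; exact word_mem_wspan hw
  · rw [word_mul_vt_of_ne h]; exact zero_mem _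

theorem Later.mul_aw_mem {z : Λ} {w : σ × List σ} {ws : List (σ × List σ)}
    (h : Later z (w :: ws)) {q : Λ} (hq : q ∈ wspan z (w :: ws)) (x : σ) :
    q * 𝐚 x ∈ wspan z ws := by
  have key : 𝐰 w.1 w.2 * 𝐚 x ∈ wspan z ws := by
    by_cases h' : t (lastLetter w.1 w.2) = s x
    · exact h.1 x h'
    · rw [word_mul_aw_of_ne h']; exact zero_mem _
  induction ws generalizing w q with
  | nil =>
    refine mul_mem_wspan_of_word (fun w' hw => ?_) hq
    obtain rfl := List.mem_singleton.1 hw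
    exact key
  | cons w₁ ws ih =>
    refine mul_mem_wspan_of_word (fun w' hw => ?_) hq
    obtain rfl | hw := List.mem_cons.1 hw
    · exact key
    · refine wspan_mono (List.subset_cons_self _ _) (ih h.2 (word_mem_wspan hw) ?_)
      by_cases h' : t (lastLetter w₁.1 w₁.2) = s x
      · exact h.2.1 x h'
      · rw [word_mul_aw_of_ne h']; exact zero_mem _

theorem Later.mul_mem {z : Λ} {ws : List (σ × List σ)} (h : Later z ws) (y : Λ) :
    ∀ q ∈ wspan z ws, q * y ∈ wspan z ws := by
  let S : Subalgebra K Λ :=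
    { carrier := {y | ∀ q ∈ wspan z ws, q * y ∈ wspan z ws}
      mul_mem' := fun {a b} ha hb q hq => by rw [← mul_assoc]; exact hb _ (ha _ hq)
      add_mem' := fun {a b} ha hb q hq => by rw [mul_add]; exact add_mem (ha _ hq) (hb _ hq)
      algebraMap_mem' := fun r q hq => by
        rw [← Algebra.commutes, ← Algebra.smul_def]; exact Submodule.smul_mem _ _ hq }
  refine subalgebra_eq_top (S := S) (fun i q hq => mul_vt_mem_wspan hq i) (fun x q hq => ?_) y
  cases ws with
  | nil => exact mul_mem_wspan_of_word (by simp) hq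
  | cons w ws => exact wspan_mono (List.subset_cons_self _ _) (h.mul_aw_mem hq x)

variable (h : IsAug rels)

/-- The semisimple part of an element. -/
def IsAug.top : Λ →ₐ[K] Λ where
  toFun y := h.eps 0 y • 𝐞 0 + h.eps 1 y • 𝐞 1
  map_one' := by simp [vt_add]
  map_mul' a b := by
    simp [mul_add, add_mul, vt_mul_self, vt_mul_of_ne, smul_smul, mul_comm]
  map_zero' := by simp
  map_add' a b := by simp only [map_add, add_smul]; abel
  commutes' r := by
    simp only [AlgHom.commutes, Algebra.algebraMap_self, RingHom.id_apply, ← smul_add, vt_add]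
    exact (Algebra.algebraMap_eq_smul_one r).symm

theorem IsAug.top_apply (y : Λ) :
    h.top y = h.eps 0 y • 𝐞 0 + h.eps 1 y • 𝐞 1 := rfl

theorem IsAug.top_vt (i : Fin 2) : h.top (𝐞 i) = 𝐞 i := by
  rw [top_apply, h.eps_vt, h.eps_vt]
  fin_cases i <;> simp

theorem IsAug.top_aw (x : σ) : h.top (𝐚 x) = 0 := by
  rw [top_apply, h.eps_aw, h.eps_aw, zero_smul, zero_smul, add_zero]

theorem Later.mul_sub_mem {z : Λ} {w : σ × List σ} {ws : List (σ × List σ)}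
    (H : Later z (w :: ws)) (y : Λ) :
    ∀ q ∈ wspan z (w :: ws), q * (y - h.top y) ∈ wspan z ws := by
  let S : Subalgebra K Λ :=
    { carrier := {y | ∀ q ∈ wspan z (w :: ws), q * (y - h.top y) ∈ wspan z ws}
      mul_mem' := fun {a b} ha hb q hq => by
        have : q * (a * b - h.top (a * b)) =
            q * (a - h.top a) * b + q * h.top a * (b - h.top b) := by
          simp only [map_mul, mul_sub, sub_mul, mul_assoc]; abel
        rw [this]
        exact add_mem (Later.mul_mem H.2 _ _ (ha _ hq)) (hb _ (Later.mul_mem H _ _ hq))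
      add_mem' := fun {a b} ha hb q hq => by
        rw [map_add, add_sub_add_comm, mul_add]; exact add_mem (ha _ hq) (hb _ hq)
      algebraMap_mem' := fun r q hq => by simp }
  refine subalgebra_eq_top (S := S) (fun i q hq => ?_) (fun x q hq => ?_) y
  · rw [h.top_vt, sub_self, mul_zero]; exact zero_mem _
  · rw [h.top_aw, sub_zero]; exact H.mul_aw_mem hq x

theorem top_mul_mem_wspan {z : Λ} (hz : ∀ y, z * y = y * z) {ws : List (σ × List σ)} (y : Λ) :
    ∀ q ∈ wspan z ws, h.top y * q ∈ wspan z ws := by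
  have key : ∀ i, ∀ q ∈ wspan z ws, 𝐞 i * q ∈ wspan z ws := by
    intro i q hq
    refine wspan_induction (P := (wspan z ws).comap (LinearMap.mulLeft K (𝐞 i)))
      (fun w hw => ?_) (fun y => ?_) hq
    · rw [Submodule.mem_comap, LinearMap.mulLeft_apply]
      by_cases h' : i = s w.1
      · rw [h', vt_mul_word]; exact word_mem_wspan hw
      · rw [vt_mul_word_of_ne h']; exact zero_mem _
    · rw [Submodule.mem_comap, LinearMap.mulLeft_apply, ← mul_assoc, ← hz, mul_assoc]
      exact mul_mem_wspan _
  intro q hq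
  rw [h.top_apply, add_mul, smul_mul_assoc, smul_mul_assoc]
  exact add_mem (Submodule.smul_mem _ _ (key _ _ hq)) (Submodule.smul_mem _ _ (key _ _ hq))

theorem Later.sub_mem {z : Λ} (hz : ∀ y, z * y = y * z) {ws : List (σ × List σ)} (H : Later z ws)
    (ha : ∀ x, 𝐚 x ∈ wspan z ws) (y : Λ) : y - h.top y ∈ wspan z ws := by
  let S : Subalgebra K Λ :=
    { carrier := {y | y - h.top y ∈ wspan z ws}
      mul_mem' := fun {a b} ha hb => by
        have : a * b - h.top (a * b) = (a - h.top a) * b + h.top a * (b - h.top b) := by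
          simp only [map_mul, mul_sub, sub_mul]; abel
        rw [Set.mem_ofPred_eq, this]
        exact add_mem (H.mul_mem _ _ ha) (top_mul_mem_wspan h hz _ _ hb)
      add_mem' := fun {a b} ha hb => by
        rw [Set.mem_ofPred_eq, map_add, add_sub_add_comm]; exact add_mem ha hb
      algebraMap_mem' := fun r => by simp }
  refine subalgebra_eq_top (S := S) (fun i => ?_) (fun x => ?_) y
  · change _ ∈ wspan z ws
    rw [h.top_vt, sub_self]; exact zero_mem _
  · change _ ∈ wspan z ws
    rw [h.top_aw, sub_zero]; exact ha x

/-- A central nilpotent `z` and a list of words exhibiting the algebra as finite-dimensional. -/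
structure WordData (z : Λ) (ws : List (σ × List σ)) : Prop where
  central : ∀ y, z * y = y * z
  nilp : IsNilpotent z
  later : Later z ws
  aw_mem : ∀ x, 𝐚 x ∈ wspan z ws

theorem eq_top_of_nilpotent {z : Λ} (hz : IsNilpotent z) {P : Submodule K Λ}
    (hP : ∀ y ∈ P, z * y ∈ P) (h : ∀ x, ∃ y, x - z * y ∈ P) (x : Λ) : x ∈ P := by
  obtain ⟨n, hn⟩ := hz
  have key : ∀ k, ∀ x, ∃ y, x - z ^ k * y ∈ P := by
    intro k
    induction k with
    | zero => exact fun x => ⟨x, by simp⟩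
    | succ k ih =>
      intro x
      obtain ⟨y, hy⟩ := ih x
      obtain ⟨y', hy'⟩ := h y
      have hk : ∀ q ∈ P, z ^ k * q ∈ P := by
        clear ih hy hy'
        induction k with
        | zero => simp
        | succ k ih => exact fun q hq => by rw [pow_succ, mul_assoc]; exact ih _ (hP _ hq)
      refine ⟨y', ?_⟩
      have := add_mem hy (hk _ hy')
      rwa [mul_sub, ← mul_assoc, ← pow_succ, sub_add_sub_cancel] at this
  obtain ⟨y, hy⟩ := key n x
  simpa [hn] using hy

include h in
theorem WordData.induction {z : Λ} {ws : List (σ × List σ)} (D : WordData z ws)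
    {P : Submodule K Λ} (hP : ∀ y ∈ P, z * y ∈ P) (hv : ∀ i, 𝐞 i ∈ P)
    (hw : ∀ w ∈ ws, 𝐰 w.1 w.2 ∈ P) (x : Λ) : x ∈ P := by
  refine eq_top_of_nilpotent D.nilp hP (fun x => ?_) x
  have hx : x ∈ P ⊔ LinearMap.range (LinearMap.mulLeft K z) := by
    rw [← sub_add_cancel x (h.top x)]
    refine add_mem ?_ (Submodule.mem_sup_left ?_)
    · refine wspan_induction (fun w hw' => Submodule.mem_sup_left (hw w hw'))
        (fun y => Submodule.mem_sup_right (LinearMap.mem_range.2 ⟨y, rfl⟩)) (D.later.sub_mem h D.central D.aw_mem x)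
    · rw [h.top_apply]
      exact add_mem (Submodule.smul_mem _ _ (hv 0)) (Submodule.smul_mem _ _ (hv 1))
  obtain ⟨p, hp, _, ⟨y, rfl⟩, rfl⟩ := Submodule.mem_sup.1 hx
  exact ⟨y, by rwa [LinearMap.mulLeft_apply, add_sub_cancel_right]⟩

include h in
theorem WordData.finite {z : Λ} {ws : List (σ × List σ)} (D : WordData z ws) :
    Module.Finite K Λ := by
  obtain ⟨n, hn⟩ := D.nilp
  let T : Set Λ := (Set.range 𝐞 ∪
    (fun w => 𝐰 w.1 w.2) '' {w | w ∈ ws})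
  have hT : T.Finite := (Set.finite_range _).union (ws.finite_toSet.image _)
  let P : Submodule K Λ := Submodule.span K (Set.image2 (fun k b => z ^ k * b) (Set.Iio n) T)
  have hfin : (Set.image2 (fun k b => z ^ k * b) (Set.Iio n) T).Finite :=
    (Set.finite_Iio n).image2 _ hT
  have hmem : ∀ k, ∀ b ∈ T, z ^ k * b ∈ P := by
    intro k b hb
    by_cases hk : k < n
    · exact Submodule.subset_span ⟨k, hk, b, hb, rfl⟩
    · rw [pow_eq_zero_of_le (not_lt.1 hk) hn, zero_mul]; exact zero_mem _
  have hP : P = ⊤ := by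
    refine eq_top_iff.2 fun x _ => D.induction h (fun y hy => ?_) (fun i => ?_) (fun w hw => ?_) x
    · have : P ≤ P.comap (LinearMap.mulLeft K z) := by
        refine Submodule.span_le.2 ?_
        rintro _ ⟨k, -, b, hb, rfl⟩
        change z * (z ^ k * b) ∈ P
        rw [← mul_assoc, ← pow_succ']
        exact hmem _ _ hb
      exact this hy
    · simpa using hmem 0 _ (Or.inl ⟨i, rfl⟩)
    · simpa using hmem 0 _ (Or.inr ⟨w, hw, rfl⟩)
  exact ⟨hP ▸ Submodule.fg_span hfin⟩

/-- A right ideal as a left ideal of the opposite algebra. -/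
def opIdeal (z : Λ) {ws : List (σ × List σ)} (H : Later z ws) : Ideal (Λ)ᵐᵒᵖ where
  carrier := {x | x.unop ∈ wspan z ws}
  add_mem' {a b} ha hb := by
    rw [Set.mem_ofPred_eq, unop_add]
    exact add_mem ha hb
  zero_mem' := zero_mem (wspan z ws)
  smul_mem' c x hx := H.mul_mem c.unop x.unop hx

theorem mem_J_iff {i : Fin 2} {x : (Λ)ᵐᵒᵖ} : x ∈ (h.frame s t i).J ↔ h.top x.unop = 0 := by
  have h1 : x ∈ (h.frame s t i).J ↔ h.eps i x.unop = 0 ∧ h.eps (i + 1) x.unop = 0 := Iff.rfl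
  have h2 : h.top x.unop = 0 ↔ h.eps 0 x.unop = 0 ∧ h.eps 1 x.unop = 0 := by
    constructor
    · intro H
      have h0 := congrArg (h.eps 0) H
      have h1 := congrArg (h.eps 1) H
      simpa [h.top_apply, h.eps_vt] using And.intro h0 h1
    · rintro ⟨h0, h1⟩; rw [h.top_apply, h0, h1]; simp
  rw [h1, h2]
  fin_cases i
  exacts [Iff.rfl, and_comm]

theorem WordData.nak {z : Λ} {ws : List (σ × List σ)} (D : WordData z ws) (i : Fin 2) :
    Nak (h.frame s t i).J := by
  intro M _ _ N N' hN
  have hJ : ∀ I : Ideal (Λ)ᵐᵒᵖ, N ≤ N' ⊔ I • N → N ≤ N' ⊔ (h.frame s t i).J • I • N := by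
    intro I hI
    refine hN.trans (sup_le le_sup_left ?_)
    refine (smul_mono_right (h.frame s t i).J hI).trans ?_
    rw [Submodule.smul_sup]
    exact sup_le_sup_right Submodule.smul_le_right _
  have key : ∀ ws (H : Later z ws), N ≤ N' ⊔ opIdeal z H • N →
      N ≤ N' ⊔ opIdeal z (ws := []) trivial • N := by
    intro ws
    induction ws with
    | nil => exact fun _ => id
    | cons w ws ih =>
      intro H hN
      refine ih H.2 ((hJ _ hN).trans (sup_le_sup_left ?_ _))
      refine Submodule.smul_le.2 fun j hj m hm => ?_
      refine Submodule.smul_induction_on hm (fun q hq n hn => ?_) (fun a b ha hb => ?_)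
      · rw [smul_smul]
        refine Submodule.smul_mem_smul ?_ hn
        have := H.mul_sub_mem h j.unop _ hq
        rwa [(mem_J_iff h).1 hj, sub_zero] at this
      · rw [smul_add]; exact add_mem ha hb
  have h0 := key ws D.later (hN.trans (sup_le_sup_left (Submodule.smul_mono_left fun x hx => by
    have := D.later.sub_mem h D.central D.aw_mem x.unop
    rwa [(mem_J_iff h).1 hx, sub_zero] at this) _))
  have hc : ∀ y : (Λ)ᵐᵒᵖ, op z * y = y * op z := fun y => congrArg op (D.central y.unop).symm
  have hz : ∀ n ∈ N, ∃ n' ∈ N, n - op z • n' ∈ N' := by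
    have : opIdeal z (ws := []) trivial • N ≤
        { carrier := {m | ∃ n' ∈ N, m = op z • n'}
          add_mem' := by
            rintro _ _ ⟨a, ha, rfl⟩ ⟨b, hb, rfl⟩; exact ⟨a + b, add_mem ha hb, (smul_add _ _ _).symm⟩
          zero_mem' := ⟨0, zero_mem _, by simp⟩
          smul_mem' := by
            rintro c _ ⟨a, ha, rfl⟩
            exact ⟨c • a, N.smul_mem _ ha, by rw [smul_smul, smul_smul, hc]⟩ } := by
      refine Submodule.smul_le.2 fun q hq n hn => ?_
      have hq' : q.unop ∈ wspan z [] := hq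
      simp only [wspan, List.not_mem_nil, false_and, exists_false, Set.ofPred_false,
        Submodule.span_empty, bot_sup_eq] at hq'
      obtain ⟨y, hy⟩ := hq'
      refine ⟨op y • n, N.smul_mem _ hn, ?_⟩
      rw [smul_smul, hc, ← op_mul]
      exact congrArg (· • n) (congrArg op hy.symm)
    intro n hn
    obtain ⟨a, ha, b, hb, rfl⟩ := Submodule.mem_sup.1 (h0 hn)
    obtain ⟨n', hn', rfl⟩ := this hb
    exact ⟨n', hn', by simpa using ha⟩
  obtain ⟨k, hk⟩ := D.nilp
  have hk' : ∀ k, ∀ n ∈ N, ∃ n' ∈ N, n - op z ^ k • n' ∈ N' := by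
    intro k
    induction k with
    | zero => exact fun n hn => ⟨n, hn, by simp⟩
    | succ k ih =>
      intro n hn
      obtain ⟨n₁, h₁, h₁'⟩ := ih n hn
      obtain ⟨n₂, h₂, h₂'⟩ := hz n₁ h₁
      refine ⟨n₂, h₂, ?_⟩
      have := add_mem h₁' (N'.smul_mem (op z ^ k) h₂')
      rwa [smul_sub, smul_smul, ← pow_succ, sub_add_sub_cancel] at this
  intro n hn
  obtain ⟨n', -, h'⟩ := hk' k n hn
  rwa [← op_pow, hk, op_zero, zero_smul, sub_zero] at h'

end quiver

section truncated
open Polynomial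

variable (K : Type) [Field K] (d : ℕ)

/-- The truncated polynomial algebra. -/
abbrev Trunc : Type := AdjoinRoot (X ^ d : K[X])

namespace Trunc
variable {K d}

/-- The coefficients of a truncated polynomial. -/
def coef (l : ℕ) : Trunc K d →ₗ[K] K :=
  (lcoeff K l).comp (AdjoinRoot.modByMonicHom (monic_X_pow d))

theorem coef_mk {l : ℕ} (hl : l < d) (p : K[X]) :
    coef l (AdjoinRoot.mk (X ^ d) p : Trunc K d) = p.coeff l := by
  change (AdjoinRoot.modByMonicHom (monic_X_pow d) _).coeff l = _
  rw [AdjoinRoot.modByMonicHom_mk]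
  conv_rhs => rw [← modByMonic_add_div p (X ^ d)]
  rw [coeff_add, coeff_X_pow_mul', if_neg (not_le.2 hl), add_zero]

theorem coef_root_pow_mul {l k : ℕ} (hl : l < d) (x : Trunc K d) :
    coef l (AdjoinRoot.root (X ^ d) ^ k * x) = if k ≤ l then coef (l - k) x else 0 := by
  obtain ⟨p, rfl⟩ := AdjoinRoot.mk_surjective x
  rw [← AdjoinRoot.mk_X, ← map_pow, ← map_mul, coef_mk hl, coef_mk (lt_of_le_of_lt (Nat.sub_le _ _) hl),
    coeff_X_pow_mul']

theorem root_pow : (AdjoinRoot.root (X ^ d) : Trunc K d) ^ d = 0 := by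
  rw [← AdjoinRoot.mk_X, ← map_pow, AdjoinRoot.mk_self]

theorem coef_algebraMap {l : ℕ} (hl : l < d) (c : K) :
    coef l (algebraMap K (Trunc K d) c) = if l = 0 then c else 0 := by
  rw [AdjoinRoot.algebraMap_eq, ← AdjoinRoot.mk_C, coef_mk hl, coeff_C]

theorem coef_zero_mul (hd : 0 < d) (x y : Trunc K d) : coef 0 (x * y) = coef 0 x * coef 0 y := by
  obtain ⟨p, rfl⟩ := AdjoinRoot.mk_surjective x
  obtain ⟨q, rfl⟩ := AdjoinRoot.mk_surjective y
  rw [← map_mul, coef_mk hd, coef_mk hd, coef_mk hd, mul_coeff_zero]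

end Trunc
end truncated

section quiver

variable {K : Type} [Field K] {σ : Type} {s t : σ → Fin 2}
  {rels : Set (FreeAlgebra K (TPGen σ) × FreeAlgebra K (TPGen σ))}

local notation "Λ" => BoundQuiverAlgebra K σ s t rels
local notation "𝐞" => vt K s t rels
local notation "𝐚" => aw K s t rels
local notation "𝐰" => word K s t rels

section corner

variable (h : IsAug rels) (i : Fin 2)

theorem IsAug.isV_iff {x : (Λ)ᵐᵒᵖ} : (h.frame s t i).IsV x ↔
    x.unop * 𝐞 (i + 1) = x.unop ∧ 𝐞 i * x.unop = x.unop := by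
  constructor
  · rintro ⟨h₁, h₂⟩
    exact ⟨congrArg unop h₁, congrArg unop h₂⟩
  · rintro ⟨h₁, h₂⟩
    exact ⟨congrArg op h₁, congrArg op h₂⟩

theorem WordData.corner_induction {z : Λ} {ws : List (σ × List σ)} (D : WordData z ws)
    {Q : Submodule K Λ} (hQ : ∀ q ∈ Q, z * q ∈ Q)
    (hw : ∀ w ∈ ws, s w.1 = i → t (lastLetter w.1 w.2) = i + 1 → 𝐰 w.1 w.2 ∈ Q)
    {x : (Λ)ᵐᵒᵖ} (hx : (h.frame s t i).IsV x) : x.unop ∈ Q := by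
  rw [IsAug.isV_iff] at hx
  let P : Submodule K Λ := Q.comap
    ((LinearMap.mulLeft K (𝐞 i)).comp (LinearMap.mulRight K (𝐞 (i + 1))))
  have hP : ∀ y, y ∈ P ↔ 𝐞 i * (y * 𝐞 (i + 1)) ∈ Q := fun y => Iff.rfl
  have key : ∀ y, y ∈ P := by
    refine D.induction h (fun y hy => ?_) (fun j => ?_) fun w hw' => ?_
    · rw [hP, mul_assoc z, ← mul_assoc, ← D.central, mul_assoc]
      exact hQ _ hy
    · rw [hP]
      by_cases hj : i = j
      · rw [← hj, vt_mul_of_ne (by fin_cases i <;> decide), mul_zero]; exact zero_mem _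
      · rw [← mul_assoc, vt_mul_of_ne hj, zero_mul]; exact zero_mem _
    · rw [hP]
      by_cases h₁ : i = s w.1
      · by_cases h₂ : i + 1 = t (lastLetter w.1 w.2)
        · rw [h₂, word_mul_vt, h₁, vt_mul_word]; exact hw w hw' h₁.symm h₂.symm
        · rw [word_mul_vt_of_ne h₂, mul_zero]; exact zero_mem _
      · rw [← mul_assoc, vt_mul_word_of_ne h₁, zero_mul]; exact zero_mem _
  have := key x.unop
  rwa [hP, hx.1, hx.2] at this

theorem op_mem_center {y : Λ} (hy : ∀ x, y * x = x * y) : op y ∈ Subring.center (Λ)ᵐᵒᵖ :=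
  Subring.mem_center_iff.2 fun x => congrArg op (hy x.unop)

theorem WordData.spans {z : Λ} {ws : List (σ × List σ)} (D : WordData z ws)
    {d : ℕ} (v : Fin d → Λ) (hv₁ : ∀ l, v l * 𝐞 (i + 1) = v l)
    (hv₂ : ∀ l, 𝐞 i * v l = v l)
    (hw : ∀ w ∈ ws, s w.1 = i → t (lastLetter w.1 w.2) = i + 1 →
      ∃ l, 𝐰 w.1 w.2 = v l) :
    (h.frame s t i).Spans fun l => op (v l) where
  isV l := h.isV_iff i |>.2 ⟨hv₁ l, hv₂ l⟩
  span x hx := by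
    let Q : Submodule K Λ :=
      { carrier := {q | ∃ a : Fin d → (Λ)ᵐᵒᵖ, (∀ l, a l ∈ Subring.center (Λ)ᵐᵒᵖ) ∧
          op q = ∑ l, a l * op (v l)}
        add_mem' := by
          rintro q q' ⟨a, ha, h⟩ ⟨a', ha', h'⟩
          exact ⟨fun l => a l + a' l, fun l => add_mem (ha l) (ha' l), by
            simp_rw [op_add, h, h', add_mul, Finset.sum_add_distrib]⟩
        zero_mem' := ⟨fun _ => 0, fun _ => zero_mem _, by simp⟩
        smul_mem' := by
          rintro c q ⟨a, ha, h⟩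
          refine ⟨fun l => algebraMap K _ c * a l, fun l => mul_mem ?_ (ha l), ?_⟩
          · exact Subring.mem_center_iff.2 fun x => (Algebra.commutes c x).symm
          · simp_rw [op_smul, h, mul_assoc, ← Finset.mul_sum, Algebra.smul_def] }
    exact D.corner_induction h i (Q := Q)
      (by
        rintro q ⟨a, ha, h⟩
        refine ⟨fun l => op z * a l, fun l => mul_mem (op_mem_center D.central) (ha l), ?_⟩
        rw [D.central, op_mul, h, Finset.mul_sum]
        simp_rw [mul_assoc])
      (fun w hw' h₁ h₂ => by
        obtain ⟨l, hl⟩ := hw w hw' h₁ h₂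
        refine ⟨Pi.single l 1, fun l' => ?_, ?_⟩
        · by_cases h : l' = l
          · subst h; rw [Pi.single_eq_same]; exact one_mem _
          · rw [Pi.single_eq_of_ne h]; exact zero_mem _
        · rw [hl, Finset.sum_eq_single l (fun l' _ h => by rw [Pi.single_eq_of_ne h, zero_mul])
            (by simp), Pi.single_eq_same, one_mul]) hx

theorem WordData.cyclic {z : Λ} {ws : List (σ × List σ)} (D : WordData z ws)
    {v : Λ} (hv₁ : v * 𝐞 (i + 1) = v)
    (hv₂ : 𝐞 i * v = v)
    (hw : ∀ w ∈ ws, s w.1 = i → t (lastLetter w.1 w.2) = i + 1 →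
      (∃ a, 𝐰 w.1 w.2 = v * a) ∧ ∃ a, 𝐰 w.1 w.2 = a * v) :
    (h.frame s t i).Cyclic (op v) where
  isV := h.isV_iff i |>.2 ⟨hv₁, hv₂⟩
  left x hx := by
    obtain ⟨a, ha⟩ := D.corner_induction h i (Q := LinearMap.range (LinearMap.mulLeft K v))
      (by
        rintro _ ⟨y, rfl⟩
        exact ⟨z * y, by simp_rw [LinearMap.mulLeft_apply, ← mul_assoc, D.central]⟩)
      (fun w hw' h₁ h₂ => by
        obtain ⟨a, ha⟩ := (hw w hw' h₁ h₂).1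
        exact ⟨a, ha.symm⟩) hx
    exact ⟨op a, congrArg op ha.symm⟩
  right x hx := by
    obtain ⟨a, ha⟩ := D.corner_induction h i (Q := LinearMap.range (LinearMap.mulRight K v))
      (by
        rintro _ ⟨y, rfl⟩
        exact ⟨z * y, by simp_rw [LinearMap.mulRight_apply, mul_assoc]⟩)
      (fun w hw' h₁ h₂ => by
        obtain ⟨a, ha⟩ := (hw w hw' h₁ h₂).2
        exact ⟨a, ha.symm⟩) hx
    exact ⟨op a, congrArg op ha.symm⟩

theorem WordData.isV_eq_zero {z : Λ} {ws : List (σ × List σ)} (D : WordData z ws)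
    (hw : ∀ w ∈ ws, ¬ (s w.1 = i ∧ t (lastLetter w.1 w.2) = i + 1)) {x : (Λ)ᵐᵒᵖ}
    (hx : (h.frame s t i).IsV x) : x = 0 := by
  have := D.corner_induction h i (Q := ⊥) (by simp) (fun w hw' h₁ h₂ => (hw w hw' ⟨h₁, h₂⟩).elim) hx
  exact congrArg op ((Submodule.mem_bot K).1 this)

end corner

section rep

theorem vec_zero {A : Type} [Zero A] : (![0, 0] : Fin 2 → A) = 0 := by
  funext k; fin_cases k <;> rfl

/-- Images of the vertices in a triangular representation. -/
def repV (K : Type) [Field K] (d : ℕ) (i j : Fin 2) : Matrix (Fin 2) (Fin 2) (Trunc K d) :=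
  if j = i then !![1, 0; 0, 0] else !![0, 0; 0, 1]

/-- Images of the arrows in a triangular representation. -/
def repA {K : Type} [Field K] {d : ℕ} [DecidableEq σ] (x₀ x₁ : σ) (p q : Trunc K d) (x : σ) :
    Matrix (Fin 2) (Fin 2) (Trunc K d) :=
  if x = x₀ then !![0, 1; 0, 0] else if x = x₁ then !![p, 0; 0, q] else 0

/-- The root. -/
abbrev Trunc.T (K : Type) [Field K] (d : ℕ) : Trunc K d := AdjoinRoot.root (Polynomial.X ^ d)

variable (h : IsAug rels) (i : Fin 2) [DecidableEq σ] {x₀ x₁ : σ} {d : ℕ}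

theorem exists_rep (hd : 0 < d) {p q : Trunc K d} (hs₀ : s x₀ = i) (ht₀ : t x₀ = i + 1)
    (hp : Trunc.coef 0 p = 0) (hq : Trunc.coef 0 q = 0)
    (h₁ : s x₁ = i ∧ t x₁ = i ∧ q = 0 ∨ s x₁ = i + 1 ∧ t x₁ = i + 1 ∧ p = 0)
    (hr : ∀ r ∈ rels, freeLift (K := K) (repV K d i) (repA x₀ x₁ p q) r.1 =
      freeLift (repV K d i) (repA x₀ x₁ p q) r.2) :
    ∃ φ : Λ →ₐ[K] Matrix (Fin 2) (Fin 2) (Trunc K d),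
      (∀ j, φ (𝐞 j) = repV K d i j) ∧ (∀ x, φ (𝐚 x) = repA x₀ x₁ p q x) ∧
      (∀ x, φ x 1 0 = 0) ∧ (∀ x, Trunc.coef 0 (φ x 0 0) = h.eps i x) ∧
      ∀ x, Trunc.coef 0 (φ x 1 1) = h.eps (i + 1) x := by
  have hi : i + 1 ≠ i := by fin_cases i <;> decide
  have hone : Trunc.coef 0 (1 : Trunc K d) = 1 := by
    simpa using Trunc.coef_algebraMap hd (1 : K)
  obtain ⟨φ, hv, ha⟩ := exists_lift (s := s) (t := t) (repV K d i) (repA x₀ x₁ p q)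
    (fun j => by unfold repV; split_ifs <;> simp [vec_zero])
    (fun j k hjk => by
      have : ¬ (j = i ∧ k = i) := fun ⟨a, b⟩ => hjk (a.trans b.symm)
      have h' : j = i ∨ k = i := by
        revert hjk this; fin_cases i <;> fin_cases j <;> fin_cases k <;> decide
      unfold repV
      rcases h' with rfl | rfl
      · rw [if_pos rfl, if_neg hjk.symm]
        ext a b; fin_cases a <;> fin_cases b <;> simp
      · rw [if_pos rfl, if_neg hjk]
        ext a b; fin_cases a <;> fin_cases b <;> simp)
    (by
      unfold repV
      ext a b
      fin_cases i <;> fin_cases a <;> fin_cases b <;> simp)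
    (fun x => by
      unfold repA repV
      split_ifs with h1 h2 h3 h4 h5 <;> simp_all [vec_zero])
    (fun x => by
      unfold repA repV
      split_ifs with h1 h2 h3 h4 h5 <;> simp_all [vec_zero]) hr
  have key : ∀ x, φ x 1 0 = 0 ∧ Trunc.coef 0 (φ x 0 0) = h.eps i x ∧
      Trunc.coef 0 (φ x 1 1) = h.eps (i + 1) x := by
    let S : Subalgebra K Λ :=
      { carrier := {x | φ x 1 0 = 0 ∧ Trunc.coef 0 (φ x 0 0) = h.eps i x ∧
          Trunc.coef 0 (φ x 1 1) = h.eps (i + 1) x}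
        mul_mem' := by
          rintro a b ⟨a1, a2, a3⟩ ⟨b1, b2, b3⟩
          refine ⟨?_, ?_, ?_⟩
          · simp [Matrix.mul_apply, a1, b1]
          · simp [Matrix.mul_apply, b1, Trunc.coef_zero_mul hd, a2, b2]
          · simp [Matrix.mul_apply, a1, Trunc.coef_zero_mul hd, a3, b3]
        add_mem' := by
          rintro a b ⟨a1, a2, a3⟩ ⟨b1, b2, b3⟩
          refine ⟨?_, ?_, ?_⟩
          · simp [a1, b1]
          · simp [a2, b2]
          · simp [a3, b3]
        algebraMap_mem' := fun r => by
          refine ⟨?_, ?_, ?_⟩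
          · simp [Matrix.algebraMap_matrix_apply]
          · simpa [Matrix.algebraMap_matrix_apply] using Trunc.coef_algebraMap hd r
          · simpa [Matrix.algebraMap_matrix_apply] using Trunc.coef_algebraMap hd r }
    refine subalgebra_eq_top (S := S) (fun j => ?_) (fun x => ?_)
    · change φ _ 1 0 = 0 ∧ Trunc.coef 0 (φ _ 0 0) = _ ∧ Trunc.coef 0 (φ _ 1 1) = _
      rw [hv, h.eps_vt, h.eps_vt]
      unfold repV
      by_cases hj : j = i
      · simp [hj, hone, hi.symm]
      · have : j = i + 1 := by revert hj; fin_cases i <;> fin_cases j <;> decide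
        simp [this, hone, hi]
    · change φ _ 1 0 = 0 ∧ Trunc.coef 0 (φ _ 0 0) = _ ∧ Trunc.coef 0 (φ _ 1 1) = _
      rw [ha, h.eps_aw, h.eps_aw]
      unfold repA
      split_ifs <;> simp [hp, hq]
  exact ⟨φ, hv, ha, fun x => (key x).1, fun x => (key x).2.1, fun x => (key x).2.2⟩

theorem repA_pow_mul {p q : Trunc K d} (hne : x₁ ≠ x₀) (k : ℕ) :
    repA x₀ x₁ p q x₁ ^ k * repA x₀ x₁ p q x₀ = !![0, p ^ k; 0, 0] := by
  unfold repA
  rw [if_pos rfl, if_neg hne, if_pos rfl]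
  induction k with
  | zero => simp
  | succ k ih => rw [pow_succ', mul_assoc, ih]; simp [pow_succ']

theorem repA_mul_pow {p q : Trunc K d} (hne : x₁ ≠ x₀) (k : ℕ) :
    repA x₀ x₁ p q x₀ * repA x₀ x₁ p q x₁ ^ k = !![0, q ^ k; 0, 0] := by
  unfold repA
  rw [if_pos rfl, if_neg hne, if_pos rfl]
  induction k with
  | zero => simp
  | succ k ih => rw [pow_succ, ← mul_assoc, ih]; simp [pow_succ, vec_zero]

theorem diag_eq_algebraMap {φ : Λ →ₐ[K] Matrix (Fin 2) (Fin 2) (Trunc K d)}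
    (hl : ∀ x, φ x 1 0 = 0) (e : Fin 2) (j : Fin 2)
    (hv : ∀ k, φ (𝐞 k) e e = if k = j then 1 else 0)
    (ha : ∀ x, φ (𝐚 x) e e = 0) (x : Λ) :
    φ x e e = algebraMap K _ (h.eps j x) := by
  let S : Subalgebra K Λ :=
    { carrier := {x | φ x e e = algebraMap K _ (h.eps j x)}
      mul_mem' := by
        intro a b ha hb
        rw [Set.mem_ofPred_eq] at *
        rw [map_mul, map_mul, map_mul, ← ha, ← hb, Matrix.mul_apply, Fin.sum_univ_two]
        fin_cases e <;> simp [hl]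
      add_mem' := by
        intro a b ha hb
        rw [Set.mem_ofPred_eq] at *
        rw [map_add, map_add, map_add, ← ha, ← hb, Matrix.add_apply]
      algebraMap_mem' := fun r => by
        rw [Set.mem_ofPred_eq, AlgHom.commutes, AlgHom.commutes, Matrix.algebraMap_matrix_apply,
          if_pos rfl]
        rfl }
  refine subalgebra_eq_top (S := S) (fun k => ?_) (fun x => ?_) x
  · change φ _ e e = _
    rw [hv, h.eps_vt]
    split_ifs <;> simp
  · change φ _ e e = _
    rw [ha, h.eps_aw, map_zero]

/-- A matrix entry, as a functional on the opposite algebra. -/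
def entry (φ : Λ →ₐ[K] Matrix (Fin 2) (Fin 2) (Trunc K d)) (a b : Fin 2) (l : ℕ) :
    (Λ)ᵐᵒᵖ →ₗ[K] K :=
  (Trunc.coef l).comp ((Matrix.entryLinearMap K (Trunc K d) a b).comp
    (φ.toLinearMap.comp (opLinearEquiv K).symm.toLinearMap))

theorem entry_op (φ : Λ →ₐ[K] Matrix (Fin 2) (Fin 2) (Trunc K d)) (a b : Fin 2) (l : ℕ) (x : Λ) :
    entry φ a b l (op x) = Trunc.coef l (φ x a b) := rfl

theorem coef_T (hd : 0 < d) : Trunc.coef 0 (Trunc.T K d) = 0 := by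
  simpa using Trunc.coef_root_pow_mul (k := 1) hd (1 : Trunc K d)

theorem coef_algebraMap_ite {l k : ℕ} (hl : l < d) (c : K) :
    (if k ≤ l then Trunc.coef (l - k) (algebraMap K (Trunc K d) c) else 0) =
      if k = l then c else 0 := by
  rw [Trunc.coef_algebraMap (lt_of_le_of_lt (Nat.sub_le l k) hl)]
  split_ifs <;> first | rfl | omega

theorem lData (hd : 0 < d) (hs₀ : s x₀ = i) (ht₀ : t x₀ = i + 1) (hs₁ : s x₁ = i) (ht₁ : t x₁ = i)
    (hr : ∀ r ∈ rels, freeLift (K := K) (repV K d i) (repA x₀ x₁ (Trunc.T K d) 0) r.1 =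
      freeLift (repV K d i) (repA x₀ x₁ (Trunc.T K d) 0) r.2) :
    (h.frame s t i).LData (fun l => op (𝐚 x₁ ^ l * 𝐚 x₀)) d := by
  have hne : x₁ ≠ x₀ := fun e => by rw [e, ht₀] at ht₁; revert ht₁; fin_cases i <;> decide
  obtain ⟨φ, hv, ha, h10, h00, h11⟩ := exists_rep h i hd hs₀ ht₀ (coef_T hd) (map_zero _)
    (Or.inl ⟨hs₁, ht₁, rfl⟩) hr
  have key := diag_eq_algebraMap h h10 1 (i + 1) (fun k => by
    rw [hv]
    fin_cases i <;> fin_cases k <;> simp [repV]) fun x => by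
    rw [ha]
    unfold repA
    split_ifs <;> simp
  refine ⟨entry φ 0 1, entry φ 0 0, LinearMap.ext fun x => h00 x.unop, fun l hl k hk c => ?_,
    fun l hl k hk a => ?_⟩
  · obtain ⟨c, rfl⟩ := op_surjective c
    rw [← op_mul, entry_op, map_mul, map_mul, map_pow, ha, ha, repA_pow_mul hne]
    have : (!![0, Trunc.T K d ^ k; 0, 0] * φ c) 0 1 =
        Trunc.T K d ^ k * algebraMap K _ (h.eps (i + 1) c) := by
      simp [Matrix.mul_apply, key]
    rw [this, Trunc.coef_root_pow_mul hl, coef_algebraMap_ite hl]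
    rfl
  · obtain ⟨a, rfl⟩ := op_surjective a
    rw [← op_mul, entry_op, entry_op, map_mul, map_mul, map_pow, ha, ha, repA_pow_mul hne]
    have : (φ a * !![0, Trunc.T K d ^ k; 0, 0]) 0 1 = Trunc.T K d ^ k * φ a 0 0 := by
      simp [Matrix.mul_apply, mul_comm]
    rw [this, Trunc.coef_root_pow_mul hl]

theorem rData (hd : 0 < d) (hs₀ : s x₀ = i) (ht₀ : t x₀ = i + 1) (hs₁ : s x₁ = i + 1)
    (ht₁ : t x₁ = i + 1)
    (hr : ∀ r ∈ rels, freeLift (K := K) (repV K d i) (repA x₀ x₁ 0 (Trunc.T K d)) r.1 =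
      freeLift (repV K d i) (repA x₀ x₁ 0 (Trunc.T K d)) r.2) :
    (h.frame s t i).RData (fun l => op (𝐚 x₀ * 𝐚 x₁ ^ l)) d := by
  have hne : x₁ ≠ x₀ := fun e => by rw [e, hs₀] at hs₁; revert hs₁; fin_cases i <;> decide
  obtain ⟨φ, hv, ha, h10, h00, h11⟩ := exists_rep h i hd hs₀ ht₀ (map_zero _) (coef_T hd)
    (Or.inr ⟨hs₁, ht₁, rfl⟩) hr
  have key := diag_eq_algebraMap h h10 0 i (fun k => by
    rw [hv]
    fin_cases i <;> fin_cases k <;> simp [repV]) fun x => by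
    rw [ha]
    unfold repA
    split_ifs <;> simp
  refine ⟨entry φ 0 1, entry φ 1 1, LinearMap.ext fun x => h11 x.unop, fun l hl k hk a => ?_,
    fun l hl k hk c => ?_⟩
  · obtain ⟨a, rfl⟩ := op_surjective a
    rw [← op_mul, entry_op, map_mul, map_mul, map_pow, ha, ha, repA_mul_pow hne]
    have : (φ a * !![0, Trunc.T K d ^ k; 0, 0]) 0 1 =
        Trunc.T K d ^ k * algebraMap K _ (h.eps i a) := by
      simp [Matrix.mul_apply, key, mul_comm]
    rw [this, Trunc.coef_root_pow_mul hl, coef_algebraMap_ite hl]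
    rfl
  · obtain ⟨c, rfl⟩ := op_surjective c
    rw [← op_mul, entry_op, entry_op, map_mul, map_mul, map_pow, ha, ha, repA_mul_pow hne]
    have : (!![0, Trunc.T K d ^ k; 0, 0] * φ c) 0 1 = Trunc.T K d ^ k * φ c 1 1 := by
      simp [Matrix.mul_apply]
    rw [this, Trunc.coef_root_pow_mul hl]

end rep

theorem Frame.RData.lData_one {R : Type} [Ring R] [Algebra K R] {F : Frame K R} {v : ℕ → R}
    (h : F.RData v 1) : F.LData v 1 := by
  obtain ⟨ψ, θ, hθ, hl, hr⟩ := h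
  refine ⟨ψ, fun _ => F.ε₁.toLinearMap, rfl, fun l h₁ k h₂ c => ?_, fun l h₁ k h₂ a => ?_⟩
  · obtain rfl := Nat.lt_one_iff.1 h₁
    obtain rfl := Nat.lt_one_iff.1 h₂
    rw [hr 0 h₁ 0 h₂, if_pos le_rfl, if_pos rfl, hθ]
    rfl
  · obtain rfl := Nat.lt_one_iff.1 h₁
    obtain rfl := Nat.lt_one_iff.1 h₂
    rw [hl 0 h₁ 0 h₂, if_pos le_rfl, if_pos rfl]
    rfl

theorem word_append (x : σ) (l : List σ) (y : σ) :
    𝐰 x (l ++ [y]) = 𝐰 x l * 𝐚 y := by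
  induction l generalizing x with
  | nil => rfl
  | cons z l ih => rw [List.cons_append, word, ih, word, mul_assoc]

variable (s t) in
/-- Every prolongation of a word in the list is a later word, or rewrites to later words. -/
def Closed (red : List ((σ × List σ) × List (σ × List σ))) : List (σ × List σ) → Prop
  | [] => True
  | w :: ws => (∀ y, t (lastLetter w.1 w.2) = s y → (w.1, w.2 ++ [y]) ∈ ws ∨
      ∃ r ∈ red, r.1 = (w.1, w.2 ++ [y]) ∧ r.2 ⊆ ws) ∧ Closed red ws

instance Closed.decidable [Fintype σ] [DecidableEq σ] (red : List ((σ × List σ) × List (σ × List σ))) :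
    ∀ ws, Decidable (Closed s t red ws)
  | [] => isTrue trivial
  | _ :: ws => @instDecidableAnd _ _ inferInstance (Closed.decidable red ws)

theorem Closed.later {red : List ((σ × List σ) × List (σ × List σ))} {z : Λ}
    (hred : ∀ r ∈ red, 𝐰 r.1.1 r.1.2 ∈ wspan z r.2) :
    ∀ {ws}, Closed s t red ws → Later z ws
  | [], _ => trivial
  | _ :: _, ⟨h, h'⟩ => by
    refine ⟨fun y hy => ?_, Closed.later hred h'⟩
    rw [← word_append]
    rcases h y hy with hm | ⟨r, hr, e, hs⟩
    · exact word_mem_wspan hm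
    · have := wspan_mono hs (hred r hr)
      rwa [e] at this

theorem central_of {z : Λ} (hv : ∀ i, z * 𝐞 i = 𝐞 i * z)
    (ha : ∀ x, z * 𝐚 x = 𝐚 x * z) (y : Λ) : z * y = y * z :=
  (Subalgebra.mem_centralizer_iff K (s := {z})).1
    (subalgebra_eq_top (S := Subalgebra.centralizer K {z})
      (fun i => (Subalgebra.mem_centralizer_iff K).2 fun _ h => by rw [Set.mem_singleton_iff.1 h, hv])
      (fun x => (Subalgebra.mem_centralizer_iff K).2 fun _ h => by rw [Set.mem_singleton_iff.1 h, ha])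
      y) z rfl

theorem WordData.of_closed {z : Λ} {ws : List (σ × List σ)}
    (red : List ((σ × List σ) × List (σ × List σ))) (hc : Closed s t red ws)
    (hred : ∀ r ∈ red, 𝐰 r.1.1 r.1.2 ∈ wspan z r.2) (hw : ∀ x, (x, []) ∈ ws)
    (hz : IsNilpotent z) (hv : ∀ i, z * 𝐞 i = 𝐞 i * z)
    (ha : ∀ x, z * 𝐚 x = 𝐚 x * z) : WordData z ws where
  central := central_of hv ha
  nilp := hz
  later := hc.later hred
  aw_mem x := word_mem_wspan (hw x)

theorem mem_wspan_nil {z y : Λ} (h : ∃ x, y = z * x) : y ∈ wspan z [] := by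
  obtain ⟨x, rfl⟩ := h
  exact mul_mem_wspan x

/-- Membership in the span of one word modulo `z`. -/
theorem mem_wspan_singleton {z y : Λ} {w : σ × List σ} (c : K)
    (h : ∃ x, y = c • 𝐰 w.1 w.2 + z * x) : y ∈ wspan z [w] := by
  obtain ⟨x, rfl⟩ := h
  exact add_mem (Submodule.smul_mem _ _ (word_mem_wspan (List.mem_singleton_self w)))
    (mul_mem_wspan x)

section main
variable (h : IsAug rels)

theorem WordData.tauTiltingData {z : Λ} {ws : List (σ × List σ)} (D : WordData z ws)
    [IsAlgClosed K] (i : Fin 2) {m n : ℕ}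
    (hm : (h.frame s t i).HasChain m) (hn : (h.frame s t (i + 1)).HasChain n) :
    TauTiltingData Λ (m + n + 4) (m + 1) (n + 1) := by
  have : Infinite K := IsAlgClosed.instInfinite
  have : Module.Finite K Λ := D.finite h
  have : Module.Finite K (Λ)ᵐᵒᵖ := Module.Finite.equiv (opLinearEquiv K)
  rw [← h.frame_swap] at hn
  obtain ⟨b, c, f, H⟩ := hm
  obtain ⟨b', c', g, G⟩ := hn
  exact (H.twoChains (D.nak h i) G).tauTiltingData

variable (i : Fin 2) {x₀ x₁ : σ}

theorem WordData.hasChain_zero {z : Λ} {ws : List (σ × List σ)} (D : WordData z ws)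
    (hw : ∀ w ∈ ws, ¬ (s w.1 = i ∧ t (lastLetter w.1 w.2) = i + 1)) :
    (h.frame s t i).HasChain 0 :=
  Frame.hasChain0 (D.nak h i) fun _ => D.isV_eq_zero h i hw

theorem WordData.hasChain_one_of_cyclic {z : Λ} {ws : List (σ × List σ)} (D : WordData z ws)
    (hs₀ : s x₀ = i) (ht₀ : t x₀ = i + 1) {v : ℕ → (Λ)ᵐᵒᵖ} (hd : (h.frame s t i).LData v 1)
    (hv : v 0 = op (𝐚 x₀))
    (hw : ∀ w ∈ ws, s w.1 = i → t (lastLetter w.1 w.2) = i + 1 →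
      (∃ a, 𝐰 w.1 w.2 = 𝐚 x₀ * a) ∧
        ∃ a, 𝐰 w.1 w.2 = a * 𝐚 x₀) :
    (h.frame s t i).HasChain 1 := by
  refine hd.hasChain1 (D.nak h i) ?_
  rw [hv]
  exact D.cyclic h i (by rw [← ht₀, aw_mul_vt]) (by rw [← hs₀, vt_mul_aw]) hw

theorem WordData.hasChain_one {z : Λ} {ws : List (σ × List σ)} (D : WordData z ws)
    (hs₀ : s x₀ = i) (ht₀ : t x₀ = i + 1) {v : ℕ → (Λ)ᵐᵒᵖ} (hd : (h.frame s t i).LData v 1)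
    (hv : v 0 = op (𝐚 x₀))
    (hw : ∀ w : σ × List σ, w ∈ ws → s w.1 = i → t (lastLetter w.1 w.2) = i + 1 → w = (x₀, [])) :
    (h.frame s t i).HasChain 1 :=
  D.hasChain_one_of_cyclic h i hs₀ ht₀ hd hv fun w h₀ h₁ h₂ => by
    rw [hw w h₀ h₁ h₂]
    exact ⟨⟨1, (mul_one _).symm⟩, 1, (one_mul _).symm⟩

section left
variable (hs₀ : s x₀ = i) (ht₀ : t x₀ = i + 1) (hs₁ : s x₁ = i) (ht₁ : t x₁ = i)
include hs₀ ht₀ hs₁ ht₁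

theorem WordData.spans_left {z : Λ} {ws : List (σ × List σ)} (D : WordData z ws)
    {d : ℕ} (hw : ∀ w ∈ ws, s w.1 = i → t (lastLetter w.1 w.2) = i + 1 →
      ∃ l < d, 𝐰 w.1 w.2 = 𝐚 x₁ ^ l * 𝐚 x₀) :
    (h.frame s t i).Spans
      fun l : Fin d => (fun l => op (𝐚 x₁ ^ l * 𝐚 x₀)) (l : ℕ) := by
  refine D.spans h i (fun l : Fin d => 𝐚 x₁ ^ (l : ℕ) * 𝐚 x₀)
    (fun l => by rw [mul_assoc, ← ht₀, aw_mul_vt]) (fun l => ?_) (fun w hw₀ hw₁ hw₂ => ?_)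
  · cases l.1 with
    | zero => rw [pow_zero, one_mul, ← hs₀, vt_mul_aw]
    | succ k => rw [pow_succ', ← mul_assoc, ← mul_assoc, ← hs₁, vt_mul_aw]
  · obtain ⟨l, hl, e⟩ := hw w hw₀ hw₁ hw₂
    exact ⟨⟨l, hl⟩, e⟩

theorem WordData.hasChain_left_two {z : Λ} {ws : List (σ × List σ)} (D : WordData z ws)
    (hd : (h.frame s t i).LData (fun l => op (𝐚 x₁ ^ l * 𝐚 x₀)) 2)
    (hw : ∀ w : σ × List σ, w ∈ ws → s w.1 = i → t (lastLetter w.1 w.2) = i + 1 → w = (x₀, []) ∨ w = (x₁, [x₀]))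
    {y : Λ} (hy : ∀ x, y * x = x * y) (hz : 𝐚 x₁ ^ 2 * 𝐚 x₀ = y * 𝐚 x₀) :
    (h.frame s t i).HasChain 2 := by
  refine hd.hasChain2 (t := op (𝐚 x₁)) (D.nak h i)
    (D.spans_left h i hs₀ ht₀ hs₁ ht₁ fun w h₀ h₁ h₂ => ?_) ?_ (z₀ := op y) (zero_mem _) ?_
  · rcases hw w h₀ h₁ h₂ with rfl | rfl
    · exact ⟨0, by simp, by simp [word]⟩
    · exact ⟨1, by simp, by simp [word]⟩
  · simp [← op_mul]
  · rw [zero_mul, add_zero, ← op_mul, ← op_mul, pow_zero, one_mul, ← hy, ← hz, pow_one, ← mul_assoc,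
      ← sq]

theorem WordData.hasChain_left_four {z : Λ} {ws : List (σ × List σ)} (D : WordData z ws)
    (hd : (h.frame s t i).LData (fun l => op (𝐚 x₁ ^ l * 𝐚 x₀)) 3)
    (hw : ∀ w : σ × List σ, w ∈ ws → s w.1 = i → t (lastLetter w.1 w.2) = i + 1 →
      w = (x₀, []) ∨ w = (x₁, [x₀]) ∨ w = (x₁, [x₁, x₀]))
    (hz : 𝐚 x₁ ^ 3 * 𝐚 x₀ = 0) :
    (h.frame s t i).HasChain 4 := by
  refine hd.hasChain4 (t := op (𝐚 x₁)) (D.nak h i)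
    (D.spans_left h i hs₀ ht₀ hs₁ ht₁ fun w h₀ h₁ h₂ => ?_) ?_ ?_ ?_
  · rcases hw w h₀ h₁ h₂ with rfl | rfl | rfl
    · exact ⟨0, by simp, by simp [word]⟩
    · exact ⟨1, by simp, by simp [word]⟩
    · exact ⟨2, by simp, by simp [word, sq, mul_assoc]⟩
  · simp [← op_mul]
  · simp [← op_mul, sq, mul_assoc]
  · rw [← op_mul, ← mul_assoc, ← pow_succ', hz, op_zero]

end left

section right
variable (hs₀ : s x₀ = i) (ht₀ : t x₀ = i + 1) (hs₁ : s x₁ = i + 1) (ht₁ : t x₁ = i + 1)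
include hs₀ ht₀ hs₁ ht₁

theorem WordData.spans_right {z : Λ} {ws : List (σ × List σ)} (D : WordData z ws)
    {d : ℕ} (hw : ∀ w ∈ ws, s w.1 = i → t (lastLetter w.1 w.2) = i + 1 →
      ∃ l < d, 𝐰 w.1 w.2 = 𝐚 x₀ * 𝐚 x₁ ^ l) :
    (h.frame s t i).Spans
      fun l : Fin d => (fun l => op (𝐚 x₀ * 𝐚 x₁ ^ l)) (l : ℕ) := by
  refine D.spans h i (fun l : Fin d => 𝐚 x₀ * 𝐚 x₁ ^ (l : ℕ))
    (fun l => ?_) (fun l => by rw [← mul_assoc, ← hs₀, vt_mul_aw]) (fun w hw₀ hw₁ hw₂ => ?_)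
  · cases l.1 with
    | zero => rw [pow_zero, mul_one, ← ht₀, aw_mul_vt]
    | succ k => rw [pow_succ, mul_assoc, mul_assoc, ← ht₁, aw_mul_vt]
  · obtain ⟨l, hl, e⟩ := hw w hw₀ hw₁ hw₂
    exact ⟨⟨l, hl⟩, e⟩

theorem WordData.hasChain_right_two {z : Λ} {ws : List (σ × List σ)} (D : WordData z ws)
    (hd : (h.frame s t i).RData (fun l => op (𝐚 x₀ * 𝐚 x₁ ^ l)) 2)
    (hw : ∀ w : σ × List σ, w ∈ ws → s w.1 = i → t (lastLetter w.1 w.2) = i + 1 → w = (x₀, []) ∨ w = (x₀, [x₁]))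
    {y : Λ} (hy : ∀ x, y * x = x * y)
    (hz : 𝐚 x₀ * 𝐚 x₁ ^ 2 = y * 𝐚 x₀) :
    (h.frame s t i).HasChain 2 := by
  refine hd.hasChain2 (t := op (𝐚 x₁)) (D.nak h i)
    (D.spans_right h i hs₀ ht₀ hs₁ ht₁ fun w h₀ h₁ h₂ => ?_) ?_ (z₀ := op y) (op_mem_center hy)
    (zero_mem _) ?_
  · rcases hw w h₀ h₁ h₂ with rfl | rfl
    · exact ⟨0, by simp, by simp [word]⟩
    · exact ⟨1, by simp, by simp [word]⟩
  · simp [← op_mul]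
  · rw [zero_mul, add_zero, ← op_mul, ← op_mul, pow_zero, mul_one, ← hy, ← hz, pow_one, mul_assoc,
      ← sq]

theorem WordData.hasChain_right_four {z : Λ} {ws : List (σ × List σ)} (D : WordData z ws)
    (hd : (h.frame s t i).RData (fun l => op (𝐚 x₀ * 𝐚 x₁ ^ l)) 3)
    (hw : ∀ w : σ × List σ, w ∈ ws → s w.1 = i → t (lastLetter w.1 w.2) = i + 1 →
      w = (x₀, []) ∨ w = (x₀, [x₁]) ∨ w = (x₀, [x₁, x₁]))
    (hz : 𝐚 x₀ * 𝐚 x₁ ^ 3 = 0) :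
    (h.frame s t i).HasChain 4 := by
  refine hd.hasChain4 (t := op (𝐚 x₁)) (D.nak h i)
    (D.spans_right h i hs₀ ht₀ hs₁ ht₁ fun w h₀ h₁ h₂ => ?_) ?_ ?_ ?_
  · rcases hw w h₀ h₁ h₂ with rfl | rfl | rfl
    · exact ⟨0, by simp, by simp [word]⟩
    · exact ⟨1, by simp, by simp [word]⟩
    · exact ⟨2, by simp, by simp [word, sq]⟩
  · simp [← op_mul]
  · simp [← op_mul, sq, mul_assoc]
  · rw [← op_mul, mul_assoc, ← pow_succ, hz, op_zero]

end right
end main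

end quiver

theorem Trunc.T_pow (K : Type) [Field K] {d n : ℕ} (h : d ≤ n) : Trunc.T K d ^ n = 0 := by
  rw [← Nat.sub_add_cancel h, pow_add, Trunc.root_pow, mul_zero]

theorem Trunc.T_one (K : Type) [Field K] : Trunc.T K 1 = 0 := by
  simpa using Trunc.T_pow K (d := 1) le_rfl

theorem matrix_zero {A : Type} [Zero A] : !![(0 : A), 0; 0, 0] = 0 := by
  ext i j; fin_cases i <;> fin_cases j <;> rfl

theorem diag_pow {A : Type} [CommRing A] (p q : A) (n : ℕ) :
    !![p, 0; 0, q] ^ n = !![p ^ n, 0; 0, q ^ n] := by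
  induction n with
  | zero => ext i j; fin_cases i <;> fin_cases j <;> simp
  | succ n ih => rw [pow_succ, ih]; ext i j; fin_cases i <;> fin_cases j <;> simp [pow_succ]

section semigroup
variable {A : Type} [Semigroup A]

theorem reassoc₂ {a b c : A} (h : a * b = c) (x : A) : a * (b * x) = c * x := by
  rw [← h, mul_assoc]

theorem reassoc₃ {a b c d : A} (h : a * (b * c) = d) (x : A) : a * (b * (c * x)) = d * x := by
  rw [← h, mul_assoc, mul_assoc]

end semigroup

section nilpotent
variable {A : Type} [Ring A] {x y : A}

theorem isNilpotent_add (hx : IsNilpotent x) (hy : IsNilpotent y) (h : x * y = 0)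
    (h' : y * x = 0) : IsNilpotent (x + y) :=
  Commute.isNilpotent_add (h.trans h'.symm) hx hy

theorem isNilpotent_mul_swap (h : IsNilpotent (x * y)) : IsNilpotent (y * x) := by
  obtain ⟨n, hn⟩ := h
  refine ⟨n + 1, ?_⟩
  have : ∀ k, (y * x) ^ (k + 1) = y * (x * y) ^ k * x := fun k => by
    induction k with
    | zero => simp
    | succ k ih => rw [pow_succ, ih, pow_succ]; simp only [mul_assoc]
  rw [this, hn, mul_zero, zero_mul]

end nilpotent

section paths
variable {K : Type} [Field K] {σ : Type} {s t : σ → Fin 2}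
  {rels : Set (FreeAlgebra K (TPGen σ) × FreeAlgebra K (TPGen σ))}

local notation "Λ" => BoundQuiverAlgebra K σ s t rels
local notation "𝐞" => vt K s t rels
local notation "𝐚" => aw K s t rels
local notation "𝐰" => word K s t rels

theorem vt_mul_aw_ite (i : Fin 2) (x : σ) :
    𝐞 i * 𝐚 x = if i = s x then 𝐚 x else 0 := by
  split_ifs with h
  · rw [h, vt_mul_aw]
  · rw [vt_mul_aw_of_ne h]

theorem vt_mul_aw_mul_ite (i : Fin 2) (x : σ) (y : Λ) :
    𝐞 i * (𝐚 x * y) = if i = s x then 𝐚 x * y else 0 := by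
  rw [← mul_assoc, vt_mul_aw_ite, ite_mul, zero_mul]

theorem aw_mul_vt_ite (i : Fin 2) (x : σ) :
    𝐚 x * 𝐞 i = if i = t x then 𝐚 x else 0 := by
  split_ifs with h
  · rw [h, aw_mul_vt]
  · rw [aw_mul_vt_of_ne h]

theorem aw_mul_aw_mul_of_ne {x y : σ} (h : t x ≠ s y) (a : Λ) :
    𝐚 x * (𝐚 y * a) = 0 := by
  rw [← mul_assoc, aw_mul_aw_of_ne h, zero_mul]

/-- To study a bound quiver algebra, one may forget the relations, keeping their consequences. -/
theorem TauTiltingData.of_rels {N m n : ℕ} (aug : IsAug rels)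
    (h : ∀ rels', rels' = rels → IsAug rels' →
      (∀ p ∈ rels, proj K s t rels' p.1 = proj K s t rels' p.2) →
        TauTiltingData (BoundQuiverAlgebra K σ s t rels') N m n) : TauTiltingData Λ N m n :=
  h _ rfl aug fun _ hp => proj_rel hp

theorem mem_wspan_neg {z y : Λ} {w : σ × List σ}
    (h : ∃ x, y = -𝐰 w.1 w.2 + z * x) : y ∈ wspan z [w] := by
  obtain ⟨x, rfl⟩ := h
  exact add_mem (neg_mem (word_mem_wspan (List.mem_singleton_self w))) (mul_mem_wspan x)

theorem mem_wspan_self {z y : Λ} {w : σ × List σ} (c : K)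
    (h : y = c • 𝐰 w.1 w.2) : y ∈ wspan z [w] :=
  mem_wspan_singleton c ⟨0, by rw [h, mul_zero, add_zero]⟩

end paths

theorem QI.st : QI.s 0 = 0 ∧ QI.s 1 = 0 ∧ QI.t 0 = 0 ∧ QI.t 1 = 1 := by decide

theorem QB.st : QB.s 0 = 0 ∧ QB.s 1 = 0 ∧ QB.s 2 = 1 ∧ QB.t 0 = 0 ∧ QB.t 1 = 1 ∧ QB.t 2 = 1 := by
  decide

theorem QD.st : QD.s 0 = 0 ∧ QD.s 1 = 0 ∧ QD.s 2 = 1 ∧ QD.t 0 = 0 ∧ QD.t 1 = 1 ∧ QD.t 2 = 0 := by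
  decide

theorem QE.st : (QE.s 0 = 0 ∧ QE.s 1 = 1 ∧ QE.s 2 = 0 ∧ QE.s 3 = 1) ∧
    QE.t 0 = 0 ∧ QE.t 1 = 1 ∧ QE.t 2 = 1 ∧ QE.t 3 = 0 := by
  decide

section loopArrow
variable (K : Type) [Field K] [IsAlgClosed K]

local notation "𝐚" => aw K QI.s QI.t _

theorem tauTiltingData_T2 : TauTiltingData (TabT2 K) 6 1 3 := by
  refine .of_rels (by simp [IsAug, QI.al, QI.mu]) fun rels hrels aug r => ?_
  simp [QI.al, QI.mu, proj_arr] at r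
  obtain ⟨r1, r2⟩ := r
  have D : WordData (rels := rels) (𝐚 0 ^ 2) [(0, []), (1, []), (0, [1])] := by
    refine WordData.of_closed [((0, [0]), [])] (by decide) ?_ (by decide)
      ⟨3, by rw [← pow_mul, r1]⟩ ?_ ?_
    · simp only [List.forall_mem_cons, List.not_mem_nil, false_imp_iff, implies_true, and_true, word]
      exact mem_wspan_nil ⟨1, by simp [sq]⟩
    · simp [sq, mul_assoc, aw_mul_vt_ite, vt_mul_aw_mul_ite, QI.st]
    · simp [Fin.forall_fin_two, (pow_mul_comm' _ _).symm, r2]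
      simp [sq, aw_mul_aw_mul_of_ne, QI.st]
  refine D.tauTiltingData aug 1 (m := 0) (n := 2) (D.hasChain_zero _ _ (by decide)) ?_
  refine D.hasChain_left_two aug _ (x₀ := 1) (x₁ := 0) rfl rfl rfl rfl
    (lData _ _ (by decide) rfl rfl rfl rfl ?_) (by decide) (y := 0) (by simp) ?_
  · simp [hrels, QI.al, QI.mu, repA, diag_pow, Trunc.T_pow, matrix_zero]
  · rw [r2, zero_mul]

end loopArrow

section twoLoops
variable (K : Type) [Field K] [IsAlgClosed K]

local notation "𝐞" => vt K QB.s QB.t _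
local notation "𝐚" => aw K QB.s QB.t _
local notation "Λ" => BoundQuiverAlgebra K (Fin 3) QB.s QB.t

theorem tauTiltingData_T4 (n : ℕ) (hn : 2 ≤ n) : TauTiltingData (TabT4 K n) 6 1 3 := by
  have hn0 : n ≠ 0 := by omega
  refine .of_rels (by simp [IsAug, QB.al, QB.mu, QB.be, hn0]) fun rels hrels aug r => ?_
  simp [QB.al, QB.mu, QB.be, proj_arr, sq] at r
  obtain ⟨r1, r2, r3⟩ := r
  have D : WordData (rels := rels) (𝐚 2) [(0, []), (2, []), (1, []), (0, [1])] := by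
    refine WordData.of_closed [((0, [0]), []), ((2, [2]), []), ((1, [2]), []), ((0, [1, 2]), [])]
      (by decide) ?_ (by decide) ⟨n, r2⟩ ?_ ?_
    · simp only [List.forall_mem_cons, List.not_mem_nil, false_imp_iff, implies_true, and_true, word,
        r1, r3, mul_zero, zero_mem, true_and]
      exact mem_wspan_nil ⟨_, rfl⟩
    · simp [vt_mul_aw_ite, aw_mul_vt_ite, QB.st]
    · simp [Fin.forall_fin_succ, r3, aw_mul_aw_of_ne, QB.st]
  refine D.tauTiltingData aug 1 (m := 0) (n := 2) (D.hasChain_zero _ _ (by decide)) ?_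
  refine D.hasChain_left_two aug _ (x₀ := 1) (x₁ := 0) rfl rfl rfl rfl
    (lData _ _ (by decide) rfl rfl rfl rfl ?_) (by decide) (y := 0) (by simp) ?_
  · simp [hrels, QB.al, QB.mu, QB.be, repA, diag_pow, Trunc.T_pow, matrix_zero, hn0]
  · rw [sq, r1, zero_mul]

theorem tauTiltingData_T5 (m n : ℕ) (hm : 2 ≤ m) (hn : 2 ≤ n) :
    TauTiltingData (TabT5 K m n) 5 1 2 := by
  have hm0 : m ≠ 0 := by omega
  have hn0 : n ≠ 0 := by omega
  refine .of_rels (by simp [IsAug, QB.al, QB.mu, QB.be, hm0, hn0]) fun rels hrels aug r => ?_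
  simp [QB.al, QB.mu, QB.be, proj_arr] at r
  obtain ⟨r1, r2, r3, r4⟩ := r
  have D : WordData (rels := rels) (𝐚 0 + 𝐚 2)
      [(0, []), (2, []), (1, [])] := by
    refine WordData.of_closed [((0, [0]), []), ((0, [1]), []), ((2, [2]), []), ((1, [2]), [])]
      (by decide) ?_ (by decide) (isNilpotent_add ⟨m, r1⟩ ⟨n, r2⟩ (aw_mul_aw_of_ne (by decide))
        (aw_mul_aw_of_ne (by decide))) ?_ ?_
    · simp only [List.forall_mem_cons, List.not_mem_nil, false_imp_iff, implies_true, and_true, word,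
        r3, r4, zero_mem, true_and]
      exact ⟨mem_wspan_nil ⟨𝐚 0, by simp [add_mul, aw_mul_aw_of_ne, QB.st]⟩,
        mem_wspan_nil ⟨𝐚 2, by simp [add_mul, aw_mul_aw_of_ne, QB.st]⟩⟩
    · simp [vt_mul_aw_ite, aw_mul_vt_ite, add_mul, mul_add, QB.st]
    · simp [Fin.forall_fin_succ, r3, r4, aw_mul_aw_of_ne, add_mul, mul_add, QB.st]
  refine D.tauTiltingData aug 1 (m := 0) (n := 1) (D.hasChain_zero _ _ (by decide)) ?_
  refine D.hasChain_one aug _ (x₀ := 1) rfl rfl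
    (lData (x₀ := 1) (x₁ := 0) _ _ (by decide) rfl rfl rfl rfl ?_) (by simp) (by decide)
  simp [hrels, QB.al, QB.mu, QB.be, repA, Trunc.T_one, matrix_zero, hm0, hn0]

theorem tauTiltingData_of_commute (m n : ℕ) (hm : 2 ≤ m) (hn : 2 ≤ n) :
    TauTiltingData (BoundQuiverAlgebra K (Fin 3) QB.s QB.t
      {(QB.al K ^ m, 0), (QB.be K ^ n, 0), (QB.al K * QB.mu K, QB.mu K * QB.be K)}) 5 1 2 := by
  have hm0 : m ≠ 0 := by omega
  have hn0 : n ≠ 0 := by omega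
  refine .of_rels (by simp [IsAug, QB.al, QB.mu, QB.be, hm0, hn0]) fun rels hrels aug r => ?_
  simp [QB.al, QB.mu, QB.be, proj_arr] at r
  obtain ⟨r1, r2, r3⟩ := r
  have D : WordData (rels := rels) (𝐚 0 + 𝐚 2)
      [(0, []), (2, []), (1, [])] := by
    refine WordData.of_closed [((0, [0]), []), ((0, [1]), []), ((2, [2]), []), ((1, [2]), [])]
      (by decide) ?_ (by decide) (isNilpotent_add ⟨m, r1⟩ ⟨n, r2⟩ (aw_mul_aw_of_ne (by decide))
        (aw_mul_aw_of_ne (by decide))) ?_ ?_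
    · simp only [List.forall_mem_cons, List.not_mem_nil, false_imp_iff, implies_true, and_true, word,
        ← r3]
      refine ⟨mem_wspan_nil ⟨𝐚 0, ?_⟩, mem_wspan_nil ⟨𝐚 1, ?_⟩,
        mem_wspan_nil ⟨𝐚 2, ?_⟩, mem_wspan_nil ⟨𝐚 1, ?_⟩⟩ <;>
      simp [add_mul, aw_mul_aw_of_ne, QB.st]
    · simp [vt_mul_aw_ite, aw_mul_vt_ite, add_mul, mul_add, QB.st]
    · simp [Fin.forall_fin_succ, r3, aw_mul_aw_of_ne, add_mul, mul_add, QB.st]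
  refine D.tauTiltingData aug 1 (m := 0) (n := 1) (D.hasChain_zero _ _ (by decide)) ?_
  refine D.hasChain_one aug _ (x₀ := 1) rfl rfl
    (lData (x₀ := 1) (x₁ := 0) _ _ (by decide) rfl rfl rfl rfl ?_) (by simp) (by decide)
  simp [hrels, QB.al, QB.mu, QB.be, repA, Trunc.T_one, matrix_zero, hm0, hn0]

theorem tauTiltingData_T6 : TauTiltingData (TabT6 K) 6 1 3 := by
  refine .of_rels (by simp [IsAug, QB.al, QB.mu, QB.be]) fun rels hrels aug r => ?_
  simp [QB.al, QB.mu, QB.be, proj_arr] at r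
  obtain ⟨r1, r2, r3⟩ := r
  have hc : ∀ i, ((𝐚 0 + 𝐚 2 ^ 2) * 𝐞 i : Λ rels) = 𝐞 i * (𝐚 0 + 𝐚 2 ^ 2) := by
    simp [vt_mul_aw_ite, aw_mul_vt_ite, vt_mul_aw_mul_ite, mul_assoc, sq, add_mul,
      mul_add, QB.st]
  have ha : ∀ x, ((𝐚 0 + 𝐚 2 ^ 2) * 𝐚 x : Λ rels) = 𝐚 x * (𝐚 0 + 𝐚 2 ^ 2) := by
    simp [Fin.forall_fin_succ, r3, sq, mul_assoc, aw_mul_aw_of_ne, aw_mul_aw_mul_of_ne, add_mul,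
      mul_add, QB.st]
  have D : WordData (rels := rels) (𝐚 0 + 𝐚 2 ^ 2)
      [(0, []), (2, []), (1, []), (1, [2])] := by
    refine WordData.of_closed [((0, [0]), []), ((0, [1]), []), ((2, [2]), []), ((1, [2, 2]), [])]
      (by decide) ?_ (by decide) (isNilpotent_add ⟨2, r1⟩ ⟨2, ?_⟩ ?_ ?_) hc ha
    · simp only [List.forall_mem_cons, List.not_mem_nil, false_imp_iff, implies_true, and_true, word,
        ← sq, r1, ← r3, zero_mem, true_and]
      refine ⟨mem_wspan_nil ⟨𝐚 1, ?_⟩,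
        mem_wspan_nil ⟨𝐞 1, ?_⟩, mem_wspan_nil ⟨𝐚 1, ?_⟩⟩ <;>
      simp [sq, mul_assoc, add_mul, aw_mul_vt_ite, aw_mul_aw_of_ne, QB.st]
    · rw [← pow_mul, show 2 * 2 = 3 + 1 from rfl, pow_succ, r2, zero_mul]
    · rw [sq, aw_mul_aw_mul_of_ne (by decide)]
    · rw [sq, mul_assoc, aw_mul_aw_of_ne (by decide), mul_zero]
  refine D.tauTiltingData aug 1 (m := 0) (n := 2) (D.hasChain_zero _ _ (by decide)) ?_
  refine D.hasChain_right_two aug _ (x₀ := 1) (x₁ := 2) rfl rfl rfl rfl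
    (rData _ _ (by decide) rfl rfl rfl rfl ?_) (by decide) (central_of hc ha) ?_
  · simp [hrels, QB.al, QB.mu, QB.be, repA, diag_pow, Trunc.T_pow, matrix_zero]
  · rw [← r3, add_mul, sq, mul_assoc, aw_mul_aw_of_ne (x := 2) (y := 1) (by decide), mul_zero, add_zero]

end twoLoops

section twoCycle
variable (K : Type) [Field K] [IsAlgClosed K]

local notation "𝐞" => vt K QD.s QD.t _
local notation "𝐚" => aw K QD.s QD.t _
local notation "Λ" => BoundQuiverAlgebra K (Fin 3) QD.s QD.t

theorem tauTiltingData_T9 (n : ℕ) (hn : 1 ≤ n) : TauTiltingData (TabT9 K n) 8 3 3 := by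
  have hn0 : n ≠ 0 := by omega
  refine .of_rels (by simp [IsAug, QD.al, QD.mu, QD.nu, hn0]) fun rels hrels aug r => ?_
  simp [QD.al, QD.mu, QD.nu, proj_arr, sq, mul_assoc] at r
  obtain ⟨r1, r2, r3, r4⟩ := r
  have r1' := reassoc₂ r1
  have r3' := reassoc₃ r3
  have n3 : IsNilpotent (𝐚 2 * (𝐚 0 * 𝐚 1) : Λ rels) :=
    ⟨n, r4⟩
  have n1 := isNilpotent_mul_swap n3
  have n2 := isNilpotent_mul_swap (mul_assoc (𝐚 2) _ _ ▸ n3)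
  rw [mul_assoc] at n1
  have D : WordData (rels := rels) (𝐚 0 * (𝐚 1 * 𝐚 2) +
      𝐚 1 * (𝐚 2 * 𝐚 0) +
      𝐚 2 * (𝐚 0 * 𝐚 1))
      [(0, []), (1, []), (2, []), (0, [1]), (1, [2]), (2, [0]), (2, [1]), (0, [1, 2])] := by
    refine WordData.of_closed [((0, [0]), []), ((1, [2, 0]), [(0, [1, 2])]), ((1, [2, 1]), []),
      ((2, [0, 0]), []), ((2, [0, 1]), []), ((2, [1, 2]), []), ((0, [1, 2, 0]), []),
      ((0, [1, 2, 1]), [])] (by decide) ?_ (by decide) (isNilpotent_add (isNilpotent_add n1 n2 ?_ ?_)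
        n3 ?_ ?_) ?_ ?_
    · simp only [List.forall_mem_cons, List.not_mem_nil, false_imp_iff, implies_true, and_true, word,
        r1, r2, r3, mul_zero, zero_mem, true_and]
      refine ⟨mem_wspan_neg ⟨𝐞 0, ?_⟩,
        mem_wspan_nil ⟨𝐞 1, ?_⟩, mem_wspan_nil ⟨𝐚 0, ?_⟩⟩ <;>
      simp [word, mul_assoc, add_mul, aw_mul_vt_ite, aw_mul_aw_of_ne, r1, QD.st]
    all_goals simp [Fin.forall_fin_succ, mul_assoc, add_mul, mul_add, aw_mul_vt_ite, vt_mul_aw_mul_ite,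
      aw_mul_aw_of_ne, aw_mul_aw_mul_of_ne, r1, r1', r2, r3', QD.st]
  refine D.tauTiltingData aug 0 (m := 2) (n := 2)
    (D.hasChain_left_two aug _ (x₀ := 1) (x₁ := 0) rfl rfl rfl rfl
      (lData _ _ (by decide) rfl rfl rfl rfl ?_) (by decide) (y := 0) (by simp) ?_)
    (D.hasChain_right_two aug _ (x₀ := 2) (x₁ := 0) rfl rfl rfl rfl
      (rData _ _ (by decide) rfl rfl rfl rfl ?_) (by decide) (y := 0) (by simp) ?_)
  · simp [hrels, QD.al, QD.mu, QD.nu, repA, diag_pow, Trunc.T_pow, matrix_zero, hn0]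
  · rw [sq, r1, zero_mul]
  · simp [hrels, QD.al, QD.mu, QD.nu, repA, diag_pow, Trunc.T_pow, matrix_zero, hn0]
  · rw [sq, r1, mul_zero, zero_mul]

theorem tauTiltingData_T10 : TauTiltingData (TabT10 K) 12 5 5 := by
  refine .of_rels (by simp [IsAug, QD.al, QD.mu, QD.nu]) fun rels hrels aug r => ?_
  simp [QD.al, QD.mu, QD.nu, proj_arr, mul_assoc] at r
  obtain ⟨r1, r2, r3, r4⟩ := r
  have r1' := r1
  rw [pow_succ, sq, mul_assoc] at r1'
  have D : WordData (0 : Λ rels)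
      [(0, []), (1, []), (2, []), (0, [0]), (0, [1]), (2, [0]), (0, [0, 1]), (2, [0, 0]),
        (2, [0, 0, 1])] := by
    refine WordData.of_closed [((1, [2]), []), ((2, [1]), []), ((0, [0, 0]), []), ((0, [1, 2]), []),
      ((2, [0, 1]), []), ((0, [0, 1, 2]), []), ((2, [0, 0, 0]), []), ((2, [0, 0, 1, 2]), [])]
      (by decide) ?_ (by decide) IsNilpotent.zero (by simp) (by simp)
    simp [word, r1', r2, r3, r4]
  refine D.tauTiltingData aug 0 (m := 4) (n := 4)
    (D.hasChain_left_four aug _ (x₀ := 1) (x₁ := 0) rfl rfl rfl rfl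
      (lData _ _ (by decide) rfl rfl rfl rfl ?_) (by decide) ?_)
    (D.hasChain_right_four aug _ (x₀ := 2) (x₁ := 0) rfl rfl rfl rfl
      (rData _ _ (by decide) rfl rfl rfl rfl ?_) (by decide) ?_)
  · simp [hrels, QD.al, QD.mu, QD.nu, repA, diag_pow, Trunc.T_pow, matrix_zero]
  · rw [r1, zero_mul]
  · simp [hrels, QD.al, QD.mu, QD.nu, repA, diag_pow, Trunc.T_pow, matrix_zero]
  · rw [r1, mul_zero]

theorem tauTiltingData_T13 (m n : ℕ) (hm : 2 ≤ m) (hn : 1 ≤ n) :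
    TauTiltingData (TabT13 K m n) 6 2 2 := by
  have hm0 : m ≠ 0 := by omega
  have hn0 : n ≠ 0 := by omega
  refine .of_rels (by simp [IsAug, QD.al, QD.mu, QD.nu, hm0, hn0]) fun rels hrels aug r => ?_
  simp [QD.al, QD.mu, QD.nu, proj_arr] at r
  obtain ⟨r1, r2, r3, r4⟩ := r
  have r3' := reassoc₂ r3
  have n1 : IsNilpotent (𝐚 1 * 𝐚 2 : Λ rels) := ⟨n, r4⟩
  have D : WordData (rels := rels) (𝐚 0 + 𝐚 1 * 𝐚 2 +
      𝐚 2 * 𝐚 1) [(1, []), (2, []), (0, [])] := by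
    refine WordData.of_closed [((1, [2]), [(0, [])]), ((2, [0]), []), ((2, [1]), []), ((0, [0]), []),
      ((0, [1]), [])] (by decide) ?_ (by decide) (isNilpotent_add (isNilpotent_add ⟨m, r1⟩ n1 ?_ ?_)
        (isNilpotent_mul_swap n1) ?_ ?_) ?_ ?_
    · simp only [List.forall_mem_cons, List.not_mem_nil, false_imp_iff, implies_true, and_true, word,
        r2, r3, zero_mem, true_and]
      refine ⟨mem_wspan_neg ⟨𝐞 0, ?_⟩,
        mem_wspan_nil ⟨𝐞 1, ?_⟩, mem_wspan_nil ⟨𝐚 0, ?_⟩⟩ <;>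
      simp [word, mul_assoc, add_mul, aw_mul_vt_ite, aw_mul_aw_of_ne, r2, QD.st]
    all_goals simp [Fin.forall_fin_succ, mul_assoc, add_mul, mul_add, vt_mul_aw_ite, aw_mul_vt_ite,
      vt_mul_aw_mul_ite, aw_mul_aw_of_ne, aw_mul_aw_mul_of_ne, r2, r3, r3', QD.st]
  refine D.tauTiltingData aug 0 (m := 1) (n := 1)
    (D.hasChain_one aug _ (x₀ := 1) rfl rfl (lData (x₀ := 1) (x₁ := 0) _ _ (by decide) rfl rfl rfl rfl ?_)
      (by simp) (by decide))
    (D.hasChain_one aug _ (x₀ := 2) rfl rfl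
      (rData (x₀ := 2) (x₁ := 0) _ _ (by decide) rfl rfl rfl rfl ?_).lData_one (by simp) (by decide))
  all_goals simp [hrels, QD.al, QD.mu, QD.nu, repA, Trunc.T_one, matrix_zero, hm0, hn0]

theorem tauTiltingData_T11 : TauTiltingData (TabT11 K) 8 3 3 := by
  refine .of_rels (by simp [IsAug, QD.al, QD.mu, QD.nu]) fun rels hrels aug r => ?_
  simp [QD.al, QD.mu, QD.nu, proj_arr, pow_succ, mul_assoc] at r
  obtain ⟨r1, r2, r3, r4⟩ := r
  have r3' := reassoc₃ r3
  have h5 : (𝐚 0 * (𝐚 0 * (𝐚 0 * (𝐚 0 * 𝐚 0))) : Λ rels) = 0 := by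
    rw [r1, reassoc₃ r4, zero_mul]
  have D : WordData (0 : Λ rels)
      [(0, []), (1, []), (2, []), (0, [0]), (0, [1]), (2, [0]), (0, [0, 0]), (2, [0, 1]), (0, [0, 0, 0])] := by
    refine WordData.of_closed [((1, [2]), [(0, [0, 0])]), ((2, [1]), []), ((0, [0, 1]), []),
      ((0, [1, 2]), [(0, [0, 0, 0])]), ((2, [0, 0]), []), ((0, [0, 0, 1]), []), ((2, [0, 1, 2]), []),
      ((0, [0, 0, 0, 0]), []), ((0, [0, 0, 0, 1]), [])]
      (by decide) ?_ (by decide) IsNilpotent.zero (by simp) (by simp)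
    simp only [List.forall_mem_cons, List.not_mem_nil, false_imp_iff, implies_true, and_true, word,
      ← r1, r2, r3, r3', r4, h5, zero_mul, mul_zero, zero_mem, true_and]
    exact ⟨word_mem_wspan (List.mem_singleton_self _), word_mem_wspan (List.mem_singleton_self _)⟩
  refine D.tauTiltingData aug 0 (m := 2) (n := 2)
    (D.hasChain_left_two aug _ (x₀ := 1) (x₁ := 0) rfl rfl rfl rfl
      (lData _ _ (by decide) rfl rfl rfl rfl ?_) (by decide) (y := 0) (by simp) ?_)
    (D.hasChain_right_two aug _ (x₀ := 2) (x₁ := 0) rfl rfl rfl rfl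
      (rData _ _ (by decide) rfl rfl rfl rfl ?_) (by decide) (y := 0) (by simp) ?_)
  · simp [hrels, QD.al, QD.mu, QD.nu, repA, diag_pow, Trunc.T_pow, matrix_zero]
  · rw [sq, mul_assoc, r4, zero_mul]
  · simp [hrels, QD.al, QD.mu, QD.nu, repA, diag_pow, Trunc.T_pow, matrix_zero]
  · rw [sq, r3, zero_mul]

theorem tauTiltingData_T12 : TauTiltingData (TabT12 K) 7 2 3 := by
  refine .of_rels (by simp [IsAug, QD.al, QD.mu, QD.nu]) fun rels hrels aug r => ?_
  simp [QD.al, QD.mu, QD.nu, proj_arr, pow_succ, mul_assoc] at r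
  obtain ⟨r1, r2, r3⟩ := r
  have h5 : (𝐚 0 * (𝐚 0 * (𝐚 0 * (𝐚 0 * 𝐚 0))) : Λ rels) = 0 := by
    have := congrArg (· * 𝐚 0) r1
    simpa only [mul_assoc, r2, mul_zero] using this
  have D : WordData (0 : Λ rels)
      [(0, []), (1, []), (2, []), (0, [0]), (0, [1]), (2, [1]), (0, [0, 0]), (0, [0, 0, 0])] := by
    refine WordData.of_closed [((1, [2]), [(0, [0, 0, 0])]), ((2, [0]), []), ((0, [0, 1]), []), ((0, [1, 2]), []),
      ((2, [1, 2]), []), ((0, [0, 0, 1]), []), ((0, [0, 0, 0, 0]), []), ((0, [0, 0, 0, 1]), [])]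
      (by decide) ?_ (by decide) IsNilpotent.zero (by simp) (by simp)
    simp only [List.forall_mem_cons, List.not_mem_nil, false_imp_iff, implies_true, and_true, word,
      ← r1, r2, reassoc₂ r2, r3, h5, zero_mul, mul_zero, zero_mem]
    exact word_mem_wspan (List.mem_singleton_self _)
  refine D.tauTiltingData aug 1 (m := 1) (n := 2)
    (D.hasChain_one aug _ (x₀ := 2) rfl rfl
      (rData (x₀ := 2) (x₁ := 0) _ _ (by decide) rfl rfl rfl rfl ?_).lData_one (by simp) (by decide))
    (D.hasChain_left_two aug _ (x₀ := 1) (x₁ := 0) rfl rfl rfl rfl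
      (lData _ _ (by decide) rfl rfl rfl rfl ?_) (by decide) (y := 0) (by simp) ?_)
  · simp [hrels, QD.al, QD.mu, QD.nu, repA, Trunc.T_one, matrix_zero]
  · simp [hrels, QD.al, QD.mu, QD.nu, repA, diag_pow, Trunc.T_pow, matrix_zero]
  · rw [sq, mul_assoc, r3, zero_mul]

theorem tauTiltingData_T15 : TauTiltingData (TabT15 K) 7 2 3 := by
  refine .of_rels (by simp [IsAug, QD.al, QD.mu, QD.nu]) fun rels hrels aug r => ?_
  simp [QD.al, QD.mu, QD.nu, proj_arr, pow_succ, mul_assoc] at r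
  obtain ⟨r1, r2, r3⟩ := r
  have h5 : (𝐚 0 * (𝐚 0 * (𝐚 0 * 𝐚 0)) : Λ rels) = 0 := by
    have := congrArg (· * 𝐚 0) r1
    simpa only [mul_assoc, r2, mul_zero] using this
  have D : WordData (0 : Λ rels)
      [(0, []), (1, []), (2, []), (0, [0]), (0, [1]), (2, [1]), (0, [0, 0])] := by
    refine WordData.of_closed [((1, [2]), [(0, [0, 0])]), ((2, [0]), []), ((0, [0, 1]), []), ((0, [1, 2]), []),
      ((2, [1, 2]), []), ((0, [0, 0, 0]), []), ((0, [0, 0, 1]), [])]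
      (by decide) ?_ (by decide) IsNilpotent.zero (by simp) (by simp)
    simp only [List.forall_mem_cons, List.not_mem_nil, false_imp_iff, implies_true, and_true, word,
      ← r1, r2, reassoc₂ r2, r3, h5, zero_mul, mul_zero, zero_mem]
    exact word_mem_wspan (List.mem_singleton_self _)
  refine D.tauTiltingData aug 1 (m := 1) (n := 2)
    (D.hasChain_one aug _ (x₀ := 2) rfl rfl
      (rData (x₀ := 2) (x₁ := 0) _ _ (by decide) rfl rfl rfl rfl ?_).lData_one (by simp) (by decide))
    (D.hasChain_left_two aug _ (x₀ := 1) (x₁ := 0) rfl rfl rfl rfl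
      (lData _ _ (by decide) rfl rfl rfl rfl ?_) (by decide) (y := 0) (by simp) ?_)
  · simp [hrels, QD.al, QD.mu, QD.nu, repA, Trunc.T_one, matrix_zero]
  · simp [hrels, QD.al, QD.mu, QD.nu, repA, diag_pow, Trunc.T_pow, matrix_zero]
  · rw [sq, mul_assoc, r3, zero_mul]

theorem tauTiltingData_T16 : TauTiltingData (TabT16 K) 9 2 5 := by
  refine .of_rels (by simp [IsAug, QD.al, QD.mu, QD.nu]) fun rels hrels aug r => ?_
  simp [QD.al, QD.mu, QD.nu, proj_arr, pow_succ, mul_assoc] at r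
  obtain ⟨r1, r2, r3⟩ := r
  have h5 : (𝐚 0 * (𝐚 0 * (𝐚 0 * 𝐚 0)) : Λ rels) = 0 := by
    have := congrArg (· * 𝐚 0) r1
    simpa only [mul_assoc, r2, mul_zero] using this
  have h3 : (𝐚 0 * (𝐚 0 * (𝐚 0 * 𝐚 1)) : Λ rels) = 0 := by
    have := congrArg (· * 𝐚 1) r1
    simpa only [mul_assoc, r3, mul_zero] using this
  have D : WordData (0 : Λ rels)
      [(0, []), (1, []), (2, []), (0, [0]), (0, [1]), (0, [0, 0]), (0, [0, 1])] := by
    refine WordData.of_closed [((1, [2]), [(0, [0, 0])]), ((2, [0]), []), ((2, [1]), []), ((0, [1, 2]), []),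
      ((0, [0, 0, 0]), []), ((0, [0, 0, 1]), []), ((0, [0, 1, 2]), [])]
      (by decide) ?_ (by decide) IsNilpotent.zero (by simp) (by simp)
    simp only [List.forall_mem_cons, List.not_mem_nil, false_imp_iff, implies_true, and_true, word,
      ← r1, r2, r3, h3, h5, mul_zero, zero_mem]
    exact word_mem_wspan (List.mem_singleton_self _)
  refine D.tauTiltingData aug 1 (m := 1) (n := 4)
    (D.hasChain_one aug _ (x₀ := 2) rfl rfl
      (rData (x₀ := 2) (x₁ := 0) _ _ (by decide) rfl rfl rfl rfl ?_).lData_one (by simp) (by decide))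
    (D.hasChain_left_four aug _ (x₀ := 1) (x₁ := 0) rfl rfl rfl rfl
      (lData _ _ (by decide) rfl rfl rfl rfl ?_) (by decide) ?_)
  · simp [hrels, QD.al, QD.mu, QD.nu, repA, Trunc.T_one, matrix_zero]
  · simp [hrels, QD.al, QD.mu, QD.nu, repA, diag_pow, Trunc.T_pow, matrix_zero]
  · simpa only [pow_succ, pow_zero, one_mul, mul_assoc] using h3

theorem tauTiltingData_T14 : TauTiltingData (TabT14 K) 8 3 3 := by
  refine .of_rels (by simp [IsAug, QD.al, QD.mu, QD.nu]) fun rels hrels aug r => ?_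
  simp [QD.al, QD.mu, QD.nu, proj_arr, pow_succ, mul_assoc] at r
  obtain ⟨r1, r2⟩ := r
  have r1' := reassoc₂ r1.symm
  have h3 : (𝐚 0 * (𝐚 0 * (𝐚 0 * 𝐚 1)) : Λ rels) = 0 := by
    rw [reassoc₂ r1, mul_assoc, r2, mul_zero]
  have h5 : (𝐚 0 * (𝐚 0 * (𝐚 0 * (𝐚 0 * 𝐚 0))) : Λ rels) = 0 := by
    have := congrArg (· * 𝐚 2) h3
    simpa only [mul_assoc, ← r1, zero_mul] using this
  have hv : ∀ i, ((𝐚 0 * 𝐚 0 + 𝐚 2 * 𝐚 1) * 𝐞 i : Λ rels) = 𝐞 i * (𝐚 0 * 𝐚 0 + 𝐚 2 * 𝐚 1) := by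
    simp [mul_assoc, add_mul, mul_add, aw_mul_vt_ite, vt_mul_aw_mul_ite, QD.st]
  have ha : ∀ x, ((𝐚 0 * 𝐚 0 + 𝐚 2 * 𝐚 1) * 𝐚 x : Λ rels) = 𝐚 x * (𝐚 0 * 𝐚 0 + 𝐚 2 * 𝐚 1) := by
    simp [Fin.forall_fin_succ, mul_assoc, add_mul, mul_add, aw_mul_aw_of_ne, aw_mul_aw_mul_of_ne, r1',
      ← r1, QD.st]
  have D : WordData (rels := rels) (𝐚 0 * 𝐚 0 + 𝐚 2 * 𝐚 1)
      [(1, []), (2, []), (0, []), (0, [1]), (2, [0])] := by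
    refine WordData.of_closed [((1, [2]), []), ((2, [1]), []), ((0, [0]), []), ((0, [1, 2]), []),
      ((2, [0, 0]), []), ((2, [0, 1]), [])] (by decide) ?_ (by decide)
      (isNilpotent_add ⟨3, ?_⟩ ⟨3, ?_⟩ ?_ ?_) hv ha
    · simp only [List.forall_mem_cons, List.not_mem_nil, false_imp_iff, implies_true, and_true, word,
        ← r1, r2, zero_mem]
      refine ⟨mem_wspan_nil ⟨𝐞 0, ?_⟩, mem_wspan_nil ⟨𝐞 1, ?_⟩,
        mem_wspan_nil ⟨𝐞 0, ?_⟩, mem_wspan_nil ⟨𝐚 0, ?_⟩,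
        mem_wspan_nil ⟨𝐚 2, ?_⟩⟩ <;>
      simp [mul_assoc, add_mul, aw_mul_vt_ite, aw_mul_aw_of_ne, ← r1, QD.st]
    all_goals simp [pow_succ, mul_assoc, aw_mul_aw_mul_of_ne, r1', h3, h5, QD.st]
  have hz := central_of hv ha
  refine D.tauTiltingData aug 0 (m := 2) (n := 2)
    (D.hasChain_left_two aug _ (x₀ := 1) (x₁ := 0) rfl rfl rfl rfl
      (lData _ _ (by decide) rfl rfl rfl rfl ?_) (by decide) hz ?_)
    (D.hasChain_right_two aug _ (x₀ := 2) (x₁ := 0) rfl rfl rfl rfl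
      (rData _ _ (by decide) rfl rfl rfl rfl ?_) (by decide) hz ?_)
  · simp [hrels, QD.al, QD.mu, QD.nu, repA, diag_pow, Trunc.T_pow, matrix_zero]
  · simp [sq, add_mul, mul_assoc, aw_mul_aw_of_ne, QD.st]
  · simp [hrels, QD.al, QD.mu, QD.nu, repA, diag_pow, Trunc.T_pow, matrix_zero]
  · simp [sq, add_mul, mul_assoc, aw_mul_aw_of_ne, ← r1, QD.st]

end twoCycle

section twoCycleTwoLoops
variable (K : Type) [Field K] [IsAlgClosed K]

local notation "𝐞" => vt K QE.s QE.t _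
local notation "𝐚" => aw K QE.s QE.t _
local notation "Λ" => BoundQuiverAlgebra K (Fin 4) QE.s QE.t

theorem tauTiltingData_T18 (m n : ℕ) (hm : 2 ≤ m) (hn : 1 ≤ n) :
    TauTiltingData (TabT18 K m n) 8 3 3 := by
  have hm0 : m ≠ 0 := by omega
  have hn0 : n ≠ 0 := by omega
  refine .of_rels (by simp [IsAug, QE.al, QE.be, QE.mu, QE.nu, hm0, hn0]) fun rels hrels aug r => ?_
  simp [QE.al, QE.be, QE.mu, QE.nu, proj_arr, sq, mul_assoc] at r
  obtain ⟨r1, r2, r3, r4, r5, r6⟩ := r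
  have r1' := reassoc₂ r1
  have r3' := reassoc₂ r3
  have r5' := reassoc₂ r5
  have n3 : IsNilpotent (𝐚 3 * (𝐚 0 * 𝐚 2) : Λ rels) :=
    ⟨n, r6⟩
  have n1 := isNilpotent_mul_swap n3
  have n2 := isNilpotent_mul_swap (mul_assoc (𝐚 3) _ _ ▸ n3)
  rw [mul_assoc] at n1
  have D : WordData (rels := rels) (𝐚 0 * (𝐚 2 * 𝐚 3) +
      𝐚 2 * (𝐚 3 * 𝐚 0) +
      𝐚 3 * (𝐚 0 * 𝐚 2) +
      𝐚 1)
      [(0, []), (2, []), (3, []), (0, [2]), (2, [3]), (3, [0]), (1, []), (0, [2, 3])] := by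
    refine WordData.of_closed [((0, [0]), []), ((2, [1]), []), ((3, [2]), []), ((0, [2, 1]), []),
      ((2, [3, 0]), [(0, [2, 3])]), ((2, [3, 2]), []), ((3, [0, 0]), []), ((3, [0, 2]), [(1, [])]),
      ((1, [1]), []), ((1, [3]), []), ((0, [2, 3, 0]), []), ((0, [2, 3, 2]), [])]
      (by decide) ?_ (by decide) (isNilpotent_add (isNilpotent_add (isNilpotent_add n1 n2 ?_ ?_)
        n3 ?_ ?_) ⟨m, r2⟩ ?_ ?_) ?_ ?_
    · simp only [List.forall_mem_cons, List.not_mem_nil, false_imp_iff, implies_true, and_true, word,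
        r1, r3, r4, r5, mul_zero, zero_mem, true_and]
      refine ⟨mem_wspan_neg ⟨𝐞 0, ?_⟩, mem_wspan_neg ⟨𝐞 1, ?_⟩,
        mem_wspan_nil ⟨𝐚 1, ?_⟩, mem_wspan_nil ⟨𝐚 0, ?_⟩⟩ <;>
      simp [word, mul_assoc, add_mul, aw_mul_vt_ite, aw_mul_aw_of_ne, r1, r4, QE.st]
    all_goals simp [Fin.forall_fin_succ, mul_assoc, add_mul, mul_add, vt_mul_aw_ite, aw_mul_vt_ite,
      vt_mul_aw_mul_ite, aw_mul_aw_of_ne, aw_mul_aw_mul_of_ne, r1, r1', r3, r3', r4, r5, r5', QE.st]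
  refine D.tauTiltingData aug 0 (m := 2) (n := 2)
    (D.hasChain_left_two aug _ (x₀ := 2) (x₁ := 0) rfl rfl rfl rfl
      (lData _ _ (by decide) rfl rfl rfl rfl ?_) (by decide) (y := 0) (by simp) ?_)
    (D.hasChain_right_two aug _ (x₀ := 3) (x₁ := 0) rfl rfl rfl rfl
      (rData _ _ (by decide) rfl rfl rfl rfl ?_) (by decide) (y := 0) (by simp) ?_)
  · simp [hrels, QE.al, QE.be, QE.mu, QE.nu, repA, diag_pow, Trunc.T_pow, matrix_zero, hm0, hn0]
  · rw [sq, r1, zero_mul]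
  · simp [hrels, QE.al, QE.be, QE.mu, QE.nu, repA, diag_pow, Trunc.T_pow, matrix_zero, hm0, hn0]
  · rw [sq, r1, mul_zero, zero_mul]

theorem tauTiltingData_T19 (m n l : ℕ) (hm : 2 ≤ m) (hn : 2 ≤ n) (hl : 1 ≤ l) :
    TauTiltingData (TabT19 K m n l) 6 2 2 := by
  have hm0 : m ≠ 0 := by omega
  have hn0 : n ≠ 0 := by omega
  have hl0 : l ≠ 0 := by omega
  refine .of_rels (by simp [IsAug, QE.al, QE.be, QE.mu, QE.nu, hm0, hn0, hl0]) fun rels hrels aug r => ?_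
  simp [QE.al, QE.be, QE.mu, QE.nu, proj_arr] at r
  obtain ⟨r1, r2, r3, r4, r5, r6, r7⟩ := r
  have r4' := reassoc₂ r4
  have r7' := reassoc₂ r7
  have n1 : IsNilpotent (𝐚 3 * 𝐚 2 : Λ rels) := ⟨l, r3⟩
  have D : WordData (rels := rels) (𝐚 0 + 𝐚 1 +
      𝐚 2 * 𝐚 3 + 𝐚 3 * 𝐚 2)
      [(2, []), (3, []), (1, []), (0, [])] := by
    refine WordData.of_closed [((2, [3]), [(0, [])]), ((2, [1]), []), ((3, [2]), [(1, [])]),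
      ((3, [0]), []), ((1, [1]), []), ((1, [3]), []), ((0, [0]), []), ((0, [2]), [])]
      (by decide) ?_ (by decide) (isNilpotent_add (isNilpotent_add (isNilpotent_add ⟨m, r1⟩ ⟨n, r2⟩
        ?_ ?_) (isNilpotent_mul_swap n1) ?_ ?_) n1 ?_ ?_) ?_ ?_
    · simp only [List.forall_mem_cons, List.not_mem_nil, false_imp_iff, implies_true, and_true, word,
        r4, r5, r6, r7, zero_mem, true_and]
      refine ⟨mem_wspan_neg ⟨𝐞 0, ?_⟩, mem_wspan_neg ⟨𝐞 1, ?_⟩,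
        mem_wspan_nil ⟨𝐚 1, ?_⟩, mem_wspan_nil ⟨𝐚 0, ?_⟩⟩ <;>
      simp [word, mul_assoc, add_mul, aw_mul_vt_ite, aw_mul_aw_of_ne, r5, r6, QE.st]
    all_goals simp [Fin.forall_fin_succ, mul_assoc, add_mul, mul_add, vt_mul_aw_ite, aw_mul_vt_ite,
      vt_mul_aw_mul_ite, aw_mul_aw_of_ne, aw_mul_aw_mul_of_ne, r4, r4', r5, r6, r7, r7', QE.st]
  refine D.tauTiltingData aug 0 (m := 1) (n := 1)
    (D.hasChain_one aug _ (x₀ := 2) rfl rfl (lData (x₀ := 2) (x₁ := 0) _ _ (by decide) rfl rfl rfl rfl ?_)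
      (by simp) (by decide))
    (D.hasChain_one aug _ (x₀ := 3) rfl rfl (lData (x₀ := 3) (x₁ := 1) _ _ (by decide) rfl rfl rfl rfl ?_)
      (by simp) (by decide))
  all_goals simp [hrels, QE.al, QE.be, QE.mu, QE.nu, repA, Trunc.T_one, matrix_zero, hm0, hn0, hl0]

end twoCycleTwoLoops

section relations
variable {K A : Type} [Field K] [Ring A] [Algebra K A]

theorem eq_zero_of_eq_smul {k : K} (hk : k ≠ 1) {x : A} (h : x = k • x) : x = 0 := by
  have : (1 - k) • x = 0 := by rw [sub_smul, one_smul, ← h, sub_self]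
  exact (smul_eq_zero.1 this).resolve_left (sub_ne_zero.2 hk.symm)

theorem cube_eq_zero_of_twist {k₁ k₂ : K} (h₁ : k₁ ≠ 0) {a b m n : A} (h : k₂ ≠ 1)
    (r1 : b * b = n * m) (r2 : n * a = b * n) (r3 : k₁ • (a * a) = m * n)
    (r4 : a * m = k₂ • (m * b)) : a * (a * a) = 0 ∧ b * (b * b) = 0 := by
  constructor
  · refine (smul_eq_zero.1 (eq_zero_of_eq_smul (x := k₁ • (a * (a * a))) h ?_)).resolve_left h₁
    calc k₁ • (a * (a * a)) = a * m * n := by rw [← mul_smul_comm, r3, mul_assoc]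
      _ = k₂ • (m * n * a) := by rw [r4, smul_mul_assoc, mul_assoc, ← r2, mul_assoc]
      _ = k₂ • k₁ • (a * (a * a)) := by rw [← r3, smul_mul_assoc, mul_assoc]
  · refine eq_zero_of_eq_smul h ?_
    calc b * (b * b) = n * (a * m) := by rw [r1, ← mul_assoc, ← r2, mul_assoc]
      _ = k₂ • (b * (b * b)) := by rw [r4, mul_smul_comm, ← mul_assoc, ← r1, mul_assoc]

theorem fourth_eq_zero_of_twist {k₁ k₂ : K} (h₁ : k₁ ≠ 0) {a b m n : A}
    (h : ¬(k₁ = 1 ∧ k₂ = 1)) (r1 : b * b = n * m) (r2 : n * a = b * n) (r3 : k₁ • (a * a) = m * n)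
    (r4 : a * m = k₂ • (m * b)) :
    a * (a * (a * a)) = 0 ∧ a * (a * (a * m)) = 0 ∧ b * (b * (b * b)) = 0 ∧
      n * (a * (a * a)) = 0 := by
  by_cases h2 : k₂ = 1
  · subst h2
    have h : k₁ ≠ 1 := fun e => h ⟨e, rfl⟩
    rw [one_smul] at r4
    have e1 : n * (a * a) = b * (b * n) := by rw [← mul_assoc, r2, mul_assoc, r2]
    have e2 : a * (a * m) = m * (b * b) := by rw [r4, ← mul_assoc, r4, mul_assoc]
    have f1 : n * (a * a) = 0 := eq_zero_of_eq_smul h <| by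
      rw [← mul_smul_comm, r3, ← mul_assoc n m, ← r1, mul_assoc, e1]
    have f2 : a * (a * m) = 0 := eq_zero_of_eq_smul h <| by
      rw [← mul_assoc a a, ← smul_mul_assoc, r3, mul_assoc m n, ← r1, mul_assoc, e2]
    refine ⟨(smul_eq_zero.1 (?_ : k₁ • (a * (a * (a * a))) = 0)).resolve_left h₁, by rw [f2, mul_zero], ?_, ?_⟩
    · rw [← mul_smul_comm, ← mul_smul_comm, r3, ← mul_assoc a m, ← mul_assoc, f2, zero_mul]
    · rw [r1, ← mul_assoc b n, ← mul_assoc b, ← e1, f1, zero_mul]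
    · rw [← mul_assoc, r2, mul_assoc, f1, mul_zero]
  · obtain ⟨e, e'⟩ := cube_eq_zero_of_twist h₁ h2 r1 r2 r3 r4
    refine ⟨by rw [e, mul_zero], ?_, by rw [e', mul_zero], by rw [e, mul_zero]⟩
    rw [← mul_assoc a a m, ← mul_assoc, e, zero_mul]

end relations

section twoCycleTwoLoops
variable (K : Type) [Field K] [IsAlgClosed K]

local notation "𝐚" => aw K QE.s QE.t _
local notation "Λ" => BoundQuiverAlgebra K (Fin 4) QE.s QE.t

theorem tauTiltingData_T20 (k : K) (hk : k ≠ 0) : TauTiltingData (TabT20 K k) 7 2 3 := by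
  refine .of_rels (by simp [IsAug, QE.al, QE.be, QE.mu, QE.nu]) fun rels hrels aug r => ?_
  simp [map_smul, QE.al, QE.be, QE.mu, QE.nu, proj_arr, sq] at r
  obtain ⟨r1, r2, r3, r4⟩ := r
  have r4' : (𝐚 2 * 𝐚 1 : Λ rels) = k⁻¹ • (𝐚 0 * 𝐚 2) := by rw [r4, inv_smul_smul₀ hk]
  have h1 : (𝐚 0 * (𝐚 2 * 𝐚 3) : Λ rels) = 0 := by
    rw [← mul_assoc, r4, smul_mul_assoc, mul_assoc, r3, mul_zero, smul_zero]
  have h2 : (𝐚 1 * (𝐚 3 * 𝐚 2) : Λ rels) = 0 := by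
    rw [reassoc₂ r3, zero_mul]
  have h3 : (𝐚 3 * (𝐚 2 * 𝐚 3) : Λ rels) = 0 := by
    rw [← mul_assoc, ← r2, mul_assoc, r3, mul_zero]
  have h4 : (𝐚 3 * (𝐚 0 * 𝐚 2) : Λ rels) = 0 := by
    rw [r4, mul_smul_comm, ← mul_assoc, ← r2, mul_assoc, r2, h2, smul_zero]
  have D : WordData (0 : Λ rels)
      [(0, []), (1, []), (2, []), (3, []), (0, [0]), (0, [2]), (1, [1]), (3, [0]), (0, [0, 2])] := by
    refine WordData.of_closed [((1, [3]), []), ((2, [3]), [(0, [0])]), ((2, [1]), [(0, [2])]),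
      ((3, [2]), [(1, [1])]), ((0, [0, 0]), []), ((0, [2, 3]), []), ((0, [2, 1]), [(0, [0, 2])]),
      ((1, [1, 1]), []), ((1, [1, 3]), []), ((3, [0, 0]), []), ((3, [0, 2]), []),
      ((0, [0, 2, 3]), []), ((0, [0, 2, 1]), [])]
      (by decide) ?_ (by decide) IsNilpotent.zero (by simp) (by simp)
    simp only [List.forall_mem_cons, List.not_mem_nil, false_imp_iff, implies_true, and_true, word,
      r1, r2, r3, r4', h1, h2, h3, h4, mul_zero, mul_smul_comm, zero_mem, true_and]
    refine ⟨mem_wspan_self 1 ?_, mem_wspan_self k⁻¹ rfl, mem_wspan_self 1 ?_, mem_wspan_self k⁻¹ rfl,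
      mem_wspan_nil ⟨0, ?_⟩⟩
    · rw [one_smul]; exact r1.symm
    · rw [one_smul]; exact r2.symm
    · rw [reassoc₂ r1, mul_assoc, h4]
      simp
  refine D.tauTiltingData aug 0 (m := 1) (n := 2)
    (D.hasChain_one_of_cyclic aug _ (x₀ := 2) rfl rfl
      (lData (x₀ := 2) (x₁ := 0) _ _ (by decide) rfl rfl rfl rfl ?_) (by simp) ?_)
    (D.hasChain_right_two aug _ (x₀ := 3) (x₁ := 0) rfl rfl rfl rfl
      (rData _ _ (by decide) rfl rfl rfl rfl ?_) (by decide) (y := 0) (by simp) ?_)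
  · simp [hrels, QE.al, QE.be, QE.mu, QE.nu, repA, Trunc.T_one, matrix_zero]
  · simp only [List.forall_mem_cons, List.not_mem_nil, false_imp_iff, implies_true, and_true, word,
      lastLetter, QE.st, zero_add, zero_ne_one, one_ne_zero, forall_const, true_and]
    exact ⟨⟨⟨1, (mul_one _).symm⟩, 1, (one_mul _).symm⟩,
      ⟨⟨k • 𝐚 1, by rw [r4, mul_smul_comm]⟩, _, rfl⟩,
      ⟨k • k • (𝐚 1 * 𝐚 1), by
        rw [r4, mul_smul_comm, ← mul_assoc, r4, smul_mul_assoc, mul_assoc, mul_smul_comm,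
          mul_smul_comm]⟩, _, (mul_assoc _ _ _).symm⟩
  · simp [hrels, QE.al, QE.be, QE.mu, QE.nu, repA, diag_pow, Trunc.T_pow, matrix_zero]
  · rw [sq, r1, h3, zero_mul]

theorem tauTiltingData_T21_of_ne (k₁ k₂ : K) (h₁ : k₁ ≠ 0) (h₂ : k₂ ≠ 0)
    (h : ¬(k₁ = 1 ∧ k₂ = 1)) : TauTiltingData (TabT21 K k₁ k₂) 6 2 2 := by
  refine .of_rels (by simp [IsAug, QE.al, QE.be, QE.mu, QE.nu]) fun rels hrels aug r => ?_
  simp [map_smul, QE.al, QE.be, QE.mu, QE.nu, proj_arr, sq] at r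
  obtain ⟨r1, r2, r3, r4⟩ := r
  obtain ⟨ha, hm, hb, hn⟩ := fourth_eq_zero_of_twist h₁ h r1 r2 r3 r4
  have r4' : (𝐚 2 * 𝐚 1 : Λ rels) = k₂⁻¹ • (𝐚 0 * 𝐚 2) := by rw [r4, inv_smul_smul₀ h₂]
  have e1 : (𝐚 1 * (𝐚 1 * 𝐚 3) : Λ rels) = 𝐚 3 * (𝐚 0 * 𝐚 0) := by
    rw [← r2, ← mul_assoc, ← r2, mul_assoc]
  have e2 : (𝐚 0 * (𝐚 0 * 𝐚 2) : Λ rels) = (k₂ * k₂) • (𝐚 2 * (𝐚 1 * 𝐚 1)) := by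
    rw [r4, mul_smul_comm, ← mul_assoc, r4, smul_mul_assoc, mul_assoc, smul_smul]
  have e3 : (𝐚 3 * (𝐚 0 * 𝐚 2) : Λ rels) = 𝐚 1 * (𝐚 1 * 𝐚 1) := by
    rw [← mul_assoc, r2, mul_assoc, r1]
  have D : WordData (0 : Λ rels)
      [(0, []), (1, []), (2, []), (3, []), (0, [0]), (1, [1]), (0, [2]), (3, [0]), (0, [0, 0]),
        (1, [1, 1]), (0, [0, 2]), (3, [0, 0])] := by
    refine WordData.of_closed [((2, [3]), [(0, [0])]), ((2, [1]), [(0, [2])]), ((3, [2]), [(1, [1])]),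
      ((1, [3]), [(3, [0])]), ((0, [2, 3]), [(0, [0, 0])]), ((0, [2, 1]), [(0, [0, 2])]),
      ((3, [0, 2]), [(1, [1, 1])]), ((1, [1, 3]), [(3, [0, 0])]), ((0, [0, 0, 0]), []),
      ((0, [0, 0, 2]), []), ((1, [1, 1, 1]), []), ((1, [1, 1, 3]), []), ((0, [0, 2, 3]), []),
      ((0, [0, 2, 1]), []), ((3, [0, 0, 0]), []), ((3, [0, 0, 2]), [])]
      (by decide) ?_ (by decide) IsNilpotent.zero (by simp) (by simp)
    simp only [List.forall_mem_cons, List.not_mem_nil, false_imp_iff, implies_true, and_true, word,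
      ← r1, ← r2, ← r3, r4', e3, ha, hm, hb, hn, mul_smul_comm, smul_zero, zero_mem, true_and]
    refine ⟨mem_wspan_self k₁ rfl, mem_wspan_self k₂⁻¹ rfl, word_mem_wspan (List.mem_singleton_self _),
      word_mem_wspan (List.mem_singleton_self _), mem_wspan_self k₁ rfl, mem_wspan_self k₂⁻¹ rfl,
      word_mem_wspan (List.mem_singleton_self _), mem_wspan_self 1 ?_, mem_wspan_nil ⟨0, ?_⟩,
      mem_wspan_nil ⟨0, ?_⟩⟩
    · rw [one_smul, r2]
      exact e1
    · rw [r2, e1, ← mul_assoc, ← r2, mul_assoc, hn, mul_zero]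
    · rw [reassoc₂ r2, mul_assoc, e3, hb, mul_zero]
  refine D.tauTiltingData aug 0 (m := 1) (n := 1)
    (D.hasChain_one_of_cyclic aug _ (x₀ := 2) rfl rfl
      (lData (x₀ := 2) (x₁ := 0) _ _ (by decide) rfl rfl rfl rfl ?_) (by simp) ?_)
    (D.hasChain_one_of_cyclic aug _ (x₀ := 3) rfl rfl
      (lData (x₀ := 3) (x₁ := 1) _ _ (by decide) rfl rfl rfl rfl ?_) (by simp) ?_)
  · simp [hrels, QE.al, QE.be, QE.mu, QE.nu, repA, Trunc.T_one, matrix_zero]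
  · simp only [List.forall_mem_cons, List.not_mem_nil, false_imp_iff, implies_true, and_true, word,
      lastLetter, QE.st, zero_add, zero_ne_one, one_ne_zero, forall_const, true_and]
    exact ⟨⟨⟨1, (mul_one _).symm⟩, 1, (one_mul _).symm⟩,
      ⟨⟨k₂ • 𝐚 1, by rw [r4, mul_smul_comm]⟩, _, rfl⟩,
      ⟨_, e2.trans (mul_smul_comm _ _ _).symm⟩, _, (mul_assoc _ _ _).symm⟩
  · simp [hrels, QE.al, QE.be, QE.mu, QE.nu, repA, Trunc.T_one, matrix_zero]
  · simp only [List.forall_mem_cons, List.not_mem_nil, false_imp_iff, implies_true, and_true, word,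
      lastLetter, QE.st, zero_add, show (1 : Fin 2) + 1 = 0 from rfl, zero_ne_one, one_ne_zero, forall_const, true_and]
    exact ⟨⟨⟨1, (mul_one _).symm⟩, 1, (one_mul _).symm⟩, ⟨⟨_, rfl⟩, _, r2⟩, ⟨_, rfl⟩,
      _, e1.symm.trans (mul_assoc _ _ _).symm⟩

end twoCycleTwoLoops
end TwoPoint

namespace TwoPoint
open Polynomial

variable {K R : Type} [Field K] [Ring R] [Algebra K R]

/-- A presentation of `R` as the order of matrices over `K[X]` whose off-diagonal entries vanish
at `0`; the variable acts as `x`. -/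
structure Lat (F : Frame K R) (x m n : R) : Prop where
  e₁x : F.e₁ * x = x * F.e₁
  e₂x : F.e₂ * x = x * F.e₂
  mx : m * x = x * m
  nx : n * x = x * n
  e₁m : F.e₁ * m = m
  me₂ : m * F.e₂ = m
  e₂n : F.e₂ * n = n
  ne₁ : n * F.e₁ = n
  mn : m * n = x * (x * F.e₁)
  nm : n * m = x * (x * F.e₂)
  ε₁x : F.ε₁ x = 0
  ε₂x : F.ε₂ x = 0
  adjoin : ∀ S : Subalgebra K R, F.e₁ ∈ S → F.e₂ ∈ S → x ∈ S → m ∈ S → n ∈ S → S = ⊤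
  indep : ∀ f g h k : K[X], aeval x f * F.e₁ + aeval x g * m + aeval x h * n +
    aeval x k * F.e₂ = 0 → f = 0 ∧ g = 0 ∧ h = 0 ∧ k = 0

namespace Lat

variable {F : Frame K R} {x m n : R} (L : Lat F x m n)
include L

theorem swap : Lat F.swap x n m where
  e₁x := L.e₂x
  e₂x := L.e₁x
  mx := L.nx
  nx := L.mx
  e₁m := L.e₂n
  me₂ := L.ne₁
  e₂n := L.e₁m
  ne₁ := L.me₂
  mn := L.nm
  nm := L.mn
  ε₁x := L.ε₂x
  ε₂x := L.ε₁x
  adjoin S h₁ h₂ h₃ h₄ h₅ := L.adjoin S h₂ h₁ h₃ h₅ h₄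
  indep f g h k H := by
    obtain ⟨h₁, h₂, h₃, h₄⟩ := L.indep k h g f (by
      rw [← H]; change _ = _ * F.e₂ + _ + _ + _ * F.e₁; abel)
    exact ⟨h₄, h₃, h₂, h₁⟩

theorem e₂m : F.e₂ * m = 0 := by rw [← L.e₁m, ← mul_assoc, F.mul₂₁, zero_mul]
theorem me₁ : m * F.e₁ = 0 := by rw [← L.me₂, mul_assoc, F.mul₂₁, mul_zero]
theorem e₁n : F.e₁ * n = 0 := L.swap.e₂m
theorem ne₂ : n * F.e₂ = 0 := L.swap.me₁
theorem mm : m * m = 0 := by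
  rw [← L.me₂, mul_assoc, ← mul_assoc F.e₂, L.e₂m, zero_mul, mul_zero]
theorem nn : n * n = 0 := L.swap.mm
theorem isV : F.IsV n := ⟨L.e₂n, L.ne₁⟩

theorem commute_x (r : R) : Commute r x := by
  have h := L.adjoin (Subalgebra.centralizer K {x}) (by
      simp [Subalgebra.mem_centralizer_iff, L.e₁x]) (by
      simp [Subalgebra.mem_centralizer_iff, L.e₂x]) (by
      simp [Subalgebra.mem_centralizer_iff]) (by
      simp [Subalgebra.mem_centralizer_iff, L.mx]) (by
      simp [Subalgebra.mem_centralizer_iff, L.nx])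
  have : r ∈ Subalgebra.centralizer K {x} := h ▸ Algebra.mem_top
  exact ((Subalgebra.mem_centralizer_iff K).1 this _ rfl).symm

theorem commute_aeval (r : R) (f : K[X]) : Commute r (aeval x f) := by
  induction f using Polynomial.induction_on' with
  | add p q hp hq => rw [map_add]; exact hp.add_right hq
  | monomial k c =>
    rw [aeval_monomial]
    exact (Algebra.commute_algebraMap_right c r).mul_right ((L.commute_x r).pow_right k)

theorem mul_aeval_mul (u : R) (f : K[X]) (v : R) :
    u * (aeval x f * v) = aeval x f * (u * v) := by
  rw [← mul_assoc, (L.commute_aeval u f).eq, mul_assoc]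

theorem exists_coeffs (r : R) : ∃ f g h k : K[X], r = aeval x f * F.e₁ +
    aeval x g * m + aeval x h * n + aeval x k * F.e₂ := by
  let P (s : R) : Prop := ∃ f g h k : K[X], s = aeval x f * F.e₁ +
    aeval x g * m + aeval x h * n + aeval x k * F.e₂
  let T : Subalgebra K R :=
    { carrier := {r | ∀ s, P s → P (r * s)}
      mul_mem' := fun {p q} hp hq s hs => by rw [mul_assoc]; exact hp _ (hq _ hs)
      add_mem' := fun {p q} hp hq s hs => by
        obtain ⟨f, g, h, k, e⟩ := hp _ hs
        obtain ⟨f', g', h', k', e'⟩ := hq _ hs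
        refine ⟨f + f', g + g', h + h', k + k', ?_⟩
        rw [add_mul, e, e']
        simp only [map_add, add_mul]
        abel
      algebraMap_mem' := fun c s ⟨f, g, h, k, e⟩ => ⟨C c * f, C c * g, C c * h, C c * k, by
        rw [e]; simp only [map_mul, aeval_C, mul_add, mul_assoc]⟩ }
  have hT : T = ⊤ := by
    refine L.adjoin T ?_ ?_ ?_ ?_ ?_ <;> rintro s ⟨f, g, h, k, rfl⟩
    · exact ⟨f, g, 0, 0, by simp [mul_add, L.mul_aeval_mul, F.mul₁₁, L.e₁m, L.e₁n, F.mul₁₂]⟩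
    · exact ⟨0, 0, h, k, by simp [mul_add, L.mul_aeval_mul, F.mul₂₂, L.e₂n, L.e₂m, F.mul₂₁]⟩
    · exact ⟨f * X, g * X, h * X, k * X, by simp [mul_add, L.mul_aeval_mul, mul_assoc]⟩
    · exact ⟨h * X * X, k, 0, 0, by
        simp [mul_add, L.mul_aeval_mul, L.mn, L.me₁, L.mm, L.me₂, mul_assoc]⟩
    · exact ⟨0, 0, f, g * X * X, by
        simp [mul_add, L.mul_aeval_mul, L.nm, L.ne₂, L.nn, L.ne₁, mul_assoc]⟩
  have hr : r ∈ T := hT ▸ Algebra.mem_top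
  have h1 := hr 1 ⟨1, 0, 0, 1, by simp [F.add]⟩
  rwa [mul_one] at h1

/-- `R` has no torsion over `K[X]`. -/
theorem aeval_mul_eq_zero {f : K[X]} (hf : f ≠ 0) {r : R} (h : aeval x f * r = 0) : r = 0 := by
  obtain ⟨p, q, u, v, rfl⟩ := L.exists_coeffs r
  have := L.indep (f * p) (f * q) (f * u) (f * v) (by
    rw [← h]; simp only [map_mul, mul_add, mul_assoc])
  simp only [mul_eq_zero, hf, false_or] at this
  obtain ⟨rfl, rfl, rfl, rfl⟩ := this
  simp

theorem exists_of_mul_eq {z y : R} (hz : F.e₁ * z = z) (hy : F.e₂ * y = y) (h : x * z = m * y) :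
    ∃ z' y', z = x * z' + m * y' ∧ y = n * z' + x * y' := by
  obtain ⟨f, g, p, q, rfl⟩ := L.exists_coeffs z
  obtain ⟨f', g', p', q', rfl⟩ := L.exists_coeffs y
  simp only [mul_add, L.mul_aeval_mul, F.mul₁₁, L.e₁m, L.e₁n, F.mul₁₂, F.mul₂₂, L.e₂n, L.e₂m,
    F.mul₂₁, mul_zero, add_zero, zero_add] at hz hy
  rw [← hz, ← hy] at h ⊢
  simp only [mul_add, L.mul_aeval_mul, L.mn, L.me₂] at h
  obtain ⟨h₁, h₂, -⟩ := L.indep (X * (f - X * p')) (X * g - q') 0 0 (by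
    rw [← sub_eq_zero] at h
    rw [← h]
    simp only [map_sub, map_mul, aeval_X, sub_mul, mul_sub, map_zero, zero_mul, add_zero,
      mul_assoc, L.mul_aeval_mul x]
    abel)
  obtain rfl := sub_eq_zero.1 ((mul_eq_zero.1 h₁).resolve_left X_ne_zero)
  obtain rfl := sub_eq_zero.1 h₂
  refine ⟨aeval x p' * F.e₁, aeval x g * F.e₂, ?_, ?_⟩ <;>
    simp only [L.mul_aeval_mul, L.ne₁, L.me₂, map_mul, aeval_X, mul_assoc]

end Lat
end TwoPoint

namespace TwoPoint
open Polynomial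

section functional
variable {K R : Type} [Field K] [Ring R] [Algebra K R]
  {M : Type} [AddCommGroup M] [Module R M] [Module K M] [IsScalarTower K R M]

theorem exists_functional_of_not_mem {W : Submodule K M} {ω : M} (h : ω ∉ W) :
    ∃ l : M →ₗ[K] K, l ω = 1 ∧ ∀ w ∈ W, l w = 0 := by
  obtain ⟨f, hf, hW⟩ := Submodule.exists_dual_map_eq_bot_of_notMem h inferInstance
  refine ⟨(f ω)⁻¹ • f, by simp [hf], fun w hw => ?_⟩
  have : f w = 0 := by simpa [hW] using Submodule.mem_map_of_mem (f := f) hw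
  simp [this]

theorem exists_functional_of_ne_smul {r : R} {ω : M} (h : ∀ v : M, ω ≠ r • v) :
    ∃ l : M →ₗ[K] K, l ω = 1 ∧ ∀ v : M, l (r • v) = 0 := by
  obtain ⟨l, h₁, h₂⟩ := exists_functional_of_not_mem (W := LinearMap.range (Algebra.lsmul K K M r))
    (ω := ω) (by rintro ⟨v, hv⟩; exact h v hv.symm)
  exact ⟨l, h₁, fun v => h₂ _ ⟨v, rfl⟩⟩

theorem exists_functional_of_ne_add {r s : R} {ω : M} (h : ∀ v w : M, ω ≠ r • v + s • w) :
    ∃ l : M →ₗ[K] K, l ω = 1 ∧ (∀ v : M, l (r • v) = 0) ∧ ∀ v : M, l (s • v) = 0 := by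
  obtain ⟨l, h₁, h₂⟩ := exists_functional_of_not_mem
    (W := LinearMap.range (Algebra.lsmul K K M r) ⊔ LinearMap.range (Algebra.lsmul K K M s))
    (ω := ω) (by
      intro hω
      obtain ⟨_, ⟨v, rfl⟩, _, ⟨w, rfl⟩, e⟩ := Submodule.mem_sup.1 hω
      exact h v w e.symm)
  exact ⟨l, h₁, fun v => h₂ _ (Submodule.mem_sup_left ⟨v, rfl⟩),
    fun v => h₂ _ (Submodule.mem_sup_right ⟨v, rfl⟩)⟩

/-- A retract of an indecomposable module is the whole module. -/
theorem nonempty_equiv_of_retract {N Y : Type} [AddCommGroup N] [Module R N] [AddCommGroup Y]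
    [Module R Y] (hN : IsIndecModule R N) [Nontrivial Y] (i : Y →ₗ[R] N) (p : N →ₗ[R] Y)
    (h : p ∘ₗ i = LinearMap.id) : Nonempty (Y ≃ₗ[R] N) := by
  have hp : ∀ y, p (i y) = y := fun y => LinearMap.congr_fun h y
  refine ⟨LinearEquiv.ofBijective i ⟨fun y z e => by rw [← hp y, e, hp], ?_⟩⟩
  rw [← LinearMap.range_eq_top]
  have hc : IsCompl (LinearMap.range i) (LinearMap.ker p) := by
    refine ⟨Submodule.disjoint_def.2 ?_, codisjoint_iff.2 (eq_top_iff.2 fun v _ => ?_)⟩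
    · rintro _ ⟨y, rfl⟩ hy
      rw [LinearMap.mem_ker, hp] at hy
      rw [hy, map_zero]
    · rw [← add_sub_cancel (i (p v)) v]
      exact Submodule.add_mem_sup ⟨_, rfl⟩ (by simp [hp])
  rcases hN.2 _ _ hc with h0 | h0
  · obtain ⟨y, hy⟩ := exists_ne (0 : Y)
    have : i y ∈ LinearMap.range i := ⟨y, rfl⟩
    rw [h0, Submodule.mem_bot] at this
    exact absurd (by rw [← hp y, this, map_zero]) hy
  · simpa [h0] using hc.sup_eq_top

end functional

namespace Lat

variable {K R : Type} [Field K] [Ring R] [Algebra K R] {F : Frame K R} {x m n : R}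
  (L : Lat F x m n)
include L

section hom
variable {M Y : Type} [AddCommGroup M] [Module R M] [Module K M] [IsScalarTower K R M]
  [AddCommGroup Y] [Module R Y] [Module K Y] [IsScalarTower K R Y]

theorem exists_hom (h : M →ₗ[K] Y) (h₁ : ∀ v, h (F.e₁ • v) = F.e₁ • h v)
    (hx : ∀ v, h (x • v) = x • h v) (hm : ∀ v, h (m • v) = m • h v)
    (hn : ∀ v, h (n • v) = n • h v) : ∃ h' : M →ₗ[R] Y, ∀ v, h' v = h v := by
  let T : Subalgebra K R :=
    { carrier := {r | ∀ v, h (r • v) = r • h v}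
      mul_mem' := fun {p q} hp hq v => by rw [mul_smul, hp, hq, mul_smul]
      add_mem' := fun {p q} hp hq v => by rw [add_smul, map_add, hp, hq, add_smul]
      algebraMap_mem' := fun c v => by rw [algebraMap_smul, map_smul, algebraMap_smul] }
  have hT := L.adjoin T h₁ (fun v => by
    have : F.e₂ = 1 - F.e₁ := eq_sub_of_add_eq' F.add
    rw [this, sub_smul, sub_smul, map_sub, h₁, one_smul, one_smul]) hx hm hn
  exact ⟨{ h with map_smul' := fun r v => (hT ▸ Algebra.mem_top : r ∈ T) v }, fun v => rfl⟩

theorem smul_comm (r : R) (v : M) : r • x • v = x • r • v := by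
  rw [smul_smul, (L.commute_x r).eq, mul_smul]

theorem e₁_m (v : M) : F.e₁ • m • v = m • v := by rw [smul_smul, L.e₁m]
theorem e₁_n (v : M) : F.e₁ • n • v = 0 := by rw [smul_smul, L.e₁n, zero_smul]
theorem m_e₁ (v : M) : m • F.e₁ • v = 0 := by rw [smul_smul, L.me₁, zero_smul]
theorem n_e₁ (v : M) : n • F.e₁ • v = n • v := by rw [smul_smul, L.ne₁]
theorem e₁_e₁ (v : M) : F.e₁ • F.e₁ • v = F.e₁ • v := by rw [smul_smul, F.mul₁₁]
theorem m_m (v : M) : m • m • v = 0 := by rw [smul_smul, L.mm, zero_smul]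
theorem m_n (v : M) : m • n • v = x • x • F.e₁ • v := by rw [smul_smul, L.mn, mul_smul, mul_smul]
theorem m_of_e₁ {v : M} (h : F.e₁ • v = v) : m • v = 0 := by rw [← h, L.m_e₁]

instance : Module K F.S := inferInstanceAs (Module K K)
omit L in
theorem isScalarTower_S : IsScalarTower K R F.S := ⟨fun c r z => by
  change (F.ε₁ (c • r) * (show K from z) : K) = c * (F.ε₁ r * (show K from z))
  rw [map_smul, smul_eq_mul, mul_assoc]⟩

theorem ε₁m : F.ε₁ m = 0 := by rw [← L.me₂, map_mul, F.ε₁₂, mul_zero]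
theorem ε₁n : F.ε₁ n = 0 := by rw [← L.e₂n, map_mul, F.ε₁₂, zero_mul]

theorem exists_hom_S {ω : M} (h₁ : F.e₁ • ω = ω) (hω : ∀ v w, ω ≠ x • v + m • w) :
    ∃ h : M →ₗ[R] F.S, h ω = (1 : K) := by
  obtain ⟨l, hl, lx, lm⟩ := exists_functional_of_ne_add (K := K) hω
  have := isScalarTower_S (F := F)
  let h : M →ₗ[K] F.S := l ∘ₗ Algebra.lsmul K K M F.e₁
  have hh : ∀ v, h v = l (F.e₁ • v) := fun v => rfl
  have hS : ∀ (r : R) (z : F.S), F.ε₁ r = 0 → r • z = 0 := fun r z hr => by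
    change (F.ε₁ r * (show K from z) : K) = 0
    rw [hr, zero_mul]
  suffices H : ∃ h' : M →ₗ[R] F.S, ∀ v, h' v = h v by
    obtain ⟨h', e⟩ := H
    exact ⟨h', by rw [e, hh, h₁, hl]⟩
  refine L.exists_hom h (fun v => ?_) (fun v => ?_) (fun v => ?_) (fun v => ?_)
  · rw [hh, hh, L.e₁_e₁]
    change _ = (F.ε₁ F.e₁ * l (F.e₁ • v) : K)
    rw [F.ε₁₁, one_mul]
  · rw [hS _ _ L.ε₁x, hh, L.smul_comm, lx]; rfl
  · rw [hS _ _ L.ε₁m, hh, L.e₁_m, lm]; rfl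
  · rw [hS _ _ L.ε₁n, hh, L.e₁_n, map_zero]; rfl

theorem fac_S {ω : M} (h₁ : F.e₁ • ω = ω) (hω : ∀ v w, ω ≠ x • v + m • w) : Fac R M F.S := by
  obtain ⟨h, e⟩ := L.exists_hom_S (K := K) h₁ hω
  refine Fac.of_surjective h fun z => ⟨algebraMap K R z • ω, ?_⟩
  rw [map_smul, e]
  change (F.ε₁ (algebraMap K R z) * 1 : K) = z
  exact (mul_one _).trans (F.ε₁.commutes _)

end hom

section cover
variable {N : Type} [AddCommGroup N] [Module R N] {k : ℕ} {π : (Fin k → R) →ₗ[R] N}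

theorem aeval_smul_eq_zero {f : K[X]} (hf : f ≠ 0) {p : Fin k → R} (h : aeval x f • p = 0) :
    p = 0 :=
  funext fun i => L.aeval_mul_eq_zero hf (congrFun h i)

theorem x_smul_injective {p q : Fin k → R} (h : x • p = x • q) : p = q :=
  sub_eq_zero.1 (L.aeval_smul_eq_zero X_ne_zero (by rw [aeval_X, smul_sub, h, sub_self]))

theorem exists_of_smul_eq {z y : Fin k → R} (hz : F.e₁ • z = z) (hy : F.e₂ • y = y)
    (h : x • z = m • y) : ∃ z' y', z = x • z' + m • y' ∧ y = n • z' + x • y' := by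
  choose z' y' h₁ h₂ using fun i =>
    L.exists_of_mul_eq (congrFun hz i) (congrFun hy i) (congrFun h i)
  exact ⟨z', y', funext h₁, funext h₂⟩

/-- If the simple module at the first vertex is a factor of a compatible module `N`, then the
relations of `N` at that vertex that lie in the radical of the free cover lie in the radical of
the module of relations. -/
theorem descend (hr : RigidTo R N F.S) (hπ : Function.Surjective π) {ω p q : Fin k → R}
    (hω : π ω = 0) (h₁ : F.e₁ • ω = ω) (e : ω = x • p + m • q) :
    ∃ ω₁ ω₂, π ω₁ = 0 ∧ π ω₂ = 0 ∧ F.e₁ • ω₁ = ω₁ ∧ F.e₂ • ω₂ = ω₂ ∧ ω = x • ω₁ + m • ω₂ := by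
  have key : ∃ ω₁ ω₂, π ω₁ = 0 ∧ π ω₂ = 0 ∧ ω = x • ω₁ + m • ω₂ := by
    by_contra! H
    obtain ⟨h, hh⟩ := L.exists_hom_S (K := K) (M := LinearMap.ker π) (ω := ⟨ω, hω⟩) (Subtype.ext h₁)
      fun v w e => H v w v.2 w.2 (congrArg Subtype.val e)
    obtain ⟨h', e'⟩ := hr (Fin k → R) π hπ h
    have h0 : h ⟨ω, hω⟩ = (0 : K) := by
      rw [← e']
      change h' ω = _
      rw [e, map_add, map_smul, map_smul]
      change (F.ε₁ x * (show K from h' p) + F.ε₁ m * (show K from h' q) : K) = 0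
      rw [L.ε₁x, L.ε₁m, zero_mul, zero_mul, add_zero]
    exact one_ne_zero (α := K) (hh.symm.trans h0)
  obtain ⟨ω₁, ω₂, h₂, h₃, e'⟩ := key
  refine ⟨F.e₁ • ω₁, F.e₂ • ω₂, by rw [map_smul, h₂, smul_zero], by rw [map_smul, h₃, smul_zero],
    by rw [smul_smul, F.mul₁₁], by rw [smul_smul, F.mul₂₂], ?_⟩
  rw [smul_smul m, L.me₂, ← L.smul_comm, ← h₁, e', smul_add, L.e₁_m]

end cover

end Lat
end TwoPoint

namespace TwoPoint
open Polynomial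

/-- The action of polynomials through an element of the ring. -/
abbrev polyModule {K R : Type} [Field K] [Ring R] [Algebra K R] (x : R) (N : Type)
    [AddCommGroup N] [Module R N] : Module K[X] N :=
  Module.compHom N (aeval (R := K) x).toRingHom

namespace Lat

variable {K R : Type} [Field K] [Ring R] [Algebra K R] {F : Frame K R} {x m n : R}
  (L : Lat F x m n)
  {N : Type} [AddCommGroup N] [Module R N] [Module K N] [IsScalarTower K R N]

theorem eq_zero_of_aeval_smul_eq_zero [IsAlgClosed K] {r : K[X]} (hr : r ≠ 0)
    (H : ∀ c, r.IsRoot c → ∀ v : N, x • v = c • v → v = 0) {w : N} (h : aeval x r • w = 0) :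
    w = 0 := by
  induction hd : r.natDegree generalizing r with
  | zero =>
    obtain ⟨c, rfl⟩ := natDegree_eq_zero.1 hd
    rw [aeval_C, algebraMap_smul] at h
    exact (smul_eq_zero.1 h).resolve_left (by simpa using hr)
  | succ d ih =>
    obtain ⟨c, hc⟩ := IsAlgClosed.exists_root r (fun h0 => by
      rw [natDegree_eq_zero_iff_degree_le_zero.2 h0.le] at hd
      omega)
    obtain ⟨s, rfl⟩ := dvd_iff_isRoot.2 hc
    have hs := right_ne_zero_of_mul hr
    refine ih hs (fun b hb => H b (by simp [hb.eq_zero])) ?_ ?_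
    · refine H c hc _ (sub_eq_zero.1 ?_)
      rw [map_mul, mul_smul, map_sub, aeval_X, aeval_C, sub_smul, algebraMap_smul] at h
      exact h
    · rw [natDegree_mul (X_sub_C_ne_zero c) hs, natDegree_X_sub_C] at hd
      omega

include L

theorem finite_polynomial [Module.Finite R N] :
    letI := polyModule (K := K) x N
    Module.Finite K[X] N := by
  let _ := polyModule (K := K) x N
  let _ := polyModule (K := K) x R
  have : IsScalarTower K[X] R N := ⟨fun f r v => mul_smul (aeval x f) r v⟩
  have : Module.Finite K[X] R := by
    refine ⟨⟨({F.e₁, m, n, F.e₂} : Set R).toFinite.toFinset, eq_top_iff.2 fun r _ => ?_⟩⟩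
    rw [Set.Finite.coe_toFinset]
    obtain ⟨f, g, h, k, rfl⟩ := L.exists_coeffs r
    have hs (f : K[X]) {s : R} (hs : s ∈ ({F.e₁, m, n, F.e₂} : Set R)) :
        aeval x f * s ∈ Submodule.span K[X] ({F.e₁, m, n, F.e₂} : Set R) :=
      Submodule.smul_mem _ f (Submodule.subset_span hs)
    exact add_mem (add_mem (add_mem (hs _ (by simp)) (hs _ (by simp))) (hs _ (by simp)))
      (hs _ (by simp))
  exact Module.Finite.trans R N

/-- Nakayama's lemma at the origin, for modules supported there. -/
theorem smul_eq_zero_of_forall_eq [IsAlgClosed K] [Module.Finite R N]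
    (H : ∀ c : K, c ≠ 0 → ∀ v : N, x • v = c • v → v = 0) (c : R)
    (hc : ∀ v : N, ∃ v', c • v = x • c • v') (v : N) : c • v = 0 := by
  let _ := polyModule (K := K) x N
  have := L.finite_polynomial (N := N)
  let g : N →ₗ[K[X]] N :=
    { toFun := (c • ·)
      map_add' := smul_add c
      map_smul' := fun f w => by
        change c • aeval x f • w = aeval x f • c • w
        rw [smul_smul, (L.commute_aeval c f).eq, mul_smul] }
  have hg : ∀ v, g v = c • v := fun _ => rfl
  obtain ⟨r, hr, h⟩ := Submodule.exists_sub_one_mem_and_smul_eq_zero_of_fg_of_le_smul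
    (Ideal.span {X}) (LinearMap.range g) (IsNoetherian.noetherian _) (by
      rintro _ ⟨w, rfl⟩
      obtain ⟨w', e⟩ := hc w
      have : g w = (X : K[X]) • g w' := by
        change c • w = aeval x X • c • w'
        rw [aeval_X, e]
      rw [this]
      exact Submodule.smul_mem_smul (Ideal.mem_span_singleton_self X) ⟨w', rfl⟩)
  have h0 : r.eval 0 = 1 := by
    obtain ⟨s, hs⟩ := Ideal.mem_span_singleton.1 hr
    rw [sub_eq_iff_eq_add.1 hs]
    simp
  refine eq_zero_of_aeval_smul_eq_zero (r := r) (by rintro rfl; simp at h0) (fun c hc => H c ?_)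
    (h (c • v) ⟨v, rfl⟩)
  rintro rfl
  exact one_ne_zero (h0.symm.trans hc)

/-- A polynomial in `x` as an endomorphism. -/
def aevalEnd (f : K[X]) (N : Type) [AddCommGroup N] [Module R N] : N →ₗ[R] N where
  toFun := (aeval x f • ·)
  map_add' := smul_add _
  map_smul' r v := by simp only [smul_smul, (L.commute_aeval r f).eq, RingHom.id_apply]

theorem aevalEnd_apply (f : K[X]) (v : N) : L.aevalEnd f N v = aeval x f • v := rfl

theorem eq_zero_of_e₁_smul_eq [Module.Finite R N] (hN : Comp R N N) {c : K} (hc : c ≠ 0) {z : N}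
    (h₁ : F.e₁ • z = z) (hz : x • z = c • z) : z = 0 := by
  by_contra hz0
  obtain ⟨k, π, hπ⟩ := Module.Finite.exists_fin' R N
  set f : K[X] := X - C c with hf
  have hf0 : f ≠ 0 := X_sub_C_ne_zero c
  have af {M : Type} [AddCommGroup M] [Module R M] [Module K M] [IsScalarTower K R M] (v : M) :
      aeval x f • v = x • v - c • v := by
    rw [hf, map_sub, aeval_X, aeval_C, sub_smul, algebraMap_smul]
  let W := LinearMap.range (L.aevalEnd f N)
  have hW : W ≠ ⊤ := by
    intro h
    let _ := polyModule (K := K) x N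
    have := L.finite_polynomial (N := N)
    let g : N →ₗ[K[X]] N := LinearMap.lsmul K[X] N f
    have hg : Function.Injective g :=
      OrzechProperty.injective_of_surjective_endomorphism g (fun v => LinearMap.range_eq_top.1 h v)
    refine hz0 (hg ?_)
    rw [map_zero]
    exact (af z).trans (sub_eq_zero.2 hz)
  have hx (y : N ⧸ W) : x • y = c • y := by
    obtain ⟨v, rfl⟩ := W.mkQ_surjective y
    rw [← sub_eq_zero, ← af, ← map_smul]
    exact (Submodule.Quotient.mk_eq_zero _).2 ⟨v, rfl⟩
  obtain ⟨y, hy, hy0⟩ : ∃ y : N ⧸ W, F.e₁ • y = y ∧ y ≠ 0 := by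
    by_contra! H
    have h0 : ∀ y : N ⧸ W, F.e₁ • y = 0 := fun y => H _ (L.e₁_e₁ y)
    have : Nontrivial (N ⧸ W) := Submodule.Quotient.nontrivial_iff.2 hW
    obtain ⟨y, hy⟩ := exists_ne (0 : N ⧸ W)
    have e₂y : F.e₂ • y = y := by
      rw [← zero_add (F.e₂ • y), ← h0 y, ← add_smul, F.add, one_smul]
    have := L.swap.m_n y
    change n • m • y = x • x • F.e₂ • y at this
    rw [← L.e₁_m, h0, smul_zero, e₂y, hx, hx, eq_comm] at this
    simp [hc, hy] at this
  obtain ⟨z', rfl⟩ := hπ z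
  let ω : LinearMap.ker π := ⟨aeval x f • F.e₁ • z', by
    rw [LinearMap.mem_ker, map_smul, map_smul, h₁, af, hz, sub_self]⟩
  have hl : ∀ v : LinearMap.ker π, ω ≠ aeval x f • v := fun v e => by
    have e : aeval x f • F.e₁ • z' = aeval x f • v.1 := congrArg Subtype.val e
    have := L.aeval_smul_eq_zero hf0 (p := F.e₁ • z' - v.1) (by rw [smul_sub, e, sub_self])
    rw [sub_eq_zero] at this
    exact hz0 (by rw [← h₁, ← map_smul, this, v.2])
  obtain ⟨l, hl1, hl⟩ := exists_functional_of_ne_smul (K := K) (M := LinearMap.ker π)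
    (r := aeval x f) hl
  have lx (v : LinearMap.ker π) : l (x • v) = c * l v := by
    rw [← sub_eq_zero, ← smul_eq_mul, ← map_smul, ← map_sub]
    exact (congrArg l (af v)).symm.trans (hl v)
  let h : LinearMap.ker π →ₗ[K] N ⧸ W :=
    (l ∘ₗ Algebra.lsmul K K (LinearMap.ker π) F.e₁).smulRight y +
      (l ∘ₗ Algebra.lsmul K K (LinearMap.ker π) m).smulRight ((c⁻¹ * c⁻¹) • n • y)
  have hh (v : LinearMap.ker π) : h v = l (F.e₁ • v) • y + l (m • v) • (c⁻¹ * c⁻¹) • n • y := rfl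
  have sc (r : R) (a : K) (v : N ⧸ W) : r • a • v = a • r • v :=
    smul_algebra_smul_comm a r v
  obtain ⟨h', e⟩ := L.exists_hom h (fun v => by
      simp [hh, L.e₁_e₁, L.m_e₁, sc, hy, L.e₁_n]) (fun v => by
      rw [hh, hh, L.smul_comm, L.smul_comm, lx, lx, smul_add, sc, sc, sc, hx,
        ← L.smul_comm n, hx, sc n, smul_smul, smul_smul, smul_smul, smul_smul]
      congr 2 <;> ring) (fun v => by
      simp [hh, L.e₁_m, L.m_m, sc, L.m_of_e₁ hy, L.m_n, hy, hx,
        smul_smul, mul_assoc, hc]) (fun v => by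
      rw [hh, hh, L.e₁_n, L.m_n, lx, lx]
      simp [sc, L.swap.m_m, smul_smul, mul_assoc]
      congr 1
      field_simp)
  obtain ⟨h'', e'⟩ := hN (N ⧸ W) (Fac.of_surjective _ W.mkQ_surjective) (Fin k → R) π hπ h'
  have h1 : F.e₁ • ω = ω := Subtype.ext <| by
    change F.e₁ • aeval x f • F.e₁ • z' = aeval x f • F.e₁ • z'
    rw [smul_smul, (L.commute_aeval F.e₁ f).eq, mul_smul, L.e₁_e₁]
  have : h'' ω = 0 := (map_smul h'' _ (F.e₁ • z')).trans (by rw [af, hx, sub_self])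
  have h2 : m • ω = 0 := L.m_of_e₁ (M := LinearMap.ker π) (v := ω) h1
  rw [e', e, hh, h2, h1, hl1, map_zero, zero_smul, add_zero, one_smul] at this
  exact hy0 this

end Lat
end TwoPoint

namespace TwoPoint
open Polynomial
open TwoPoint.Frame (M₀ ev_M₀ projective_X_of_isEmpty)

namespace Lat

variable {K R : Type} [Field K] [Ring R] [Algebra K R] {F : Frame K R} {x m n : R}

theorem smul_gen_eq_zero {r : R} : r • F.gen (M₀ R) 0 = 0 ↔ r * F.e₁ = 0 := by
  have := F.sum_gen_eq_zero (ev_M₀ (F := F)) (x := fun _ => r)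
  simpa using this

theorem nontrivial_X_M₀ : Nontrivial (F.X (M₀ R)) := by
  refine ⟨F.gen (M₀ R) 0, 0, fun h => ?_⟩
  rw [← one_smul R (F.gen (M₀ R) 0), smul_gen_eq_zero, one_mul] at h
  have := F.ε₁₁
  rw [h, map_zero] at this
  exact zero_ne_one this

variable (L : Lat F x m n)
  {N : Type} [AddCommGroup N] [Module R N] [Module K N] [IsScalarTower K R N]
include L

/-- A torsion-free indecomposable module with an element `z` at the first vertex such that `x z`
does not come from the second vertex is projective. -/
theorem nonempty_equiv_X_M₀ [IsAlgClosed K] [Module.Finite R N] (hN : IsIndecModule R N)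
    (H : ∀ (c : K) (v : N), x • v = c • v → v = 0) {z : N} (h₁ : F.e₁ • z = z)
    (hz : ∀ v, x • z ≠ m • v) : Nonempty (F.X (M₀ R) ≃ₗ[R] N) := by
  let _ := polyModule (K := K) x N
  have hs (f : K[X]) (v : N) : f • v = aeval x f • v := rfl
  have := L.finite_polynomial (N := N)
  have : Module.IsTorsionFree K[X] N := ⟨fun f hf v w e => by
    have e : f • v = f • w := e
    refine sub_eq_zero.1 (eq_zero_of_aeval_smul_eq_zero hf.ne_zero (fun c _ => H c) ?_)
    rw [← hs, smul_sub, e, sub_self]⟩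
  obtain ⟨l, hl, hm⟩ := exists_functional_of_ne_smul (K := K) hz
  have hlx (v : N) : l (x • x • F.e₁ • v) = 0 := by rw [← L.m_n, hm]
  let I : Ideal K[X] := Ideal.span {X ^ 2}
  let ψ₀ : N → K[X] := fun v => C (l (x • F.e₁ • v)) + C (l (F.e₁ • v)) * X
  have hX (v : N) : ψ₀ (x • v) = X * ψ₀ v - X ^ 2 * C (l (F.e₁ • v)) := by
    simp only [ψ₀, L.smul_comm, hlx, C_0]
    ring
  have hadd (v w : N) : ψ₀ (v + w) = ψ₀ v + ψ₀ w := by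
    simp only [ψ₀, smul_add, map_add]
    ring
  have hC (a : K) (v : N) : ψ₀ (a • v) = C a * ψ₀ v := by
    simp only [ψ₀, smul_algebra_smul_comm, map_smul, smul_eq_mul, C_mul]
    ring
  let ψ : N →ₗ[K[X]] K[X] ⧸ I :=
    { toFun := fun v => I.mkQ (ψ₀ v)
      map_add' := fun v w => by rw [hadd, map_add]
      map_smul' := fun f v => by
        induction f using Polynomial.induction_on generalizing v with
        | C a =>
          rw [hs, aeval_C, algebraMap_smul, hC, RingHom.id_apply, ← map_smul, smul_eq_mul]
        | add f g hf hg => simp only [RingHom.id_apply] at hf hg ⊢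
                           rw [add_smul, hadd, map_add, hf, hg, add_smul]
        | monomial k a ih =>
          have h0 : I.mkQ (X ^ 2 * C (l (F.e₁ • v))) = 0 := (Submodule.Quotient.mk_eq_zero I).2
            (Ideal.mul_mem_right _ _ (Ideal.mem_span_singleton_self _))
          rw [pow_succ, ← mul_assoc, mul_smul, hs X, aeval_X, ih, hX, map_sub, h0, sub_zero,
            RingHom.id_apply, RingHom.id_apply, mul_smul (C a * X ^ k) X, ← map_smul _ X,
            smul_eq_mul X] }
  obtain ⟨φ, hφ⟩ := Module.projective_lifting_property I.mkQ ψ I.mkQ_surjective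
  have hφ (v : N) : X ^ 2 ∣ φ v - ψ₀ v := by
    rw [← Ideal.mem_span_singleton, ← Submodule.Quotient.mk_eq_zero, Submodule.Quotient.mk_sub]
    exact sub_eq_zero.2 (LinearMap.congr_fun hφ v)
  have φx (v : N) : φ (x • v) = X * φ v := by
    rw [← smul_eq_mul, ← map_smul, hs, aeval_X]
  have φc (a : K) (v : N) : φ (a • v) = C a * φ v := by
    rw [← smul_eq_mul, ← map_smul, hs, aeval_C, algebraMap_smul]
  let g : N →ₗ[K[X]] N :=
    { toFun := fun v => F.e₁ • v
      map_add' := smul_add _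
      map_smul' := fun f v => by
        rw [hs, smul_smul, (L.commute_aeval F.e₁ f).eq, mul_smul]; rfl }
  have hg (v : N) : φ (F.e₁ • v) = (φ ∘ₗ g) v := rfl
  obtain ⟨q, hq⟩ := (IsPrincipalIdealRing.principal (LinearMap.range (φ ∘ₗ g))).principal
  have hc (v : N) : ∃ c, φ (F.e₁ • v) = q * c := by
    have : (φ ∘ₗ g) v ∈ LinearMap.range (φ ∘ₗ g) := ⟨v, rfl⟩
    rw [hq] at this
    exact Ideal.mem_span_singleton.1 this
  choose c hc using hc
  have hXq : ¬ X ∣ q := by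
    intro h
    have h2 := hφ z
    rw [← h₁, hc] at h2
    have h3 := (dvd_sub_right (h.mul_right (c z))).1 ((dvd_pow_self X two_ne_zero).trans h2)
    rw [X_dvd_iff] at h3
    simp [ψ₀, h₁, hl] at h3
  have hq0 : q ≠ 0 := by rintro rfl; exact hXq (dvd_zero _)
  have hd (v : N) : ∃ d, φ (m • v) = q * (X ^ 2 * d) := by
    have h2 := hφ (m • v)
    have h3 : ψ₀ (m • v) = 0 := by
      simp only [ψ₀, L.e₁_m, ← L.smul_comm m, hm]
      simp
    rw [h3, sub_zero, ← L.e₁_m, hc] at h2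
    obtain ⟨d, e⟩ := ((prime_X.coprime_iff_not_dvd.2 hXq).pow_left (m := 2)).dvd_of_dvd_mul_left h2
    exact ⟨d, by rw [← L.e₁_m, hc, e]⟩
  choose d hd using hd
  have hc' {v p} (e : φ (F.e₁ • v) = q * p) : c v = p :=
    mul_left_cancel₀ hq0 ((hc v).symm.trans e)
  have hd' {v p} (e : φ (m • v) = q * (X ^ 2 * p)) : d v = p :=
    mul_left_cancel₀ (pow_ne_zero 2 X_ne_zero) (mul_left_cancel₀ hq0 ((hd v).symm.trans e))
  set y := F.gen (M₀ R) 0 with hy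
  have y₁ : F.e₁ • y = y := F.e₁_gen 0
  have sc (p : K[X]) (r : R) (v : F.X (M₀ R)) : r • aeval x p • v = aeval x p • r • v := by
    rw [smul_smul, (L.commute_aeval r p).eq, mul_smul]
  let h : N →ₗ[K] F.X (M₀ R) :=
    { toFun := fun v => aeval x (c v) • y + aeval x (d v) • n • y
      map_add' := fun v w => by
        rw [hc' (v := v + w) (p := c v + c w) (by rw [smul_add, map_add, hc, hc]; ring),
          hd' (v := v + w) (p := d v + d w) (by rw [smul_add, map_add, hd, hd]; ring),
          map_add, map_add, add_smul, add_smul]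
        abel
      map_smul' := fun a v => by
        rw [hc' (v := a • v) (p := C a * c v)
            (by rw [smul_algebra_smul_comm, φc, hc]; ring),
          hd' (v := a • v) (p := C a * d v)
            (by rw [smul_algebra_smul_comm, φc, hd]; ring),
          map_mul, map_mul, mul_smul, mul_smul, aeval_C, algebraMap_smul, algebraMap_smul,
          ← smul_add]
        rfl }
  have hh (v) : h v = aeval x (c v) • y + aeval x (d v) • n • y := rfl
  obtain ⟨h', e⟩ := L.exists_hom h (fun v => by
      rw [hh, hh, hc' (v := F.e₁ • v) (by rw [L.e₁_e₁, hc]),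
        hd' (v := F.e₁ • v) (p := 0) (by rw [L.m_e₁, map_zero]; ring), smul_add, sc, sc,
        y₁, L.e₁_n, map_zero, zero_smul, smul_zero]) (fun v => by
      rw [hh, hh, hc' (v := x • v) (p := X * c v) (by rw [L.smul_comm, φx, hc]; ring),
        hd' (v := x • v) (p := X * d v) (by rw [L.smul_comm, φx, hd]; ring),
        map_mul, map_mul, aeval_X, mul_smul, mul_smul, smul_add]) (fun v => by
      rw [hh, hh, hc' (v := m • v) (by rw [L.e₁_m, hd]),
        hd' (v := m • v) (p := 0) (by rw [L.m_m, map_zero]; ring), smul_add, sc, sc,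
        L.m_of_e₁ y₁, L.m_n, y₁, map_zero, zero_smul, smul_zero, zero_add,
        add_zero, mul_comm, map_mul, mul_smul, map_pow, aeval_X, pow_two, mul_smul]) (fun v => by
      rw [hh, hh, hc' (v := n • v) (p := 0) (by rw [L.e₁_n, map_zero, mul_zero]),
        hd' (v := n • v) (p := c v) (by rw [L.m_n, φx, φx, hc]; ring), smul_add, sc, sc,
        L.swap.m_m, map_zero, zero_smul, smul_zero, zero_add, add_zero])
  have hsurj : Function.Surjective h' := F.surjective_of_gen fun i => by
    obtain ⟨z', hz'⟩ : q ∈ LinearMap.range (φ ∘ₗ g) := hq ▸ Submodule.mem_span_singleton_self q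
    refine ⟨F.e₁ • z', ?_⟩
    rw [e, hh, hc' (v := F.e₁ • z') (p := 1) (by rw [L.e₁_e₁, hg, hz', mul_one]),
      hd' (v := F.e₁ • z') (p := 0) (by rw [L.m_e₁, map_zero]; ring)]
    simp [hy, Subsingleton.elim i 0]
  have := projective_X_of_isEmpty (F := F) (M₀ R)
  obtain ⟨s, hs⟩ := Module.projective_lifting_property h' LinearMap.id hsurj
  have := nontrivial_X_M₀ (F := F)
  exact nonempty_equiv_of_retract hN s h' hs

end Lat
end TwoPoint

namespace TwoPoint
open Polynomial
open TwoPoint.Frame (M₀ ev_M₀)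

namespace Lat

variable {K R : Type} [Field K] [Ring R] [Algebra K R] {F : Frame K R} {x m n : R}
  (L : Lat F x m n)
  {N : Type} [AddCommGroup N] [Module R N] [Module K N] [IsScalarTower K R N]
include L

theorem e₁_add_e₂ (v : N) : F.e₁ • v + F.e₂ • v = v := by rw [← add_smul, F.add, one_smul]

theorem n_m (v : N) : n • m • v = x • x • F.e₂ • v := L.swap.m_n v
theorem e₂_n (v : N) : F.e₂ • n • v = n • v := L.swap.e₁_m v
theorem e₂_e₂ (v : N) : F.e₂ • F.e₂ • v = F.e₂ • v := L.swap.e₁_e₁ v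
theorem m_e₂ (v : N) : m • F.e₂ • v = m • v := L.swap.n_e₁ v

theorem eq_zero_of_smul_eq [Module.Finite R N] (hN : Comp R N N) {c : K} (hc : c ≠ 0) {v : N}
    (h : x • v = c • v) : v = 0 := by
  have (r : R) : x • r • v = c • r • v := by
    rw [← L.smul_comm, h, smul_algebra_smul_comm]
  rw [← L.e₁_add_e₂ v, L.eq_zero_of_e₁_smul_eq hN hc (L.e₁_e₁ v) (this _),
    show F.e₂ • v = 0 from
      L.swap.eq_zero_of_e₁_smul_eq hN hc (L.swap.e₁_e₁ v) (this _), add_zero]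

theorem exists_n_smul (H : ∀ y : N, F.e₂ • y = y → ∃ v w, y = x • v + n • w) {y : N}
    (hy : F.e₂ • y = y) : ∃ w, F.e₁ • w = w ∧ y = n • w := by
  obtain ⟨v, w, e⟩ := H y hy
  obtain ⟨v', w', e'⟩ := H (F.e₂ • v) (L.swap.e₁_e₁ v)
  refine ⟨F.e₁ • (m • v' + x • w' + w), L.e₁_e₁ _, ?_⟩
  have e₃ := congrArg (F.e₂ • ·) e'
  simp only [L.e₂_e₂, smul_add, L.smul_comm, L.e₂_n] at e₃
  rw [L.n_e₁, smul_add, smul_add, L.n_m, ← hy, e, smul_add, L.e₂_n, L.smul_comm, e₃, smul_add,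
    L.smul_comm n]

section cover
variable {k : ℕ} {π : (Fin k → R) →ₗ[R] N} (hπ : Function.Surjective π) (hr₁ : RigidTo R N F.S)
include hπ hr₁

theorem x_smul_ne {z : N} (h₁ : F.e₁ • z = z) (hz : ∀ v w, z ≠ x • v + m • w) (v : N) :
    x • z ≠ m • v := by
  intro e
  obtain ⟨p, rfl⟩ := hπ z
  obtain ⟨q, rfl⟩ := hπ v
  obtain ⟨ω₁, ω₂, i₁, i₂, h₂, h₃, e'⟩ := L.descend hr₁ hπ
    (ω := x • F.e₁ • p + m • (-q)) (p := F.e₁ • p) (q := -q)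
    (by rw [map_add, map_smul, map_smul, map_smul, map_neg, h₁, e, smul_neg, add_neg_cancel])
    (by rw [smul_add, L.smul_comm, L.e₁_e₁, L.e₁_m]) rfl
  obtain ⟨z', y', h, -⟩ := L.exists_of_smul_eq (z := F.e₁ • p - ω₁) (y := F.e₂ • q + ω₂)
    (by rw [smul_sub, L.e₁_e₁, h₂]) (by rw [smul_add, L.e₂_e₂, h₃])
    (by rw [smul_sub, smul_add, L.m_e₂, ← sub_eq_iff_eq_add'.2 e', smul_neg]; abel)
  refine hz (π z') (π y') ?_
  rw [← map_smul, ← map_smul, ← map_add, ← h, map_sub, map_smul, h₁, i₁, sub_zero]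

theorem eq_zero_of_x_smul_eq_zero (hr₂ : RigidTo R N F.swap.S) {z : N} (h₁ : F.e₁ • z = z)
    (hz : x • z = 0) : z = 0 := by
  obtain ⟨p, rfl⟩ := hπ z
  obtain ⟨ω₁, ω₂, i₁, i₂, h₂, h₃, e⟩ := L.descend hr₁ hπ
    (ω := x • F.e₁ • p) (p := F.e₁ • p) (q := 0) (by rw [map_smul, map_smul, h₁, hz])
    (by rw [L.smul_comm, L.e₁_e₁]) (by rw [smul_zero, add_zero])
  obtain ⟨z', y', -, h⟩ := L.exists_of_smul_eq (z := F.e₁ • p - ω₁) (y := ω₂)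
    (by rw [smul_sub, L.e₁_e₁, h₂]) h₃ (by rw [smul_sub, e, add_sub_cancel_left])
  obtain ⟨ω₃, ω₄, i₃, i₄, h₄, h₅, e'⟩ := L.swap.descend hr₂ hπ i₂ h₃ (h.trans (add_comm _ _))
  have := L.x_smul_injective (p := F.e₁ • p) (q := ω₁ + m • ω₃ + x • F.e₁ • ω₄) (by
    rw [e, e', smul_add, smul_add, smul_add, L.m_n, L.smul_comm, add_assoc])
  rw [← h₁, ← map_smul, this]
  simp [i₁, i₃, i₄]

/-- The elements at the first vertex killed by `x`, if the second vertex is not in the top. -/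
theorem exists_of_x_smul_eq_zero
    (H : ∀ y : N, F.e₂ • y = y → ∃ v w, y = x • v + n • w) {z : N} (h₁ : F.e₁ • z = z)
    (hz : x • z = 0) : ∃ w, F.e₁ • w = w ∧ z = x • w ∧ n • w = 0 := by
  obtain ⟨p, rfl⟩ := hπ z
  obtain ⟨ω₁, ω₂, i₁, i₂, h₂, h₃, e⟩ := L.descend hr₁ hπ
    (ω := x • F.e₁ • p) (p := F.e₁ • p) (q := 0) (by rw [map_smul, map_smul, h₁, hz])
    (by rw [L.smul_comm, L.e₁_e₁]) (by rw [smul_zero, add_zero])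
  obtain ⟨z', y', h, h'⟩ := L.exists_of_smul_eq (z := F.e₁ • p - ω₁) (y := ω₂)
    (by rw [smul_sub, L.e₁_e₁, h₂]) h₃ (by rw [smul_sub, e, add_sub_cancel_left])
  replace h := congrArg π h
  replace h' := congrArg π h'
  simp only [map_sub, map_smul, map_add, i₁, i₂, h₁, sub_zero] at h h'
  obtain ⟨w, hw, e'⟩ := L.exists_n_smul H (L.e₂_e₂ (π y'))
  refine ⟨F.e₁ • (π z' + x • w), L.e₁_e₁ _, ?_, ?_⟩
  · rw [← L.smul_comm, smul_add, ← hw, ← L.m_n, ← e', L.m_e₂, ← h, h₁]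
  · rw [L.n_e₁, smul_add, L.smul_comm, ← e', ← L.smul_comm, ← L.e₂_n, ← smul_add, ← h', smul_zero]

/-- If moreover all elements at the first vertex killed by `x` come from the second vertex, then
there are none. -/
theorem eq_zero_of_forall_eq_m_smul [IsAlgClosed K] [Module.Finite R N] (hC : Comp R N N)
    (H : ∀ y : N, F.e₂ • y = y → ∃ v w, y = x • v + n • w)
    (H' : ∀ z : N, F.e₁ • z = z → x • z = 0 → ∃ v, z = m • v) {z : N} (h₁ : F.e₁ • z = z)
    (hz : x • z = 0) : z = 0 := by
  by_contra hz0
  have hm (v : N) : ∃ w, F.e₁ • w = w ∧ m • v = x • x • w := by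
    obtain ⟨w, hw, e⟩ := L.exists_n_smul H (L.e₂_e₂ v)
    exact ⟨w, hw, by rw [← L.m_e₂, e, L.m_n, hw]⟩
  obtain ⟨w, hw, hzw, hnw⟩ : ∃ w, F.e₁ • w = w ∧ z = x • x • w ∧ n • x • w = 0 := by
    obtain ⟨z', h', rfl, e'⟩ := L.exists_of_x_smul_eq_zero hπ hr₁ H h₁ hz
    obtain ⟨v, e⟩ := H' _ h₁ hz
    obtain ⟨w₀, h₀, e₀⟩ := hm v
    obtain ⟨v', e₁⟩ := H' (z' - x • w₀) (by rw [smul_sub, h', L.smul_comm, h₀])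
      (by rw [smul_sub, e, e₀, sub_self])
    obtain ⟨w₁, h₂, e₂⟩ := hm v'
    have : z' = x • (w₀ + x • w₁) := by
      rw [smul_add, ← e₂, ← e₁, add_sub_cancel]
    exact ⟨w₀ + x • w₁, by rw [smul_add, h₀, L.smul_comm, h₂], by rw [← this], by rw [← this, e']⟩
  have hnw0 : n • w ≠ 0 := fun h => hz0 (by rw [hzw, ← hw, ← L.m_n, h, smul_zero])
  obtain ⟨y, hy, hyx⟩ : ∃ y : N, F.e₂ • y = y ∧ ∀ v, y ≠ x • v := by
    by_contra! h
    refine hnw0 ?_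
    rw [← L.e₂_n]
    refine L.smul_eq_zero_of_forall_eq (fun c hc v => L.eq_zero_of_smul_eq hC hc) _ (fun v => ?_) _
    obtain ⟨v', e⟩ := h _ (L.e₂_e₂ v)
    exact ⟨v', by rw [← L.e₂_e₂, e, L.smul_comm]⟩
  obtain ⟨p, hp⟩ := hπ w
  let ω : LinearMap.ker π := ⟨n • x • F.e₁ • p, by
    rw [LinearMap.mem_ker, map_smul, map_smul, map_smul, hp, hw, hnw]⟩
  have hω : ∀ v v' : LinearMap.ker π, ω ≠ x • v + n • v' := fun v v' e => by
    have e : n • x • F.e₁ • p = x • v.1 + n • v'.1 := congrArg Subtype.val e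
    obtain ⟨z', y', h, h'⟩ := L.swap.exists_of_smul_eq (z := F.e₂ • v.1)
      (y := x • F.e₁ • p - F.e₁ • v'.1) (L.e₂_e₂ _)
      (by change F.e₁ • _ = _; rw [smul_sub, L.smul_comm, L.e₁_e₁, L.e₁_e₁])
      (by rw [smul_sub, L.n_e₁, ← L.e₂_n (x • _), e, smul_add, L.e₂_n, L.smul_comm,
          add_sub_cancel_right])
    obtain ⟨ω₁, ω₂, i₁, i₂, h₂, h₃, e'⟩ := L.descend hr₁ hπ (ω := F.e₁ • v'.1)
      (p := F.e₁ • p - y') (q := -z') (by rw [map_smul, v'.2, smul_zero]) (L.e₁_e₁ _)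
      (by rw [smul_sub, smul_neg, ← sub_eq_iff_eq_add.2 h']; abel)
    obtain ⟨z₃, y₃, g, g'⟩ := L.exists_of_smul_eq (z := F.e₁ • p - ω₁ - F.e₁ • y')
      (y := F.e₂ • z' + ω₂) (by rw [smul_sub, smul_sub, L.e₁_e₁, L.e₁_e₁, h₂])
      (by rw [smul_add, L.e₂_e₂, h₃]) (by
        replace h' := congrArg (F.e₁ • ·) h'
        simp only [smul_sub, smul_add, L.smul_comm, L.e₁_e₁, L.e₁_m, e', h₂] at h'
        rw [smul_sub, smul_sub, smul_add, L.m_e₂, ← sub_eq_zero, ← sub_eq_zero.2 h']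
        abel)
    refine hnw0 ?_
    replace h := congrArg (F.e₂ • π ·) h
    replace g := congrArg (n • π ·) g
    replace g' := congrArg (F.e₂ • π ·) g'
    simp only [map_add, map_sub, map_smul, hp, i₁, i₂, smul_add, smul_sub, L.n_e₁, sub_zero,
      L.smul_comm, L.n_m, L.e₂_n, L.e₂_e₂, smul_zero, add_zero, LinearMap.mem_ker.1 v.2] at h g g'
    rw [← sub_add_cancel (n • w) (n • π y'), g, h, g', smul_add]
  obtain ⟨l, hl, lx, ln⟩ := exists_functional_of_ne_add (K := K) (M := LinearMap.ker π) hω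
  let W := LinearMap.range (L.aevalEnd X N)
  have hW (v : N) : W.mkQ (x • v) = 0 :=
    (Submodule.Quotient.mk_eq_zero _).2 ⟨v, by rw [L.aevalEnd_apply, aeval_X]⟩
  have hx (v : N ⧸ W) : x • v = 0 := by
    obtain ⟨v, rfl⟩ := W.mkQ_surjective v
    rw [← map_smul, hW]
  let h : LinearMap.ker π →ₗ[K] N ⧸ W :=
    (l ∘ₗ Algebra.lsmul K K (LinearMap.ker π) F.e₂).smulRight (W.mkQ y)
  have hh (v : LinearMap.ker π) : h v = l (F.e₂ • v) • W.mkQ y := rfl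
  have sc (r : R) (a : K) (v : N ⧸ W) : r • a • v = a • r • v := smul_algebra_smul_comm a r v
  have hy₁ : F.e₁ • W.mkQ y = 0 := by rw [← map_smul, ← hy, smul_smul, F.mul₁₂, zero_smul, map_zero]
  have hym : m • W.mkQ y = 0 := by
    obtain ⟨w, -, e⟩ := hm y
    rw [← map_smul, e, hW]
  have hyn : n • W.mkQ y = 0 := by rw [← map_smul, ← hy, smul_smul, L.ne₂, zero_smul, map_zero]
  obtain ⟨h', e⟩ := L.exists_hom h
    (fun v => by rw [hh, hh, sc, hy₁, smul_zero, smul_smul, F.mul₂₁, zero_smul, map_zero, zero_smul])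
    (fun v => by rw [hh, hx, L.smul_comm, lx, zero_smul])
    (fun v => by rw [hh, hh, sc, hym, smul_zero, smul_smul, L.e₂m, zero_smul, map_zero, zero_smul])
    (fun v => by rw [hh, hh, sc, hyn, smul_zero, L.e₂_n, ln, zero_smul])
  obtain ⟨h'', e'⟩ := hC (N ⧸ W) (Fac.of_surjective _ W.mkQ_surjective) (Fin k → R) π hπ h'
  have h1 : F.e₂ • ω = ω := Subtype.ext (L.e₂_n _)
  have : h'' ω = 0 := by
    change h'' (n • x • F.e₁ • p) = 0
    rw [map_smul, map_smul, hx, smul_zero]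
  rw [e', e, hh, h1, hl, one_smul] at this
  obtain ⟨v, hv⟩ := (Submodule.Quotient.mk_eq_zero W).1 this
  exact hyx v (by rw [← hv, L.aevalEnd_apply, aeval_X])

end cover

end Lat
end TwoPoint

namespace TwoPoint
open Polynomial
open TwoPoint.Frame (M₀ ev_M₀ ev_single lift lift_gen hom_ext row_gen sum_gen_eq_zero exists_gen)

namespace Lat

variable {K R : Type} [Field K] [Ring R] [Algebra K R] {F : Frame K R} {x m n : R}
  (L : Lat F x m n)
include L

theorem smul_gen_single_eq_zero {r : R} : r • F.gen !![n] 0 = 0 ↔ ∃ c, r * F.e₁ = c * n := by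
  have := sum_gen_eq_zero (ev_single L.isV) (x := fun _ => r)
  simp only [Fin.forall_fin_one, Fintype.sum_unique, Fin.default_eq_zero] at this
  rw [this]
  exact ⟨fun ⟨c, h⟩ => ⟨c 0, h⟩, fun ⟨c, h⟩ => ⟨fun _ => c, h⟩⟩

theorem sq_dvd_of_smul_gen {p : K[X]} (h : aeval x p • F.gen !![n] 0 = 0) : X ^ 2 ∣ p := by
  obtain ⟨c, h⟩ := L.smul_gen_single_eq_zero.1 h
  obtain ⟨f, g, k, q, rfl⟩ := L.exists_coeffs c
  simp only [add_mul, mul_assoc, L.e₁n, L.mn, L.nn, L.e₂n, mul_zero, zero_add, add_zero] at h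
  obtain ⟨h, -⟩ := L.indep (p - X ^ 2 * g) 0 (-q) 0 (by
    rw [← sub_eq_zero] at h
    rw [← h]
    simp only [map_mul, map_sub, map_neg, aeval_X, map_zero, sub_mul,
      neg_mul, zero_mul, add_zero, mul_assoc, L.mul_aeval_mul x, pow_two]
    abel)
  exact ⟨g, sub_eq_zero.1 h⟩

theorem n_smul_gen : n • F.gen !![n] 0 = 0 := by
  rw [L.smul_gen_single_eq_zero]
  exact ⟨1, by rw [L.ne₁, one_mul]⟩

theorem nontrivial_X_n : Nontrivial (F.X !![n]) :=
  ⟨F.gen !![n] 0, 0, fun h => by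
    exact not_isUnit_X ((isUnit_pow_iff two_ne_zero).1 (isUnit_of_dvd_one
      (L.sq_dvd_of_smul_gen (p := 1) (by simp [h]))))⟩

variable {N : Type} [AddCommGroup N] [Module R N] [Module K N] [IsScalarTower K R N]

/-- The non-projective summand. -/
theorem nonempty_equiv_X_n (hN : IsIndecModule R N)
    (H : ∀ z : N, F.e₁ • z = z → x • z = 0 → ∃ w, F.e₁ • w = w ∧ z = x • w ∧ n • w = 0)
    {z : N} (h₁ : F.e₁ • z = z) (hx : x • z = 0) (hz : ∀ v, z ≠ m • v) :
    Nonempty (F.X !![n] ≃ₗ[R] N) := by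
  obtain ⟨w, hw, e, hn⟩ := H z h₁ hx
  obtain ⟨l, hl, lm⟩ := exists_functional_of_ne_smul (K := K) hz
  have lx (v : N) : l (x • x • F.e₁ • v) = 0 := by rw [← L.m_n, lm]
  have sc (r : R) (a : K) (v : N) : r • a • v = a • r • v := smul_algebra_smul_comm a r v
  have sc' (r : R) (a : K) (v : F.X !![n]) : r • a • v = a • r • v := smul_algebra_smul_comm a r v
  set w' := w - l w • z with hw'
  have e₁w : F.e₁ • w' = w' := by rw [hw', smul_sub, sc, h₁, hw]
  have xw : x • w' = z := by rw [hw', smul_sub, sc, hx, smul_zero, sub_zero, e]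
  have nw : n • w' = 0 := by
    rw [hw', smul_sub, sc, hn, e, L.smul_comm, hn, smul_zero, smul_zero, sub_zero]
  have lw : l w' = 0 := by rw [hw', map_sub, map_smul, hl, smul_eq_mul, mul_one, sub_self]
  set y := F.gen !![n] 0 with hy
  have y₁ : F.e₁ • y = y := F.e₁_gen 0
  have ny : n • y = 0 := L.n_smul_gen
  have xy : x • x • y = 0 := by rw [← y₁, ← L.m_n, ny, smul_zero]
  let h : N →ₗ[K] F.X !![n] :=
    (l ∘ₗ Algebra.lsmul K K N (x * F.e₁)).smulRight y +
      (l ∘ₗ Algebra.lsmul K K N F.e₁).smulRight (x • y)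
  have hh (v : N) : h v = l (x • F.e₁ • v) • y + l (F.e₁ • v) • x • y := by
    rw [smul_smul]; rfl
  obtain ⟨ρ, hρ⟩ := L.exists_hom h
    (fun v => by rw [hh, hh, L.e₁_e₁, smul_add, sc', sc', L.smul_comm, y₁])
    (fun v => by
      rw [hh, hh, L.smul_comm, lx, smul_add, sc', sc', xy, zero_smul, smul_zero, zero_add,
        add_zero])
    (fun v => by
      rw [hh, hh, L.e₁_m, ← L.smul_comm, lm, lm, smul_add, sc', sc', L.smul_comm, L.m_of_e₁ y₁]
      simp)
    (fun v => by
      rw [hh, hh, L.e₁_n, smul_add, sc', sc', L.smul_comm, ny]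
      simp)
  have := L.nontrivial_X_n
  refine nonempty_equiv_of_retract hN (lift (fun _ => w') (fun _ => e₁w) fun k => ?_) ρ
    (hom_ext fun i => ?_)
  · simp [Subsingleton.elim k 0, nw]
  · rw [LinearMap.comp_apply, lift_gen, hρ, hh, e₁w, xw, hl, lw, one_smul, zero_smul, add_zero,
      Subsingleton.elim i 0]
    rfl

theorem nonempty_equiv_of_not [IsAlgClosed K] [Module.Finite R N] (hN : IsIndecModule R N)
    (hC : Comp R N N) {z : N} (h₁ : F.e₁ • z = z) (hz : ∀ v w, z ≠ x • v + m • w) :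
    Nonempty (F.X (M₀ R) ≃ₗ[R] N) ∨ Nonempty (F.X !![n] ≃ₗ[R] N) := by
  obtain ⟨k, π, hπ⟩ := Module.Finite.exists_fin' R N
  have hr₁ : RigidTo R N F.S := hC _ (L.fac_S (K := K) h₁ hz)
  have hP (hx : ∀ v : N, x • v = 0 → v = 0) : Nonempty (F.X (M₀ R) ≃ₗ[R] N) := by
    refine L.nonempty_equiv_X_M₀ hN (fun c v h => ?_) h₁ (L.x_smul_ne hπ hr₁ h₁ hz)
    by_cases hc : c = 0
    · exact hx v (by rw [h, hc, zero_smul])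
    · exact L.eq_zero_of_smul_eq hC hc h
  by_cases H : ∀ y : N, F.e₂ • y = y → ∃ v w, y = x • v + n • w
  · by_cases H' : ∃ z : N, F.e₁ • z = z ∧ x • z = 0 ∧ ∀ v, z ≠ m • v
    · obtain ⟨z, h₁, hx, hz⟩ := H'
      exact Or.inr (L.nonempty_equiv_X_n hN
        (fun z h h' => L.exists_of_x_smul_eq_zero hπ hr₁ H h h') h₁ hx hz)
    · push Not at H'
      have h₀ {z : N} := L.eq_zero_of_forall_eq_m_smul hπ hr₁ hC H H' (z := z)
      refine Or.inl (hP fun v hv => ?_)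
      have e₁v : F.e₁ • v = 0 := h₀ (L.e₁_e₁ _) (by rw [← L.smul_comm, hv, smul_zero])
      obtain ⟨w, hw, e⟩ := L.exists_n_smul H (L.e₂_e₂ v)
      have e₁x {u : N} (h : F.e₁ • u = u) : F.e₁ • x • u = x • u := by rw [L.smul_comm, h]
      have : w = 0 := h₀ hw (h₀ (e₁x hw) (h₀ (e₁x (e₁x hw)) (by
        rw [← hw, ← L.m_n, ← L.smul_comm, ← e, ← L.smul_comm, hv, smul_zero, smul_zero])))
      rw [← L.e₁_add_e₂ v, e₁v, e, this, smul_zero, add_zero]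
  · push Not at H
    obtain ⟨y, hy, hy'⟩ := H
    have hr₂ : RigidTo R N F.swap.S := hC _ (L.swap.fac_S (K := K) hy hy')
    refine Or.inl (hP fun v hv => ?_)
    rw [← L.e₁_add_e₂ v,
      L.eq_zero_of_x_smul_eq_zero hπ hr₁ hr₂ (L.e₁_e₁ _) (by rw [← L.smul_comm, hv, smul_zero]),
      show F.e₂ • v = 0 from L.swap.eq_zero_of_x_smul_eq_zero hπ hr₂ hr₁ (L.swap.e₁_e₁ _)
        (by rw [← L.smul_comm, hv, smul_zero]), add_zero]

/-- The indecomposable `τ`-rigid modules. -/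
theorem nonempty_equiv [IsAlgClosed K] [Module.Finite R N] (hN : IsIndecModule R N)
    (hC : Comp R N N) :
    (Nonempty (F.X (M₀ R) ≃ₗ[R] N) ∨ Nonempty (F.X !![n] ≃ₗ[R] N)) ∨
      (Nonempty (F.swap.X (M₀ R) ≃ₗ[R] N) ∨ Nonempty (F.swap.X !![m] ≃ₗ[R] N)) := by
  by_cases H₁ : ∀ y : N, F.e₁ • y = y → ∃ v w, y = x • v + m • w
  · by_cases H₂ : ∀ y : N, F.e₂ • y = y → ∃ v w, y = x • v + n • w
    · have key (v : N) : ∃ w, v = x • w := by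
        obtain ⟨w, -, e⟩ := L.swap.exists_n_smul H₁ (L.e₁_e₁ v)
        obtain ⟨w', -, e'⟩ := L.exists_n_smul H₂ (L.e₂_e₂ w)
        obtain ⟨u, -, f⟩ := L.exists_n_smul H₂ (L.e₂_e₂ v)
        obtain ⟨u', -, f'⟩ := L.swap.exists_n_smul H₁ (L.e₁_e₁ u)
        refine ⟨x • F.e₁ • w' + x • F.e₂ • u', ?_⟩
        rw [smul_add, ← L.m_n, ← L.n_m, ← e', L.m_e₂, ← e, ← f', L.n_e₁, ← f, L.e₁_add_e₂]
      obtain ⟨v, hv⟩ := @exists_ne N hN.1 0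
      refine absurd ?_ hv
      rw [← one_smul R v]
      exact L.smul_eq_zero_of_forall_eq (fun c hc v => L.eq_zero_of_smul_eq hC hc) _
        (fun v => by simpa using key v) _
    · push Not at H₂
      obtain ⟨y, hy, hy'⟩ := H₂
      exact Or.inr (L.swap.nonempty_equiv_of_not hN hC hy hy')
  · push Not at H₁
    obtain ⟨y, hy, hy'⟩ := H₁
    exact Or.inl (L.nonempty_equiv_of_not hN hC hy hy')

end Lat
end TwoPoint

namespace TwoPoint
open Polynomial MulOpposite
open TwoPoint.Frame (M₀ row_gen mkQ_eq_sum exists_gen Cyclic exists_chain1)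

namespace Lat

variable {K R : Type} [Field K] [Ring R] [Algebra K R] {F : Frame K R} {x m n : R}
  (L : Lat F x m n)
include L

theorem isIndecModule_X {κ : Type} [Fintype κ] {f : Matrix κ (Fin 1) R} [Nontrivial (F.X f)]
    (H : ∀ p : K[X], aeval x (p * (1 - p)) • F.gen f 0 = 0 →
      aeval x p • F.gen f 0 = 0 ∨ aeval x (1 - p) • F.gen f 0 = 0) :
    IsIndecModule R (F.X f) := by
  refine ⟨inferInstance, fun A B hAB => ?_⟩
  have key {C : Submodule R (F.X f)} (h : F.gen f 0 ∈ C) : C = ⊤ := by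
    refine eq_top_iff.2 fun v _ => ?_
    obtain ⟨r, rfl⟩ := exists_gen v
    rw [Fin.sum_univ_one]
    exact C.smul_mem _ h
  obtain ⟨u, hu, w, hw, e⟩ := Submodule.mem_sup.1
    (hAB.sup_eq_top ▸ Submodule.mem_top : F.gen f 0 ∈ A ⊔ B)
  obtain ⟨r, rfl⟩ := exists_gen u
  rw [Fin.sum_univ_one] at hu e
  obtain ⟨p, q, s, t, hr⟩ := L.exists_coeffs (r 0)
  have hp : F.e₁ • r 0 • F.gen f 0 = aeval x p • F.gen f 0 := by
    rw [← F.e₁_gen, smul_smul, smul_smul, smul_smul, hr]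
    simp only [add_mul, mul_add, mul_assoc, L.mul_aeval_mul F.e₁, F.mul₁₁, L.me₁, L.e₁n,
      F.mul₂₁, mul_zero, add_zero]
  have e' := congrArg (F.e₁ • ·) e
  simp only [smul_add, hp, F.e₁_gen] at e'
  have hA : aeval x p • F.gen f 0 ∈ A := hp ▸ A.smul_mem _ hu
  have hB : aeval x (1 - p) • F.gen f 0 ∈ B := by
    rw [map_sub, map_one, sub_smul, one_smul, ← eq_sub_of_add_eq' e']
    exact B.smul_mem _ hw
  rcases H p (Submodule.disjoint_def.1 hAB.disjoint _
    (by rw [mul_comm, map_mul, mul_smul]; exact A.smul_mem _ hA)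
    (by rw [map_mul, mul_smul]; exact B.smul_mem _ hB)) with h | h
  · left
    have := key (C := B) (by
      rw [map_sub, map_one, sub_smul, one_smul, h, sub_zero] at hB; exact hB)
    exact eq_bot_iff.2 (by simpa [this] using hAB.inf_eq_bot.le)
  · right
    have := key (C := A) (by
      rw [map_sub, map_one, sub_smul, one_smul, sub_eq_zero] at h; rw [h]; exact hA)
    exact eq_bot_iff.2 (by simpa [this] using hAB.inf_eq_bot.le)

theorem isIndecModule_X_M₀ : IsIndecModule R (F.X (M₀ R)) := by
  have := nontrivial_X_M₀ (F := F)
  refine L.isIndecModule_X fun p h => ?_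
  rw [smul_gen_eq_zero] at h
  obtain ⟨h, -⟩ := L.indep (p * (1 - p)) 0 0 0 (by simpa using h)
  rcases mul_eq_zero.1 h with h | h <;> simp [h]

theorem isIndecModule_X_n : IsIndecModule R (F.X !![n]) := by
  have := L.nontrivial_X_n
  have hX {p : K[X]} (h : X ^ 2 ∣ p) : aeval x p • F.gen !![n] 0 = 0 := by
    obtain ⟨q, rfl⟩ := h
    rw [mul_comm, map_mul, map_pow, aeval_X, pow_two, mul_smul, mul_smul, ← F.e₁_gen, ← L.m_n,
      L.n_smul_gen, smul_zero, smul_zero]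
  refine L.isIndecModule_X fun p h => ?_
  have h := L.sq_dvd_of_smul_gen h
  by_cases hp : X ∣ p
  · refine Or.inl (hX (((prime_X.coprime_iff_not_dvd.2 fun h' => ?_).pow_left).dvd_of_dvd_mul_right
      h))
    have := dvd_add hp h'
    rw [add_sub_cancel] at this
    exact prime_X.not_dvd_one this
  · exact Or.inr (hX (((prime_X.coprime_iff_not_dvd.2 hp).pow_left).dvd_of_dvd_mul_left h))

theorem cyclic : F.Cyclic n := by
  have key {v : R} (hv : F.IsV v) : ∃ h : K[X], v = aeval x h * n := by
    obtain ⟨p, q, h, k, e⟩ := L.exists_coeffs v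
    refine ⟨h, ?_⟩
    rw [← hv.1, ← hv.2, e]
    simp only [add_mul, mul_add, mul_assoc, L.mul_aeval_mul F.e₂, F.mul₁₁, F.mul₂₁, L.me₁, L.ne₁,
      L.e₂n, mul_zero, add_zero, zero_add]
  refine ⟨L.isV, fun v hv => ?_, fun v hv => ?_⟩ <;> obtain ⟨h, rfl⟩ := key hv
  exacts [⟨_, rfl⟩, ⟨_, (L.commute_aeval n h).symm⟩]

theorem exists_chain : ∃ (b c : ℕ → ℕ) (f : ∀ i, Matrix (Fin (b i)) (Fin (c i)) R),
    F.Chain 1 b c f ∧ ∀ (N : Type) [AddCommGroup N] [Module R N],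
      Nonempty (F.X (M₀ R) ≃ₗ[R] N) ∨ Nonempty (F.X !![n] ≃ₗ[R] N) →
        ∃ i ≤ 1, Nonempty (F.X (f i) ≃ₗ[R] N) := by
  refine exists_chain1 Nak.bot (fun c h k => ?_) L.isIndecModule_X_M₀ L.isIndecModule_X_n
    (fun h => ?_) L.cyclic
  · have h : c k * n = 0 := by simpa [Subsingleton.elim k 0] using h 0
    refine L.aeval_mul_eq_zero (pow_ne_zero 2 X_ne_zero) ?_
    rw [← L.mul_aeval_mul, map_pow, aeval_X, pow_two, mul_assoc, ← L.nm, ← mul_assoc, h, zero_mul]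
  · simpa using L.indep 0 0 1 0 (by simp [h])

end Lat

theorem Lat.tauTiltingData {K Λ : Type} [Field K] [IsAlgClosed K] [Ring Λ] [Algebra K Λ]
    {F : Frame K Λᵐᵒᵖ} {x m n : Λᵐᵒᵖ} (L : Lat F x m n) : TauTiltingData Λ 6 2 2 := by
  obtain ⟨b, c, f, H, hf⟩ := L.exists_chain
  obtain ⟨b', c', g, G, hg⟩ := L.swap.exists_chain
  refine TwoChains.tauTiltingData (Frame.twoChains H G fun N _ _ _ hN hC => ?_)
  let _ : Module K N := Module.compHom N (algebraMap K Λᵐᵒᵖ)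
  have : IsScalarTower K Λᵐᵒᵖ N := ⟨fun c r v => by
    rw [Algebra.smul_def, mul_smul]; rfl⟩
  exact (L.nonempty_equiv hN hC).imp (hf N) (hg N)

variable (K : Type) [Field K]

theorem tauTiltingData_T21_one [IsAlgClosed K] : TauTiltingData (TabT21 K 1 1) 6 2 2 := by
  set rels : Set (FreeAlgebra K (TPGen (Fin 4)) × FreeAlgebra K (TPGen (Fin 4))) :=
    {(QE.be K ^ 2, QE.nu K * QE.mu K), (QE.nu K * QE.al K, QE.be K * QE.nu K),
      ((1 : K) • QE.al K ^ 2, QE.mu K * QE.nu K),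
      (QE.al K * QE.mu K, (1 : K) • (QE.mu K * QE.be K))} with hrels
  have aug : IsAug rels := by simp [hrels, IsAug, QE.al, QE.be, QE.mu, QE.nu]
  have r {p q} (h : (p, q) ∈ rels) := proj_rel (s := QE.s) (t := QE.t) h
  have r1 := r (p := QE.be K ^ 2) (q := QE.nu K * QE.mu K) (by simp [hrels])
  have r2 := r (p := QE.nu K * QE.al K) (q := QE.be K * QE.nu K) (by simp [hrels])
  have r3 := r (p := (1 : K) • QE.al K ^ 2) (q := QE.mu K * QE.nu K) (by simp [hrels])
  have r4 := r (p := QE.al K * QE.mu K) (q := (1 : K) • (QE.mu K * QE.be K)) (by simp [hrels])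
  simp only [map_mul, one_smul, QE.al, QE.be, QE.mu, QE.nu, proj_arr, sq] at r1 r2 r3 r4
  set v := vt K QE.s QE.t rels with hv
  set a := aw K QE.s QE.t rels with ha
  have z {i} {j : Fin 4} (h : i ≠ QE.s j) : v i * a j = 0 := vt_mul_aw_of_ne h
  have z' {i} {j : Fin 4} (h : i ≠ QE.t j) : a j * v i = 0 := aw_mul_vt_of_ne h
  have za {i j : Fin 4} (h : QE.t i ≠ QE.s j) : a i * a j = 0 := aw_mul_aw_of_ne h
  have e (j : Fin 4) : v (QE.s j) * a j = a j := vt_mul_aw j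
  have e' (j : Fin 4) : a j * v (QE.t j) = a j := aw_mul_vt j
  have L : Lat (aug.frame QE.s QE.t 0) (op (a 0 + a 1)) (op (a 3)) (op (a 2)) :=
    { e₁x := congrArg op (show (a 0 + a 1) * v 0 = v 0 * (a 0 + a 1) by
        rw [add_mul, mul_add, z (i := 0) (j := 1) (by decide), z' (i := 0) (j := 1) (by decide)]
        exact congrArg (· + 0) ((e' 0).trans (e 0).symm))
      e₂x := congrArg op (show (a 0 + a 1) * v 1 = v 1 * (a 0 + a 1) by
        rw [add_mul, mul_add, z (i := 1) (j := 0) (by decide), z' (i := 1) (j := 0) (by decide)]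
        exact congrArg (0 + ·) ((e' 1).trans (e 1).symm))
      mx := congrArg op (show (a 0 + a 1) * a 3 = a 3 * (a 0 + a 1) by
        rw [add_mul, mul_add, za (i := 0) (j := 3) (by decide), za (i := 3) (j := 1) (by decide),
          r2, zero_add, add_zero])
      nx := congrArg op (show (a 0 + a 1) * a 2 = a 2 * (a 0 + a 1) by
        rw [add_mul, mul_add, za (i := 1) (j := 2) (by decide), za (i := 2) (j := 0) (by decide),
          r4, zero_add, add_zero])
      e₁m := congrArg op (e' 3)
      me₂ := congrArg op (e 3)
      e₂n := congrArg op (e' 2)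
      ne₁ := congrArg op (e 2)
      mn := congrArg op (show a 2 * a 3 = v 0 * (a 0 + a 1) * (a 0 + a 1) by
        rw [mul_add (v 0), z (i := 0) (j := 1) (by decide), add_zero, mul_add, mul_assoc, mul_assoc,
          za (i := 0) (j := 1) (by decide), r3, mul_zero, add_zero, ← mul_assoc]
        exact congrArg (· * a 3) (e 2).symm)
      nm := congrArg op (show a 3 * a 2 = v 1 * (a 0 + a 1) * (a 0 + a 1) by
        rw [mul_add (v 1), z (i := 1) (j := 0) (by decide), zero_add, mul_add, mul_assoc, mul_assoc,
          za (i := 1) (j := 0) (by decide), r1, mul_zero, zero_add, ← mul_assoc]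
        exact congrArg (· * a 2) (e 3).symm)
      ε₁x := (map_add (aug.eps 0) _ _).trans (by rw [aug.eps_aw, aug.eps_aw, add_zero])
      ε₂x := (map_add (aug.eps 1) _ _).trans (by rw [aug.eps_aw, aug.eps_aw, add_zero])
      adjoin := fun S h₁ h₂ hx hm hn => by
        have h0 : op (a 0) ∈ S := by
          convert S.mul_mem hx h₁
          exact congrArg op (show a 0 = v 0 * (a 0 + a 1) by
            rw [mul_add, z (i := 0) (j := 1) (by decide), add_zero]; exact (e 0).symm)
        have h1 : op (a 1) ∈ S := by
          convert S.mul_mem hx h₂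
          exact congrArg op (show a 1 = v 1 * (a 0 + a 1) by
            rw [mul_add, z (i := 1) (j := 0) (by decide), zero_add]; exact (e 1).symm)
        have := subalgebra_eq_top (S := S.unop)
          (fun i => by fin_cases i; exacts [h₁, h₂])
          (fun i => by fin_cases i; exacts [h0, h1, hn, hm])
        exact eq_top_iff.2 fun y _ => this y.unop
      indep := fun f g h k H => by
        have h₀ : ![0, 0] = (0 : Fin 2 → K[X]) := by ext i; fin_cases i <;> rfl
        obtain ⟨φ, h₁, h₂⟩ := exists_lift (K := K) (s := QE.s) (t := QE.t) (rels := rels)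
          (B := Matrix (Fin 2) (Fin 2) K[X]) ![!![1, 0; 0, 0], !![0, 0; 0, 1]]
          ![!![X, 0; 0, 0], !![0, 0; 0, X], !![0, X; 0, 0], !![0, 0; X, 0]]
          (fun i => by fin_cases i <;> simp [h₀])
          (fun i j => by fin_cases i <;> fin_cases j <;>
            simp [h₀, ← Matrix.ext_iff, Fin.forall_fin_two])
          (by simp [Matrix.one_fin_two])
          (fun i => by fin_cases i <;> simp [QE.s, h₀])
          (fun i => by fin_cases i <;> simp [QE.t, h₀])
          (by simp [hrels, QE.al, QE.be, QE.mu, QE.nu, pow_two])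
        set ψ : _ →ₐ[K] Matrix (Fin 2) (Fin 2) K[X] :=
          (Matrix.transposeAlgEquiv (Fin 2) K K[X]).symm.toAlgHom.comp (AlgHom.op φ) with hψ
        have hx : ψ (op (a 0 + a 1)) = algebraMap K[X] _ X := by
          simp [hψ, ha, h₂, Matrix.algebraMap_eq_diagonal, ← Matrix.ext_iff, Fin.forall_fin_two]
        have hf (f : K[X]) : ψ (aeval (op (a 0 + a 1)) f) = algebraMap K[X] _ f := by
          rw [← aeval_algHom_apply, hx, aeval_algebraMap_apply, aeval_X_left_apply]
        have H := congrArg ψ H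
        have hv0 : ψ (op (v 0)) = !![1, 0; 0, 0] := by
          simp [hψ, hv, h₁, ← Matrix.ext_iff, Fin.forall_fin_two]
        have hv1 : ψ (op (v 1)) = !![0, 0; 0, 1] := by
          simp [hψ, hv, h₁, ← Matrix.ext_iff, Fin.forall_fin_two]
        have ha2 : ψ (op (a 2)) = !![0, 0; X, 0] := by
          simp [hψ, ha, h₂, ← Matrix.ext_iff, Fin.forall_fin_two]
        have ha3 : ψ (op (a 3)) = !![0, X; 0, 0] := by
          simp [hψ, ha, h₂, ← Matrix.ext_iff, Fin.forall_fin_two]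
        change ψ (_ * op (v 0) + _ * _ + _ * _ + _ * op (v 1)) = ψ 0 at H
        simp only [map_add, map_mul, hf, hv0, hv1, ha2, ha3, ← Algebra.smul_def, map_zero] at H
        simp [← Matrix.ext_iff, Fin.forall_fin_two] at H
        tauto }
  exact L.tauTiltingData

end TwoPoint

namespace TwoPoint

/-- Theorem 1.4(2), Table T part.  The listed Table T algebras are
τ-tilting finite for all admissible parameters, with the indicated numbers of basic
support τ-tilting modules and Hasse quiver types. -/
theorem table_T_tau_tilting_finite (K : Type) [Field K] [IsAlgClosed K] :
    TauTiltingData (TabT2 K) 6 1 3 ∧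
    (∀ n : ℕ, 2 ≤ n → TauTiltingData (TabT4 K n) 6 1 3) ∧
    (∀ m n : ℕ, 2 ≤ m → 2 ≤ n → TauTiltingData (TabT5 K m n) 5 1 2) ∧
    TauTiltingData (TabT6 K) 6 1 3 ∧
    TauTiltingData (TabT7 K) 5 1 2 ∧
    TauTiltingData (TabT8 K) 5 1 2 ∧
    (∀ n : ℕ, 1 ≤ n → TauTiltingData (TabT9 K n) 8 3 3) ∧
    TauTiltingData (TabT10 K) 12 5 5 ∧
    TauTiltingData (TabT11 K) 8 3 3 ∧
    TauTiltingData (TabT12 K) 7 2 3 ∧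
    (∀ m n : ℕ, 2 ≤ m → 1 ≤ n → TauTiltingData (TabT13 K m n) 6 2 2) ∧
    TauTiltingData (TabT14 K) 8 3 3 ∧
    TauTiltingData (TabT15 K) 7 2 3 ∧
    TauTiltingData (TabT16 K) 9 2 5 ∧
    (∀ m n : ℕ, 2 ≤ m → 1 ≤ n → TauTiltingData (TabT18 K m n) 8 3 3) ∧
    (∀ m n r : ℕ, 2 ≤ m → 2 ≤ n → 1 ≤ r → TauTiltingData (TabT19 K m n r) 6 2 2) ∧
    (∀ k : K, k ≠ 0 → TauTiltingData (TabT20 K k) 7 2 3) ∧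
    (∀ k1 k2 : K, k1 ≠ 0 → k2 ≠ 0 → TauTiltingData (TabT21 K k1 k2) 6 2 2) := by
  refine ⟨tauTiltingData_T2 K, tauTiltingData_T4 K, tauTiltingData_T5 K, tauTiltingData_T6 K,
    tauTiltingData_of_commute K 3 6 (by norm_num) (by norm_num),
    tauTiltingData_of_commute K 4 4 (by norm_num) (by norm_num), tauTiltingData_T9 K,
    tauTiltingData_T10 K, tauTiltingData_T11 K, tauTiltingData_T12 K, tauTiltingData_T13 K,
    tauTiltingData_T14 K, tauTiltingData_T15 K, tauTiltingData_T16 K, tauTiltingData_T18 K,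
    tauTiltingData_T19 K, tauTiltingData_T20 K, fun k₁ k₂ h₁ h₂ => ?_⟩
  by_cases h : k₁ = 1 ∧ k₂ = 1
  · obtain ⟨rfl, rfl⟩ := h
    exact tauTiltingData_T21_one K
  · exact tauTiltingData_T21_of_ne K k₁ k₂ h₁ h₂ h

end TwoPoint
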